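/- Let f : S² → S² be a periodic homeomorphism of the unit 2-sphere, i.e. f^n = id for some n ≥ 1. Then there exist an orthogonal matrix A ∈ O(3) and a homeomorphism h : S² → S² such that f = h ∘ r_A ∘ h⁻¹, where r_A : S² → S² denotes the restriction to S² of the linear isometry x ↦ Ax of ℝ³. -/

import Mathlib

/-- The unit 2-sphere in Euclidean 3-space. -/
abbrev Sphere2 := Metric.sphere (0 : EuclideanSpace ℝ (Fin 3)) 1

open Set Filter Topology Metric
open Complex (I exp slitPlane norm_real exp_add normSq_apply)
open Homeomorph (mul_apply)
open Subgroup (zpowers)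
open scoped Real Pointwise

namespace Kerekjarto

/-- `F` has a continuous logarithm on the set `K`. -/
def HasLog {X : Type*} [TopologicalSpace X] (F : X → ℂ) (K : Set X) : Prop :=
  ∃ L : X → ℂ, ContinuousOn L K ∧ ∀ z ∈ K, exp (L z) = F z

section HasLog

variable {X Y : Type*} [TopologicalSpace X] [TopologicalSpace Y] {F G : X → ℂ} {K L : Set X}

lemma HasLog.mono (h : HasLog F L) (hKL : K ⊆ L) : HasLog F K := by
  obtain ⟨l, hl, he⟩ := h
  exact ⟨l, hl.mono hKL, fun z hz => he z (hKL hz)⟩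

lemma HasLog.congr (h : HasLog F K) (hFG : ∀ z ∈ K, F z = G z) : HasLog G K := by
  obtain ⟨l, hl, he⟩ := h
  exact ⟨l, hl, fun z hz => (he z hz).trans (hFG z hz)⟩

lemma HasLog.mul (hF : HasLog F K) (hG : HasLog G K) : HasLog (fun z => F z * G z) K := by
  obtain ⟨l, hl, he⟩ := hF
  obtain ⟨m, hm, hf⟩ := hG
  exact ⟨fun z => l z + m z, hl.add hm, fun z hz => by rw [exp_add, he z hz, hf z hz]⟩

lemma HasLog.inv (hF : HasLog F K) : HasLog (fun z => (F z)⁻¹) K := by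
  obtain ⟨l, hl, he⟩ := hF
  exact ⟨fun z => - l z, hl.neg, fun z hz => by rw [Complex.exp_neg, he z hz]⟩

lemma HasLog.div (hF : HasLog F K) (hG : HasLog G K) : HasLog (fun z => F z / G z) K := by
  simpa only [div_eq_mul_inv] using hF.mul hG.inv

lemma HasLog.ne_zero (hF : HasLog F K) {z : X} (hz : z ∈ K) : F z ≠ 0 := by
  obtain ⟨l, hl, he⟩ := hF
  rw [← he z hz]
  exact Complex.exp_ne_zero _

lemma HasLog.comp {g : Y → X} {M : Set Y} (hF : HasLog F K) (hg : ContinuousOn g M)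
    (hm : MapsTo g M K) : HasLog (fun y => F (g y)) M := by
  obtain ⟨l, hl, he⟩ := hF
  exact ⟨fun y => l (g y), hl.comp hg hm, fun y hy => he _ (hm hy)⟩

lemma hasLog_const {c : ℂ} (hc : c ≠ 0) : HasLog (fun _ : X => c) K :=
  ⟨fun _ => Complex.log c, continuousOn_const, fun _ _ => Complex.exp_log hc⟩

lemma hasLog_of_slitPlane (hF : ContinuousOn F K) (h : ∀ z ∈ K, F z ∈ slitPlane) :
    HasLog F K :=
  ⟨fun z => Complex.log (F z), hF.clog h,
    fun z hz => Complex.exp_log (Complex.slitPlane_ne_zero (h z hz))⟩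

lemma mem_slitPlane_of_norm_sub_one_lt {w : ℂ} (h : ‖w - 1‖ < 1) : w ∈ slitPlane := by
  have := Complex.mem_slitPlane_of_norm_lt_one h
  simpa using this

lemma sub_eq_sub_of_exp_eq {l m : X → ℂ} (hK : IsPreconnected K) (hl : ContinuousOn l K)
    (hm : ContinuousOn m K) (he : ∀ z ∈ K, exp (l z) = exp (m z))
    {x y : X} (hx : x ∈ K) (hy : y ∈ K) : l x - m x = l y - m y := by
  refine hK.induction₂' (fun x y => l x - m x = l y - m y) ?_ ?_ hx hy
  · intro x hx
    have hc : ContinuousWithinAt (fun z => l z - m z) K x := (hl.sub hm) x hx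
    filter_upwards [hc (Metric.ball_mem_nhds _ one_pos), self_mem_nhdsWithin] with y hy hyK
    have hy' : ‖(l y - m y) - (l x - m x)‖ < 1 := by simpa [dist_eq_norm] using hy
    have h1 : exp ((l y - m y) - (l x - m x)) = 1 := by
      simp [Complex.exp_sub, he y hyK, he x hx]
    obtain ⟨n, hn⟩ := Complex.exp_eq_one_iff.1 h1
    have : n = 0 := by
      by_contra hne
      have h2 : (1 : ℝ) ≤ |(n : ℝ)| := by exact_mod_cast Int.one_le_abs hne
      rw [hn, norm_mul] at hy'
      have h3 : ‖(2 * (π : ℂ) * I)‖ = 2 * π := by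
        simp [abs_of_pos Real.pi_pos]
      rw [h3, Complex.norm_intCast] at hy'
      nlinarith [Real.pi_gt_three]
    rw [this] at hn
    have : l y - m y = l x - m x := by
      have := hn
      push_cast at this
      linear_combination this
    exact ⟨this.symm, this⟩
  · intro x y z _ _ _ h1 h2
    exact h1.trans h2

open Classical in
lemma HasLog.exists_union (hF : HasLog F K) (hG : HasLog F L)
    (hKL : IsPreconnected (K ∩ L)) :
    ∃ l : X → ℂ, ContinuousOn l K ∧ ContinuousOn l L ∧ ∀ z ∈ K ∪ L, exp (l z) = F z := by
  obtain ⟨l, hl, he⟩ := hF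
  obtain ⟨m, hm, hf⟩ := hG
  obtain ⟨c, hc1, hc⟩ : ∃ c : ℂ, exp c = 1 ∧ ∀ z ∈ K ∩ L, l z = m z + c := by
    rcases (K ∩ L).eq_empty_or_nonempty with h0 | ⟨x, hx⟩
    · exact ⟨0, Complex.exp_zero, by simp [h0]⟩
    · refine ⟨l x - m x, ?_, fun z hz => ?_⟩
      · rw [Complex.exp_sub, he x hx.1, hf x hx.2, div_self]
        rw [← he x hx.1]
        exact Complex.exp_ne_zero _
      · have := sub_eq_sub_of_exp_eq hKL (hl.mono inter_subset_left) (hm.mono inter_subset_right)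
          (fun z hz => (he z hz.1).trans (hf z hz.2).symm) hz hx
        linear_combination this
  refine ⟨fun z => if z ∈ K then l z else m z + c, ?_, ?_, ?_⟩
  · exact hl.congr fun z hz => by simp [hz]
  · refine (hm.add (continuousOn_const (c := c))).congr fun z hz => ?_
    by_cases hzK : z ∈ K
    · simp only [hzK, if_true]; exact hc z ⟨hzK, hz⟩
    · simp [hzK]
  · rintro z hz
    by_cases hzK : z ∈ K
    · simp [hzK, he z hzK]
    · simp [hzK, exp_add, hc1, hf z (hz.resolve_left hzK)]

lemma HasLog.union_of_isClosed (hF : HasLog F K) (hG : HasLog F L)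
    (hKL : IsPreconnected (K ∩ L)) (hK : IsClosed K) (hL : IsClosed L) : HasLog F (K ∪ L) := by
  obtain ⟨l, h1, h2, h3⟩ := hF.exists_union hG hKL
  exact ⟨l, h1.union_of_isClosed h2 hK hL, h3⟩

lemma HasLog.union_of_isOpen (hF : HasLog F K) (hG : HasLog F L)
    (hKL : IsPreconnected (K ∩ L)) (hK : IsOpen K) (hL : IsOpen L) : HasLog F (K ∪ L) := by
  obtain ⟨l, h1, h2, h3⟩ := hF.exists_union hG hKL
  exact ⟨l, h1.union_of_isOpen h2 hK hL, h3⟩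

lemma hasLog_univ [SimplyConnectedSpace X] [LocallyPathConnectedSpace X]
    (hF : Continuous F) (h0 : ∀ z, F z ≠ 0) : HasLog F univ := by
  obtain ⟨a⟩ : Nonempty X := inferInstance
  obtain ⟨l, ⟨-, hl⟩, -⟩ := Complex.isCoveringMapOn_exp.existsUnique_continuousMap_lifts ⟨F, hF⟩
    (a₀ := a) (e₀ := Complex.log (F a)) (by simp [Complex.exp_log (h0 a)]) (by simpa using h0)
  exact ⟨l, l.continuous.continuousOn, fun z _ => congrFun hl z⟩

/-- Nowhere vanishing functions have logarithms on arcs. -/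
theorem hasLog_image_Icc [T2Space X] {c : ℝ → X} {s t : ℝ} (hst : s ≤ t)
    (hc : ContinuousOn c (Icc s t))
    (hinj : InjOn c (Icc s t)) (hF : ContinuousOn F (c '' Icc s t))
    (h0 : ∀ z ∈ c '' Icc s t, F z ≠ 0) : HasLog F (c '' Icc s t) := by
  have hp : Continuous fun x : ℝ => ((projIcc s t hst x : Icc s t) : ℝ) :=
    continuous_subtype_val.comp continuous_projIcc
  have h1 : Continuous fun x : ℝ => F (c (projIcc s t hst x)) := by
    have : Continuous fun x : ℝ => c (projIcc s t hst x) :=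
      hc.comp_continuous hp fun x => (projIcc s t hst x).2
    exact hF.comp_continuous this fun x => mem_image_of_mem _ (projIcc s t hst x).2
  obtain ⟨l, hl, he⟩ := hasLog_univ h1 fun x => h0 _ (mem_image_of_mem _ (projIcc s t hst x).2)
  have hl : Continuous l := by simpa [continuousOn_univ] using hl
  obtain ⟨d, hd⟩ : ∃ d : X → ℝ, ∀ x ∈ Icc s t, d (c x) = x :=
    ⟨Function.invFunOn c (Icc s t), fun x hx => hinj.leftInvOn_invFunOn hx⟩
  have hdc : ContinuousOn d (c '' Icc s t) := by
    rw [continuousOn_iff_isClosed]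
    intro A hA
    refine ⟨c '' (Icc s t ∩ A), ?_, ?_⟩
    · exact ((isCompact_Icc.inter_right hA).image_of_continuousOn
        (hc.mono inter_subset_left)).isClosed
    · ext z
      constructor
      · rintro ⟨hz, x, hx, rfl⟩
        refine ⟨⟨x, ⟨hx, ?_⟩, rfl⟩, ⟨x, hx, rfl⟩⟩
        simpa [hd x hx] using hz
      · rintro ⟨⟨x, hx, rfl⟩, hz⟩
        exact ⟨by simpa [hd x hx.1] using hx.2, hz⟩
  refine ⟨fun z => l (d z), hl.comp_continuousOn hdc, ?_⟩
  rintro _ ⟨x, hx, rfl⟩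
  simp [hd x hx, he x (mem_univ _), projIcc_of_mem hst hx]

end HasLog

lemma not_hasLog_sphere {a : ℂ} {R : ℝ} (hR : 0 < R) :
    ¬ HasLog (fun z : ℂ => z - a) (sphere a R) := by
  rintro ⟨l, hl, he⟩
  have hmem : ∀ t : ℝ, a + R * exp (t * I) ∈ sphere a R := by
    intro t
    simp [Complex.norm_exp_ofReal_mul_I, abs_of_pos hR]
  have h1 : Continuous fun t : ℝ => l (a + R * exp (t * I)) :=
    hl.comp_continuous (by fun_prop) hmem
  have h2 : Continuous fun t : ℝ => (Real.log R : ℂ) + t * I := by fun_prop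
  have := sub_eq_sub_of_exp_eq (K := (univ : Set ℝ)) isPreconnected_univ h1.continuousOn
    h2.continuousOn (fun t _ => by
      rw [he _ (hmem t), exp_add, ← Complex.ofReal_exp, Real.exp_log hR]; ring)
    (mem_univ 0) (mem_univ (2 * π))
  have h3 : exp (((2 * π : ℝ) : ℂ) * I) = 1 := by
    push_cast; exact Complex.exp_two_pi_mul_I
  rw [h3] at this
  simp only [Complex.ofReal_zero, zero_mul, Complex.exp_zero, mul_one, add_zero] at this
  have h4 : ((2 * π : ℝ) : ℂ) * I = 0 := by linear_combination this
  simp [Real.pi_ne_zero] at h4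

/-- The points `a` and `b` lie in a common preconnected subset of `U`. -/
def Conn {X : Type*} [TopologicalSpace X] (U : Set X) (a b : X) : Prop :=
  ∃ C ⊆ U, IsPreconnected C ∧ a ∈ C ∧ b ∈ C

section Conn

variable {X Y : Type*} [TopologicalSpace X] [TopologicalSpace Y] {U V : Set X} {a b c : X}

lemma Conn.symm (h : Conn U a b) : Conn U b a := by
  obtain ⟨C, h1, h2, h3, h4⟩ := h
  exact ⟨C, h1, h2, h4, h3⟩

lemma Conn.trans (h : Conn U a b) (h' : Conn U b c) : Conn U a c := by
  obtain ⟨C, h1, h2, h3, h4⟩ := h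
  obtain ⟨D, k1, k2, k3, k4⟩ := h'
  exact ⟨C ∪ D, union_subset h1 k1, h2.union b h4 k3 k2, Or.inl h3, Or.inr k4⟩

lemma Conn.mono (h : Conn U a b) (hUV : U ⊆ V) : Conn V a b := by
  obtain ⟨C, h1, h2⟩ := h
  exact ⟨C, h1.trans hUV, h2⟩

lemma Conn.left_mem (h : Conn U a b) : a ∈ U := by
  obtain ⟨C, h1, h2, h3, h4⟩ := h
  exact h1 h3

lemma Conn.right_mem (h : Conn U a b) : b ∈ U := h.symm.left_mem

lemma Conn.refl (h : a ∈ U) : Conn U a a :=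
  ⟨{a}, by simpa using h, isPreconnected_singleton, rfl, rfl⟩

lemma _root_.IsPreconnected.conn (h : IsPreconnected U) (ha : a ∈ U) (hb : b ∈ U) :
    Conn U a b := ⟨U, subset_rfl, h, ha, hb⟩

lemma isPreconnected_of_conn (h : ∀ a ∈ U, ∀ b ∈ U, Conn U a b) : IsPreconnected U :=
  isPreconnected_of_forall_pair fun x hx y hy => by
    obtain ⟨C, h1, h2, h3, h4⟩ := h x hx y hy
    exact ⟨C, h1, h3, h4, h2⟩

lemma Conn.image {g : X → Y} (h : Conn U a b) (hg : ContinuousOn g U) :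
    Conn (g '' U) (g a) (g b) := by
  obtain ⟨C, h1, h2, h3, h4⟩ := h
  exact ⟨g '' C, image_mono h1, h2.image g (hg.mono h1), mem_image_of_mem _ h3,
    mem_image_of_mem _ h4⟩

lemma conn_iff_mem_connectedComponentIn (ha : a ∈ U) :
    Conn U a b ↔ b ∈ connectedComponentIn U a := by
  constructor
  · rintro ⟨C, h1, h2, h3, h4⟩
    exact h2.subset_connectedComponentIn h3 h1 h4
  · intro h
    exact ⟨_, connectedComponentIn_subset U a, isPreconnected_connectedComponentIn,
      mem_connectedComponentIn ha, h⟩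

/-- A preconnected set meeting `V` but not its frontier is contained in `V`. -/
theorem subset_of_disjoint_frontier {C : Set X} (hC : IsPreconnected C) (hV : (C ∩ V).Nonempty)
    (hf : C ∩ frontier V = ∅) : C ⊆ V := by
  have h1 : C ⊆ interior V ∪ (closure V)ᶜ := by
    intro x hx
    by_contra h
    simp only [mem_union, mem_compl_iff, not_or, not_not] at h
    exact (hf ▸ (⟨hx, h.2, h.1⟩ : x ∈ C ∩ frontier V) : x ∈ (∅ : Set X))
  obtain ⟨y, hyC, hyV⟩ := hV
  have hy : y ∈ interior V := by
    rcases h1 hyC with h | h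
    · exact h
    · exact absurd (subset_closure hyV) h
  refine (hC.subset_left_of_subset_union isOpen_interior isClosed_closure.isOpen_compl ?_ h1
    ⟨y, hyC, hy⟩).trans interior_subset
  exact disjoint_compl_right.mono_left (interior_subset.trans subset_closure)

lemma frontier_connectedComponentIn_subset [LocallyConnectedSpace X] (hU : IsOpen U) :
    frontier (connectedComponentIn U a) ⊆ Uᶜ := by
  intro x hx hxU
  have h1 : connectedComponentIn U x ∈ 𝓝 x := connectedComponentIn_mem_nhds (hU.mem_nhds hxU)
  obtain ⟨y, hy1, hy2⟩ := mem_closure_iff_nhds.1 hx.1 _ h1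
  have h2 := (connectedComponentIn_eq hy1).trans (connectedComponentIn_eq hy2).symm
  have h3 : x ∈ connectedComponentIn U a := h2 ▸ mem_connectedComponentIn hxU
  rw [hU.connectedComponentIn.frontier_eq] at hx
  exact hx.2 h3

end Conn

lemma continuousOn_leftInverse_of_isCompact {X Y : Type*} [TopologicalSpace X]
    [TopologicalSpace Y] [T2Space Y] {K : Set X} (hK : IsCompact K) {c : X → Y} {d : Y → X}
    (hc : ContinuousOn c K) (hd : ∀ x ∈ K, d (c x) = x) : ContinuousOn d (c '' K) := by
  rw [continuousOn_iff_isClosed]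
  intro A hA
  refine ⟨c '' (K ∩ A), ?_, ?_⟩
  · exact ((hK.inter_right hA).image_of_continuousOn (hc.mono inter_subset_left)).isClosed
  · ext z
    constructor
    · rintro ⟨hz, x, hx, rfl⟩
      refine ⟨⟨x, ⟨hx, ?_⟩, rfl⟩, ⟨x, hx, rfl⟩⟩
      simpa [hd x hx] using hz
    · rintro ⟨⟨x, hx, rfl⟩, hz⟩
      exact ⟨by simpa [hd x hx.1] using hx.2, hz⟩

section Charts

instance : Fact (Module.finrank ℝ (EuclideanSpace ℝ (Fin 3)) = 2 + 1) := ⟨by simp⟩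

instance : LocallyPathConnectedSpace Sphere2 :=
  ChartedSpace.locallyPathConnectedSpace (EuclideanSpace ℝ (Fin 2)) Sphere2

instance : LocallyConnectedSpace Sphere2 :=
  ChartedSpace.locallyConnectedSpace (EuclideanSpace ℝ (Fin 2)) Sphere2

/-- Stereographic projection from `v` to the complex plane. -/
noncomputable def st (v x : Sphere2) : ℂ :=
  Complex.orthonormalBasisOneI.repr.symm (stereographic' 2 v x)

/-- The inverse of the stereographic projection from `v`. -/
noncomputable def sti (v : Sphere2) (z : ℂ) : Sphere2 :=
  (stereographic' 2 v).symm (Complex.orthonormalBasisOneI.repr z)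

lemma continuousOn_st (v : Sphere2) : ContinuousOn (st v) {v}ᶜ := by
  have := (stereographic' 2 v).continuousOn
  rw [stereographic'_source] at this
  exact (LinearIsometryEquiv.continuous _).comp_continuousOn this

lemma continuous_sti (v : Sphere2) : Continuous (sti v) := by
  have := (stereographic' 2 v).continuousOn_symm
  rw [stereographic'_target, continuousOn_univ] at this
  exact this.comp (LinearIsometryEquiv.continuous _)

@[simp] theorem sti_ne (v : Sphere2) (z : ℂ) : sti v z ≠ v := by
  have := (stereographic' 2 v).map_target (x := Complex.orthonormalBasisOneI.repr z) (by simp)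
  rw [stereographic'_source] at this
  exact this

@[simp] theorem st_sti (v : Sphere2) (z : ℂ) : st v (sti v z) = z := by
  rw [st, sti, (stereographic' 2 v).right_inv (by simp)]
  simp

lemma sti_st {v x : Sphere2} (h : x ≠ v) : sti v (st v x) = x := by
  rw [st, sti, LinearIsometryEquiv.apply_symm_apply, (stereographic' 2 v).left_inv (by simpa using h)]

lemma st_injOn (v : Sphere2) : InjOn (st v) {v}ᶜ := by
  intro x hx y hy h
  rw [← sti_st hx, ← sti_st hy, h]

lemma sti_injective (v : Sphere2) : Function.Injective (sti v) :=
  Function.LeftInverse.injective (st_sti v)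

lemma range_sti (v : Sphere2) : range (sti v) = {v}ᶜ := by
  ext x
  constructor
  · rintro ⟨z, rfl⟩; simp
  · intro h; exact ⟨st v x, sti_st h⟩

lemma isOpenEmbedding_sti (v : Sphere2) : IsOpenEmbedding (sti v) := by
  refine .of_continuous_injective_isOpenMap (continuous_sti v) (sti_injective v) ?_
  intro U hU
  have : sti v '' U = {v}ᶜ ∩ st v ⁻¹' U := by
    ext x
    constructor
    · rintro ⟨z, hz, rfl⟩; simpa using hz
    · rintro ⟨h1, h2⟩; exact ⟨st v x, h2, sti_st h1⟩
  rw [this]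
  exact (continuousOn_st v).isOpen_inter_preimage isOpen_compl_singleton hU

lemma tendsto_norm_st (v : Sphere2) : Tendsto (fun x => ‖st v x‖) (𝓝[≠] v) atTop := by
  rw [Filter.tendsto_atTop]
  intro R
  have h : (sti v '' closedBall 0 R)ᶜ ∈ 𝓝 v := by
    refine ((isCompact_closedBall 0 R).image (continuous_sti v)).isClosed.isOpen_compl.mem_nhds ?_
    rintro ⟨z, -, hz⟩
    exact sti_ne v z hz
  filter_upwards [mem_nhdsWithin_of_mem_nhds h, self_mem_nhdsWithin] with x hx hxv
  by_contra hlt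
  exact hx ⟨st v x, by simp; linarith, sti_st hxv⟩

lemma isCompact_image_st {v : Sphere2} {K : Set Sphere2} (hK : IsClosed K) (hv : v ∉ K) :
    IsCompact (st v '' K) :=
  hK.isCompact.image_of_continuousOn ((continuousOn_st v).mono fun _ hx h => hv (h ▸ hx))

end Charts

/-- The chart at `b`, translated so that `a` goes to zero. -/
noncomputable def cr (a b z : Sphere2) : ℂ := st b z - st b a

lemma continuousOn_cr (a b : Sphere2) : ContinuousOn (cr a b) {b}ᶜ :=
  (continuousOn_st b).sub continuousOn_const

lemma cr_ne_zero {a b z : Sphere2} (hab : a ≠ b) (hza : z ≠ a) (hzb : z ≠ b) : cr a b z ≠ 0 :=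
  sub_ne_zero.2 fun h => hza (st_injOn b hzb hab h)

section Criterion

variable {K L : Set Sphere2} {a b : Sphere2}

lemma hasLog_cr_of_near {c c' : Sphere2} (hbK : b ∉ K) {r : ℝ}
    (hr : ∀ z ∈ K, r ≤ ‖st b z - st b c‖) (hc : ‖st b c' - st b c‖ < r) (h : HasLog (cr c b) K) :
    HasLog (cr c' b) K := by
  have hcont : ContinuousOn (st b) K := (continuousOn_st b).mono fun x hx h => hbK (h ▸ hx)
  have h1 : HasLog (fun z => (st b z - st b c') / (st b z - st b c)) K := by
    refine hasLog_of_slitPlane ((hcont.sub continuousOn_const).div (hcont.sub continuousOn_const)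
      fun z hz => h.ne_zero hz) fun z hz => mem_slitPlane_of_norm_sub_one_lt ?_
    have hne : st b z - st b c ≠ 0 := h.ne_zero hz
    have : (st b z - st b c') / (st b z - st b c) - 1 = -((st b c' - st b c) / (st b z - st b c)) := by
      field_simp; ring
    rw [this, norm_neg, norm_div, div_lt_one (norm_pos_iff.2 hne)]
    exact hc.trans_le (hr z hz)
  refine (h1.mul h).congr fun z hz => ?_
  have hne : st b z - st b c ≠ 0 := h.ne_zero hz
  simp only [cr]
  field_simp

lemma exists_pos_le_norm_st_sub {c : Sphere2} (hK : IsClosed K) (hbK : b ∉ K) (hcb : c ≠ b)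
    (hcK : c ∉ K) : ∃ r > 0, ∀ z ∈ K, r ≤ ‖st b z - st b c‖ := by
  have h2 : st b c ∉ st b '' K := by
    rintro ⟨z, hz, h⟩
    exact hcK (st_injOn b (fun h => hbK (h ▸ hz)) hcb h ▸ hz)
  have h3 := (isCompact_image_st hK hbK).isClosed.isOpen_compl.mem_nhds h2
  obtain ⟨r, hr, hrK⟩ := Metric.mem_nhds_iff.1 h3
  refine ⟨r, hr, fun z hz => ?_⟩
  by_contra hlt
  have : st b z ∈ ball (st b c) r := by rw [mem_ball, dist_eq_norm]; linarith
  exact hrK this ⟨z, hz, rfl⟩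

lemma hasLog_cr_of_conn (hK : IsClosed K) (hab : a ≠ b) (h : Conn Kᶜ a b) :
    HasLog (cr a b) K := by
  have hbK : b ∉ K := h.right_mem
  have hcont : ContinuousOn (st b) K := (continuousOn_st b).mono fun x hx h => hbK (h ▸ hx)
  obtain ⟨C, hCK, hC, haC, hbC⟩ := h
  set P : Sphere2 → Prop := fun c => c = b ∨ HasLog (cr c b) K with hP
  have key : P b ↔ P a := by
    refine hC.induction₂' (fun c c' => P c ↔ P c') ?_ (fun x y z _ _ _ h1 h2 => h1.trans h2) hbC haC
    intro c hc
    suffices ∀ᶠ y in 𝓝[C] c, (P c ↔ P y) by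
      filter_upwards [this] with y hy using ⟨hy, hy.symm⟩
    by_cases hcb : c = b
    · subst hcb
      obtain ⟨R, hR⟩ := (isCompact_image_st hK hbK).isBounded.exists_norm_le
      have := (Filter.tendsto_atTop.1 (tendsto_norm_st c)) (|R| + 1)
      rw [eventually_nhdsWithin_iff] at this
      filter_upwards [mem_nhdsWithin_of_mem_nhds this] with y hy
      refine iff_of_true (Or.inl rfl) ?_
      by_cases hyc : y = c
      · exact Or.inl hyc
      · right
        have hy := hy hyc
        have hy0 : st c y ≠ 0 := by
          rintro h0
          rw [h0, norm_zero] at hy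
          linarith [abs_nonneg R]
        have h1 : HasLog (fun z => 1 - st c z / st c y) K := by
          refine hasLog_of_slitPlane (continuousOn_const.sub (hcont.div_const _)) fun z hz =>
            mem_slitPlane_of_norm_sub_one_lt ?_
          rw [sub_sub_cancel_left, norm_neg, norm_div, div_lt_one (norm_pos_iff.2 hy0)]
          linarith [hR _ ⟨z, hz, rfl⟩, le_abs_self R]
        refine (h1.mul (hasLog_const (c := - st c y) (neg_ne_zero.2 hy0))).congr fun z hz => ?_
        simp only [cr]
        field_simp
        ring
    · obtain ⟨r, hr, hrK⟩ := exists_pos_le_norm_st_sub hK hbK hcb (hCK hc)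
      have hcc : ContinuousAt (st b) c := (continuousOn_st b).continuousAt (isOpen_compl_singleton.mem_nhds hcb)
      have h4 := hcc (ball_mem_nhds _ (half_pos hr))
      filter_upwards [mem_nhdsWithin_of_mem_nhds h4,
        mem_nhdsWithin_of_mem_nhds (isOpen_compl_singleton.mem_nhds hcb)] with y hy hyb
      have hy : ‖st b y - st b c‖ < r / 2 := by simpa [dist_eq_norm] using hy
      simp only [hP, hcb, false_or, show y ≠ b from hyb]
      constructor
      · exact hasLog_cr_of_near hbK hrK (by linarith)
      · refine hasLog_cr_of_near hbK (r := r / 2) (fun z hz => ?_) (by rwa [norm_sub_rev])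
        have := norm_sub_le_norm_sub_add_norm_sub (st b z) (st b y) (st b c)
        linarith [hrK z hz]
  exact (key.1 (Or.inl rfl)).resolve_left hab

open Classical in
lemma conn_of_hasLog_cr (hK : IsClosed K) (hab : a ≠ b) (haK : a ∉ K) (hbK : b ∉ K)
    (h : HasLog (cr a b) K) : Conn Kᶜ a b := by
  by_contra hcon
  rw [conn_iff_mem_connectedComponentIn (show a ∈ Kᶜ from haK)] at hcon
  set U := connectedComponentIn Kᶜ a with hU
  have hUo : IsOpen U := hK.isOpen_compl.connectedComponentIn
  have haU : a ∈ U := mem_connectedComponentIn haK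
  have hfr : frontier U ⊆ K := by
    simpa using frontier_connectedComponentIn_subset (a := a) hK.isOpen_compl
  have hbcl : b ∉ closure U := by
    rw [closure_eq_self_union_frontier]
    rintro (h | h)
    · exact hcon h
    · exact hbK (hfr h)
  obtain ⟨l, hl, he⟩ := h
  obtain ⟨m, hm⟩ := ContinuousMap.exists_restrict_eq hK ⟨K.domRestrict l, hl.domRestrict⟩
  have hm : ∀ z ∈ K, m z = l z := fun z hz => by
    exact congrArg (fun q : C(K, ℂ) => q ⟨z, hz⟩) hm
  set G : Sphere2 → ℂ := fun z => if z ∈ U then exp (m z) else cr a b z with hG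
  have hGc : ContinuousOn G {b}ᶜ := by
    refine ContinuousOn.if ?_ ?_ ?_
    · rintro z ⟨-, hz⟩
      rw [hm z (hfr hz), he z (hfr hz)]
    · exact (Complex.continuous_exp.comp m.continuous).continuousOn
    · exact (continuousOn_cr a b).mono inter_subset_left
  have hG0 : ∀ z ∈ ({b}ᶜ : Set Sphere2), G z ≠ 0 := by
    intro z hz
    by_cases hzU : z ∈ U
    · simp [hG, hzU]
    · simp only [hG, hzU, if_false]
      exact cr_ne_zero hab (fun h => hzU (h ▸ haU)) hz
  have hlog : HasLog (fun z => G (sti b z)) univ :=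
    hasLog_univ (hGc.comp_continuous (continuous_sti b) fun z => sti_ne b z)
      fun z => hG0 _ (sti_ne b z)
  obtain ⟨R, hR⟩ := (isCompact_image_st isClosed_closure hbcl).isBounded.subset_ball_lt 0 (st b a)
  refine not_hasLog_sphere (a := st b a) hR.1 ((hlog.mono (subset_univ _)).congr fun z hz => ?_)
  have : sti b z ∉ U := by
    intro hzU
    have := hR.2 ⟨_, subset_closure hzU, st_sti b z⟩
    simp only [mem_ball, mem_sphere] at this hz
    linarith
  simp [hG, this, cr]

/-- Janiszewski's theorem. -/
theorem conn_compl_union (hK : IsClosed K) (hL : IsClosed L) (hKL : IsPreconnected (K ∩ L))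
    (h1 : Conn Kᶜ a b) (h2 : Conn Lᶜ a b) : Conn (K ∪ L)ᶜ a b := by
  by_cases hab : a = b
  · subst hab
    exact Conn.refl fun h => h.elim h1.left_mem h2.left_mem
  · exact conn_of_hasLog_cr (hK.union hL) hab (fun h => h.elim h1.left_mem h2.left_mem)
      (fun h => h.elim h1.right_mem h2.right_mem)
      ((hasLog_cr_of_conn hK hab h1).union_of_isClosed (hasLog_cr_of_conn hL hab h2) hKL hK hL)

lemma isPreconnected_compl_of_hasLog (hK : IsClosed K)
    (h : ∀ F : Sphere2 → ℂ, ContinuousOn F K → (∀ z ∈ K, F z ≠ 0) → HasLog F K) :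
    IsPreconnected Kᶜ := by
  refine isPreconnected_of_conn fun a ha b hb => ?_
  by_cases hab : a = b
  · subst hab
    exact Conn.refl ha
  · exact conn_of_hasLog_cr hK hab ha hb (h _ ((continuousOn_cr a b).mono fun z hz h => hb (h ▸ hz))
      fun z hz => cr_ne_zero hab (fun h => ha (h ▸ hz)) fun h => hb (h ▸ hz))

/-- An arc does not separate the sphere. -/
theorem isPreconnected_compl_arc {c : ℝ → Sphere2} {s t : ℝ} (hst : s ≤ t)
    (hc : ContinuousOn c (Icc s t)) (hinj : InjOn c (Icc s t)) :
    IsPreconnected (c '' Icc s t)ᶜ :=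
  isPreconnected_compl_of_hasLog (isCompact_Icc.image_of_continuousOn hc).isClosed fun _ hF h0 =>
    hasLog_image_Icc hst hc hinj hF h0

/-- The homeomorphic image of a closed disc does not separate the sphere. -/
theorem isPreconnected_compl_disc {c : ℂ → Sphere2} (hc : ContinuousOn c (closedBall 0 1))
    (hinj : InjOn c (closedBall 0 1)) : IsPreconnected (c '' closedBall 0 1)ᶜ := by
  have hco := isCompact_closedBall (0 : ℂ) 1
  refine isPreconnected_compl_of_hasLog (hco.image_of_continuousOn hc).isClosed fun F hF h0 => ?_
  set ρ : ℂ → ℂ := fun z => ((max 1 ‖z‖)⁻¹ : ℝ) * z with hρ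
  have hρc : Continuous ρ := by
    refine Continuous.mul (Complex.continuous_ofReal.comp ?_) continuous_id
    exact (continuous_const.max continuous_norm).inv₀ fun z => (lt_max_of_lt_left one_pos).ne'
  have hρm : ∀ z, ρ z ∈ closedBall (0 : ℂ) 1 := by
    intro z
    have h1 : 0 < max 1 ‖z‖ := lt_max_of_lt_left one_pos
    simp only [hρ, mem_closedBall, dist_zero_right, norm_mul, norm_real, norm_inv,
      Real.norm_of_nonneg h1.le]
    rw [inv_mul_le_iff₀ h1, mul_one]
    exact le_max_right _ _
  have hρe : ∀ z ∈ closedBall (0 : ℂ) 1, ρ z = z := by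
    intro z hz
    have : max 1 ‖z‖ = 1 := max_eq_left (by simpa using hz)
    simp [hρ, this]
  obtain ⟨l, hl, he⟩ := hasLog_univ (F := fun z => F (c (ρ z)))
    (hF.comp_continuous (hc.comp_continuous hρc hρm) fun z => mem_image_of_mem _ (hρm z))
    fun z => h0 _ (mem_image_of_mem _ (hρm z))
  have hd : ∀ x ∈ closedBall (0 : ℂ) 1, Function.invFunOn c (closedBall 0 1) (c x) = x :=
    fun x hx => hinj.leftInvOn_invFunOn hx
  refine ⟨fun z => l (Function.invFunOn c (closedBall 0 1) z),
    hl.comp (continuousOn_leftInverse_of_isCompact hco hc hd) fun _ _ => mem_univ _, ?_⟩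
  rintro _ ⟨x, hx, rfl⟩
  simp only [hd x hx]
  simp only [he x (mem_univ _), hρe x hx]

end Criterion

lemma hasLog_of_forall_isCompact {X : Type*} [TopologicalSpace X] [LocallyPathConnectedSpace X]
    {F : X → ℂ} {O : Set X} (hO : IsOpen O) (hOc : IsPreconnected O)
    (h : ∀ K ⊆ O, IsCompact K → HasLog F K) (hF : ContinuousOn F O) : HasLog F O := by
  rcases O.eq_empty_or_nonempty with rfl | ⟨z0, hz0⟩
  · exact ⟨fun _ => 0, continuousOn_const, by simp⟩
  have hpc : IsPathConnected O := (hO.isConnected_iff_isPathConnected).1 ⟨⟨z0, hz0⟩, hOc⟩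
  have hF0 : ∀ z ∈ O, F z ≠ 0 := fun z hz =>
    (h {z} (by simpa using hz) isCompact_singleton).ne_zero rfl
  have hnorm : ∀ K ⊆ O, IsCompact K → z0 ∈ K → ∃ l : X → ℂ, ContinuousOn l K ∧
      (∀ z ∈ K, exp (l z) = F z) ∧ l z0 = Complex.log (F z0) := by
    intro K hK hKc hzK
    obtain ⟨l, hl, he⟩ := h K hK hKc
    refine ⟨fun z => l z + (Complex.log (F z0) - l z0), hl.add continuousOn_const, fun z hz => ?_,
      by ring⟩
    rw [exp_add, Complex.exp_sub, Complex.exp_log (hF0 z0 hz0), he z0 hzK, he z hz,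
      div_self (hF0 z0 hz0), mul_one]
  set Q : X → ℂ → Prop := fun z w => ∃ K ⊆ O, IsCompact K ∧ IsPreconnected K ∧ z0 ∈ K ∧ z ∈ K ∧
    ∃ l : X → ℂ, ContinuousOn l K ∧ (∀ z ∈ K, exp (l z) = F z) ∧
      l z0 = Complex.log (F z0) ∧ l z = w with hQ
  have hpath : ∀ z ∈ O, ∃ K ⊆ O, IsCompact K ∧ IsPreconnected K ∧ z0 ∈ K ∧ z ∈ K := by
    intro z hz
    obtain ⟨γ, hγ⟩ := hpc.joinedIn z0 hz0 z hz
    exact ⟨range γ, by rintro _ ⟨t, rfl⟩; exact hγ t, isCompact_range γ.continuous,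
      isPreconnected_range γ.continuous, ⟨0, γ.source⟩, ⟨1, γ.target⟩⟩
  have hex : ∀ z ∈ O, ∃ w, Q z w := by
    intro z hz
    obtain ⟨K, h1, h2, h3, h4, h5⟩ := hpath z hz
    obtain ⟨l, k1, k2, k3⟩ := hnorm K h1 h2 h4
    exact ⟨l z, K, h1, h2, h3, h4, h5, l, k1, k2, k3, rfl⟩
  have hagree : ∀ (l m : X → ℂ) (K : Set X), IsPreconnected K → ContinuousOn l K →
      ContinuousOn m K → (∀ z ∈ K, exp (l z) = F z) →
      (∀ z ∈ K, exp (m z) = F z) → ∀ z ∈ K, ∀ y ∈ K, l y = m y → l z = m z := by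
    intro l m K hK hl hm hle hme z hz y hy hly
    have := sub_eq_sub_of_exp_eq hK hl hm (fun z hz => (hle z hz).trans (hme z hz).symm) hz hy
    rw [hly, sub_self] at this
    exact sub_eq_zero.1 this
  have huniq : ∀ z w w', Q z w → Q z w' → w = w' := by
    rintro z w w' ⟨K, h1, h2, h3, h4, h5, l, k1, k2, k3, rfl⟩
      ⟨K', h1', h2', h3', h4', h5', l', k1', k2', k3', rfl⟩
    obtain ⟨m, m1, m2, m3⟩ := hnorm (K ∪ K') (union_subset h1 h1') (h2.union h2') (Or.inl h4)
    rw [hagree l m K h3 k1 (m1.mono subset_union_left) k2 (fun z hz => m2 z (Or.inl hz)) z h5 z0 h4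
      (k3.trans m3.symm)]
    exact hagree m l' K' h3' (m1.mono subset_union_right) k1' (fun z hz => m2 z (Or.inr hz)) k2'
      z h5' z0 h4' (m3.trans k3'.symm)
  choose! L hL using hex
  refine ⟨L, fun z hz => ?_, fun z hz => ?_⟩
  · obtain ⟨K, h1, h2, h3, h4, h5, l, k1, k2, k3, k4⟩ := hL z hz
    have hFz : ContinuousAt (fun y => F y / F z) z :=
      (hF.continuousAt (hO.mem_nhds hz)).div_const _
    have hN : O ∩ {y | F y / F z ∈ slitPlane} ∈ 𝓝 z := by
      refine inter_mem (hO.mem_nhds hz) (hFz.preimage_mem_nhds ?_)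
      refine Complex.isOpen_slitPlane.mem_nhds ?_
      rw [div_self (hF0 z hz)]
      exact Complex.one_mem_slitPlane
    set N := pathComponentIn (O ∩ {y | F y / F z ∈ slitPlane}) z with hNdef
    have hNz : N ∈ 𝓝 z := pathComponentIn_mem_nhds hN
    have key : ∀ y ∈ N, L y = L z + Complex.log (F y / F z) := by
      intro y hy
      obtain ⟨γ, hγ⟩ := (hy : JoinedIn _ z y)
      have hγO : range γ ⊆ O := by rintro _ ⟨t, rfl⟩; exact (hγ t).1
      have hγc : IsPreconnected (range γ) := isPreconnected_range γ.continuous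
      have hzγ : z ∈ range γ := ⟨0, γ.source⟩
      have hyγ : y ∈ range γ := ⟨1, γ.target⟩
      have hKO := union_subset h1 hγO
      have hKc := h2.union (isCompact_range γ.continuous)
      have hKp := h3.union z h5 hzγ hγc
      obtain ⟨m, m1, m2, m3⟩ := hnorm (K ∪ range γ) hKO hKc (Or.inl h4)
      have e1 : L y = m y := huniq y _ _ (hL y (hγO hyγ)) ⟨_, hKO, hKc, hKp, Or.inl h4,
        Or.inr hyγ, m, m1, m2, m3, rfl⟩
      have e2 : L z = m z := huniq z _ _ (hL z hz) ⟨_, hKO, hKc, hKp, Or.inl h4,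
        Or.inl h5, m, m1, m2, m3, rfl⟩
      rw [e1, e2]
      refine hagree m (fun x => m z + Complex.log (F x / F z)) (range γ) hγc
        (m1.mono subset_union_right) ?_ (fun x hx => m2 x (Or.inr hx)) ?_ y hyγ z hzγ ?_
      · refine continuousOn_const.add (((hF.mono hγO).div_const _).clog ?_)
        rintro _ ⟨t, rfl⟩
        exact (hγ t).2
      · intro x hx
        rw [exp_add, m2 z (Or.inl h5), Complex.exp_log (div_ne_zero (hF0 x (hγO hx))
          (hF0 z hz)), mul_div_cancel₀ _ (hF0 z hz)]
      · simp [div_self (hF0 z hz)]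
    have hcont : ContinuousAt (fun y => L z + Complex.log (F y / F z)) z := by
      refine continuousAt_const.add (hFz.clog ?_)
      rw [div_self (hF0 z hz)]
      exact Complex.one_mem_slitPlane
    exact (hcont.congr (by filter_upwards [hNz] with y hy using (key y hy).symm)).continuousWithinAt
  · obtain ⟨K, h1, h2, h3, h4, h5, l, k1, k2, k3, k4⟩ := hL z hz
    rw [← k4, k2 z h5]

/-- A closed curve, parametrized by the period one, without double points. -/
structure IsJordan {X : Type*} [TopologicalSpace X] (c : ℝ → X) : Prop where
  cont : Continuous c
  per : Function.Periodic c 1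
  inj : InjOn c (Ico 0 1)

namespace IsJordan

variable {X Y : Type*} [TopologicalSpace X] [TopologicalSpace Y] {c : ℝ → X}

lemma injOn_Ico (hc : IsJordan c) (s : ℝ) : InjOn c (Ico s (s + 1)) := by
  intro x hx y hy h
  have hf : ∀ x, c (Int.fract x) = c x := fun x => by
    have := hc.per.sub_int_mul_eq (x := x) ⌊x⌋
    rwa [mul_one] at this
  have h1 : Int.fract x = Int.fract y :=
    hc.inj ⟨Int.fract_nonneg x, Int.fract_lt_one x⟩ ⟨Int.fract_nonneg y, Int.fract_lt_one y⟩
      (by rw [hf, hf, h])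
  obtain ⟨n, hn⟩ := Int.fract_eq_fract.1 h1
  have h2 : ((-1 : ℤ) : ℝ) < n := by push_cast; linarith [hx.1, hy.2]
  have h3 : (n : ℝ) < (1 : ℤ) := by push_cast; linarith [hx.2, hy.1]
  have h4 : n = 0 := by
    have := Int.cast_lt.1 h2
    have := Int.cast_lt.1 h3
    omega
  rw [h4] at hn
  push_cast at hn
  linarith

lemma injOn_Icc (hc : IsJordan c) {s t : ℝ} (h : t < s + 1) : InjOn c (Icc s t) :=
  (hc.injOn_Ico s).mono fun _ hx => mem_Ico.2 ⟨hx.1, hx.2.trans_lt h⟩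

lemma range_eq (hc : IsJordan c) (s : ℝ) : range c = c '' Icc s (s + 1) :=
  (hc.per.image_Icc one_pos s).symm

lemma range_eq_Ico (hc : IsJordan c) (s : ℝ) : range c = c '' Ico s (s + 1) := by
  rw [hc.range_eq s]
  refine Subset.antisymm ?_ (image_mono Ico_subset_Icc_self)
  rintro _ ⟨x, hx, rfl⟩
  rcases hx.2.lt_or_eq with h | h
  · exact ⟨x, ⟨hx.1, h⟩, rfl⟩
  · exact ⟨s, by simp, by rw [h, hc.per]⟩

lemma isCompact_range (hc : IsJordan c) : IsCompact (range c) := by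
  rw [hc.range_eq 0]
  exact isCompact_Icc.image hc.cont

lemma diff_image_Ioo (hc : IsJordan c) {s t : ℝ} (hst : s ≤ t) (h : t ≤ s + 1) :
    range c \ c '' Ioo s t = c '' Icc t (s + 1) := by
  ext x
  constructor
  · rintro ⟨hx, hn⟩
    rw [hc.range_eq s] at hx
    obtain ⟨y, hy, rfl⟩ := hx
    by_cases h1 : t ≤ y
    · exact ⟨y, ⟨h1, hy.2⟩, rfl⟩
    · rcases hy.1.lt_or_eq with h2 | h2
      · exact (hn ⟨y, ⟨h2, not_le.1 h1⟩, rfl⟩).elim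
      · exact ⟨s + 1, ⟨h, le_rfl⟩, by rw [hc.per, h2]⟩
  · rintro ⟨y, hy, rfl⟩
    refine ⟨mem_range_self y, ?_⟩
    rintro ⟨z, hz, hzy⟩
    rcases hy.2.lt_or_eq with h2 | h2
    · have := hc.injOn_Ico s ⟨hz.1.le, hz.2.trans_le h⟩ ⟨hst.trans hy.1, h2⟩ hzy
      linarith [hz.2, hy.1]
    · rw [h2, hc.per] at hzy
      have := hc.injOn_Ico s ⟨hz.1.le, hz.2.trans_le h⟩ ⟨le_rfl, by linarith⟩ hzy
      linarith [hz.1]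

lemma shift (hc : IsJordan c) (s : ℝ) : IsJordan (fun x => c (x + s)) := by
  refine ⟨hc.cont.comp (by fun_prop), fun x => ?_, ?_⟩
  · show c (x + 1 + s) = _
    rw [add_right_comm, hc.per]
  · intro x hx y hy h
    have := hc.injOn_Ico s (x₁ := x + s) ⟨by linarith [hx.1], by linarith [hx.2]⟩ (x₂ := y + s)
      ⟨by linarith [hy.1], by linarith [hy.2]⟩ h
    linarith

end IsJordan

section Jordan

variable {c : ℝ → Sphere2}

lemma not_hasLog_cr_compl_pair {a b : Sphere2} : ¬ HasLog (cr a b) {a, b}ᶜ := by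
  intro h
  refine not_hasLog_sphere (a := st b a) one_pos ((h.comp (g := sti b) (M := sphere (st b a) 1)
    (continuous_sti b).continuousOn ?_).congr fun z _ => by simp [cr])
  intro z hz
  simp only [mem_compl_iff, mem_insert_iff, mem_singleton_iff, not_or]
  refine ⟨fun h => ?_, sti_ne b z⟩
  have : z = st b a := by rw [← h, st_sti]
  rw [this] at hz
  simp at hz

/-- A Jordan curve separates the sphere. -/
theorem IsJordan.not_isPreconnected_compl (hc : IsJordan c) : ¬ IsPreconnected (range c)ᶜ := by
  intro hcon
  set p := c 0 with hp
  set q := c (1 / 2) with hq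
  have hpq : p ≠ q := fun h => by
    have := hc.inj ⟨le_rfl, one_pos⟩ ⟨by norm_num, by norm_num⟩ h
    norm_num at this
  set A := c '' Icc 0 (1 / 2) with hA
  set B := c '' Icc (1 / 2) (0 + 1) with hB
  have hAc : IsCompact A := isCompact_Icc.image hc.cont
  have hBc : IsCompact B := isCompact_Icc.image hc.cont
  have hpA : p ∈ A := ⟨0, by norm_num, rfl⟩
  have hqA : q ∈ A := ⟨1 / 2, by norm_num, rfl⟩
  have hpB : p ∈ B := ⟨0 + 1, by norm_num, hc.per 0⟩
  have hqB : q ∈ B := ⟨1 / 2, by norm_num, rfl⟩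
  have hAB : A ∪ B = range c := by
    rw [hc.range_eq 0, hA, hB, ← image_union, Icc_union_Icc_eq_Icc] <;> norm_num
  have hBd := hc.diff_image_Ioo (s := 0) (t := 1 / 2) (by norm_num) (by norm_num)
  have hABi : A ∩ B ⊆ {p, q} := by
    rintro _ ⟨⟨x, hx, rfl⟩, hxB⟩
    rw [hB, ← hBd] at hxB
    rcases hx.1.lt_or_eq with h | h
    · rcases hx.2.lt_or_eq with h' | h'
      · exact (hxB.2 ⟨x, ⟨h, h'⟩, rfl⟩).elim
      · right; rw [h']; rfl
    · left; rw [← h]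
  have hlog : ∀ D : Set Sphere2, IsClosed D → IsPreconnected D → IsPreconnected Dᶜ → p ∈ D → q ∈ D →
      HasLog (cr p q) Dᶜ := by
    intro D hD hDc hDcc hpD hqD
    refine hasLog_of_forall_isCompact hD.isOpen_compl hDcc (fun K hK hKc => ?_)
      ((continuousOn_cr p q).mono fun x hx h => hx (h ▸ hqD))
    exact hasLog_cr_of_conn hKc.isClosed hpq ⟨D, subset_compl_comm.1 hK, hDc, hpD, hqD⟩
  have h1 := hlog A hAc.isClosed (isPreconnected_Icc.image c hc.cont.continuousOn)
    (isPreconnected_compl_arc (by norm_num) hc.cont.continuousOn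
      (hc.injOn_Icc (by norm_num))) hpA hqA
  have h2 := hlog B hBc.isClosed (isPreconnected_Icc.image c hc.cont.continuousOn)
    (isPreconnected_compl_arc (by norm_num) hc.cont.continuousOn
      (hc.injOn_Icc (by norm_num))) hpB hqB
  have h3 := h1.union_of_isOpen h2 (by rwa [← compl_union, hAB]) hAc.isClosed.isOpen_compl
    hBc.isClosed.isOpen_compl
  refine not_hasLog_cr_compl_pair (h3.mono ?_)
  rw [← compl_inter]
  exact compl_subset_compl.2 hABi

lemma IsJordan.exists_Ioo_image_subset (hc : IsJordan c) (s : ℝ) {N : Set Sphere2}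
    (hN : N ∈ 𝓝 (c s)) : ∃ δ > 0, δ < 1 / 2 ∧ c '' Ioo (s - δ) (s + δ) ⊆ N := by
  obtain ⟨ε, hε, h⟩ := Metric.mem_nhds_iff.1 (hc.cont.continuousAt hN)
  refine ⟨min ε (1 / 4), by positivity, (min_le_right _ _).trans_lt (by norm_num), ?_⟩
  rintro _ ⟨x, hx, rfl⟩
  refine h ?_
  rw [Real.ball_eq_Ioo]
  exact ⟨by linarith [hx.1, min_le_left ε (1 / 4)], by linarith [hx.2, min_le_left ε (1 / 4)]⟩

lemma compl_subset_of_frontier_subset {U A : Set Sphere2}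
    (hA : IsPreconnected Aᶜ) (hf : frontier U ⊆ A) (hU : (U \ A).Nonempty) : Aᶜ ⊆ U := by
  refine subset_of_disjoint_frontier hA ?_ ?_
  · obtain ⟨x, h1, h2⟩ := hU
    exact ⟨x, h2, h1⟩
  · ext x
    simp only [mem_inter_iff, mem_compl_iff, mem_empty_iff_false, iff_false, not_and]
    exact fun h1 h2 => h1 (hf h2)

/-- Every complementary component of a Jordan curve has the whole curve as its frontier. -/
theorem IsJordan.frontier_component (hc : IsJordan c) {a : Sphere2} (ha : a ∈ (range c)ᶜ) :
    frontier (connectedComponentIn (range c)ᶜ a) = range c := by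
  have hcl : IsClosed (range c) := hc.isCompact_range.isClosed
  have hfr : frontier (connectedComponentIn (range c)ᶜ a) ⊆ range c := by
    simpa using frontier_connectedComponentIn_subset (a := a) hcl.isOpen_compl
  refine hfr.antisymm ?_
  rintro _ ⟨s, rfl⟩
  by_contra hs
  obtain ⟨δ, hδ, hδ2, hδN⟩ := hc.exists_Ioo_image_subset s (isClosed_frontier.isOpen_compl.mem_nhds hs)
  have hd := hc.diff_image_Ioo (s := s - δ) (t := s + δ) (by linarith) (by linarith)
  have hsub := compl_subset_of_frontier_subset (U := connectedComponentIn (range c)ᶜ a)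
    (A := c '' Icc (s + δ) (s - δ + 1))
    (isPreconnected_compl_arc (by linarith) hc.cont.continuousOn (hc.injOn_Icc (by linarith)))
    (by rw [← hd]; exact fun x hx => ⟨hfr hx, fun h => hδN h hx⟩)
    ⟨a, mem_connectedComponentIn ha, fun ⟨x, _, hx⟩ => ha ⟨x, hx⟩⟩
  have : c s ∈ (c '' Icc (s + δ) (s - δ + 1))ᶜ := by
    rw [← hd]
    exact fun h => h.2 ⟨s, ⟨by linarith, by linarith⟩, rfl⟩
  exact connectedComponentIn_subset _ _ (hsub this) (mem_range_self s)

/-- The set `W` is locally connected near the point `x` (usually a boundary point). -/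
def BLC {X : Type*} [TopologicalSpace X] (W : Set X) (x : X) : Prop :=
  ∀ N ∈ 𝓝 x, ∃ N' ∈ 𝓝 x, ∀ w₁ ∈ W ∩ N', ∀ w₂ ∈ W ∩ N', Conn (W ∩ N) w₁ w₂

lemma IsJordan.blc_component (hc : IsJordan c) {a : Sphere2} (s : ℝ) :
    BLC (connectedComponentIn (range c)ᶜ a) (c s) := by
  intro N hN
  by_cases ha : a ∈ (range c)ᶜ
  swap
  · rw [connectedComponentIn_eq_empty ha]
    exact ⟨univ, univ_mem, by simp⟩
  obtain ⟨O, hON, hO, hsO⟩ := _root_.mem_nhds_iff.1 hN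
  obtain ⟨δ, hδ, hδ2, hδO⟩ := hc.exists_Ioo_image_subset s (hO.mem_nhds hsO)
  have hd := hc.diff_image_Ioo (s := s - δ) (t := s + δ) (by linarith) (by linarith)
  set A := c '' Icc (s + δ) (s - δ + 1) with hA
  have hAcl : IsClosed A := (isCompact_Icc.image hc.cont).isClosed
  have hsA : c s ∉ A := by
    rw [← hd]
    exact fun h => h.2 ⟨s, ⟨by linarith, by linarith⟩, rfl⟩
  have hOA : IsOpen (O \ A) := hO.sdiff hAcl
  refine ⟨connectedComponentIn (O \ A) (c s), connectedComponentIn_mem_nhds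
    (hOA.mem_nhds ⟨hsO, hsA⟩), fun w₁ hw₁ w₂ hw₂ => ?_⟩
  have hcl : IsClosed (range c) := hc.isCompact_range.isClosed
  have h1 : Conn (range c)ᶜ w₁ w₂ := ⟨_, connectedComponentIn_subset _ _,
    isPreconnected_connectedComponentIn, hw₁.1, hw₂.1⟩
  have h2 : Conn (A ∪ Oᶜ)ᶜ w₁ w₂ := by
    refine ⟨_, (connectedComponentIn_subset (O \ A) (c s)).trans ?_,
      isPreconnected_connectedComponentIn, hw₁.2, hw₂.2⟩
    rw [compl_union, compl_compl, inter_comm]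
    rfl
  have hAc : A ⊆ range c := image_subset_range _ _
  have hi : range c ∩ (A ∪ Oᶜ) = A := by
    rw [inter_union_distrib_left, inter_eq_right.2 hAc, union_eq_left]
    rintro x ⟨hx, hxO⟩
    rw [← hd]
    exact ⟨hx, fun h => hxO (hδO h)⟩
  have h3 := conn_compl_union hcl (hAcl.union hO.isClosed_compl)
    (by rw [hi]; exact isPreconnected_Icc.image c hc.cont.continuousOn) h1 h2
  obtain ⟨D, hD, hDp, hwD, hwD'⟩ := h3
  refine ⟨D, fun x hx => ⟨?_, ?_⟩, hDp, hwD, hwD'⟩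
  · have : D ⊆ (range c)ᶜ := hD.trans (compl_subset_compl.2 subset_union_left)
    rw [connectedComponentIn_eq hw₁.1]
    exact hDp.subset_connectedComponentIn hwD this hx
  · by_contra hxN
    exact hD hx (Or.inr (Or.inr fun h => hxN (hON h)))

end Jordan

/-- Outside a large compact set, all points of `W` can be joined away from a given one. -/
def OneEnded {X : Type*} [TopologicalSpace X] (W : Set X) : Prop :=
  ∀ K ⊆ W, IsCompact K → ∃ K' ⊆ W, IsCompact K' ∧ ∀ y ∈ W \ K', ∀ z ∈ W \ K', Conn (W \ K) y z

lemma OneEnded.image {X Y : Type*} [TopologicalSpace X] [TopologicalSpace Y] {W : Set X}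
    (hW : OneEnded W) {g : X → Y} {d : Y → X} (hg : ContinuousOn g W)
    (hd : ContinuousOn d (g '' W)) (hdg : ∀ x ∈ W, d (g x) = x) : OneEnded (g '' W) := by
  intro K hK hKc
  have hdK : d '' K ⊆ W := by
    rintro _ ⟨y, hy, rfl⟩
    obtain ⟨x, hx, rfl⟩ := hK hy
    rwa [hdg x hx]
  obtain ⟨K', hK', hK'c, h⟩ := hW _ hdK (hKc.image_of_continuousOn (hd.mono hK))
  refine ⟨g '' K', image_mono hK', hK'c.image_of_continuousOn (hg.mono hK'), ?_⟩
  rintro _ ⟨⟨x, hx, rfl⟩, hx'⟩ _ ⟨⟨y, hy, rfl⟩, hy'⟩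
  refine ((h x ⟨hx, fun h => hx' ⟨x, h, rfl⟩⟩ y ⟨hy, fun h => hy' ⟨y, h, rfl⟩⟩).image
    (hg.mono sdiff_subset)).mono ?_
  rintro _ ⟨z, hz, rfl⟩
  exact ⟨⟨z, hz.1, rfl⟩, fun h => hz.2 ⟨_, h, hdg z hz.1⟩⟩

lemma oneEnded_of_isPreconnected_compl {W : Set Sphere2} (hW : IsOpen W)
    (hWc : IsPreconnected W) (hW' : IsPreconnected Wᶜ) : OneEnded W := by
  intro K hK hKc
  rcases Wᶜ.eq_empty_or_nonempty with h0 | ⟨x, hx⟩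
  · rw [compl_empty_iff] at h0
    subst h0
    exact ⟨univ, subset_rfl, isCompact_univ, by simp⟩
  have hWK : Wᶜ ⊆ Kᶜ := compl_subset_compl.2 hK
  have hV := hW'.subset_connectedComponentIn hx hWK
  refine ⟨(connectedComponentIn Kᶜ x)ᶜ, compl_subset_comm.1 hV,
    hKc.isClosed.isOpen_compl.connectedComponentIn.isClosed_compl.isCompact, ?_⟩
  rintro y ⟨hy, hy'⟩ z ⟨hz, hz'⟩
  have h1 : Conn Wᶜᶜ y z := by
    rw [compl_compl]
    exact hWc.conn hy hz
  have h2 : Conn Kᶜ y z := ⟨_, connectedComponentIn_subset _ _, isPreconnected_connectedComponentIn,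
    not_not.1 hy', not_not.1 hz'⟩
  refine (conn_compl_union hW.isClosed_compl hKc.isClosed ?_ h1 h2).mono ?_
  · rw [show Wᶜ ∩ K = ∅ from (disjoint_compl_left_iff_subset.2 hK).inter_eq]
    exact isPreconnected_empty
  · rw [compl_union, compl_compl]
    rfl

instance : ConnectedSpace Sphere2 := by
  have h : IsConnected (Metric.sphere (0 : EuclideanSpace ℝ (Fin 3)) 1) :=
    isConnected_sphere (by rw [← Module.finrank_eq_rank]; simp) 0 zero_le_one
  exact isConnected_iff_connectedSpace.1 h

lemma OneEnded.exists_conn_mem {W K K' : Set Sphere2} (hWo : IsOpen W) (hK : K ⊆ W)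
    (hKc : IsCompact K) (hK' : K' ⊆ W) (hK'c : IsCompact K') {a b : Sphere2} (ha : a ∉ W)
    (hab : ¬ Conn Kᶜ a b) : ∃ y ∈ W \ K', Conn Kᶜ a y := by
  have haK : a ∈ Kᶜ := fun h => ha (hK h)
  set O := connectedComponentIn Kᶜ a with hO
  have hOo : IsOpen O := hKc.isClosed.isOpen_compl.connectedComponentIn
  have haO : a ∈ O := mem_connectedComponentIn haK
  have hbO : b ∉ O := fun h => hab ((conn_iff_mem_connectedComponentIn haK).2 h)
  have hOp : IsPreconnected O := isPreconnected_connectedComponentIn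
  obtain ⟨x, hx⟩ : (frontier O).Nonempty :=
    nonempty_frontier_iff.2 ⟨⟨a, haO⟩, fun h => hbO (h ▸ mem_univ b)⟩
  have hxK : x ∈ K := by
    simpa using frontier_connectedComponentIn_subset (a := a) hKc.isClosed.isOpen_compl hx
  obtain ⟨u, huW, huO⟩ := mem_closure_iff.1 hx.1 W hWo (hK hxK)
  obtain ⟨w, hwO, hw⟩ : (O ∩ frontier W).Nonempty := by
    by_contra hne
    rw [not_nonempty_iff_eq_empty] at hne
    exact ha (subset_of_disjoint_frontier hOp ⟨u, huO, huW⟩ hne haO)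
  have hwW : w ∉ W := by
    rw [hWo.frontier_eq] at hw
    exact hw.2
  obtain ⟨y, ⟨hyO, hyK⟩, hyW⟩ := mem_closure_iff.1 hw.1 (O \ K') (hOo.sdiff hK'c.isClosed)
    ⟨hwO, fun h => hwW (hK' h)⟩
  exact ⟨y, ⟨hyW, hyK⟩, (conn_iff_mem_connectedComponentIn haK).2 hyO⟩

lemma OneEnded.conn_compl {W K : Set Sphere2} (hW : OneEnded W) (hWo : IsOpen W) (hK : K ⊆ W)
    (hKc : IsCompact K) {a b : Sphere2} (ha : a ∉ W) (hb : b ∉ W) : Conn Kᶜ a b := by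
  by_contra hab
  obtain ⟨K', hK', hK'c, h⟩ := hW K hK hKc
  obtain ⟨y, hy, hay⟩ := exists_conn_mem hWo hK hKc hK' hK'c ha hab
  obtain ⟨z, hz, hbz⟩ := exists_conn_mem hWo hK hKc hK' hK'c hb fun h => hab h.symm
  exact hab ((hay.trans ((h y hy z hz).mono fun x hx => hx.2)).trans hbz.symm)

lemma OneEnded.hasLog_sub {W : Set ℂ} (hW : OneEnded W) (hWo : IsOpen W)
    (hWc : IsPreconnected W) {w : ℂ} (hw : w ∉ W) : HasLog (fun z => z - w) W := by
  obtain ⟨v⟩ : Nonempty Sphere2 := inferInstance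
  refine hasLog_of_forall_isCompact hWo hWc (fun K hK hKc => ?_) (by fun_prop)
  have h1 : OneEnded (sti v '' W) := hW.image (d := st v) (continuous_sti v).continuousOn
    ((continuousOn_st v).mono (by rintro _ ⟨z, -, rfl⟩; exact sti_ne v z)) fun z _ => st_sti v z
  have h2 := h1.conn_compl ((isOpenEmbedding_sti v).isOpenMap W hWo) (image_mono hK)
    (hKc.image (continuous_sti v)) (a := sti v w) (b := v)
    (by rintro ⟨z, hz, h⟩; exact hw (sti_injective v h ▸ hz))
    (by rintro ⟨z, hz, h⟩; exact sti_ne v z h)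
  have h3 := hasLog_cr_of_conn (hKc.image (continuous_sti v)).isClosed (sti_ne v w) h2
  exact (h3.comp (g := sti v) (M := K) (continuous_sti v).continuousOn
    (mapsTo_image _ _)).congr fun z _ => by simp [cr]

section Injective

variable {W : Set ℂ} {φ : ℂ → ℂ}

lemma map_nhds_of_injOn (hW : IsOpen W) (hφ : DifferentiableOn ℂ φ W) (hi : InjOn φ W)
    {z : ℂ} (hz : z ∈ W) : 𝓝 (φ z) ≤ map φ (𝓝 z) := by
  have ha : AnalyticAt ℂ φ z := hφ.analyticAt (hW.mem_nhds hz)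
  refine ha.eventually_constant_or_nhds_le_map_nhds.resolve_left fun h => ?_
  have h1 : ∀ᶠ y in 𝓝[≠] z, φ y = φ z ∧ y ∈ W ∧ y ≠ z :=
    (h.filter_mono nhdsWithin_le_nhds).and
      (((hW.eventually_mem hz).filter_mono nhdsWithin_le_nhds).and self_mem_nhdsWithin)
  obtain ⟨y, hy1, hy2, hy3⟩ := h1.exists
  exact hy3 (hi hy2 hz hy1)

lemma isOpen_image_of_injOn (hW : IsOpen W) (hφ : DifferentiableOn ℂ φ W) (hi : InjOn φ W) :
    IsOpen (φ '' W) := by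
  rw [isOpen_iff_mem_nhds]
  rintro _ ⟨z, hz, rfl⟩
  exact map_nhds_of_injOn hW hφ hi hz (image_mem_map (hW.mem_nhds hz))

lemma continuousAt_invFunOn (hW : IsOpen W) (hφ : DifferentiableOn ℂ φ W) (hi : InjOn φ W)
    {z : ℂ} (hz : z ∈ W) : ContinuousAt (Function.invFunOn φ W) (φ z) := by
  intro N hN
  rw [hi.leftInvOn_invFunOn hz] at hN
  have := map_nhds_of_injOn hW hφ hi hz (image_mem_map (inter_mem hN (hW.mem_nhds hz)))
  refine mem_map.2 (mem_of_superset this ?_)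
  rintro _ ⟨y, ⟨hyN, hyW⟩, rfl⟩
  simpa [hi.leftInvOn_invFunOn hyW] using hyN

lemma eventually_deriv_ne_zero (hW : IsOpen W) (hφ : DifferentiableOn ℂ φ W) (hi : InjOn φ W)
    {z : ℂ} (hz : z ∈ W) : ∀ᶠ y in 𝓝[≠] z, deriv φ y ≠ 0 := by
  have ha : AnalyticAt ℂ φ z := hφ.analyticAt (hW.mem_nhds hz)
  refine ha.deriv.eventually_eq_zero_or_eventually_ne_zero.resolve_left fun h => ?_
  obtain ⟨r, hr, hball⟩ := Metric.eventually_nhds_iff_ball.1 (h.and (hW.eventually_mem hz))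
  have hy : z + (r / 2 : ℝ) ∈ ball z r := by
    simp [abs_of_pos hr, hr]
  have h0 : ‖φ (z + (r / 2 : ℝ)) - φ z‖ ≤ 0 * ‖z + (r / 2 : ℝ) - z‖ :=
    Convex.norm_image_sub_le_of_norm_deriv_le (s := ball z r)
      (fun x hx => hφ.differentiableAt (hW.mem_nhds (hball x hx).2))
      (fun x hx => by rw [(hball x hx).1, norm_zero]) (convex_ball z r) (mem_ball_self hr) hy
  rw [zero_mul, norm_le_zero_iff, sub_eq_zero] at h0
  have := hi (hball _ hy).2 hz h0
  simp [hr.ne'] at this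

lemma differentiableAt_invFunOn (hW : IsOpen W) (hφ : DifferentiableOn ℂ φ W) (hi : InjOn φ W)
    {z : ℂ} (hz : z ∈ W) : DifferentiableAt ℂ (Function.invFunOn φ W) (φ z) := by
  have h1 := eventually_deriv_ne_zero hW hφ hi hz
  rw [eventually_nhdsWithin_iff] at h1
  set s := φ '' {y | (y ≠ z → deriv φ y ≠ 0) ∧ y ∈ W} with hs
  have hsn : s ∈ 𝓝 (φ z) :=
    map_nhds_of_injOn hW hφ hi hz (image_mem_map (h1.and (hW.eventually_mem hz)))
  refine ((Complex.differentiableOn_compl_singleton_and_continuousAt_iff hsn).1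
    ⟨?_, continuousAt_invFunOn hW hφ hi hz⟩).differentiableAt hsn
  rintro _ ⟨⟨y, ⟨hy, hyW⟩, rfl⟩, hyz⟩
  have hyz : y ≠ z := fun h => hyz (by rw [h]; rfl)
  have hd : HasDerivAt φ (deriv φ y) (Function.invFunOn φ W (φ y)) := by
    rw [hi.leftInvOn_invFunOn hyW]
    exact (hφ.differentiableAt (hW.mem_nhds hyW)).hasDerivAt
  refine (HasDerivAt.of_local_left_inverse (continuousAt_invFunOn hW hφ hi hyW) hd (hy hyz)
    ?_).differentiableAt.differentiableWithinAt
  filter_upwards [(isOpen_image_of_injOn hW hφ hi).mem_nhds (mem_image_of_mem φ hyW)] with x hx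
  exact Function.invFunOn_eq hx

lemma differentiableOn_invFunOn (hW : IsOpen W) (hφ : DifferentiableOn ℂ φ W) (hi : InjOn φ W) :
    DifferentiableOn ℂ (Function.invFunOn φ W) (φ '' W) := by
  rintro _ ⟨z, hz, rfl⟩
  exact (differentiableAt_invFunOn hW hφ hi hz).differentiableWithinAt

end Injective

/-- Hurwitz: a nonconstant locally uniform limit of injective holomorphic maps is injective. -/
theorem injOn_of_tendstoLocallyUniformlyOn {ι : Type*} {l : Filter ι} [l.NeBot] {W : Set ℂ}
    (hW : IsOpen W) (hWc : IsPreconnected W) {F : ι → ℂ → ℂ} {f : ℂ → ℂ}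
    (h : TendstoLocallyUniformlyOn F f l W) (hd : ∀ n, DifferentiableOn ℂ (F n) W)
    (hi : ∀ n, InjOn (F n) W) (hne : ∃ x ∈ W, ∃ y ∈ W, f x ≠ f y) : InjOn f W := by
  intro z₁ hz₁ z₂ hz₂ hz
  by_contra hz12
  have hf : DifferentiableOn ℂ f W := h.differentiableOn (Eventually.of_forall hd) hW
  have hg : AnalyticOnNhd ℂ (fun z => f z - f z₂) W := fun z hz =>
    (hf.analyticAt (hW.mem_nhds hz)).sub analyticAt_const
  have hev : ∀ᶠ z in 𝓝[≠] z₁, f z - f z₂ ≠ 0 := by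
    by_contra hcon
    have := hg.eqOn_zero_of_preconnected_of_frequently_eq_zero hWc hz₁
      (by simpa only [Filter.not_eventually, not_not] using hcon)
    obtain ⟨x, hx, y, hy, hxy⟩ := hne
    exact hxy ((sub_eq_zero.1 (this hx)).trans (sub_eq_zero.1 (this hy)).symm)
  rw [eventually_nhdsWithin_iff] at hev
  obtain ⟨r, hr, hball⟩ := Metric.nhds_basis_closedBall.eventually_iff.1
    ((hev.and (hW.eventually_mem hz₁)).and (isOpen_compl_singleton.eventually_mem hz12))
  have hsph : ∀ z ∈ sphere z₁ r, z ∈ closedBall z₁ r ∧ z ≠ z₁ := fun z hz =>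
    ⟨sphere_subset_closedBall hz, by rintro rfl; simp at hz; exact hr.ne hz⟩
  have hcont : ContinuousOn (fun z => ‖f z - f z₂‖) (sphere z₁ r) :=
    ((hf.continuousOn.mono fun z hz => (hball (hsph z hz).1).1.2).sub continuousOn_const).norm
  obtain ⟨x₀, hx₀, hmin⟩ := (isCompact_sphere z₁ r).exists_isMinOn
    (NormedSpace.sphere_nonempty.2 hr.le) hcont
  set m := ‖f x₀ - f z₂‖ with hm
  have hm0 : 0 < m := norm_pos_iff.2 ((hball (hsph x₀ hx₀).1).1.1 (hsph x₀ hx₀).2)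
  have hK : closedBall z₁ r ∪ {z₂} ⊆ W :=
    union_subset (fun z hz => (hball hz).1.2) (by simpa using hz₂)
  have hu := (tendstoLocallyUniformlyOn_iff_forall_isCompact hW).1 h _ hK
    ((isCompact_closedBall z₁ r).union isCompact_singleton)
  obtain ⟨n, hn⟩ := ((Metric.tendstoUniformlyOn_iff.1 hu) (m / 8) (by positivity)).exists
  have hn' : ∀ x ∈ closedBall z₁ r, ‖(F n x - F n z₂) - (f x - f z₂)‖ ≤ m / 4 := by
    intro x hx
    have h1 := hn x (Or.inl hx)
    have h2 := hn z₂ (Or.inr rfl)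
    rw [dist_eq_norm, norm_sub_rev] at h1
    rw [dist_eq_norm] at h2
    calc _ = ‖(F n x - f x) + (f z₂ - F n z₂)‖ := by congr 1; ring
      _ ≤ ‖F n x - f x‖ + ‖f z₂ - F n z₂‖ := norm_add_le _ _
      _ ≤ _ := by linarith
  have hF0 : ∀ x ∈ closedBall z₁ r, F n x - F n z₂ ≠ 0 := fun x hx h0 =>
    (hball hx).2 (hi n (hball hx).1.2 hz₂ (sub_eq_zero.1 h0))
  have hG : DiffContOnCl ℂ (fun x => (F n x - F n z₂)⁻¹) (ball z₁ r) := by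
    refine DifferentiableOn.diffContOnCl ?_
    rw [closure_ball _ hr.ne']
    exact (((hd n).mono fun z hz => (hball hz).1.2).sub_const _).inv hF0
  have hle := Complex.norm_le_of_forall_mem_frontier_norm_le isBounded_ball hG
    (C := (3 * m / 4)⁻¹) ?_ (subset_closure (mem_ball_self hr))
  · have h1 := hn' z₁ (mem_closedBall_self hr.le)
    rw [hz, sub_self, sub_zero] at h1
    rw [norm_inv, inv_le_inv₀ (norm_pos_iff.2 (hF0 z₁ (mem_closedBall_self hr.le)))
      (by positivity)] at hle
    linarith
  · intro x hx
    rw [frontier_ball _ hr.ne'] at hx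
    have h1 := hn' x (hsph x hx).1
    have h2 : m ≤ ‖f x - f z₂‖ := hmin hx
    rw [norm_inv]
    refine inv_anti₀ (by positivity) ?_
    have h3 := norm_sub_norm_le (f x - f z₂) (F n x - F n z₂)
    rw [norm_sub_rev (f x - f z₂) (F n x - F n z₂)] at h3
    linarith

lemma differentiableOn_of_exp {W : Set ℂ} (hW : IsOpen W) {F L : ℂ → ℂ}
    (hF : DifferentiableOn ℂ F W) (hL : ContinuousOn L W)
    (he : ∀ z ∈ W, exp (L z) = F z) : DifferentiableOn ℂ L W := by
  intro z hz
  have h0 : F z ≠ 0 := he z hz ▸ Complex.exp_ne_zero _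
  have h1 : DifferentiableAt ℂ (fun y => L z + Complex.log (F y / F z)) z := by
    refine (DifferentiableAt.clog ((hF.differentiableAt (hW.mem_nhds hz)).div_const _) ?_).const_add _
    rw [div_self h0]
    exact Complex.one_mem_slitPlane
  have hc : ContinuousAt L z := hL.continuousAt (hW.mem_nhds hz)
  refine (h1.congr_of_eventuallyEq ?_).differentiableWithinAt
  filter_upwards [hc (ball_mem_nhds _ Real.pi_pos), hW.mem_nhds hz] with y hy hyW
  have hy : ‖L y - L z‖ < π := by simpa [dist_eq_norm] using hy
  have him := abs_le.1 (Complex.abs_im_le_norm (L y - L z))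
  rw [← he y hyW, ← he z hz, ← Complex.exp_sub, Complex.log_exp (by linarith) (by linarith)]
  ring

/-- Montel's theorem for maps into the unit disc, along an ultrafilter. -/
theorem exists_tendstoLocallyUniformlyOn {ι : Type*} (l : Ultrafilter ι) {W : Set ℂ}
    (hW : IsOpen W) {F : ι → ℂ → ℂ} (hd : ∀ n, DifferentiableOn ℂ (F n) W)
    (hm : ∀ n, MapsTo (F n) W (ball 0 1)) :
    ∃ f : ℂ → ℂ, TendstoLocallyUniformlyOn F f l W ∧ (∀ z ∈ W, ‖f z‖ ≤ 1) ∧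
      ∀ z ∈ W, Tendsto (fun n => F n z) l (𝓝 (f z)) := by
  have hex : ∀ z ∈ W, ∃ w ∈ closedBall (0 : ℂ) 1, Tendsto (fun n => F n z) l (𝓝 w) := by
    intro z hz
    refine (isCompact_closedBall (0 : ℂ) 1).ultrafilter_le_nhds (l.map fun n => F n z) ?_
    rw [le_principal_iff]
    have : ∀ᶠ n in (l : Filter ι), F n z ∈ closedBall (0 : ℂ) 1 :=
      Eventually.of_forall fun n => ball_subset_closedBall (hm n hz)
    exact this
  choose! f hf1 hf2 using hex
  refine ⟨f, ?_, fun z hz => by simpa using hf1 z hz, hf2⟩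
  rw [Metric.tendstoLocallyUniformlyOn_iff]
  intro ε hε x hx
  obtain ⟨r, hr, hball⟩ := Metric.isOpen_iff.1 hW x hx
  have hlip : ∀ n, ∀ z ∈ ball x r, dist (F n z) (F n x) ≤ 2 / r * dist z x := by
    intro n z hz
    refine Complex.dist_le_div_mul_dist_of_mapsTo_ball ((hd n).mono hball) ?_ hz
    intro y hy
    have h1 := hm n (hball hy)
    have h2 := hm n hx
    rw [mem_closedBall, dist_eq_norm]
    rw [mem_ball_zero_iff] at h1 h2
    linarith [norm_sub_le (F n y) (F n x)]
  have hlipf : ∀ z ∈ ball x r, dist (f z) (f x) ≤ 2 / r * dist z x := fun z hz =>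
    le_of_tendsto ((hf2 z (hball hz)).dist (hf2 x hx)) (Eventually.of_forall fun n => hlip n z hz)
  set ρ := min r (ε * r / 8) with hρ
  have hρ0 : 0 < ρ := by positivity
  refine ⟨ball x ρ, mem_nhdsWithin_of_mem_nhds (ball_mem_nhds x hρ0), ?_⟩
  filter_upwards [hf2 x hx (ball_mem_nhds _ (half_pos hε))] with n hn z hz
  have hzr : z ∈ ball x r := ball_subset_ball (min_le_left _ _) hz
  have hzd : 2 / r * dist z x < ε / 4 := by
    have : dist z x < ε * r / 8 := (mem_ball.1 hz).trans_le (min_le_right _ _)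
    rw [div_mul_eq_mul_div, div_lt_iff₀ hr]
    linarith
  have h1 := hlip n z hzr
  have h2 := hlipf z hzr
  have h3 : dist (F n x) (f x) < ε / 2 := hn
  have h4 := dist_triangle4 (f z) (f x) (F n x) (F n z)
  rw [dist_comm (f x), dist_comm (F n x) (F n z)] at h4
  linarith

open ComplexConjugate

/-- The disc automorphism taking `a` to `0`. -/
noncomputable def mob (a z : ℂ) : ℂ := (z - a) / (1 - conj a * z)

lemma mob_denom_ne_zero {a z : ℂ} (ha : ‖a‖ < 1) (hz : ‖z‖ < 1) : 1 - conj a * z ≠ 0 := by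
  intro h
  have h1 : ‖conj a * z‖ = 1 := by rw [← sub_eq_zero.1 h, norm_one]
  rw [norm_mul, Complex.norm_conj] at h1
  nlinarith [norm_nonneg a, norm_nonneg z]

lemma norm_mob_lt_one {a z : ℂ} (ha : ‖a‖ < 1) (hz : ‖z‖ < 1) : ‖mob a z‖ < 1 := by
  rw [mob, norm_div, div_lt_one (norm_pos_iff.2 (mob_denom_ne_zero ha hz))]
  refine lt_of_pow_lt_pow_left₀ 2 (norm_nonneg _) ?_
  have ha' : ‖a‖ ^ 2 < 1 := by nlinarith [norm_nonneg a]
  have hz' : ‖z‖ ^ 2 < 1 := by nlinarith [norm_nonneg z]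
  rw [← Complex.normSq_eq_norm_sq, normSq_apply] at ha' hz' ⊢
  rw [← Complex.normSq_eq_norm_sq, normSq_apply]
  simp
  nlinarith [mul_pos (sub_pos.2 ha') (sub_pos.2 hz')]

lemma mob_injOn {a : ℂ} (ha : ‖a‖ < 1) : InjOn (mob a) (ball 0 1) := by
  intro z hz w hw h
  rw [mem_ball_zero_iff] at hz hw
  rw [mob, mob, div_eq_div_iff (mob_denom_ne_zero ha hz) (mob_denom_ne_zero ha hw)] at h
  have h2 : (z - w) * (1 - conj a * a) = 0 := by linear_combination h
  rcases mul_eq_zero.1 h2 with h3 | h3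
  · exact sub_eq_zero.1 h3
  · exact absurd h3 (mob_denom_ne_zero ha ha)

lemma hasDerivAt_mob {a z : ℂ} (ha : ‖a‖ < 1) (hz : ‖z‖ < 1) :
    HasDerivAt (mob a) ((1 - conj a * a) / (1 - conj a * z) ^ 2) z := by
  have h1 : HasDerivAt (fun z => z - a) 1 z := (hasDerivAt_id z).sub_const a
  have h2 : HasDerivAt (fun z => 1 - conj a * z) (-conj a) z := by
    simpa using ((hasDerivAt_id z).const_mul (conj a)).const_sub 1
  have h3 := h1.div h2 (mob_denom_ne_zero ha hz)
  have e : (1 * (1 - conj a * z) - (z - a) * -conj a) = 1 - conj a * a := by ring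
  rw [e] at h3
  exact h3

@[simp] theorem mob_self (a : ℂ) : mob a a = 0 := by simp [mob]

lemma exists_norm_deriv_lt {W : Set ℂ} (hW : IsOpen W) (hWc : IsPreconnected W)
    (hE : OneEnded W) {w₀ : ℂ} (hw₀ : w₀ ∈ W) {f : ℂ → ℂ} (hf : DifferentiableOn ℂ f W)
    (hi : InjOn f W) (hm : MapsTo f W (ball 0 1)) (h0 : f w₀ = 0) (hd : deriv f w₀ ≠ 0)
    {w : ℂ} (hw : ‖w‖ < 1) (hwf : w ∉ f '' W) :
    ∃ g : ℂ → ℂ, DifferentiableOn ℂ g W ∧ InjOn g W ∧ MapsTo g W (ball 0 1) ∧ g w₀ = 0 ∧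
      ‖deriv f w₀‖ < ‖deriv g w₀‖ := by
  have hE' : OneEnded (f '' W) := hE.image hf.continuousOn
    (differentiableOn_invFunOn hW hf hi).continuousOn hi.leftInvOn_invFunOn
  have hmd : ∀ {a z : ℂ}, ‖a‖ < 1 → ‖z‖ < 1 → DifferentiableAt ℂ (mob a) z := fun ha hz =>
    (hasDerivAt_mob ha hz).differentiableAt
  have hm' : ∀ z ∈ W, ‖f z‖ < 1 := fun z hz => by simpa using hm hz
  have hlog : HasLog (fun z => mob w (f z)) W := by
    refine HasLog.div (F := fun z => f z - w) (G := fun z => 1 - conj w * f z) ?_ ?_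
    · exact (hE'.hasLog_sub (isOpen_image_of_injOn hW hf hi)
        (hWc.image f hf.continuousOn) hwf).comp (g := f) hf.continuousOn (mapsTo_image f W)
    · refine hasLog_of_slitPlane (continuousOn_const.sub (continuousOn_const.mul hf.continuousOn))
        fun z hz => mem_slitPlane_of_norm_sub_one_lt ?_
      have := hm' z hz
      simp only [sub_sub_cancel_left, norm_neg, norm_mul, Complex.norm_conj]
      nlinarith [norm_nonneg w, norm_nonneg (f z)]
  have hdm : DifferentiableOn ℂ (fun z => mob w (f z)) W := fun z hz =>
    (((hmd hw (hm' z hz)).comp z (hf.differentiableAt (hW.mem_nhds hz))) :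
      DifferentiableAt ℂ (fun z => mob w (f z)) z).differentiableWithinAt
  obtain ⟨L, hL, hLe⟩ := hlog
  have hLd := differentiableOn_of_exp hW hdm hL hLe
  set q : ℂ → ℂ := fun z => exp (L z / 2) with hq
  have hqd : DifferentiableOn ℂ q W := (hLd.div_const 2).cexp
  have hq2 : ∀ z ∈ W, q z ^ 2 = mob w (f z) := fun z hz => by
    refine Eq.trans ?_ (hLe z hz)
    rw [hq, ← Complex.exp_nat_mul]
    congr 1
    push_cast
    ring
  have hq1 : ∀ z ∈ W, ‖q z‖ < 1 := fun z hz => by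
    have h1 : ‖q z‖ ^ 2 < 1 := by
      rw [← norm_pow, hq2 z hz]
      exact norm_mob_lt_one hw (hm' z hz)
    nlinarith [norm_nonneg (q z)]
  have hqi : InjOn q W := fun x hx y hy hxy => by
    refine hi hx hy (mob_injOn hw (hm hx) (hm hy) ?_)
    rw [← hq2 x hx, ← hq2 y hy, hxy]
  set s := q w₀ with hs
  have hs1 : ‖s‖ < 1 := hq1 w₀ hw₀
  have hs0 : 0 < ‖s‖ := norm_pos_iff.2 (Complex.exp_ne_zero _)
  have hsw : ‖s‖ ^ 2 = ‖w‖ := by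
    rw [← norm_pow, hs, hq2 w₀ hw₀, h0]
    simp [mob]
  refine ⟨fun z => mob s (q z), fun z hz => ?_, fun x hx y hy hxy => ?_, fun z hz => ?_, ?_, ?_⟩
  · exact ((hmd hs1 (hq1 z hz)).comp z
      (hqd.differentiableAt (hW.mem_nhds hz))).differentiableWithinAt
  · exact hqi hx hy (mob_injOn hs1 (by simpa using hq1 x hx) (by simpa using hq1 y hy) hxy)
  · simpa using norm_mob_lt_one hs1 (hq1 z hz)
  · simp [hs]
  have hf' := (hf.differentiableAt (hW.mem_nhds hw₀)).hasDerivAt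
  have hq' := (hqd.differentiableAt (hW.mem_nhds hw₀)).hasDerivAt
  have e1 : HasDerivAt (fun z => q z ^ 2) (2 * s * deriv q w₀) w₀ := by
    simpa using hq'.fun_pow 2
  have hmf : HasDerivAt (mob w) (1 - conj w * w) (f w₀) := by
    rw [h0]
    simpa using hasDerivAt_mob (z := 0) hw (by simp)
  have e2 : HasDerivAt (fun z => q z ^ 2) ((1 - conj w * w) * deriv f w₀) w₀ :=
    (hmf.comp w₀ hf').congr_of_eventuallyEq
      ((hW.eventually_mem hw₀).mono fun z hz => hq2 z hz)
  have e3 := e1.unique e2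
  have hg' : deriv (fun z => mob s (q z)) w₀ =
      (1 - conj s * s) / (1 - conj s * s) ^ 2 * deriv q w₀ :=
    HasDerivAt.deriv (HasDerivAt.comp (h₂ := mob s) (h := q) w₀ (hasDerivAt_mob hs1 hs1) hq')
  have hns : ∀ u : ℂ, ‖u‖ < 1 → ‖1 - conj u * u‖ = 1 - ‖u‖ ^ 2 := fun u hu => by
    rw [Complex.conj_mul', ← Complex.ofReal_pow, ← Complex.ofReal_one, ← Complex.ofReal_sub,
      norm_real, Real.norm_of_nonneg]
    nlinarith [norm_nonneg u]
  have e4 := congrArg norm e3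
  rw [norm_mul, norm_mul, norm_mul, hns w hw, ← hsw, Complex.norm_two] at e4
  rw [hg', norm_mul, norm_div, norm_pow, hns s hs1]
  have hpos : 0 < 1 - ‖s‖ ^ 2 := by nlinarith
  have hdp : 0 < ‖deriv f w₀‖ := norm_pos_iff.2 hd
  have e5 : ‖deriv q w₀‖ = (1 - (‖s‖ ^ 2) ^ 2) * ‖deriv f w₀‖ / (2 * ‖s‖) := by
    rw [← e4]; field_simp
  have e6 : (1 - ‖s‖ ^ 2) / (1 - ‖s‖ ^ 2) ^ 2 * ‖deriv q w₀‖ =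
      (1 + ‖s‖ ^ 2) / (2 * ‖s‖) * ‖deriv f w₀‖ := by
    rw [e5]
    field_simp
    ring
  rw [e6]
  have : 1 < (1 + ‖s‖ ^ 2) / (2 * ‖s‖) := by
    rw [one_lt_div (by positivity)]
    nlinarith [sq_pos_of_pos (sub_pos.2 hs1)]
  nlinarith

/-- The Riemann mapping theorem for bounded one-ended domains. -/
theorem exists_conformal_disc {W : Set ℂ} (hW : IsOpen W) (hWc : IsPreconnected W)
    (hE : OneEnded W) (hWb : Bornology.IsBounded W) {w₀ : ℂ} (hw₀ : w₀ ∈ W) :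
    ∃ f : ℂ → ℂ, DifferentiableOn ℂ f W ∧ InjOn f W ∧ f '' W = ball 0 1 ∧ f w₀ = 0 := by
  set D := {f : ℂ → ℂ | DifferentiableOn ℂ f W ∧ InjOn f W ∧ MapsTo f W (ball 0 1) ∧ f w₀ = 0}
    with hD
  obtain ⟨r, hr, hball⟩ := Metric.isOpen_iff.1 hW w₀ hw₀
  have hbdd : BddAbove ((fun f => ‖deriv f w₀‖) '' D) := by
    refine ⟨1 / r, ?_⟩
    rintro _ ⟨f, ⟨h1, -, h3, h4⟩, rfl⟩
    refine Complex.norm_deriv_le_div_of_mapsTo_ball (h1.mono hball) ?_ hr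
    rw [h4]
    exact (h3.mono_left hball).mono_right ball_subset_closedBall
  obtain ⟨R, hR⟩ := hWb.subset_ball w₀
  have hRpos : 0 < R := pos_of_mem_ball (hR hw₀)
  have hid : (fun z => (z - w₀) / R) ∈ D := by
    refine ⟨by fun_prop, fun x _ y _ h => ?_, fun z hz => ?_, by simp⟩
    · have hR' : (R : ℂ) ≠ 0 := by exact_mod_cast hRpos.ne'
      simpa [div_left_inj' hR'] using h
    · have := hR hz
      rw [mem_ball, dist_eq_norm] at this
      simpa [abs_of_pos hRpos, div_lt_one hRpos] using this
  have hidd : deriv (fun z => (z - w₀) / (R : ℂ)) w₀ = 1 / R := by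
    simp
  obtain ⟨u, -, hu, huD⟩ := exists_seq_tendsto_sSup ⟨_, mem_image_of_mem _ hid⟩ hbdd
  choose F hFD hFu using huD
  set l := Filter.hyperfilter ℕ
  obtain ⟨f, hft, hf1, hfp⟩ := exists_tendstoLocallyUniformlyOn l hW (fun n => (hFD n).1)
    fun n => (hFD n).2.2.1
  have hfd : DifferentiableOn ℂ f W :=
    hft.differentiableOn (Eventually.of_forall fun n => (hFD n).1) hW
  have hl : (l : Filter ℕ) ≤ atTop := Nat.hyperfilter_le_atTop
  have hder : ‖deriv f w₀‖ = sSup ((fun f => ‖deriv f w₀‖) '' D) := by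
    have h1 := ((hft.deriv (Eventually.of_forall fun n => (hFD n).1) hW).tendsto_at hw₀).norm
    refine tendsto_nhds_unique (h1.congr fun n => ?_) (hu.mono_left hl)
    exact hFu n
  have hpos : 0 < ‖deriv f w₀‖ := by
    rw [hder]
    refine lt_of_lt_of_le ?_ (le_csSup hbdd (mem_image_of_mem _ hid))
    simp only [hidd]
    simp [hRpos.ne']
  have hf0 : f w₀ = 0 := tendsto_nhds_unique (hfp w₀ hw₀)
    (tendsto_const_nhds.congr fun n => (hFD n).2.2.2.symm)
  have hne : ∃ x ∈ W, ∃ y ∈ W, f x ≠ f y := by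
    by_contra! hcon
    have : f =ᶠ[𝓝 w₀] fun _ => f w₀ := (hW.eventually_mem hw₀).mono fun z hz => hcon z hz w₀ hw₀
    rw [this.deriv_eq] at hpos
    simp at hpos
  have hfi : InjOn f W := injOn_of_tendstoLocallyUniformlyOn hW hWc hft (fun n => (hFD n).1)
    (fun n => (hFD n).2.1) hne
  have hfm : MapsTo f W (ball 0 1) := by
    rw [mapsTo_iff_image_subset, ← interior_closedBall (0 : ℂ) one_ne_zero]
    refine interior_maximal ?_ (isOpen_image_of_injOn hW hfd hfi)
    rintro _ ⟨z, hz, rfl⟩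
    simpa using hf1 z hz
  refine ⟨f, hfd, hfi, subset_antisymm (mapsTo_iff_image_subset.1 hfm) fun w hw => ?_, hf0⟩
  by_contra hwf
  obtain ⟨g, hg1, hg2, hg3, hg4, hg5⟩ := exists_norm_deriv_lt hW hWc hE hw₀ hfd hfi hfm hf0
    (norm_pos_iff.1 hpos) (by simpa using hw) hwf
  rw [hder] at hg5
  exact absurd (le_csSup hbdd (mem_image_of_mem _ ⟨hg1, hg2, hg3, hg4⟩)) (not_le.2 hg5)

open MeasureTheory
open scoped ENNReal

lemma lintegral_enorm_deriv_sq_eq {G : ℂ → ℂ} {R : Set ℂ} (hR : IsOpen R)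
    (hG : DifferentiableOn ℂ G R) (hi : InjOn G R) :
    ∫⁻ z in R, ‖deriv G z‖ₑ ^ 2 = volume (G '' R) := by
  rw [← lintegral_abs_det_fderiv_eq_addHaar_image volume hR.measurableSet (fun x hx =>
    ((hG.differentiableAt (hR.mem_nhds hx)).hasDerivAt.complexToReal_fderiv).hasFDerivWithinAt) hi]
  congr 1
  ext z
  have : (deriv G z • (1 : ℂ →L[ℝ] ℂ)).det = ‖deriv G z‖ ^ 2 := by
    rw [← Complex.normSq_eq_norm_sq, ← Algebra.norm_complex_apply, Algebra.norm_apply]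
    rfl
  rw [this, abs_of_nonneg (by positivity), ENNReal.ofReal_pow (norm_nonneg _), ofReal_norm]

lemma sq_lintegral_le {f : ℝ → ℝ≥0∞} (hf : Measurable f) (p q : ℝ) :
    (∫⁻ x in Ioo p q, f x) ^ 2 ≤ ENNReal.ofReal (q - p) * ∫⁻ x in Ioo p q, f x ^ 2 := by
  have h := ENNReal.lintegral_mul_le_Lp_mul_Lq (volume.restrict (Ioo p q))
    Real.HolderConjugate.two_two (f := 1) (g := f) aemeasurable_const hf.aemeasurable
  simp only [one_mul, Pi.one_apply, ENNReal.one_rpow, lintegral_const, Measure.restrict_apply,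
    MeasurableSet.univ, univ_inter, Real.volume_Ioo] at h
  calc _ ≤ _ := pow_le_pow_left' h 2
    _ = _ := by
      rw [mul_pow, ← ENNReal.rpow_natCast, ← ENNReal.rpow_natCast, ← ENNReal.rpow_mul,
        ← ENNReal.rpow_mul]
      norm_num

/-- The length-area inequality on a rectangle. -/
theorem lintegral_length_sq_le {G : ℂ → ℂ} {p q s t : ℝ}
    (hG : DifferentiableOn ℂ G (Ioo p q ×ℂ Ioo s t)) (hi : InjOn G (Ioo p q ×ℂ Ioo s t)) :
    ∫⁻ y in Ioo s t, (∫⁻ x in Ioo p q, ‖deriv G (x + y * I)‖ₑ) ^ 2 ≤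
      ENNReal.ofReal (q - p) * volume (G '' (Ioo p q ×ℂ Ioo s t)) := by
  have hR : IsOpen (Ioo p q ×ℂ Ioo s t) := isOpen_Ioo.reProdIm isOpen_Ioo
  have hm : Measurable fun z => ‖deriv G z‖ₑ := (measurable_deriv G).enorm
  have hm2 : Measurable fun z : ℝ × ℝ => ‖deriv G (z.1 + z.2 * I)‖ₑ :=
    hm.comp (by fun_prop)
  have h1 : ∫⁻ y in Ioo s t, ∫⁻ x in Ioo p q, ‖deriv G (x + y * I)‖ₑ ^ 2 =
      volume (G '' (Ioo p q ×ℂ Ioo s t)) := by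
    rw [← lintegral_enorm_deriv_sq_eq hR hG hi]
    have h2 := setLIntegral_prod_symm (μ := volume) (ν := volume) (s := Ioo p q) (t := Ioo s t)
      (fun z : ℝ × ℝ => ‖deriv G (z.1 + z.2 * I)‖ₑ ^ 2) (hm2.pow_const 2).aemeasurable
    rw [← h2, ← Measure.volume_eq_prod,
      ← Complex.volume_preserving_equiv_real_prod.setLIntegral_comp_preimage_emb
        Complex.measurableEquivRealProd.measurableEmbedding]
    congr 1
    ext z
    simp [Complex.measurableEquivRealProd_apply]
  rw [← h1, ← lintegral_const_mul' _ _ ENNReal.ofReal_ne_top]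
  refine lintegral_mono fun y => ?_
  have hm3 : Measurable fun x : ℝ => ‖deriv G (x + y * I)‖ₑ :=
    hm.comp (by fun_prop)
  exact sq_lintegral_le hm3 p q

lemma enorm_sub_le_lintegral {G : ℂ → ℂ} {p q s t : ℝ}
    (hG : DifferentiableOn ℂ G (Ioo p q ×ℂ Ioo s t)) {y x₁ x₂ : ℝ} (hy : y ∈ Ioo s t)
    (h₁ : x₁ ∈ Ioo p q) (h₂ : x₂ ∈ Ioo p q) :
    ‖G (x₂ + y * I) - G (x₁ + y * I)‖ₑ ≤
      ∫⁻ x in Ioo p q, ‖deriv G (x + y * I)‖ₑ := by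
  have hR : IsOpen (Ioo p q ×ℂ Ioo s t) := isOpen_Ioo.reProdIm isOpen_Ioo
  have hsub : uIcc x₁ x₂ ⊆ Ioo p q := by
    rw [uIcc]
    exact (Icc_subset_Ioo_iff inf_le_sup).2 ⟨lt_inf_iff.2 ⟨h₁.1, h₂.1⟩, sup_lt_iff.2 ⟨h₁.2, h₂.2⟩⟩
  have hmem : ∀ x ∈ uIcc x₁ x₂, (x : ℂ) + y * I ∈ Ioo p q ×ℂ Ioo s t := fun x hx => by
    simpa [Complex.mem_reProdIm] using ⟨hsub hx, hy⟩
  have hd : ∀ x ∈ uIcc x₁ x₂, HasDerivAt (fun x : ℝ => G (x + y * I))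
      (deriv G (x + y * I)) x := fun x hx => by
    have e1 := (hG.differentiableAt (hR.mem_nhds (hmem x hx))).hasDerivAt
    have e2 : HasDerivAt (fun x : ℂ => x + y * I) 1 (x : ℂ) :=
      (hasDerivAt_id _).add_const _
    simpa using (HasDerivAt.comp (h₂ := G) (h := fun x : ℂ => x + y * I) (x : ℂ) e1
      e2).comp_ofReal
  have hc : ContinuousOn (fun x : ℝ => deriv G (x + y * I)) (uIcc x₁ x₂) :=
    (hG.deriv hR).continuousOn.comp (by fun_prop) hmem
  rw [← intervalIntegral.integral_eq_sub_of_hasDerivAt hd hc.intervalIntegrable]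
  have h3 : ‖∫ x in x₁..x₂, deriv G (x + y * I)‖ₑ ≤
      ∫⁻ x in uIoc x₁ x₂, ‖deriv G (x + y * I)‖ₑ := by
    rw [← ofReal_norm, intervalIntegral.norm_intervalIntegral_eq, ofReal_norm]
    exact enorm_integral_le_lintegral_enorm _
  exact h3.trans (lintegral_mono_set (uIoc_subset_uIcc.trans hsub))

lemma exp_eq_circleMap (x y : ℝ) :
    exp (x + y * I) = circleMap 0 (Real.exp x) y := by
  rw [exp_add, circleMap_zero, Complex.ofReal_exp]

lemma injOn_exp_reProdIm {p q s t : ℝ} (h : t ≤ s + 2 * π) :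
    InjOn exp (Ioo p q ×ℂ Ioo s t) := by
  intro z hz w hw hzw
  obtain ⟨n, hn⟩ := Complex.exp_eq_exp_iff_exists_int.1 hzw
  have him := congrArg Complex.im hn
  simp only [Complex.add_im, Complex.mul_im, Complex.intCast_re, Complex.intCast_im,
    Complex.mul_re, Complex.re_ofNat, Complex.im_ofNat, Complex.ofReal_re, Complex.ofReal_im,
    Complex.I_re, Complex.I_im] at him
  have h1 := hz.2
  have h2 := hw.2
  simp only [mem_preimage, mem_Ioo] at h1 h2
  have hpi := Real.pi_pos
  have hn0 : n = 0 := by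
    by_contra hne
    rcases lt_or_gt_of_ne hne with h0 | h0
    · have : (n : ℝ) ≤ -1 := by exact_mod_cast Int.le_sub_one_of_lt h0
      nlinarith
    · have : (1 : ℝ) ≤ n := by exact_mod_cast h0
      nlinarith
  rw [hn, hn0]
  simp

section Rays

variable {ψ : ℂ → ℂ} {a : ℂ}

lemma circleMap_mem_unit_ball {r : ℝ} (h0 : 0 ≤ r) (h1 : r < 1) (y : ℝ) :
    circleMap 0 r y ∈ ball (0 : ℂ) 1 := by
  simpa [abs_of_nonneg h0] using h1

lemma integral_sq_le_of_radial_cluster (hψ : DifferentiableOn ℂ ψ (ball 0 1))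
    (hi : InjOn ψ (ball 0 1)) (hA : volume (ψ '' ball 0 1) ≠ ∞) {s T : ℝ} (hT0 : 0 ≤ T)
    (hT : T ≤ 2 * π)
    (hcl : ∀ θ ∈ Ioo s (s + T), ∀ δ > 0, ∀ r₀ < 1, ∃ r ∈ Ioo r₀ 1, ‖ψ (circleMap 0 r θ) - a‖ < δ)
    {x : ℝ} (hx : x < 0) :
    (∫ y in s..(s + T), ‖ψ (circleMap 0 (Real.exp x) y) - a‖) ^ 2 ≤
      T * (-(2 * x) * (volume (ψ '' ball 0 1)).toReal) := by
  set G : ℂ → ℂ := fun w => ψ (exp w) with hG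
  set R := Ioo (2 * x) 0 ×ℂ Ioo s (s + T) with hR
  have hexp : MapsTo exp R (ball 0 1) := fun z hz => by
    have h1 := hz.1
    simp only [mem_preimage, mem_Ioo] at h1
    simp [Complex.norm_exp, h1.2]
  have hGd : DifferentiableOn ℂ G R := hψ.comp Complex.differentiable_exp.differentiableOn hexp
  have hGi : InjOn G R := hi.comp (injOn_exp_reProdIm (by linarith)) hexp
  have hle : ∀ y ∈ Ioo s (s + T), ‖ψ (circleMap 0 (Real.exp x) y) - a‖ₑ ≤
      ∫⁻ u in Ioo (2 * x) 0, ‖deriv G (u + y * I)‖ₑ := by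
    intro y hy
    refine ENNReal.le_of_forall_pos_le_add fun ε hε _ => ?_
    obtain ⟨r, hr, hra⟩ := hcl y hy ε (by exact_mod_cast hε) (Real.exp (2 * x))
      (by rw [Real.exp_lt_one_iff]; linarith)
    have hr0 : 0 < r := (Real.exp_pos _).trans hr.1
    have h1 := enorm_sub_le_lintegral hGd hy (x₁ := Real.log r) (x₂ := x)
      ⟨(Real.lt_log_iff_exp_lt hr0).2 hr.1, Real.log_neg hr0 hr.2⟩ ⟨by linarith, hx⟩
    simp only [hG, exp_eq_circleMap, Real.exp_log hr0] at h1
    have h2 : ‖ψ (circleMap 0 r y) - a‖ₑ ≤ ε := by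
      rw [← ofReal_norm]
      exact ENNReal.ofReal_le_coe.2 hra.le
    calc _ = ‖(ψ (circleMap 0 (Real.exp x) y) - ψ (circleMap 0 r y)) +
          (ψ (circleMap 0 r y) - a)‖ₑ := by rw [sub_add_sub_cancel]
      _ ≤ _ := enorm_add_le _ _
      _ ≤ _ := add_le_add h1 h2
  have hcont : Continuous fun y => ψ (circleMap 0 (Real.exp x) y) - a :=
    (hψ.continuousOn.comp_continuous (continuous_circleMap _ _)
      (circleMap_mem_unit_ball (Real.exp_pos x).le (by simpa using hx))).sub continuous_const
  have h2 : ∫⁻ y in Ioo s (s + T), ‖ψ (circleMap 0 (Real.exp x) y) - a‖ₑ ^ 2 ≤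
      ENNReal.ofReal (-(2 * x)) * volume (ψ '' ball 0 1) := by
    calc _ ≤ _ := setLIntegral_mono' measurableSet_Ioo fun y hy => pow_le_pow_left' (hle y hy) 2
      _ ≤ _ := lintegral_length_sq_le hGd hGi
      _ ≤ _ := by
        rw [zero_sub]
        refine mul_le_mul_right (measure_mono ?_) _
        rintro _ ⟨z, hz, rfl⟩
        exact mem_image_of_mem ψ (hexp hz)
  have h3 := (sq_lintegral_le hcont.measurable.enorm s (s + T)).trans (mul_le_mul_right h2 _)
  have h4 : ∫⁻ y in Ioo s (s + T), ‖ψ (circleMap 0 (Real.exp x) y) - a‖ₑ =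
      ENNReal.ofReal (∫ y in s..(s + T), ‖ψ (circleMap 0 (Real.exp x) y) - a‖) := by
    rw [intervalIntegral.integral_of_le (by linarith), integral_Ioc_eq_integral_Ioo,
      ofReal_integral_eq_lintegral_ofReal]
    · simp [ofReal_norm]
    · exact hcont.norm.integrableOn_Icc.mono_set Ioo_subset_Icc_self
    · exact Eventually.of_forall fun _ => norm_nonneg _
  have hJ : 0 ≤ ∫ y in s..(s + T), ‖ψ (circleMap 0 (Real.exp x) y) - a‖ :=
    intervalIntegral.integral_nonneg (by linarith) fun _ _ => norm_nonneg _
  rw [h4, ← ENNReal.ofReal_pow hJ, add_sub_cancel_left, ← ENNReal.ofReal_toReal hA,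
    ← ENNReal.ofReal_mul (by linarith), ← ENNReal.ofReal_mul hT0] at h3
  rwa [ENNReal.ofReal_le_ofReal_iff] at h3
  have := ENNReal.toReal_nonneg (a := volume (ψ '' ball 0 1))
  have : 0 ≤ -(2 * x) := by linarith
  positivity

lemma pow_norm_le_integral (hψ : DifferentiableOn ℂ ψ (ball 0 1)) {D : ℝ}
    (hD : ∀ z ∈ ball 0 1, ‖ψ z - a‖ ≤ D) (N : ℕ) {r : ℝ} (h0 : 0 ≤ r) (h1 : r < 1) (s : ℝ) :
    ‖ψ 0 - a‖ ^ (N + 1) ≤ (2 * π)⁻¹ * ((N + 1) * (D ^ N *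
      ∫ y in s..(s + 2 * π / (N + 1)), ‖ψ (circleMap 0 r y) - a‖)) := by
  set T := 2 * π / (N + 1) with hT
  have hTN : (N + 1) * T = 2 * π := by rw [hT]; field_simp
  set F : ℂ → ℂ := fun z =>
    ∏ k ∈ Finset.range (N + 1), (ψ (exp ((k * T : ℝ) * I) * z) - a) with hF
  have hω : ∀ k : ℕ, ‖exp ((k * T : ℝ) * I)‖ = 1 := fun k =>
    Complex.norm_exp_ofReal_mul_I _
  have hmap : ∀ k : ℕ, MapsTo (fun z => exp ((k * T : ℝ) * I) * z) (ball 0 1)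
      (ball 0 1) := fun k z hz => by
    rw [mem_ball_zero_iff] at hz ⊢
    rwa [norm_mul, hω, one_mul]
  have hFd : DifferentiableOn ℂ F (ball 0 1) := by
    refine DifferentiableOn.fun_finsetProd fun k _ => ?_
    exact (hψ.comp (by fun_prop) (hmap k)).sub_const a
  have hmean : Real.circleAverage F 0 r = F 0 := by
    refine DiffContOnCl.circleAverage ⟨hFd.mono (ball_subset_ball ?_),
      hFd.continuousOn.mono (closure_ball_subset_closedBall.trans (closedBall_subset_ball ?_))⟩ <;>
    rw [abs_of_nonneg h0]
    · exact h1.le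
    · exact h1
  have hF0 : ‖F 0‖ = ‖ψ 0 - a‖ ^ (N + 1) := by simp [hF]
  have hψc : ∀ k : ℕ, ∀ y : ℝ, exp ((k * T : ℝ) * I) * circleMap 0 r y =
      circleMap 0 r (y + k * T) := fun k y => by
    rw [circleMap_zero, circleMap_zero, mul_left_comm, ← exp_add]
    push_cast
    ring_nf
  have hFc : ∀ y : ℝ, F (circleMap 0 r y) =
      ∏ k ∈ Finset.range (N + 1), (ψ (circleMap 0 r (y + k * T)) - a) := fun y => by
    simp only [hF, hψc]
  have hper : Function.Periodic (fun y => ‖F (circleMap 0 r y)‖) T := by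
    intro y
    simp only [hFc]
    rw [Finset.prod_range_succ, Finset.prod_range_succ']
    congr 2
    · refine Finset.prod_congr rfl fun k _ => ?_
      push_cast
      ring_nf
    · have : y + T + N * T = (y + (0 : ℕ) * T) + 2 * π := by
        rw [← hTN]; push_cast; ring
      rw [this, periodic_circleMap]
  have hcont : Continuous fun y => ‖F (circleMap 0 r y)‖ :=
    (hFd.continuousOn.comp_continuous (continuous_circleMap _ _)
      (circleMap_mem_unit_ball h0 h1)).norm
  have hcont' : Continuous fun y => ‖ψ (circleMap 0 r y) - a‖ :=
    ((hψ.continuousOn.comp_continuous (continuous_circleMap _ _)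
      (circleMap_mem_unit_ball h0 h1)).sub continuous_const).norm
  have hint : ∫ y in (0 : ℝ)..(2 * π), ‖F (circleMap 0 r y)‖ =
      (N + 1) * ∫ y in s..(s + T), ‖F (circleMap 0 r y)‖ := by
    have e1 := hper.intervalIntegral_add_zsmul_eq (N + 1) 0
      (fun _ _ => hcont.intervalIntegrable _ _)
    rw [hper.intervalIntegral_add_eq 0 s] at e1
    simp only [zero_add, zsmul_eq_mul, Int.cast_add, Int.cast_natCast, Int.cast_one, hTN] at e1
    exact e1
  have hTpos : 0 ≤ T := by positivity
  have hbound : ∫ y in s..(s + T), ‖F (circleMap 0 r y)‖ ≤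
      D ^ N * ∫ y in s..(s + T), ‖ψ (circleMap 0 r y) - a‖ := by
    rw [← intervalIntegral.integral_const_mul]
    refine intervalIntegral.integral_mono_on (by linarith) (hcont.intervalIntegrable _ _)
      ((hcont'.const_mul _).intervalIntegrable _ _) fun y _ => ?_
    rw [hFc, Finset.prod_range_succ', norm_mul, norm_prod]
    refine mul_le_mul ?_ (by simp) (norm_nonneg _) (pow_nonneg
      ((norm_nonneg _).trans (hD 0 (by simp))) _)
    calc _ ≤ ∏ _k ∈ Finset.range N, D := Finset.prod_le_prod (fun _ _ => norm_nonneg _)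
          fun k _ => hD _ (circleMap_mem_unit_ball h0 h1 _)
      _ = _ := by simp
  rw [← hF0, ← hmean, Real.circleAverage, norm_smul, Real.norm_of_nonneg (by positivity)]
  refine mul_le_mul_of_nonneg_left ?_ (by positivity)
  calc _ ≤ ∫ y in (0 : ℝ)..(2 * π), ‖F (circleMap 0 r y)‖ :=
        intervalIntegral.norm_integral_le_integral_norm (by positivity)
    _ = _ := hint
    _ ≤ _ := mul_le_mul_of_nonneg_left hbound (by positivity)

/-- A bounded injective holomorphic function cannot have `a` as a radial cluster value along all
radii of an arc. -/
theorem exists_radius_away (hψ : DifferentiableOn ℂ ψ (ball 0 1))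
    (hi : InjOn ψ (ball 0 1)) (hA : volume (ψ '' ball 0 1) ≠ ∞) {D : ℝ}
    (hD : ∀ z ∈ ball 0 1, ‖ψ z - a‖ ≤ D) (ha : ψ 0 ≠ a) {s t : ℝ} (hst : s < t) :
    ∃ θ ∈ Ioo s t, ∃ δ > 0, ∃ r₀ < 1, ∀ r ∈ Ioo r₀ 1, δ ≤ ‖ψ (circleMap 0 r θ) - a‖ := by
  by_contra! hcl
  obtain ⟨N, hN⟩ := exists_nat_gt (2 * π / (t - s))
  have hpi := Real.pi_pos
  set T := 2 * π / (N + 1) with hT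
  have hN1 : (1 : ℝ) ≤ N + 1 := by linarith [N.cast_nonneg (α := ℝ)]
  have hTst : s + T ≤ t := by
    rw [div_lt_iff₀ (by linarith)] at hN
    have : T ≤ t - s := by
      rw [hT, div_le_iff₀ (by positivity)]
      nlinarith
    linarith
  have hT2 : T ≤ 2 * π := div_le_self (by positivity) hN1
  have hT0 : 0 < T := by positivity
  have key : ∀ x < (0 : ℝ), (‖ψ 0 - a‖ ^ (N + 1)) ^ 2 ≤
      ((2 * π)⁻¹ * ((N + 1) * D ^ N)) ^ 2 *
        (T * (-(2 * x) * (volume (ψ '' ball 0 1)).toReal)) := by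
    intro x hx
    have h1 := pow_norm_le_integral hψ hD N (Real.exp_pos x).le (by simpa using hx) s
    have h2 := integral_sq_le_of_radial_cluster hψ hi hA hT0.le hT2
      (fun θ hθ => hcl θ ⟨hθ.1, hθ.2.trans_le hTst⟩) hx
    refine (pow_le_pow_left₀ (by positivity) h1 2).trans ?_
    rw [← mul_assoc, ← mul_assoc, mul_pow, mul_assoc (2 * π)⁻¹]
    exact mul_le_mul_of_nonneg_left h2 (sq_nonneg _)
  have hlim : Tendsto (fun x : ℝ => ((2 * π)⁻¹ * ((N + 1) * D ^ N)) ^ 2 *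
      (T * (-(2 * x) * (volume (ψ '' ball 0 1)).toReal))) (𝓝[<] 0) (𝓝 0) := by
    refine Tendsto.mono_left ?_ nhdsWithin_le_nhds
    refine (Continuous.tendsto' (by fun_prop) _ _ ?_)
    simp
  have h0 := ge_of_tendsto hlim (eventually_mem_nhdsWithin.mono key)
  have : 0 < (‖ψ 0 - a‖ ^ (N + 1)) ^ 2 := by
    have : 0 < ‖ψ 0 - a‖ := norm_pos_iff.2 (sub_ne_zero.2 ha)
    positivity
  linarith

end Rays

/-- `φ` is a conformal isomorphism of the bounded open set `W` with the unit disc and `ψ` is its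
inverse. -/
structure ConfDisc (W : Set ℂ) (φ ψ : ℂ → ℂ) : Prop where
  isOpen : IsOpen W
  bdd : Bornology.IsBounded W
  hφ : DifferentiableOn ℂ φ W
  hψ : DifferentiableOn ℂ ψ (ball 0 1)
  mapsφ : MapsTo φ W (ball 0 1)
  mapsψ : MapsTo ψ (ball 0 1) W
  left : ∀ w ∈ W, ψ (φ w) = w
  right : ∀ z ∈ ball 0 1, φ (ψ z) = z

section Sector

lemma isOpen_sector (ζ : ℂ) (t₁ t₂ : ℝ) :
    IsOpen {z : ℂ | ζ⁻¹ * z ∈ slitPlane ∧ (ζ⁻¹ * z).arg ∈ Ioo t₁ t₂} := by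
  have h : IsOpen (slitPlane ∩ Complex.arg ⁻¹' Ioo t₁ t₂) :=
    ContinuousOn.isOpen_inter_preimage
      (fun x hx => (Complex.continuousAt_arg hx).continuousWithinAt)
      Complex.isOpen_slitPlane isOpen_Ioo
  exact h.preimage (continuous_const_mul ζ⁻¹)

lemma closure_sector_subset {ζ : ℂ} (hζ : ζ ≠ 0) {t₁ t₂ : ℝ} (h₁ : -(π / 2) < t₁)
    (h₂ : t₂ < π / 2) {z : ℂ}
    (hz : z ∈ closure {z : ℂ | ζ⁻¹ * z ∈ slitPlane ∧ (ζ⁻¹ * z).arg ∈ Ioo t₁ t₂})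
    (hz0 : z ≠ 0) : ζ⁻¹ * z ∈ slitPlane ∧ (ζ⁻¹ * z).arg ∈ Icc t₁ t₂ := by
  have hre : 0 ≤ (ζ⁻¹ * z).re := by
    have hcl : IsClosed {z : ℂ | 0 ≤ (ζ⁻¹ * z).re} :=
      isClosed_le continuous_const (Complex.continuous_re.comp (continuous_const_mul ζ⁻¹))
    refine closure_minimal ?_ hcl hz
    rintro y ⟨-, hy⟩
    exact Complex.abs_arg_le_pi_div_two_iff.1 (abs_le.2 ⟨by linarith [hy.1], by linarith [hy.2]⟩)
  have hs : ζ⁻¹ * z ∈ slitPlane := by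
    rw [Complex.mem_slitPlane_iff]
    by_contra! h
    have : ζ⁻¹ * z = 0 := Complex.ext (le_antisymm h.1 hre) h.2
    simp [hζ, hz0] at this
  refine ⟨hs, ?_⟩
  have hc : ContinuousAt (fun z => (ζ⁻¹ * z).arg) z :=
    ContinuousAt.comp (g := Complex.arg) (Complex.continuousAt_arg hs) (by fun_prop)
  have h3 : (ζ⁻¹ * z).arg ∈ closure (Ioo t₁ t₂) :=
    mem_closure_of_frequently_of_tendsto (mem_closure_iff_frequently.1 hz |>.mono fun y hy => hy.2) hc
  exact closure_minimal Ioo_subset_Icc_self isClosed_Icc h3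

end Sector

namespace ConfDisc

variable {W : Set ℂ} {φ ψ : ℂ → ℂ}

lemma injOn (h : ConfDisc W φ ψ) : InjOn ψ (ball 0 1) := fun x hx y hy hxy => by
  rw [← h.right x hx, ← h.right y hy, hxy]

lemma volume_ne_top (h : ConfDisc W φ ψ) : volume (ψ '' ball 0 1) ≠ ∞ :=
  ((h.bdd.subset (mapsTo_iff_image_subset.1 h.mapsψ)).measure_lt_top).ne

lemma eventually_lt_norm (h : ConfDisc W φ ψ) {a : ℂ} (ha : a ∉ W) {ρ : ℝ} (hρ : ρ < 1) :
    ∃ N ∈ 𝓝 a, ∀ w ∈ W ∩ N, ρ < ‖φ w‖ := by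
  have hK : IsCompact (ψ '' closedBall 0 ρ) :=
    (isCompact_closedBall 0 ρ).image_of_continuousOn
      (h.hψ.continuousOn.mono (closedBall_subset_ball hρ))
  refine ⟨(ψ '' closedBall 0 ρ)ᶜ, hK.isClosed.isOpen_compl.mem_nhds ?_, fun w hw => ?_⟩
  · rintro ⟨z, hz, rfl⟩
    exact ha (h.mapsψ (closedBall_subset_ball hρ hz))
  · by_contra hle
    exact hw.2 ⟨φ w, by simpa using hle, h.left w hw.1⟩

lemma norm_eq_one_of_clusterPt (h : ConfDisc W φ ψ) {a : ℂ} (ha : a ∉ W) {ζ : ℂ}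
    (hζ : MapClusterPt ζ (𝓝[W] a) φ) : ‖ζ‖ = 1 := by
  refine le_antisymm ?_ (le_of_forall_lt fun ρ hρ => ?_)
  · have := (ClusterPt.mono hζ (le_principal_iff.2 (mem_map.2 (mem_of_superset self_mem_nhdsWithin
      (show W ⊆ φ ⁻¹' closedBall 0 1 from
        fun w hw => ball_subset_closedBall (h.mapsφ hw)))))).mem_closure
    rw [isClosed_closedBall.closure_eq] at this
    simpa using this
  · obtain ⟨ρ', h1, h2⟩ := exists_between hρ
    obtain ⟨N, hN, hN'⟩ := h.eventually_lt_norm ha h2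
    have hcl : IsClosed {z : ℂ | ρ' ≤ ‖z‖} := isClosed_le continuous_const continuous_norm
    have := (ClusterPt.mono hζ (le_principal_iff.2 (mem_map.2 (mem_of_superset
      (inter_mem_nhdsWithin W hN) (show W ∩ N ⊆ φ ⁻¹' {z : ℂ | ρ' ≤ ‖z‖} from
        fun w hw => (hN' w hw).le))))).mem_closure
    rw [hcl.closure_eq] at this
    exact h1.trans_le this

lemma clusterPt_unique (h : ConfDisc W φ ψ) {a : ℂ} (ha : a ∉ W) (hb : BLC W a) {ζ ζ' : ℂ}
    (hζ : MapClusterPt ζ (𝓝[W] a) φ) (hζ' : MapClusterPt ζ' (𝓝[W] a) φ) : ζ = ζ' := by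
  by_contra hne
  have hn := h.norm_eq_one_of_clusterPt ha hζ
  have hn' := h.norm_eq_one_of_clusterPt ha hζ'
  have hζ0 : ζ ≠ 0 := norm_ne_zero_iff.1 (by rw [hn]; exact one_ne_zero)
  have hζ0' : ζ' ≠ 0 := norm_ne_zero_iff.1 (by rw [hn']; exact one_ne_zero)
  set q := ζ⁻¹ * ζ' with hq
  have hqn : ‖q‖ = 1 := by rw [hq, norm_mul, norm_inv, hn, hn']; norm_num
  have hqarg : q.arg ≠ 0 := by
    intro h0
    have : q = 1 := by
      have := Complex.norm_mul_exp_arg_mul_I q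
      rw [h0, hqn] at this
      simpa using this.symm
    rw [hq, inv_mul_eq_one₀ hζ0] at this
    exact hne this
  set η := min |q.arg| 1 with hη
  have hη0 : 0 < η := by positivity
  have hη1 : η < π / 2 := (min_le_right _ _).trans_lt (by linarith [Real.pi_gt_three])
  obtain ⟨D, hD⟩ : ∃ D, ∀ z ∈ ball 0 1, ‖ψ z - a‖ ≤ D := by
    obtain ⟨D, hD⟩ := h.bdd.subset_closedBall a
    exact ⟨D, fun z hz => by simpa [dist_eq_norm] using hD (h.mapsψ hz)⟩
  have hψ0 : ψ 0 ≠ a := fun h0 => ha (h0 ▸ h.mapsψ (by simp))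
  obtain ⟨θ₁, hθ₁, δ₁, hδ₁, r₁, hr₁, hray₁⟩ := exists_radius_away h.hψ h.injOn h.volume_ne_top hD
    hψ0 (s := ζ.arg - η) (t := ζ.arg) (by linarith)
  obtain ⟨θ₂, hθ₂, δ₂, hδ₂, r₂, hr₂, hray₂⟩ := exists_radius_away h.hψ h.injOn h.volume_ne_top hD
    hψ0 (s := ζ.arg) (t := ζ.arg + η) (by linarith)
  set t₁ := θ₁ - ζ.arg with ht₁
  set t₂ := θ₂ - ζ.arg with ht₂
  set V := {z : ℂ | ζ⁻¹ * z ∈ slitPlane ∧ (ζ⁻¹ * z).arg ∈ Ioo t₁ t₂} with hV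
  have hcl : ∀ z ∈ closure V, z ≠ 0 → ζ⁻¹ * z ∈ slitPlane ∧ (ζ⁻¹ * z).arg ∈ Icc t₁ t₂ :=
    fun z hz hz0 => closure_sector_subset hζ0 (by linarith [hθ₁.1]) (by linarith [hθ₂.2]) hz hz0
  have hζV : V ∈ 𝓝 ζ := by
    refine (isOpen_sector ζ t₁ t₂).mem_nhds ?_
    have hθ1 := hθ₁.2
    have hθ2 := hθ₂.1
    simp [hζ0, ht₁, ht₂, hθ1, hθ2]
  have hζV' : (closure V)ᶜ ∈ 𝓝 ζ' := by
    refine isClosed_closure.isOpen_compl.mem_nhds fun hmem => ?_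
    have h1 := (hcl ζ' hmem hζ0').2
    rw [← hq] at h1
    have h2 : |q.arg| < η := abs_lt.2 ⟨by linarith [h1.1, hθ₁.1], by linarith [h1.2, hθ₂.2]⟩
    exact absurd (min_le_left |q.arg| 1) (not_le.2 h2)
  obtain ⟨N, hN, hNρ⟩ := h.eventually_lt_norm ha (ρ := max 0 (max r₁ r₂))
    (max_lt one_pos (max_lt hr₁ hr₂))
  obtain ⟨N', hN', hconn⟩ := hb (N ∩ ball a (min δ₁ δ₂))
    (inter_mem hN (ball_mem_nhds a (lt_min hδ₁ hδ₂)))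
  have hev : ∀ᶠ w in 𝓝[W] a, w ∈ W ∩ N' := inter_mem_nhdsWithin W hN'
  obtain ⟨w, hwV, hw⟩ := ((mapClusterPt_iff_frequently.1 hζ V hζV).and_eventually hev).exists
  obtain ⟨w', hwV', hw'⟩ :=
    ((mapClusterPt_iff_frequently.1 hζ' _ hζV').and_eventually hev).exists
  obtain ⟨C, hC, hCc, hwC, hwC'⟩ := hconn w hw w' hw'
  have hCW : C ⊆ W := fun c hc => (hC hc).1
  have hφC : IsPreconnected (φ '' C) := hCc.image φ (h.hφ.continuousOn.mono hCW)
  by_cases hfr : φ '' C ∩ frontier V = ∅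
  · have := subset_of_disjoint_frontier hφC ⟨φ w, mem_image_of_mem φ hwC, hwV⟩ hfr
    exact hwV' (subset_closure (this (mem_image_of_mem φ hwC')))
  obtain ⟨_, ⟨c, hc, rfl⟩, hcf⟩ := nonempty_iff_ne_empty.2 hfr
  have hcW := hCW hc
  have hcN := hNρ c ⟨hcW, (hC hc).2.1⟩
  have hca : ‖c - a‖ < min δ₁ δ₂ := by simpa [dist_eq_norm] using (hC hc).2.2
  have hφ0 : φ c ≠ 0 := norm_pos_iff.1 ((le_max_left _ _).trans_lt hcN)
  rw [(isOpen_sector ζ t₁ t₂).frontier_eq] at hcf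
  obtain ⟨hsl, harg⟩ := hcl _ hcf.1 hφ0
  have hφ1 : ‖φ c‖ < 1 := by simpa using h.mapsφ hcW
  have hrep : ∀ t, (ζ⁻¹ * φ c).arg = t → φ c = circleMap 0 ‖φ c‖ (t + ζ.arg) := by
    rintro _ rfl
    have e1 := Complex.norm_mul_exp_arg_mul_I (ζ⁻¹ * φ c)
    have e2 := Complex.norm_mul_exp_arg_mul_I ζ
    rw [norm_mul, norm_inv, hn, inv_one, one_mul] at e1
    rw [hn, Complex.ofReal_one, one_mul] at e2
    rw [circleMap_zero, Complex.ofReal_add, add_mul, exp_add, ← mul_assoc, e1, e2,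
      mul_comm, mul_inv_cancel_left₀ hζ0]
  have hor : (ζ⁻¹ * φ c).arg = t₁ ∨ (ζ⁻¹ * φ c).arg = t₂ := by
    by_contra! hcon
    exact hcf.2 ⟨hsl, lt_of_le_of_ne harg.1 hcon.1.symm, lt_of_le_of_ne harg.2 hcon.2⟩
  rcases hor with ht | ht
  · have e := hrep _ ht
    rw [ht₁, sub_add_cancel] at e
    have := hray₁ ‖φ c‖ ⟨((le_max_left r₁ r₂).trans (le_max_right _ _)).trans_lt hcN, hφ1⟩
    rw [← e, h.left c hcW] at this
    exact absurd (hca.trans_le (min_le_left _ _)) (not_lt.2 this)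
  · have e := hrep _ ht
    rw [ht₂, sub_add_cancel] at e
    have := hray₂ ‖φ c‖ ⟨((le_max_right r₁ r₂).trans (le_max_right _ _)).trans_lt hcN, hφ1⟩
    rw [← e, h.left c hcW] at this
    exact absurd (hca.trans_le (min_le_right _ _)) (not_lt.2 this)

lemma exists_limit (h : ConfDisc W φ ψ) {a : ℂ} (ha : a ∈ frontier W) (hb : BLC W a) :
    ∃ ζ, ‖ζ‖ = 1 ∧ Tendsto φ (𝓝[W] a) (𝓝 ζ) := by
  have haW : a ∉ W := by rw [h.isOpen.frontier_eq] at ha; exact ha.2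
  have hne : (𝓝[W] a).NeBot := mem_closure_iff_nhdsWithin_neBot.1 ha.1
  have hmem : closedBall (0 : ℂ) 1 ∈ map φ (𝓝[W] a) :=
    mem_map.2 (mem_of_superset self_mem_nhdsWithin fun w hw => ball_subset_closedBall (h.mapsφ hw))
  obtain ⟨ζ, -, hζ⟩ := (isCompact_closedBall (0 : ℂ) 1).exists_clusterPt (le_principal_iff.2 hmem)
  refine ⟨ζ, h.norm_eq_one_of_clusterPt haW hζ, ?_⟩
  exact (isCompact_closedBall (0 : ℂ) 1).le_nhds_of_unique_clusterPt hmem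
    fun x _ hx => h.clusterPt_unique haW hb hx hζ

end ConfDisc

section Strip

/-- The conformal map of the strip `|Re w| < π / 2` onto the unit disc which sends the lower end of
the strip to the boundary point `ζ`. -/
noncomputable def stripMap (ζ w : ℂ) : ℂ :=
  ζ * (1 - exp (-I * w)) / (1 + exp (-I * w))

/-- The inverse of `stripMap ζ`. -/
noncomputable def stripInv (ζ z : ℂ) : ℂ := I * Complex.log ((ζ - z) / (ζ + z))

lemma re_exp_pos {w : ℂ} (hw : w.re ∈ Ioo (-(π / 2)) (π / 2)) :
    0 < (exp (-I * w)).re := by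
  rw [Complex.exp_re]
  have : (-I * w).im = -w.re := by simp
  rw [this, Real.cos_neg]
  exact mul_pos (Real.exp_pos _) (Real.cos_pos_of_mem_Ioo hw)

lemma one_add_ne_zero_of_re_pos {u : ℂ} (hu : 0 < u.re) : 1 + u ≠ 0 := fun h => by
  have := congrArg Complex.re h
  simp at this
  linarith

lemma stripMap_mem_ball {ζ w : ℂ} (hζ : ‖ζ‖ = 1)
    (hw : w.re ∈ Ioo (-(π / 2)) (π / 2)) : stripMap ζ w ∈ ball (0 : ℂ) 1 := by
  have hu := re_exp_pos hw
  rw [mem_ball_zero_iff, stripMap]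
  set u := exp (-I * w)
  have h1 := one_add_ne_zero_of_re_pos hu
  rw [norm_div, norm_mul, hζ, one_mul, div_lt_one (norm_pos_iff.2 h1)]
  refine lt_of_pow_lt_pow_left₀ 2 (norm_nonneg _) ?_
  rw [← Complex.normSq_eq_norm_sq, ← Complex.normSq_eq_norm_sq, normSq_apply,
    normSq_apply]
  simp
  nlinarith

lemma differentiableAt_stripMap {ζ w : ℂ}
    (hw : w.re ∈ Ioo (-(π / 2)) (π / 2)) : DifferentiableAt ℂ (stripMap ζ) w := by
  have h1 := one_add_ne_zero_of_re_pos (re_exp_pos hw)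
  unfold stripMap
  refine DifferentiableAt.div ?_ ?_ h1 <;> fun_prop

lemma re_div_pos {ζ z : ℂ} (hζ : ‖ζ‖ = 1) (hz : z ∈ ball (0 : ℂ) 1) :
    0 < ((ζ - z) / (ζ + z)).re := by
  rw [mem_ball_zero_iff] at hz
  have hne : ζ + z ≠ 0 := fun h => by
    rw [eq_neg_of_add_eq_zero_left h, norm_neg] at hζ
    linarith
  have e1 : ζ.re * ζ.re + ζ.im * ζ.im = 1 := by
    rw [← normSq_apply, Complex.normSq_eq_norm_sq, hζ, one_pow]
  have e2 : z.re * z.re + z.im * z.im < 1 := by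
    rw [← normSq_apply, Complex.normSq_eq_norm_sq]
    nlinarith [norm_nonneg z]
  rw [Complex.div_re, ← add_div]
  refine div_pos ?_ (Complex.normSq_pos.2 hne)
  simp
  nlinarith

lemma stripInv_re_mem {ζ z : ℂ} (hζ : ‖ζ‖ = 1) (hz : z ∈ ball (0 : ℂ) 1) :
    (stripInv ζ z).re ∈ Ioo (-(π / 2)) (π / 2) := by
  have h := abs_lt.1 (Complex.abs_arg_lt_pi_div_two_iff.2 (Or.inl (re_div_pos hζ hz)))
  have e : (stripInv ζ z).re = -((ζ - z) / (ζ + z)).arg := by simp [stripInv, Complex.log_im]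
  rw [e]
  constructor <;> linarith

lemma stripMap_stripInv {ζ z : ℂ} (hζ : ‖ζ‖ = 1) (hz : z ∈ ball (0 : ℂ) 1) :
    stripMap ζ (stripInv ζ z) = z := by
  have hp := re_div_pos hζ hz
  have hne : (ζ - z) / (ζ + z) ≠ 0 := fun h => by simp [h] at hp
  have hd : ζ + z ≠ 0 := fun h => by simp [h] at hne
  have hζ0 : ζ ≠ 0 := norm_ne_zero_iff.1 (by rw [hζ]; exact one_ne_zero)
  have e : exp (-I * stripInv ζ z) = (ζ - z) / (ζ + z) := by
    rw [stripInv, ← mul_assoc]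
    simp [Complex.exp_log hne]
  rw [stripMap, e]
  have : (1 + (ζ - z) / (ζ + z)) ≠ 0 := one_add_ne_zero_of_re_pos hp
  rw [div_eq_iff this]
  field_simp
  ring

lemma stripMap_injOn {ζ : ℂ} (hζ : ‖ζ‖ = 1) :
    InjOn (stripMap ζ) {w | w.re ∈ Ioo (-(π / 2)) (π / 2)} := by
  intro w hw w' hw' h
  have h1 := one_add_ne_zero_of_re_pos (re_exp_pos hw)
  have h2 := one_add_ne_zero_of_re_pos (re_exp_pos hw')
  have hζ0 : ζ ≠ 0 := norm_ne_zero_iff.1 (by rw [hζ]; exact one_ne_zero)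
  rw [stripMap, stripMap, div_eq_div_iff h1 h2, mul_assoc, mul_assoc, mul_right_inj' hζ0] at h
  have h3 : exp (-I * w) = exp (-I * w') := by
    linear_combination (-1 / 2 : ℂ) * h
  have hw1 := hw.1
  have hw2 := hw.2
  have hw3 := hw'.1
  have hw4 := hw'.2
  have h4 := Complex.exp_inj_of_neg_pi_lt_of_le_pi (by simp; linarith) (by simp; linarith)
    (by simp; linarith) (by simp; linarith) h3
  exact mul_left_cancel₀ (neg_ne_zero.2 Complex.I_ne_zero) h4

lemma continuousOn_stripInv {ζ : ℂ} (hζ : ‖ζ‖ = 1) : ContinuousOn (stripInv ζ) (ball 0 1) := by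
  intro z hz
  have hp := re_div_pos hζ hz
  have hd : ζ + z ≠ 0 := fun h => by simp [h] at hp
  refine ContinuousAt.continuousWithinAt ?_
  unfold stripInv
  refine continuousAt_const.mul (ContinuousAt.clog ?_ (Or.inl hp))
  exact ContinuousAt.div (by fun_prop) (by fun_prop) hd

lemma tendsto_stripInv_im {ζ : ℂ} (hζ : ‖ζ‖ = 1) :
    Tendsto (fun z => (stripInv ζ z).im) (𝓝[≠] ζ) atBot := by
  have hζ0 : ζ ≠ 0 := norm_ne_zero_iff.1 (by rw [hζ]; exact one_ne_zero)
  have e : (fun z => (stripInv ζ z).im) = fun z => Real.log ‖(ζ - z) / (ζ + z)‖ := by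
    ext z
    simp [stripInv, Complex.log_re]
  rw [e]
  refine Real.tendsto_log_nhdsGT_zero.comp (tendsto_nhdsWithin_iff.2 ⟨?_, ?_⟩)
  · have : ContinuousAt (fun z => ‖(ζ - z) / (ζ + z)‖) ζ :=
      (ContinuousAt.div (by fun_prop) (by fun_prop) (by simpa [← two_mul] using hζ0)).norm
    have h2 := this.tendsto
    simp only [sub_self, zero_div, norm_zero] at h2
    exact h2.mono_left nhdsWithin_le_nhds
  · have h0 : ∀ᶠ z in 𝓝[≠] ζ, ζ + z ≠ 0 := by
      refine nhdsWithin_le_nhds (ContinuousAt.eventually_ne (by fun_prop) ?_)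
      simpa [← two_mul] using hζ0
    filter_upwards [h0, self_mem_nhdsWithin] with z hz hz'
    exact norm_pos_iff.2 (div_ne_zero (sub_ne_zero.2 (Ne.symm hz')) hz)

end Strip

namespace ConfDisc

variable {W : Set ℂ} {φ ψ : ℂ → ℂ}

lemma exists_crossing (h : ConfDisc W φ ψ) {a ζ : ℂ} (ha : a ∈ frontier W) (hb : BLC W a)
    (hζ : ‖ζ‖ = 1) (hl : Tendsto φ (𝓝[W] a) (𝓝 ζ)) {ε : ℝ} (hε : 0 < ε) :
    ∃ y₀, ∀ y < y₀, ∃ c ∈ W ∩ ball a ε, (stripInv ζ (φ c)).im = y := by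
  have hne : (𝓝[W] a).NeBot := mem_closure_iff_nhdsWithin_neBot.1 ha.1
  obtain ⟨N', hN', hconn⟩ := hb (ball a ε) (ball_mem_nhds a hε)
  have hev : ∀ᶠ w in 𝓝[W] a, w ∈ W ∩ N' := inter_mem_nhdsWithin W hN'
  obtain ⟨w, hw⟩ := hev.exists
  have hφne : Tendsto φ (𝓝[W] a) (𝓝[≠] ζ) := by
    refine tendsto_nhdsWithin_iff.2 ⟨hl, mem_of_superset self_mem_nhdsWithin fun w hw hw' => ?_⟩
    have := mem_ball_zero_iff.1 (h.mapsφ hw)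
    rw [mem_singleton_iff.1 hw', hζ] at this
    exact lt_irrefl _ this
  have hbot := (tendsto_stripInv_im hζ).comp hφne
  refine ⟨(stripInv ζ (φ w)).im, fun y hy => ?_⟩
  obtain ⟨w', hw', hy'⟩ := (hev.and (hbot.eventually (eventually_le_atBot y))).exists
  obtain ⟨C, hC, hCc, hwC, hwC'⟩ := hconn w' hw' w hw
  have hcont : ContinuousOn (fun c => (stripInv ζ (φ c)).im) C :=
    Complex.continuous_im.comp_continuousOn ((continuousOn_stripInv hζ).comp
      (h.hφ.continuousOn.mono fun c hc => (hC hc).1) fun c hc => h.mapsφ (hC hc).1)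
  obtain ⟨c, hc, hcy⟩ := hCc.intermediate_value hwC hwC' hcont ⟨hy', hy.le⟩
  exact ⟨c, hC hc, hcy⟩

lemma limit_injective (h : ConfDisc W φ ψ) {a b ζ : ℂ} (ha : a ∈ frontier W) (hba : BLC W a)
    (hb : b ∈ frontier W) (hbb : BLC W b) (hζ : ‖ζ‖ = 1) (hla : Tendsto φ (𝓝[W] a) (𝓝 ζ))
    (hlb : Tendsto φ (𝓝[W] b) (𝓝 ζ)) : a = b := by
  by_contra hne
  set ε := dist a b / 3 with hε
  have hd : 0 < dist a b := dist_pos.2 hne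
  have hε0 : 0 < ε := by positivity
  obtain ⟨ya, hya⟩ := h.exists_crossing ha hba hζ hla hε0
  obtain ⟨yb, hyb⟩ := h.exists_crossing hb hbb hζ hlb hε0
  set y₀ := min ya yb
  set G := ψ ∘ stripMap ζ with hG
  have hGd : ∀ s t, DifferentiableOn ℂ G (Ioo (-(π / 2)) (π / 2) ×ℂ Ioo s t) := by
    intro s t w hw
    refine (DifferentiableAt.comp w ?_ (differentiableAt_stripMap hw.1)).differentiableWithinAt
    exact h.hψ.differentiableAt (isOpen_ball.mem_nhds (stripMap_mem_ball hζ hw.1))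
  have hGi : ∀ s t, InjOn G (Ioo (-(π / 2)) (π / 2) ×ℂ Ioo s t) := by
    intro s t w hw w' hw' hww
    exact stripMap_injOn hζ hw.1 hw'.1
      (h.injOn (stripMap_mem_ball hζ hw.1) (stripMap_mem_ball hζ hw'.1) hww)
  have hkey : ∀ y₁ < y₀, ENNReal.ofReal ε ^ 2 * ENNReal.ofReal (y₀ - y₁) ≤
      ENNReal.ofReal π * volume W := by
    intro y₁ _
    calc ENNReal.ofReal ε ^ 2 * ENNReal.ofReal (y₀ - y₁)
        = ∫⁻ _ in Ioo y₁ y₀, ENNReal.ofReal ε ^ 2 := by simp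
      _ ≤ ∫⁻ y in Ioo y₁ y₀, (∫⁻ x in Ioo (-(π / 2)) (π / 2),
            ‖deriv G (x + y * I)‖ₑ) ^ 2 := by
          refine setLIntegral_mono' measurableSet_Ioo fun y hy => ?_
          gcongr
          obtain ⟨c, hc, hcy⟩ := hya y (hy.2.trans_le (min_le_left _ _))
          obtain ⟨c', hc', hcy'⟩ := hyb y (hy.2.trans_le (min_le_right _ _))
          have hrep : ∀ c ∈ W, (stripInv ζ (φ c)).im = y →
              G (((stripInv ζ (φ c)).re : ℂ) + y * I) = c := by
            rintro c hc rfl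
            rw [Complex.re_add_im, hG, Function.comp, stripMap_stripInv hζ (h.mapsφ hc),
              h.left c hc]
          have h1 := enorm_sub_le_lintegral (hGd y₁ y₀) hy
            (stripInv_re_mem hζ (h.mapsφ hc.1)) (stripInv_re_mem hζ (h.mapsφ hc'.1))
          rw [hrep c hc.1 hcy, hrep c' hc'.1 hcy'] at h1
          refine le_trans ?_ h1
          rw [← ofReal_norm]
          refine ENNReal.ofReal_le_ofReal ?_
          have e1 := mem_ball.1 hc.2
          have e2 := mem_ball.1 hc'.2
          have e3 := dist_triangle4 a c c' b
          rw [dist_comm a c] at e3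
          rw [← dist_eq_norm, dist_comm]
          linarith
      _ ≤ ENNReal.ofReal (π / 2 - -(π / 2)) *
            volume (G '' (Ioo (-(π / 2)) (π / 2) ×ℂ Ioo y₁ y₀)) :=
          lintegral_length_sq_le (hGd _ _) (hGi _ _)
      _ ≤ ENNReal.ofReal π * volume W := by
          rw [show π / 2 - -(π / 2) = π by ring]
          gcongr
          rintro _ ⟨w, hw, rfl⟩
          exact h.mapsψ (stripMap_mem_ball hζ hw.1)
  have hfin : ENNReal.ofReal π * volume W ≠ ∞ :=
    ENNReal.mul_ne_top ENNReal.ofReal_ne_top h.bdd.measure_lt_top.ne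
  set M := (ENNReal.ofReal π * volume W).toReal with hM
  have hM0 : 0 ≤ M := ENNReal.toReal_nonneg
  have := hkey (y₀ - (M + 1) / ε ^ 2) (by have : 0 < (M + 1) / ε ^ 2 := by positivity
                                          linarith)
  rw [sub_sub_cancel, ← ENNReal.ofReal_pow hε0.le, ← ENNReal.ofReal_mul (by positivity),
    mul_div_cancel₀ _ (by positivity), ENNReal.ofReal_le_iff_le_toReal hfin] at this
  linarith

/-- Carathéodory's theorem. -/
theorem exists_extension (h : ConfDisc W φ ψ) (hb : ∀ a ∈ frontier W, BLC W a) :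
    ∃ Φ : ℂ → ℂ, ContinuousOn Φ (closedBall 0 1) ∧ InjOn Φ (closedBall 0 1) ∧
      Φ '' closedBall 0 1 = closure W ∧ Φ '' ball 0 1 = W ∧ EqOn Φ ψ (ball 0 1) := by
  have hcl : closure W = W ∪ frontier W := closure_eq_self_union_frontier W
  have hlim : ∀ a ∈ closure W, ∃ ζ, Tendsto φ (𝓝[W] a) (𝓝 ζ) := by
    intro a ha
    rw [hcl] at ha
    rcases ha with ha | ha
    · exact ⟨φ a, h.hφ.continuousOn a ha⟩
    · obtain ⟨ζ, -, hζ⟩ := h.exists_limit ha (hb a ha)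
      exact ⟨ζ, hζ⟩
  set F := extendFrom W φ with hF
  have hFc : ContinuousOn F (closure W) := continuousOn_extendFrom subset_rfl hlim
  have hFW : EqOn F φ W := fun w hw =>
    extendFrom_eq (subset_closure hw) (h.hφ.continuousOn w hw)
  have hFf : ∀ a ∈ frontier W, ‖F a‖ = 1 ∧ Tendsto φ (𝓝[W] a) (𝓝 (F a)) := by
    intro a ha
    obtain ⟨ζ, h1, h2⟩ := h.exists_limit ha (hb a ha)
    have : F a = ζ := extendFrom_eq ha.1 h2
    rw [this]
    exact ⟨h1, h2⟩
  have hFWn : ∀ w ∈ W, ‖F w‖ < 1 := fun w hw => by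
    rw [hFW hw]
    exact mem_ball_zero_iff.1 (h.mapsφ hw)
  have hFi : InjOn F (closure W) := by
    rw [hcl]
    rintro a (ha | ha) b (hb' | hb') hab
    · rw [hFW ha, hFW hb'] at hab
      rw [← h.left a ha, ← h.left b hb', hab]
    · have := hFWn a ha
      rw [hab, (hFf b hb').1] at this
      exact absurd this (lt_irrefl _)
    · have := hFWn b hb'
      rw [← hab, (hFf a ha).1] at this
      exact absurd this (lt_irrefl _)
    · exact h.limit_injective ha (hb a ha) hb' (hb b hb') (hFf a ha).1 (hFf a ha).2
        (hab ▸ (hFf b hb').2)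
  have hK : IsCompact (closure W) := h.bdd.isCompact_closure
  have hFim : F '' closure W = closedBall 0 1 := by
    refine Subset.antisymm ?_ ?_
    · rw [hcl]
      rintro _ ⟨a, ha | ha, rfl⟩
      · exact mem_closedBall_zero_iff.2 (hFWn a ha).le
      · exact mem_closedBall_zero_iff.2 (hFf a ha).1.le
    · rw [← closure_ball (0 : ℂ) one_ne_zero]
      refine closure_minimal (fun z hz => ?_) (hK.image_of_continuousOn hFc).isClosed
      exact ⟨ψ z, subset_closure (h.mapsψ hz), by rw [hFW (h.mapsψ hz), h.right z hz]⟩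
  have hinv : LeftInvOn (Function.invFunOn F (closure W)) F (closure W) := hFi.leftInvOn_invFunOn
  set Φ := Function.invFunOn F (closure W)
  have hΦψ : EqOn Φ ψ (ball 0 1) := fun z hz => by
    have h1 := hinv (subset_closure (h.mapsψ hz))
    rwa [hFW (h.mapsψ hz), h.right z hz] at h1
  refine ⟨Φ, ?_, ?_, ?_, ?_, hΦψ⟩
  · rw [← hFim]
    exact continuousOn_leftInverse_of_isCompact hK hFc hinv
  · rw [← hFim]
    rintro _ ⟨x, hx, rfl⟩ _ ⟨y, hy, rfl⟩ hxy
    rw [hinv hx, hinv hy] at hxy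
    rw [hxy]
  · rw [← hFim]
    exact hinv.image_image
  · rw [hΦψ.image_eq]
    exact Subset.antisymm (mapsTo_iff_image_subset.1 h.mapsψ)
      fun w hw => ⟨φ w, h.mapsφ hw, h.left w hw⟩

end ConfDisc

/-- A map out of a compact image is continuous as soon as its pullback is. -/
theorem continuousOn_image_of_comp {X Y Z : Type*} [TopologicalSpace X] [TopologicalSpace Y]
    [T2Space Y] [TopologicalSpace Z] {K : Set X} (hK : IsCompact K) {q : X → Y} {E : Y → Z}
    (hq : ContinuousOn q K) (h : ContinuousOn (fun x => E (q x)) K) : ContinuousOn E (q '' K) := by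
  rw [continuousOn_iff_isClosed] at h ⊢
  intro A hA
  obtain ⟨B, hB, hAB⟩ := h A hA
  refine ⟨q '' (K ∩ B), ?_, ?_⟩
  · exact ((hK.inter_right hB).image_of_continuousOn (hq.mono inter_subset_left)).isClosed
  · ext z
    constructor
    · rintro ⟨hz, x, hx, rfl⟩
      have : x ∈ B ∩ K := hAB ▸ ⟨hz, hx⟩
      exact ⟨⟨x, ⟨hx, this.1⟩, rfl⟩, x, hx, rfl⟩
    · rintro ⟨⟨x, hx, rfl⟩, hz⟩
      have : x ∈ (fun x => E (q x)) ⁻¹' A ∩ K := hAB ▸ ⟨hx.2, hx.1⟩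
      exact ⟨this.1, hz⟩

/-- `Φ` maps the closed unit disc homeomorphically onto the closure of `W` and the open disc onto
`W`. -/
structure IsDisc (Φ : ℂ → Sphere2) (W : Set Sphere2) : Prop where
  cont : ContinuousOn Φ (closedBall 0 1)
  inj : InjOn Φ (closedBall 0 1)
  image_ball : Φ '' ball 0 1 = W
  image_closedBall : Φ '' closedBall 0 1 = closure W

lemma BLC.preimage_sti {W : Set Sphere2} {v : Sphere2} {a : ℂ} (h : BLC W (sti v a)) :
    BLC (sti v ⁻¹' W) a := by
  intro N hN
  obtain ⟨N', hN', hc⟩ := h (sti v '' N) ((isOpenEmbedding_sti v).isOpenMap.image_mem_nhds hN)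
  refine ⟨sti v ⁻¹' N', (continuous_sti v).continuousAt hN', fun w₁ h₁ w₂ h₂ => ?_⟩
  have hcn := hc _ h₁ _ h₂
  have := hcn.image (g := st v) ((continuousOn_st v).mono (by
    rintro _ ⟨-, x, -, rfl⟩
    exact sti_ne v x))
  rw [st_sti, st_sti] at this
  refine this.mono ?_
  rintro _ ⟨_, ⟨hx, x, hxN, rfl⟩, rfl⟩
  rw [st_sti]
  exact ⟨hx, hxN⟩

/-- A simply connected domain of the sphere with locally connected boundary behaviour is the
interior of a closed disc. -/
theorem exists_isDisc {W : Set Sphere2} (hW : IsOpen W) (hWc : IsPreconnected W)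
    (hW' : IsPreconnected Wᶜ) {v w : Sphere2} (hv : v ∉ closure W) (hw : w ∈ W)
    (hb : ∀ a ∈ frontier W, BLC W a) : ∃ Φ, IsDisc Φ W ∧ Φ 0 = w := by
  have hWv : W ⊆ {v}ᶜ := fun x hx h => hv (subset_closure (h ▸ hx))
  have hclv : closure W ⊆ {v}ᶜ := fun x hx h => hv (h ▸ hx)
  have him : st v '' W = sti v ⁻¹' W := by
    ext z
    constructor
    · rintro ⟨x, hx, rfl⟩
      rwa [mem_preimage, sti_st (hWv hx)]
    · intro h
      exact ⟨_, h, st_sti v z⟩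
  set W₁ := sti v ⁻¹' W with hW₁
  have hcl : closure W₁ = sti v ⁻¹' closure W :=
    ((isOpenEmbedding_sti v).isOpenMap.preimage_closure_eq_closure_preimage
      (continuous_sti v) W).symm
  have hcl' : sti v '' closure W₁ = closure W := by
    rw [hcl, image_preimage_eq_inter_range, range_sti, inter_eq_left.2 hclv]
  have hopen : IsOpen W₁ := hW.preimage (continuous_sti v)
  have hbdd : Bornology.IsBounded W₁ := by
    rw [← him]
    exact (isCompact_image_st isClosed_closure hv).isBounded.subset (image_mono subset_closure)
  have hconn : IsPreconnected W₁ := by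
    rw [← him]
    exact hWc.image _ ((continuousOn_st v).mono hWv)
  have hend : OneEnded W₁ := by
    rw [← him]
    exact (oneEnded_of_isPreconnected_compl hW hWc hW').image (d := sti v)
      ((continuousOn_st v).mono hWv) (continuous_sti v).continuousOn fun x hx => sti_st (hWv hx)
  have hw₁ : st v w ∈ W₁ := him ▸ mem_image_of_mem _ hw
  obtain ⟨φ, h1, h2, h3, h4⟩ := exists_conformal_disc hopen hconn hend hbdd hw₁
  have hinv : LeftInvOn (Function.invFunOn φ W₁) φ W₁ := h2.leftInvOn_invFunOn
  have hD : ConfDisc W₁ φ (Function.invFunOn φ W₁) := by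
    refine ⟨hopen, hbdd, h1, h3 ▸ differentiableOn_invFunOn hopen h1 h2,
      fun x hx => h3 ▸ mem_image_of_mem φ hx, ?_, hinv, ?_⟩
    · rw [← h3]
      rintro _ ⟨x, hx, rfl⟩
      rwa [hinv hx]
    · rw [← h3]
      rintro _ ⟨x, hx, rfl⟩
      rw [hinv hx]
  obtain ⟨Φ, k1, k2, k3, k4, k5⟩ := hD.exists_extension (fun a ha => by
    have : sti v a ∈ frontier W := by
      rw [hopen.frontier_eq] at ha
      rw [hW.frontier_eq]
      exact ⟨by simpa [hcl] using ha.1, ha.2⟩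
    exact (hb _ this).preimage_sti)
  refine ⟨fun z => sti v (Φ z), ⟨(continuous_sti v).comp_continuousOn k1,
    (sti_injective v).comp_injOn k2, ?_, ?_⟩, ?_⟩
  · rw [← image_image (sti v) Φ, k4, hW₁, image_preimage_eq_inter_range, range_sti,
      inter_eq_left.2 hWv]
  · rw [← image_image (sti v) Φ, k3, hcl']
  · have : Φ 0 = st v w := by
      rw [k5 (by simp), ← h4]
      exact hinv hw₁
    show sti v (Φ 0) = w
    rw [this, sti_st (hWv hw)]

namespace IsDisc

variable {Φ : ℂ → Sphere2} {W : Set Sphere2}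

lemma image_sphere (h : IsDisc Φ W) (hW : IsOpen W) : Φ '' sphere 0 1 = frontier W := by
  rw [hW.frontier_eq, ← h.image_closedBall, ← h.image_ball,
    ← h.inj.image_sdiff_subset ball_subset_closedBall,
    closedBall_sdiff_ball]

lemma isPreconnected_compl_closure (h : IsDisc Φ W) : IsPreconnected (closure W)ᶜ := by
  rw [← h.image_closedBall]
  exact isPreconnected_compl_disc h.cont h.inj

end IsDisc

section Retract

/-- The radial retraction of the plane onto the closed unit disc. -/
noncomputable def discRetract (z : ℂ) : ℂ := ((max 1 ‖z‖)⁻¹ : ℝ) * z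

lemma continuous_discRetract : Continuous discRetract := by
  refine Continuous.mul (Complex.continuous_ofReal.comp ?_) continuous_id
  exact (continuous_const.max continuous_norm).inv₀ fun z => (lt_max_of_lt_left one_pos).ne'

lemma discRetract_mem (z : ℂ) : discRetract z ∈ closedBall (0 : ℂ) 1 := by
  have h1 : 0 < max 1 ‖z‖ := lt_max_of_lt_left one_pos
  simp only [discRetract, mem_closedBall, dist_zero_right, norm_mul, norm_real, norm_inv,
    Real.norm_of_nonneg h1.le]
  rw [inv_mul_le_iff₀ h1, mul_one]
  exact le_max_right _ _

lemma discRetract_eq {z : ℂ} (hz : z ∈ closedBall (0 : ℂ) 1) : discRetract z = z := by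
  have : max 1 ‖z‖ = 1 := max_eq_left (by simpa using hz)
  simp [discRetract, this]

/-- Brouwer's fixed point theorem for the closed unit disc of the plane. -/
theorem exists_fixed_closedBall {g : ℂ → ℂ} (hg : ContinuousOn g (closedBall 0 1))
    (hm : MapsTo g (closedBall 0 1) (closedBall 0 1)) : ∃ z ∈ closedBall (0 : ℂ) 1, g z = z := by
  by_contra! hne
  have hr := discRetract_mem
  have h1 : HasLog (fun z => discRetract z - g (discRetract z)) univ := by
    refine hasLog_univ ?_ fun z => sub_ne_zero.2 (hne _ (hr z)).symm
    exact continuous_discRetract.sub (hg.comp_continuous continuous_discRetract hr)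
  have hs : sphere (0 : ℂ) 1 ⊆ closedBall 0 1 := sphere_subset_closedBall
  have h0 : ∀ z ∈ sphere (0 : ℂ) 1, z ≠ 0 := fun z hz => ne_of_mem_sphere hz one_ne_zero
  have h2 : HasLog (fun z => (z - g z) / z) (sphere (0 : ℂ) 1) := by
    refine hasLog_of_slitPlane ?_ fun z hz => ?_
    · exact ContinuousOn.div (continuousOn_id.sub (hg.mono hs)) continuousOn_id h0
    · have hz0 := h0 z hz
      have hz1 : ‖z‖ = 1 := by simpa using hz
      have e : (z - g z) / z = 1 - g z / z := by field_simp
      have hn : ‖g z / z‖ ≤ 1 := by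
        rw [norm_div, hz1, div_one]
        simpa using hm (hs hz)
      have hre : (g z / z).re ≤ 1 := (Complex.re_le_norm _).trans hn
      rw [e, Complex.mem_slitPlane_iff]
      by_contra! hcon
      simp only [Complex.sub_re, Complex.one_re, Complex.sub_im, Complex.one_im] at hcon
      refine hne z (hs hz) ?_
      have : g z / z = 1 := Complex.ext (by simp; linarith [hcon.1]) (by simp; linarith [hcon.2])
      rwa [div_eq_one_iff_eq hz0] at this
  refine not_hasLog_sphere (a := 0) one_pos (((h1.mono (subset_univ _)).div h2).congr fun z hz => ?_)
  have hz0 := h0 z hz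
  have hz1 : z - g z ≠ 0 := sub_ne_zero.2 (hne z (hs hz)).symm
  simp only [discRetract_eq (hs hz), sub_zero]
  field_simp

lemma IsDisc.exists_fixed {Φ : ℂ → Sphere2} {W : Set Sphere2} (h : IsDisc Φ W)
    {g : Sphere2 → Sphere2} (hg : ContinuousOn g (closure W))
    (hm : MapsTo g (closure W) (closure W)) : ∃ z ∈ closure W, g z = z := by
  have hd : ∀ x ∈ closedBall (0 : ℂ) 1, Function.invFunOn Φ (closedBall 0 1) (Φ x) = x :=
    fun x hx => h.inj.leftInvOn_invFunOn hx
  have hdc := continuousOn_leftInverse_of_isCompact (isCompact_closedBall (0 : ℂ) 1) h.cont hd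
  have hmΦ : MapsTo Φ (closedBall 0 1) (closure W) := fun x hx =>
    h.image_closedBall ▸ mem_image_of_mem Φ hx
  rw [h.image_closedBall] at hdc
  obtain ⟨z, hz, hzf⟩ := exists_fixed_closedBall
    (g := fun z => Function.invFunOn Φ (closedBall 0 1) (g (Φ z)))
    (hdc.comp (hg.comp h.cont hmΦ) fun x hx => hm (hmΦ hx)) (fun x hx => by
      have := hm (hmΦ hx)
      rw [← h.image_closedBall] at this
      obtain ⟨y, hy, hye⟩ := this
      simp only [← hye, hd y hy]
      exact hy)
  refine ⟨Φ z, hmΦ hz, ?_⟩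
  have := hm (hmΦ hz)
  rw [← h.image_closedBall] at this
  obtain ⟨y, hy, hye⟩ := this
  simp only [← hye, hd y hy] at hzf
  rw [← hye, hzf]

end Retract

/-- The side of the point `a` with respect to the closed curve `c`. -/
def side (c : ℝ → Sphere2) (a : Sphere2) : Set Sphere2 := connectedComponentIn (range c)ᶜ a

namespace IsJordan

lemma eq_iff {X : Type*} [TopologicalSpace X] {c : ℝ → X} (hc : IsJordan c) {x y : ℝ} :
    c x = c y ↔ ∃ n : ℤ, x = y + n := by
  constructor
  · intro h
    obtain ⟨n, hn⟩ : ∃ n : ℤ, x - n ∈ Ico y (y + 1) := by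
      refine ⟨⌊x - y⌋, ?_, ?_⟩
      · linarith [Int.floor_le (x - y)]
      · linarith [Int.lt_floor_add_one (x - y)]
    have h1 : c (x - n) = c x := by
      have := hc.per.sub_int_mul_eq (x := x) n
      rwa [mul_one] at this
    have := hc.injOn_Ico y hn ⟨le_rfl, by linarith⟩ (h1.trans h)
    exact ⟨n, by linarith⟩
  · rintro ⟨n, rfl⟩
    simpa using hc.per.int_mul n y

variable {c : ℝ → Sphere2} (hc : IsJordan c) {a b : Sphere2}

include hc

lemma isClosed_range : IsClosed (range c) := hc.isCompact_range.isClosed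

lemma isPreconnected_range : IsPreconnected (range c) := by
  rw [← image_univ]
  exact isPreconnected_univ.image c hc.cont.continuousOn

lemma isOpen_side : IsOpen (side c a) := hc.isClosed_range.isOpen_compl.connectedComponentIn

lemma frontier_side (ha : a ∉ range c) : frontier (side c a) = range c :=
  hc.frontier_component ha

lemma closure_side (ha : a ∉ range c) : closure (side c a) = side c a ∪ range c := by
  rw [closure_eq_self_union_frontier, hc.frontier_side ha]

lemma isPreconnected_compl_side : IsPreconnected (side c a)ᶜ := by
  have hsub : side c a ⊆ (range c)ᶜ := connectedComponentIn_subset _ _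
  have key : ∀ x ∈ (side c a)ᶜ, Conn (side c a)ᶜ x (c 0) := by
    intro x hx
    by_cases hxc : x ∈ range c
    · exact ⟨range c, fun y hy hy' => hsub hy' hy, hc.isPreconnected_range, hxc, mem_range_self _⟩
    · refine ⟨closure (side c x), ?_, isPreconnected_connectedComponentIn.closure,
        subset_closure (mem_connectedComponentIn hxc), ?_⟩
      · rw [hc.closure_side hxc]
        rintro y (hy | hy) hy'
        · have e1 : side c x = side c y := connectedComponentIn_eq hy
          have e2 : side c a = side c y := connectedComponentIn_eq hy'
          exact hx (e2.trans e1.symm ▸ mem_connectedComponentIn hxc)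
        · exact hsub hy' hy
      · rw [hc.closure_side hxc]
        exact Or.inr (mem_range_self _)
  exact isPreconnected_of_conn fun x hx y hy => (key x hx).trans (key y hy).symm

lemma exists_notMem_closure_side (ha : a ∉ range c) : ∃ v, v ∉ closure (side c a) := by
  by_contra! h
  refine hc.not_isPreconnected_compl ?_
  have : (range c)ᶜ ⊆ side c a := by
    intro x hx
    have := h x
    rw [hc.closure_side ha] at this
    exact this.resolve_right hx
  rw [Subset.antisymm this (connectedComponentIn_subset _ _)]
  exact isPreconnected_connectedComponentIn

lemma blc_side (ha : a ∉ range c) {x : Sphere2} (hx : x ∈ frontier (side c a)) :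
    BLC (side c a) x := by
  rw [hc.frontier_side ha] at hx
  obtain ⟨s, rfl⟩ := hx
  exact hc.blc_component s

lemma exists_isDisc_side (ha : a ∉ range c) : ∃ Φ, IsDisc Φ (side c a) ∧ Φ 0 = a := by
  obtain ⟨v, hv⟩ := hc.exists_notMem_closure_side ha
  exact exists_isDisc hc.isOpen_side isPreconnected_connectedComponentIn
    hc.isPreconnected_compl_side hv (mem_connectedComponentIn ha) fun x hx => hc.blc_side ha hx

/-- The complement of a Jordan curve has at most two components. -/
theorem side_eq_of_notMem {v w : Sphere2} (ha : a ∉ range c) (hv : v ∉ range c)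
    (hva : v ∉ side c a) (hw : w ∉ range c) (hwa : w ∉ side c a) : w ∈ side c v := by
  obtain ⟨Φ, hΦ, -⟩ := hc.exists_isDisc_side ha
  have h := hΦ.isPreconnected_compl_closure
  have hm : ∀ x, x ∉ range c → x ∉ side c a → x ∈ (closure (side c a))ᶜ := by
    intro x h1 h2 h3
    rw [hc.closure_side ha] at h3
    exact h3.elim h2 h1
  refine (h.subset_connectedComponentIn (hm v hv hva) ?_) (hm w hw hwa)
  exact compl_subset_compl.2 (by rw [hc.closure_side ha]; exact subset_union_right)

lemma compl_closure_side (ha : a ∉ range c) (hb : b ∉ range c) (hab : b ∉ side c a) :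
    (closure (side c a))ᶜ = side c b := by
  rw [hc.closure_side ha]
  ext x
  constructor
  · intro hx
    exact hc.side_eq_of_notMem ha hb hab (fun h => hx (Or.inr h)) fun h => hx (Or.inl h)
  · rintro hx (h | h)
    · have e1 : side c a = side c x := connectedComponentIn_eq h
      have e2 : side c b = side c x := connectedComponentIn_eq hx
      exact hab (e1.trans e2.symm ▸ mem_connectedComponentIn hb)
    · exact connectedComponentIn_subset _ _ hx h

lemma exists_fixed_side (ha : a ∉ range c) {g : Sphere2 → Sphere2}
    (hg : Continuous g) (hm : MapsTo g (closure (side c a)) (closure (side c a))) :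
    ∃ z ∈ closure (side c a), g z = z := by
  obtain ⟨Φ, hΦ, -⟩ := hc.exists_isDisc_side ha
  exact hΦ.exists_fixed hg.continuousOn hm

end IsJordan

section Radial

/-- The point of the unit circle with angle `2 π x`. -/
noncomputable def circ (x : ℝ) : ℂ := exp (2 * π * x * I)

lemma isJordan_circ : IsJordan circ := by
  refine ⟨by unfold circ; fun_prop, fun x => ?_, ?_⟩
  · rw [circ, circ, Complex.exp_eq_exp_iff_exists_int]
    exact ⟨1, by push_cast; ring⟩
  · intro x hx y hy h
    rw [circ, circ, Complex.exp_eq_exp_iff_exists_int] at h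
    obtain ⟨n, hn⟩ := h
    have h1 : (2 * π * I : ℂ) ≠ 0 := by simp [Real.pi_ne_zero]
    have h2 : (x : ℂ) = y + n := mul_left_cancel₀ h1 (by linear_combination hn)
    have h3 : x = y + n := by exact_mod_cast h2
    have h4 : n = 0 := by
      have e1 : (n : ℝ) < 1 := by linarith [hx.2, hy.1]
      have e2 : (-1 : ℝ) < n := by linarith [hx.1, hy.2]
      have e3 : n < 1 := by exact_mod_cast e1
      have e4 : -1 < n := by exact_mod_cast e2
      omega
    simpa [h4] using h3

@[simp] theorem norm_circ (x : ℝ) : ‖circ x‖ = 1 := by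
  rw [circ, show (2 * π * x * I : ℂ) = ((2 * π * x : ℝ) : ℂ) * I by
    push_cast; ring]
  exact Complex.norm_exp_ofReal_mul_I _

lemma norm_mul_circ (z : ℂ) : ‖z‖ * circ (z.arg / (2 * π)) = z := by
  rw [circ]
  convert Complex.norm_mul_exp_arg_mul_I z using 4
  have : (π : ℂ) ≠ 0 := by exact_mod_cast Real.pi_ne_zero
  push_cast
  field_simp

lemma range_circ : range circ = sphere 0 1 := by
  ext z
  constructor
  · rintro ⟨x, rfl⟩
    simp
  · intro hz
    have hz1 : ‖z‖ = 1 := by simpa using hz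
    refine ⟨z.arg / (2 * π), ?_⟩
    have := norm_mul_circ z
    rwa [hz1, Complex.ofReal_one, one_mul] at this

lemma image_polar : (fun p : ℝ × ℝ => (p.1 : ℂ) * circ p.2) '' (Icc 0 1 ×ˢ Icc 0 1) =
    closedBall 0 1 := by
  ext z
  constructor
  · rintro ⟨p, hp, rfl⟩
    simpa [abs_of_nonneg hp.1.1] using hp.1.2
  · intro hz
    refine ⟨(‖z‖, Int.fract (z.arg / (2 * π))), ⟨⟨norm_nonneg _, by simpa using hz⟩,
      Int.fract_nonneg _, (Int.fract_lt_one _).le⟩, ?_⟩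
    have : circ (Int.fract (z.arg / (2 * π))) = circ (z.arg / (2 * π)) := by
      rw [isJordan_circ.eq_iff]
      exact ⟨-⌊z.arg / (2 * π)⌋, by push_cast; rw [Int.fract]; ring⟩
    simp only [this, norm_mul_circ]

/-- The radial extension to the plane of a closed curve in the unit circle. -/
noncomputable def radial (k : ℝ → ℂ) (z : ℂ) : ℂ := ‖z‖ * k (z.arg / (2 * π))

variable {k : ℝ → ℂ}

lemma radial_mul_circ (hk : IsJordan k) {r : ℝ} (hr : 0 ≤ r) (x : ℝ) :
    radial k (r * circ x) = r * k x := by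
  rw [radial, norm_mul, norm_circ, mul_one, norm_real, Real.norm_of_nonneg hr]
  rcases hr.eq_or_lt with rfl | hr
  · simp
  congr 1
  have h1 := norm_mul_circ (r * circ x)
  rw [norm_mul, norm_circ, mul_one, norm_real, Real.norm_of_nonneg hr.le,
    mul_right_inj' (by exact_mod_cast hr.ne'), isJordan_circ.eq_iff] at h1
  exact hk.eq_iff.2 h1

lemma continuousOn_radial (hk : IsJordan k) : ContinuousOn (radial k) (closedBall 0 1) := by
  rw [← image_polar]
  have hcirc := isJordan_circ.cont
  have hkc := hk.cont
  refine continuousOn_image_of_comp (isCompact_Icc.prod isCompact_Icc) (by fun_prop) ?_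
  have : ContinuousOn (fun p : ℝ × ℝ => (p.1 : ℂ) * k p.2) (Icc 0 1 ×ˢ Icc 0 1) := by fun_prop
  exact this.congr fun p hp => radial_mul_circ hk hp.1.1 p.2

lemma norm_radial (hk1 : ∀ x, ‖k x‖ = 1) (z : ℂ) : ‖radial k z‖ = ‖z‖ := by
  simp [radial, hk1]

lemma radial_injective (hk : IsJordan k) (hk1 : ∀ x, ‖k x‖ = 1) :
    Function.Injective (radial k) := by
  intro z w h
  have hn : ‖z‖ = ‖w‖ := by rw [← norm_radial hk1 z, h, norm_radial hk1]
  rcases eq_or_ne z 0 with rfl | hz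
  · rw [norm_zero] at hn
    exact (norm_eq_zero.1 hn.symm).symm
  rw [radial, radial, ← hn, mul_right_inj' (by simpa using hz)] at h
  rw [← norm_mul_circ z, ← norm_mul_circ w, ← hn, isJordan_circ.eq_iff.2 (hk.eq_iff.1 h)]

lemma radial_surjective (hk : IsJordan k) (hk2 : range k = sphere 0 1) :
    Function.Surjective (radial k) := by
  intro w
  rcases eq_or_ne w 0 with rfl | hw
  · exact ⟨0, by simp [radial]⟩
  have hw' : (‖w‖ : ℂ) ≠ 0 := by simpa using hw
  have : (‖w‖ : ℂ)⁻¹ * w ∈ range k := by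
    rw [hk2]
    simp [hw]
  obtain ⟨x, hx⟩ := this
  exact ⟨‖w‖ * circ x, by rw [radial_mul_circ hk (norm_nonneg w), hx, mul_inv_cancel_left₀ hw']⟩

end Radial

/-- The Schoenflies theorem for one side of a Jordan curve, with prescribed boundary values and
centre. -/
theorem IsJordan.exists_schoenflies {c : ℝ → Sphere2} (hc : IsJordan c) {a : Sphere2}
    (ha : a ∉ range c) : ∃ Φ, IsDisc Φ (side c a) ∧ Φ 0 = a ∧ ∀ x, Φ (circ x) = c x := by
  obtain ⟨Φ, hΦ, hΦ0⟩ := hc.exists_isDisc_side ha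
  have hd : ∀ x ∈ closedBall (0 : ℂ) 1, Function.invFunOn Φ (closedBall 0 1) (Φ x) = x :=
    fun x hx => hΦ.inj.leftInvOn_invFunOn hx
  have hdc := continuousOn_leftInverse_of_isCompact (isCompact_closedBall (0 : ℂ) 1) hΦ.cont hd
  set d := Function.invFunOn Φ (closedBall 0 1)
  have hsph : Φ '' sphere 0 1 = range c := by
    rw [hΦ.image_sphere hc.isOpen_side, hc.frontier_side ha]
  have hcm : ∀ x, ∃ z ∈ sphere (0 : ℂ) 1, Φ z = c x := fun x => by
    have : c x ∈ Φ '' sphere 0 1 := hsph ▸ mem_range_self x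
    exact this
  have hkΦ : ∀ x, d (c x) ∈ sphere (0 : ℂ) 1 ∧ Φ (d (c x)) = c x := by
    intro x
    obtain ⟨z, hz, he⟩ := hcm x
    rw [← he, hd z (sphere_subset_closedBall hz)]
    exact ⟨hz, rfl⟩
  have hk : IsJordan fun x => d (c x) := by
    refine ⟨hdc.comp_continuous hc.cont fun x => ?_, fun x => ?_, ?_⟩
    · obtain ⟨z, hz, he⟩ := hcm x
      exact ⟨z, sphere_subset_closedBall hz, he⟩
    · show d (c (x + 1)) = d (c x)
      rw [hc.per]
    · intro x hx y hy h
      refine hc.inj hx hy ?_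
      have := congrArg Φ h
      rwa [(hkΦ x).2, (hkΦ y).2] at this
  have hk1 : ∀ x, ‖d (c x)‖ = 1 := fun x => by simpa using (hkΦ x).1
  have hk2 : (range fun x => d (c x)) = sphere 0 1 := by
    refine Subset.antisymm ?_ fun z hz => ?_
    · rintro _ ⟨x, rfl⟩
      exact (hkΦ x).1
    · have : Φ z ∈ range c := hsph ▸ mem_image_of_mem Φ hz
      obtain ⟨x, hx⟩ := this
      exact ⟨x, by simp only [hx, hd z (sphere_subset_closedBall hz)]⟩
  set k := fun x => d (c x)
  have hnr : ∀ z, ‖radial k z‖ = ‖z‖ := norm_radial hk1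
  have hrb : radial k '' ball 0 1 = ball 0 1 := by
    ext w
    constructor
    · rintro ⟨z, hz, rfl⟩
      simpa [hnr] using hz
    · intro hw
      obtain ⟨z, rfl⟩ := radial_surjective hk hk2 w
      exact ⟨z, by simpa [hnr] using hw, rfl⟩
  have hrc : radial k '' closedBall 0 1 = closedBall 0 1 := by
    ext w
    constructor
    · rintro ⟨z, hz, rfl⟩
      simpa [hnr] using hz
    · intro hw
      obtain ⟨z, rfl⟩ := radial_surjective hk hk2 w
      exact ⟨z, by simpa [hnr] using hw, rfl⟩
  have hrm : MapsTo (radial k) (closedBall 0 1) (closedBall 0 1) := mapsTo_iff_image_subset.2 hrc.le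
  refine ⟨fun z => Φ (radial k z), ⟨hΦ.cont.comp (continuousOn_radial hk) hrm,
    hΦ.inj.comp (radial_injective hk hk1).injOn hrm, ?_, ?_⟩, ?_, fun x => ?_⟩
  · rw [← image_image Φ, hrb, hΦ.image_ball]
  · rw [← image_image Φ, hrc, hΦ.image_closedBall]
  · simp [radial, hΦ0]
  · have := radial_mul_circ hk zero_le_one x
    rw [Complex.ofReal_one, one_mul, one_mul] at this
    show Φ (radial k (circ x)) = c x
    rw [this]
    exact (hkΦ x).2

section Arc

section Gaps

variable {Y : Type*} {γ : ℝ → Y}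

/-- Closed subsets of the unit interval all of whose gaps are closed up by `γ`. -/
def gapSets (γ : ℝ → Y) : Set (Set ℝ) :=
  {K | IsClosed K ∧ K ⊆ Icc 0 1 ∧ 0 ∈ K ∧ 1 ∈ K ∧
    ∀ s ∈ K, ∀ t ∈ K, s < t → K ∩ Ioo s t = ∅ → γ s = γ t}

/-- The last point of `K` not after `x`. -/
noncomputable def lastPt (K : Set ℝ) (x : ℝ) : ℝ := sSup (K ∩ Iic x)

/-- The first point of `K` not before `x`. -/
noncomputable def firstPt (K : Set ℝ) (x : ℝ) : ℝ := sInf (K ∩ Ici x)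

lemma lastPt_isGreatest {K : Set ℝ} (hK : IsClosed K) {x y : ℝ} (hy : y ∈ K) (hyx : y ≤ x) :
    IsGreatest (K ∩ Iic x) (lastPt K x) :=
  (hK.inter isClosed_Iic).isGreatest_csSup ⟨y, hy, hyx⟩ ⟨x, fun _ h => h.2⟩

lemma firstPt_isLeast {K : Set ℝ} (hK : IsClosed K) {x y : ℝ} (hy : y ∈ K) (hyx : x ≤ y) :
    IsLeast (K ∩ Ici x) (firstPt K x) :=
  (hK.inter isClosed_Ici).isLeast_csInf ⟨y, hy, hyx⟩ ⟨x, fun _ h => h.2⟩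

lemma exists_gap {K : Set ℝ} (hK : K ∈ gapSets γ) {x y : ℝ} (hx : 0 ≤ x) (hxy : x ≤ y)
    (hy : y ≤ 1) (h : K ∩ Icc x y = ∅) :
    lastPt K x < x ∧ y < firstPt K y ∧ lastPt K x ∈ K ∧ firstPt K y ∈ K ∧
      γ (lastPt K x) = γ (firstPt K y) := by
  obtain ⟨hKc, hKs, h0, h1, hg⟩ := hK
  have hl := lastPt_isGreatest hKc h0 hx
  have hf := firstPt_isLeast hKc h1 hy
  have e1 : lastPt K x < x := lt_of_le_of_ne hl.1.2 fun e =>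
    (eq_empty_iff_forall_notMem.1 h) x ⟨e ▸ hl.1.1, le_rfl, hxy⟩
  have e2 : y < firstPt K y := lt_of_le_of_ne hf.1.2 fun e =>
    (eq_empty_iff_forall_notMem.1 h) y ⟨e ▸ hf.1.1, hxy, le_rfl⟩
  refine ⟨e1, e2, hl.1.1, hf.1.1, hg _ hl.1.1 _ hf.1.1 (by linarith) ?_⟩
  rw [eq_empty_iff_forall_notMem]
  rintro z ⟨hz, hz1, hz2⟩
  have k1 : x < z := by
    by_contra hcon
    exact absurd (hl.2 ⟨hz, not_lt.1 hcon⟩) (not_le.2 hz1)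
  have k2 : z < y := by
    by_contra hcon
    exact absurd (hf.2 ⟨hz, not_lt.1 hcon⟩) (not_le.2 hz2)
  exact (eq_empty_iff_forall_notMem.1 h) z ⟨hz, k1.le, k2.le⟩

lemma Ioo_disjoint_of_minimal {K : Set ℝ} (hK : Minimal (· ∈ gapSets γ) K) {s t : ℝ}
    (hs : s ∈ K) (ht : t ∈ K) (h : γ s = γ t) : K ∩ Ioo s t = ∅ := by
  obtain ⟨hKc, hKs, h0, h1, hg⟩ := hK.prop
  have hmem : K \ Ioo s t ∈ gapSets γ := by
    refine ⟨hKc.sdiff isOpen_Ioo, sdiff_subset.trans hKs, ⟨h0, fun h => ?_⟩, ⟨h1, fun h => ?_⟩, ?_⟩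
    · exact absurd h.1 (not_lt.2 (hKs hs).1)
    · exact absurd h.2 (not_lt.2 (hKs ht).2)
    · intro x hx y hy hxy hgap
      by_cases hsx : s ∈ Ioo x y
      · exact absurd (show s ∈ K \ Ioo s t ∩ Ioo x y from ⟨⟨hs, fun h => lt_irrefl _ h.1⟩, hsx⟩)
          (by rw [hgap]; exact fun h => h)
      by_cases htx : t ∈ Ioo x y
      · exact absurd (show t ∈ K \ Ioo s t ∩ Ioo x y from ⟨⟨ht, fun h => lt_irrefl _ h.2⟩, htx⟩)
          (by rw [hgap]; exact fun h => h)
      by_cases hxs : x = s ∧ y = t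
      · rw [hxs.1, hxs.2, h]
      refine hg x hx.1 y hy.1 hxy ?_
      rw [eq_empty_iff_forall_notMem]
      rintro z ⟨hz, hz1, hz2⟩
      have hz3 : z ∈ Ioo s t := by
        by_contra hcon
        exact (eq_empty_iff_forall_notMem.1 hgap) z ⟨⟨hz, hcon⟩, hz1, hz2⟩
      have h1 : s ≤ x := by
        by_contra hcon
        exact hsx ⟨not_le.1 hcon, hz3.1.trans hz2⟩
      have h2 : y ≤ t := by
        by_contra hcon
        exact htx ⟨hz1.trans hz3.2, not_le.1 hcon⟩
      have h3 : x = s := by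
        by_contra hcon
        exact hx.2 ⟨lt_of_le_of_ne h1 (Ne.symm hcon), (hz1.trans hz3.2)⟩
      have h4 : y = t := by
        by_contra hcon
        exact hy.2 ⟨hz3.1.trans hz2, lt_of_le_of_ne h2 hcon⟩
      exact hxs ⟨h3, h4⟩
  have hle := hK.le_of_le hmem sdiff_subset
  rw [eq_empty_iff_forall_notMem]
  rintro z ⟨hz, hz'⟩
  exact (hle hz).2 hz'

end Gaps

variable {Y : Type*} [MetricSpace Y] {γ : ℝ → Y}

lemma exists_minimal_gapSet (hγ : Continuous γ) : ∃ K, Minimal (· ∈ gapSets γ) K := by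
  refine (zorn_superset_nonempty (gapSets γ) (fun c hc hch hcne => ?_) (Icc 0 1) ?_).imp
    fun K hK => hK.2
  · refine ⟨⋂₀ c, ⟨isClosed_sInter fun K hK => (hc hK).1, ?_, fun K hK => (hc hK).2.2.1,
      fun K hK => (hc hK).2.2.2.1, ?_⟩, fun K hK => sInter_subset_of_mem hK⟩
    · obtain ⟨K, hK⟩ := hcne
      exact (sInter_subset_of_mem hK).trans (hc hK).2.1
    intro s hs t ht hst hgap
    by_contra hne
    have hd : 0 < dist (γ s) (γ t) := dist_pos.2 hne
    obtain ⟨δ₁, hδ₁, hs'⟩ := Metric.continuous_iff.1 hγ s (dist (γ s) (γ t) / 2) (half_pos hd)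
    obtain ⟨δ₂, hδ₂, ht'⟩ := Metric.continuous_iff.1 hγ t (dist (γ s) (γ t) / 2) (half_pos hd)
    set ε := min (min δ₁ δ₂) (t - s) / 3 with hε
    have hm : 0 < min (min δ₁ δ₂) (t - s) := lt_min (lt_min hδ₁ hδ₂) (sub_pos.2 hst)
    have hε0 : 0 < ε := by positivity
    have hm1 : min (min δ₁ δ₂) (t - s) ≤ δ₁ := (min_le_left _ _).trans (min_le_left _ _)
    have hm2 : min (min δ₁ δ₂) (t - s) ≤ δ₂ := (min_le_left _ _).trans (min_le_right _ _)
    have hm3 : min (min δ₁ δ₂) (t - s) ≤ t - s := min_le_right _ _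
    have hex : ∃ K ∈ c, K ∩ Icc (s + ε) (t - ε) = ∅ := by
      by_contra! hcon
      have : (⋂ K : c, (K : Set ℝ) ∩ Icc (s + ε) (t - ε)).Nonempty := by
        have : Nonempty c := hcne.to_subtype
        refine IsCompact.nonempty_iInter_of_directed_nonempty_isCompact_isClosed _ ?_
          (fun K => hcon K K.2)
          (fun K => (isCompact_Icc.inter_left (hc K.2).1))
          fun K => (hc K.2).1.inter isClosed_Icc
        intro K L
        rcases hch.total K.2 L.2 with h | h
        · exact ⟨K, subset_rfl, inter_subset_inter_left _ h⟩
        · exact ⟨L, inter_subset_inter_left _ h, subset_rfl⟩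
      obtain ⟨x, hx⟩ := this
      rw [mem_iInter] at hx
      obtain ⟨K₀, hK₀⟩ := hcne
      have hx2 := (hx ⟨K₀, hK₀⟩).2
      refine (eq_empty_iff_forall_notMem.1 hgap) x ⟨fun K hK => (hx ⟨K, hK⟩).1, ?_, ?_⟩
      · linarith [hx2.1]
      · linarith [hx2.2]
    obtain ⟨K, hK, hKe⟩ := hex
    have hKs := (hc hK).2.1
    have hsK := hKs (hs K hK)
    have htK := hKs (ht K hK)
    obtain ⟨e1, e2, -, -, e3⟩ := exists_gap (hc hK) (x := s + ε) (y := t - ε)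
      (by linarith [hsK.1]) (by linarith) (by linarith [htK.2]) hKe
    have f1 : s ≤ lastPt K (s + ε) := (lastPt_isGreatest (hc hK).1 (hs K hK)
      (by linarith)).2 ⟨hs K hK, by simp; linarith⟩
    have f2 : firstPt K (t - ε) ≤ t := (firstPt_isLeast (hc hK).1 (ht K hK)
      (by linarith)).2 ⟨ht K hK, by simp; linarith⟩
    have g1 := hs' (lastPt K (s + ε)) (by rw [Real.dist_eq, abs_lt]; constructor <;> linarith)
    have g2 := ht' (firstPt K (t - ε)) (by rw [Real.dist_eq, abs_lt]; constructor <;> linarith)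
    rw [e3] at g1
    have := dist_triangle_left (γ s) (γ t) (γ (firstPt K (t - ε)))
    linarith
  · refine ⟨isClosed_Icc, subset_rfl, by simp, by simp, fun s hs t ht hst h => ?_⟩
    exfalso
    refine (eq_empty_iff_forall_notMem.1 h) ((s + t) / 2) ⟨⟨?_, ?_⟩, ?_, ?_⟩ <;>
      linarith [hs.1, ht.2, hs.2, ht.1]

/-- A path can be replaced by one whose fibres are intervals. -/
theorem exists_monotone_path (hγ : Continuous γ) :
    ∃ δ : ℝ → Y, ContinuousOn δ (Icc 0 1) ∧ δ 0 = γ 0 ∧ δ 1 = γ 1 ∧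
      (∀ x ∈ Icc (0 : ℝ) 1, δ x ∈ γ '' Icc 0 1) ∧
      ∀ x ∈ Icc (0 : ℝ) 1, ∀ y ∈ Icc (0 : ℝ) 1, x ≤ y → δ x = δ y → ∀ z ∈ Icc x y, δ z = δ x := by
  obtain ⟨K, hK⟩ := exists_minimal_gapSet hγ
  obtain ⟨hKc, hKs, h0, h1, hg⟩ := hK.prop
  have hl : ∀ x ∈ Icc (0 : ℝ) 1, IsGreatest (K ∩ Iic x) (lastPt K x) := fun x hx =>
    lastPt_isGreatest hKc h0 hx.1
  have hself : ∀ x ∈ K, lastPt K x = x := fun x hx =>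
    le_antisymm (hl x (hKs hx)).1.2 ((hl x (hKs hx)).2 ⟨hx, mem_Iic.2 le_rfl⟩)
  have hstep : ∀ x ∈ Icc (0 : ℝ) 1, ∀ y ∈ Icc (0 : ℝ) 1, x ≤ y →
      lastPt K x = lastPt K y ∨ x < lastPt K y := by
    intro x hx y hy hxy
    by_contra! hcon
    have e1 : lastPt K y ≤ lastPt K x := (hl x hx).2 ⟨(hl y hy).1.1, hcon.2⟩
    have e2 : lastPt K x ≤ lastPt K y := (hl y hy).2 ⟨(hl x hx).1.1, (hl x hx).1.2.trans hxy⟩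
    exact hcon.1 (le_antisymm e2 e1)
  have hkey : ∀ x ∈ Icc (0 : ℝ) 1, ∀ y ∈ Icc (0 : ℝ) 1, x ≤ y →
      γ (lastPt K x) = γ (lastPt K y) ∨ ∃ x' ∈ Icc x y, ∃ y' ∈ Icc x y,
        γ (lastPt K x) = γ x' ∧ γ (lastPt K y) = γ y' := by
    intro x hx y hy hxy
    rcases hstep x hx y hy hxy with h | h
    · exact Or.inl (by rw [h])
    right
    have hf := firstPt_isLeast hKc (hl y hy).1.1 h.le
    refine ⟨firstPt K x, ⟨hf.1.2, (hf.2 ⟨(hl y hy).1.1, h.le⟩).trans (hl y hy).1.2⟩,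
      lastPt K y, ⟨h.le, (hl y hy).1.2⟩, ?_, rfl⟩
    by_cases hxK : x ∈ K
    · have : firstPt K x = x := le_antisymm (hf.2 ⟨hxK, mem_Ici.2 le_rfl⟩) hf.1.2
      rw [this, hself x hxK]
    · refine (exists_gap hK.prop hx.1 le_rfl hx.2 ?_).2.2.2.2
      rw [eq_empty_iff_forall_notMem]
      rintro z ⟨hz, hz1⟩
      rw [Icc_self, mem_singleton_iff] at hz1
      exact hxK (hz1 ▸ hz)
  refine ⟨fun x => γ (lastPt K x), ?_, congrArg γ (hself 0 h0),
    congrArg γ (hself 1 h1), ?_, ?_⟩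
  · have hu : UniformContinuousOn γ (Icc 0 1) :=
      isCompact_Icc.uniformContinuousOn_of_continuous hγ.continuousOn
    rw [Metric.uniformContinuousOn_iff] at hu
    rw [Metric.continuousOn_iff]
    intro x hx ε hε
    obtain ⟨η, hη, h⟩ := hu ε hε
    refine ⟨η, hη, fun y hy hyx => ?_⟩
    have aux : ∀ x ∈ Icc (0 : ℝ) 1, ∀ y ∈ Icc (0 : ℝ) 1, x ≤ y → dist x y < η →
        dist (γ (lastPt K x)) (γ (lastPt K y)) < ε := by
      intro x hx y hy hxy hd
      rcases hkey x hx y hy hxy with e | ⟨x', hx', y', hy', e1, e2⟩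
      · rwa [e, dist_self]
      · rw [e1, e2]
        refine h x' ⟨hx.1.trans hx'.1, hx'.2.trans hy.2⟩ y'
          ⟨hx.1.trans hy'.1, hy'.2.trans hy.2⟩ ((Real.dist_le_of_mem_Icc hx' hy').trans_lt ?_)
        rw [dist_comm, Real.dist_eq, abs_lt] at hd
        exact hd.2
    rcases le_total x y with hxy | hxy
    · rw [dist_comm]
      exact aux x hx y hy hxy (by rwa [dist_comm])
    · exact aux y hy x hx hxy hyx
  · exact fun x hx => mem_image_of_mem γ (hKs (hl x hx).1.1)
  · intro x hx y hy hxy hxy' z hz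
    have hz01 : z ∈ Icc (0 : ℝ) 1 := ⟨hx.1.trans hz.1, hz.2.trans hy.2⟩
    rcases hstep x hx z hz01 hz.1 with e1 | e1
    · exact congrArg γ e1.symm
    rcases hstep z hz01 y hy hz.2 with e2 | e2
    · exact (congrArg γ e2).trans hxy'.symm
    exfalso
    have hlt : lastPt K z < lastPt K y := (hl z hz01).1.2.trans_lt e2
    have hlt' : lastPt K x < lastPt K z := (hl x hx).1.2.trans_lt e1
    have := Ioo_disjoint_of_minimal hK (hl x hx).1.1 (hl y hy).1.1 hxy'
    exact (eq_empty_iff_forall_notMem.1 this) _ ⟨(hl z hz01).1.1, hlt', hlt⟩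

/-- The largest displacement from `δ d` along `[d, x]`. -/
noncomputable def runMax (δ : ℝ → Y) (d x : ℝ) : ℝ :=
  sSup ((fun t : ℝ => dist (δ (d + t * (max x d - d))) (δ d)) '' Icc 0 1)

variable {δ : ℝ → Y}

lemma continuous_runMax (hδ : Continuous δ) (d : ℝ) : Continuous (runMax δ d) := by
  refine isCompact_Icc.continuous_sSup
    (f := fun x t : ℝ => dist (δ (d + t * (max x d - d))) (δ d)) ?_
  change Continuous fun p : ℝ × ℝ => dist (δ (d + p.2 * (max p.1 d - d))) (δ d)
  fun_prop

lemma bddAbove_runMax (hδ : Continuous δ) (d x : ℝ) :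
    BddAbove ((fun t : ℝ => dist (δ (d + t * (max x d - d))) (δ d)) '' Icc 0 1) :=
  (isCompact_Icc.image (by fun_prop)).bddAbove

lemma runMax_nonneg (δ : ℝ → Y) (d x : ℝ) : 0 ≤ runMax δ d x := by
  refine Real.sSup_nonneg ?_
  rintro _ ⟨t, -, rfl⟩
  exact dist_nonneg

lemma le_runMax (hδ : Continuous δ) {d x s : ℝ} (hs : s ∈ Icc d x) :
    dist (δ s) (δ d) ≤ runMax δ d x := by
  rcases hs.1.eq_or_lt with e | hlt
  · rw [← e, dist_self]
    exact runMax_nonneg δ d x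
  have hx : max x d = x := max_eq_left (hs.1.trans hs.2)
  have hdx : 0 < x - d := by linarith [hs.2]
  refine le_csSup (bddAbove_runMax hδ d x) ⟨(s - d) / (x - d), ⟨?_, ?_⟩, ?_⟩
  · exact div_nonneg (by linarith) hdx.le
  · rw [div_le_one hdx]
    linarith [hs.2]
  · simp only [hx]
    rw [div_mul_cancel₀ _ hdx.ne', add_sub_cancel]

lemma runMax_le {d x c : ℝ} (hc : 0 ≤ c) (h : ∀ s ∈ Icc d x, dist (δ s) (δ d) ≤ c) :
    runMax δ d x ≤ c := by
  refine csSup_le ((nonempty_Icc.2 zero_le_one).image _) ?_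
  rintro _ ⟨t, ht, rfl⟩
  rcases le_total d x with hdx | hdx
  · simp only [max_eq_left hdx]
    refine h _ ⟨?_, ?_⟩ <;> nlinarith [ht.1, ht.2]
  · simp [max_eq_right hdx, hc]

lemma runMax_eq_zero {d x : ℝ} (hx : x ≤ d) : runMax δ d x = 0 := by
  refine le_antisymm (runMax_le le_rfl fun s hs => ?_) (runMax_nonneg δ d x)
  rw [le_antisymm (hs.2.trans hx) hs.1, dist_self]

lemma runMax_mono (hδ : Continuous δ) (d : ℝ) : Monotone (runMax δ d) := fun _ y hxy =>
  runMax_le (runMax_nonneg δ d y) fun _ hs => le_runMax hδ ⟨hs.1, hs.2.trans hxy⟩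

lemma runMax_eq_of_const (hδ : Continuous δ) {d x y : ℝ} (hxy : x ≤ y)
    (h : ∀ z ∈ Icc x y, δ z = δ x) : runMax δ d y = runMax δ d x := by
  refine le_antisymm (runMax_le (runMax_nonneg δ d x) fun s hs => ?_) (runMax_mono hδ d hxy)
  rcases le_total s x with hsx | hsx
  · exact le_runMax hδ ⟨hs.1, hsx⟩
  rcases le_total d x with hdx | hdx
  · rw [h s ⟨hsx, hs.2⟩]
    exact le_runMax hδ ⟨hdx, le_rfl⟩
  · rw [h s ⟨hsx, hs.2⟩, h d ⟨hdx, hs.1.trans hs.2⟩, dist_self]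
    exact runMax_nonneg δ d x

/-- A continuous monotone function with the same fibres as a path with interval fibres. -/
theorem exists_monotone_reparam (hδ : Continuous δ)
    (hf : ∀ x y, x ≤ y → δ x = δ y → ∀ z ∈ Icc x y, δ z = δ x) :
    ∃ q : ℝ → ℝ, Continuous q ∧ Monotone q ∧ ∀ x y, q x = q y ↔ δ x = δ y := by
  set d : ℕ → ℝ := TopologicalSpace.denseSeq ℝ with hd
  have hsum : Summable fun n : ℕ => (1 / 2 : ℝ) ^ n := summable_geometric_two
  have hb : ∀ n x, ‖(1 / 2 : ℝ) ^ n * min 1 (runMax δ (d n) x)‖ ≤ (1 / 2 : ℝ) ^ n := by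
    intro n x
    rw [Real.norm_of_nonneg (mul_nonneg (by positivity)
      (le_min zero_le_one (runMax_nonneg δ _ _)))]
    exact mul_le_of_le_one_right (by positivity) (min_le_left _ _)
  have hs : ∀ x, Summable fun n => (1 / 2 : ℝ) ^ n * min 1 (runMax δ (d n) x) := fun x =>
    hsum.of_norm_bounded fun n => hb n x
  have hm : ∀ n, Monotone fun x => (1 / 2 : ℝ) ^ n * min 1 (runMax δ (d n) x) := fun n x y hxy =>
    mul_le_mul_of_nonneg_left (min_le_min_left _ (runMax_mono hδ _ hxy)) (by positivity)
  refine ⟨fun x => ∑' n, (1 / 2 : ℝ) ^ n * min 1 (runMax δ (d n) x),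
    continuous_tsum (fun n => continuous_const.mul
      (continuous_const.min (continuous_runMax hδ (d n)))) hsum hb,
    fun x y hxy => (hs x).tsum_le_tsum (fun n => hm n hxy) (hs y), ?_⟩
  have key : ∀ x y, x ≤ y → ((∑' n, (1 / 2 : ℝ) ^ n * min 1 (runMax δ (d n) x)) =
      (∑' n, (1 / 2 : ℝ) ^ n * min 1 (runMax δ (d n) y)) ↔ δ x = δ y) := by
    intro x y hxy
    constructor
    · intro h
      by_contra hne
      have hlt : x < y := lt_of_le_of_ne hxy fun e => hne (e ▸ rfl)
      obtain ⟨r, hr, hr'⟩ : ∃ r > x, ∀ z ∈ Ico x r, δ z ≠ δ y := by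
        have : ∀ᶠ z in 𝓝 x, δ z ≠ δ y := hδ.continuousAt.eventually_ne hne
        obtain ⟨r, hr, h⟩ := (mem_nhdsGE_iff_exists_Ico_subset).1 (mem_nhdsWithin_of_mem_nhds this)
        exact ⟨r, hr, h⟩
      obtain ⟨z, ⟨hz1, hz2⟩, n, hn⟩ := (TopologicalSpace.denseRange_denseSeq ℝ).inter_open_nonempty
        (Ioo x (min r y)) isOpen_Ioo (nonempty_Ioo.2 (lt_min hr hlt))
      refine (Summable.tsum_lt_tsum (fun n => hm n hxy) (i := n) ?_ (hs x) (hs y)).ne h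
      have hdn : d n = z := hn
      simp only [hdn]
      rw [runMax_eq_zero hz1.le, min_eq_right zero_le_one, mul_zero]
      refine mul_pos (by positivity) (lt_min one_pos ?_)
      refine lt_of_lt_of_le (dist_pos.2 ?_)
        (le_runMax hδ ⟨(hz2.trans_le (min_le_right _ _)).le, le_refl y⟩)
      exact (hr' z ⟨hz1.le, hz2.trans_le (min_le_left _ _)⟩).symm
    · intro h
      refine tsum_congr fun n => ?_
      rw [runMax_eq_of_const hδ hxy (hf x y hxy h)]
  intro x y
  rcases le_total x y with h | h
  · exact key x y h
  · rw [eq_comm, key y x h, eq_comm]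

/-- Two points joined by a path are joined by an injective path inside the given one. -/
theorem exists_arc (hγ : ContinuousOn γ (Icc 0 1)) (hne : γ 0 ≠ γ 1) :
    ∃ α : ℝ → Y, ContinuousOn α (Icc 0 1) ∧ InjOn α (Icc 0 1) ∧ α 0 = γ 0 ∧ α 1 = γ 1 ∧
      ∀ x ∈ Icc (0 : ℝ) 1, α x ∈ γ '' Icc 0 1 := by
  set p : ℝ → ℝ := fun x => projIcc (0 : ℝ) 1 zero_le_one x with hp
  have hpc : Continuous p := continuous_subtype_val.comp continuous_projIcc
  have hpm : Monotone p := fun x y h => monotone_projIcc _ h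
  have hpI : ∀ x, p x ∈ Icc (0 : ℝ) 1 := fun x => (projIcc (0 : ℝ) 1 zero_le_one x).2
  have hpe : ∀ x ∈ Icc (0 : ℝ) 1, p x = x := fun x hx => by simp [hp, projIcc_of_mem _ hx]
  have h01 : (0 : ℝ) ∈ Icc (0 : ℝ) 1 := by simp
  have h11 : (1 : ℝ) ∈ Icc (0 : ℝ) 1 := by simp
  obtain ⟨δ₀, hδc, hδ0, hδ1, hδi, hδf⟩ := exists_monotone_path (γ := γ ∘ p)
    (hγ.comp_continuous hpc hpI)
  set δ := δ₀ ∘ p with hδ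
  have hδc' : Continuous δ := hδc.comp_continuous hpc hpI
  obtain ⟨q, hqc, hqm, hq⟩ := exists_monotone_reparam hδc' fun x y hxy h z hz => by
    exact hδf _ (hpI x) _ (hpI y) (hpm hxy) h _ ⟨hpm hz.1, hpm hz.2⟩
  have e0 : δ 0 = γ 0 := by simp only [hδ, Function.comp_apply, hpe 0 h01, hδ0]
  have e1 : δ 1 = γ 1 := by simp only [hδ, Function.comp_apply, hpe 1 h11, hδ1]
  have hlt : q 0 < q 1 := lt_of_le_of_ne (hqm zero_le_one) fun h => hne <| by
    rw [← e0, ← e1]; exact (hq 0 1).1 h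
  have himg : q '' Icc 0 1 = Icc (q 0) (q 1) :=
    (hqm.monotoneOn _).image_Icc_subset.antisymm (intermediate_value_Icc zero_le_one hqc.continuousOn)
  set r := Function.invFunOn q (Icc 0 1) with hr
  have hr1 : ∀ y ∈ Icc (q 0) (q 1), r y ∈ Icc (0 : ℝ) 1 ∧ q (r y) = y := by
    intro y hy
    rw [← himg] at hy
    exact ⟨Function.invFunOn_mem hy, Function.invFunOn_eq hy⟩
  have hcont : ContinuousOn (fun y => δ (r y)) (Icc (q 0) (q 1)) := by
    rw [← himg]
    refine continuousOn_image_of_comp isCompact_Icc hqc.continuousOn (hδc'.continuousOn.congr ?_)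
    intro x hx
    exact (hq _ _).1 (hr1 _ (himg ▸ mem_image_of_mem q hx)).2
  set l : ℝ → ℝ := fun x => q 0 + x * (q 1 - q 0) with hl
  have hlm : ∀ x ∈ Icc (0 : ℝ) 1, l x ∈ Icc (q 0) (q 1) := by
    intro x hx
    constructor <;> simp only [hl] <;> nlinarith [hx.1, hx.2]
  refine ⟨fun x => δ (r (l x)), hcont.comp (by fun_prop) hlm, ?_, ?_, ?_, ?_⟩
  · intro x hx y hy hxy
    have := (hq _ _).2 hxy
    rw [(hr1 _ (hlm x hx)).2, (hr1 _ (hlm y hy)).2] at this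
    simp only [hl] at this
    have h2 : (x - y) * (q 1 - q 0) = 0 := by linarith
    rcases mul_eq_zero.1 h2 with h | h <;> linarith
  · rw [← e0]
    refine (hq _ _).1 ?_
    rw [(hr1 _ (hlm 0 h01)).2]
    simp [hl]
  · rw [← e1]
    refine (hq _ _).1 ?_
    rw [(hr1 _ (hlm 1 h11)).2]
    simp [hl]
  · intro x hx
    obtain ⟨t, ht, hte⟩ := hδi _ (hpI (r (l x)))
    refine ⟨t, ht, ?_⟩
    rw [← hpe t ht]
    exact hte

end Arc

instance homeomorphAction {X : Type*} [TopologicalSpace X] : MulAction (X ≃ₜ X) X where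
  smul h x := h x
  one_smul _ := rfl
  mul_smul _ _ _ := rfl

/-- A map into a compact space converges to `a` once its image under a continuous map isolating
`a` converges to the image of `a`. -/
theorem tendsto_of_tendsto_comp {X Y Q : Type*} [TopologicalSpace Y] [CompactSpace Y]
    [TopologicalSpace Q] [T2Space Q] {pr : Y → Q} (hpr : Continuous pr) {a : Y}
    (ha : ∀ z, pr z = pr a → z = a) {F : Filter X} {u : X → Y}
    (hu : Tendsto (fun x => pr (u x)) F (𝓝 (pr a))) : Tendsto u F (𝓝 a) := by
  rw [_root_.tendsto_nhds]
  intro U hU haU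
  have hc : IsClosed (pr '' Uᶜ) := (hU.isClosed_compl.isCompact.image hpr).isClosed
  have hmem : pr a ∈ (pr '' Uᶜ)ᶜ := by
    rintro ⟨z, hz, hza⟩
    exact hz (ha z hza ▸ haU)
  refine mem_of_superset (hu (hc.isOpen_compl.mem_nhds hmem)) fun x hx => ?_
  by_contra hxU
  exact hx ⟨u x, hxU, rfl⟩

/-- An arc between two global fixed points all of whose interior translates are disjoint. -/
theorem exists_transversal_arc {G : Subgroup (Sphere2 ≃ₜ Sphere2)} [Finite G] {a b : Sphere2}
    (hab : a ≠ b) (ha : ∀ h ∈ G, h a = a) (hb : ∀ h ∈ G, h b = b) {δ : ℝ → Sphere2}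
    (hδ : ContinuousOn δ (Icc 0 1)) (h0 : δ 0 = a) (h1 : δ 1 = b)
    (hfree : ∀ t ∈ Ioo (0 : ℝ) 1, ∀ h ∈ G, h (δ t) = δ t → h = 1) :
    ∃ β : ℝ → Sphere2, ContinuousOn β (Icc 0 1) ∧ β 0 = a ∧ β 1 = b ∧
      (∀ t ∈ Ioo (0 : ℝ) 1, ∃ s ∈ Ioo (0 : ℝ) 1, ∃ h ∈ G, β t = h (δ s)) ∧
      ∀ s ∈ Icc (0 : ℝ) 1, ∀ t ∈ Icc (0 : ℝ) 1, ∀ h ∈ G, h (β s) = β t → s = t := by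
  let := MulAction.orbitRel G Sphere2
  set pr : Sphere2 → Quotient (MulAction.orbitRel G Sphere2) := Quotient.mk _ with hpr
  have hprc : Continuous pr := continuous_quotient_mk'
  have hpre : ∀ x y, pr x = pr y ↔ ∃ h ∈ G, h y = x := by
    intro x y
    rw [hpr, Quotient.eq]
    change x ∈ MulAction.orbit G y ↔ _
    rw [MulAction.mem_orbit_iff]
    exact ⟨fun ⟨h, hh⟩ => ⟨h, h.2, hh⟩, fun ⟨h, hG, hh⟩ => ⟨⟨h, hG⟩, hh⟩⟩
  have : ContinuousConstSMul G Sphere2 := ⟨fun h => h.1.continuous⟩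
  have : SecondCountableTopology (Quotient (MulAction.orbitRel G Sphere2)) :=
    ContinuousConstSMul.secondCountableTopology
  let : MetricSpace (Quotient (MulAction.orbitRel G Sphere2)) :=
    TopologicalSpace.metrizableSpaceMetric _
  have haz : ∀ z, pr z = pr a → z = a := fun z hz => by
    obtain ⟨h, hG, e⟩ := (hpre _ _).1 hz
    rw [← e, ha h hG]
  have hbz : ∀ z, pr z = pr b → z = b := fun z hz => by
    obtain ⟨h, hG, e⟩ := (hpre _ _).1 hz
    rw [← e, hb h hG]
  obtain ⟨α, hαc, hαi, hα0, hα1, hαs⟩ := exists_arc (γ := pr ∘ δ) (hprc.comp_continuousOn hδ)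
    (by simpa [h0, h1] using fun h => hab (haz b h.symm).symm)
  simp only [Function.comp_apply, h0, h1] at hα0 hα1
  have hαs' : ∀ t ∈ Ioo (0 : ℝ) 1, ∃ s ∈ Ioo (0 : ℝ) 1, pr (δ s) = α t := by
    intro t ht
    obtain ⟨s, hs, hst⟩ := hαs t (Ioo_subset_Icc_self ht)
    refine ⟨s, ⟨lt_of_le_of_ne hs.1 ?_, lt_of_le_of_ne hs.2 ?_⟩, hst⟩
    · rintro rfl
      simp only [Function.comp_apply, h0, ← hα0] at hst
      exact ht.1.ne (hαi (by simp) (Ioo_subset_Icc_self ht) hst)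
    · rintro rfl
      simp only [Function.comp_apply, h1, ← hα1] at hst
      exact ht.2.ne' (hαi (by simp) (Ioo_subset_Icc_self ht) hst)
  have : ContractibleSpace (Ioo (0 : ℝ) 1) :=
    (convex_Ioo (0 : ℝ) 1).contractibleSpace (nonempty_Ioo.2 one_pos)
  have : LocallyPathConnectedSpace (Ioo (0 : ℝ) 1) := isOpen_Ioo.locallyPathConnectedSpace
  have hhalf : (1 / 2 : ℝ) ∈ Ioo (0 : ℝ) 1 := by norm_num
  obtain ⟨s₀, -, hs₀⟩ := hαs' _ hhalf
  obtain ⟨L, ⟨-, hL⟩, -⟩ :=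
    (isCoveringMapOn_quotientMk_of_properlyDiscontinuousSMul (G := G)
      (E := Sphere2)).existsUnique_continuousMap_lifts
      ⟨fun t : Ioo (0 : ℝ) 1 => α t, (hαc.mono Ioo_subset_Icc_self).domRestrict⟩
      (a₀ := ⟨_, hhalf⟩) (e₀ := δ s₀) hs₀ (by
        rintro ⟨t, ht⟩
        obtain ⟨s, hs, hst⟩ := hαs' t ht
        refine ⟨δ s, ?_, hst⟩
        rw [mem_ofPred_eq, eq_bot_iff]
        rintro ⟨h, hG⟩ hh
        rw [MulAction.mem_stabilizer_iff] at hh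
        rw [Subgroup.mem_bot, Subtype.ext_iff]
        exact hfree s hs h hG hh)
  have hL' : ∀ t : Ioo (0 : ℝ) 1, pr (L t) = α t := fun t => congrFun hL t
  classical
  set β : ℝ → Sphere2 := fun t => if h : t ∈ Ioo (0 : ℝ) 1 then L ⟨t, h⟩ else
    if t = 0 then a else b with hβ
  have hβ0 : β 0 = a := by simp [hβ]
  have hβ1 : β 1 = b := by simp [hβ]
  have hβI : ∀ t : Ioo (0 : ℝ) 1, β t = L t := fun t => by simp only [hβ]; rw [dif_pos t.2]
  have hprβ : ∀ t ∈ Icc (0 : ℝ) 1, pr (β t) = α t := by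
    intro t ht
    by_cases ht' : t ∈ Ioo (0 : ℝ) 1
    · rw [hβI ⟨t, ht'⟩, hL']
    rcases ht.1.eq_or_lt with rfl | h
    · rw [hβ0, hα0]
    rcases ht.2.eq_or_lt with rfl | h'
    · rw [hβ1, hα1]
    exact absurd ⟨h, h'⟩ ht'
  refine ⟨β, ?_, hβ0, hβ1, ?_, ?_⟩
  · intro t ht
    by_cases ht' : t ∈ Ioo (0 : ℝ) 1
    · refine ContinuousAt.continuousWithinAt ?_
      have : ContinuousOn β (Ioo 0 1) := by
        rw [continuousOn_iff_continuous_domRestrict]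
        exact L.continuous.congr fun t => (hβI t).symm
      exact this.continuousAt (isOpen_Ioo.mem_nhds ht')
    have hiso : ∀ z, pr z = pr (β t) → z = β t := by
      rcases ht.1.eq_or_lt with rfl | h
      · rwa [hβ0]
      rcases ht.2.eq_or_lt with rfl | h'
      · rwa [hβ1]
      exact absurd ⟨h, h'⟩ ht'
    refine tendsto_of_tendsto_comp hprc hiso ?_
    rw [hprβ t ht]
    exact (hαc t ht).congr' (eventually_mem_nhdsWithin.mono fun x hx => (hprβ x hx).symm)
  · intro t ht
    obtain ⟨s, hs, hst⟩ := hαs' t ht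
    obtain ⟨h, hG, e⟩ := (hpre (β t) (δ s)).1 (by rw [hprβ t (Ioo_subset_Icc_self ht), hst])
    exact ⟨s, hs, h, hG, e.symm⟩
  · intro s hs t ht h hG e
    refine hαi hs ht ?_
    rw [← hprβ s hs, ← hprβ t ht, eq_comm, hpre]
    exact ⟨h, hG, e⟩

/-- Translates of a fundamental piece under powers of `h` fit together continuously. -/
theorem continuous_floor_glue {T X : Type*} [TopologicalSpace T] [TopologicalSpace X]
    {σ : ℝ × T → X} (hσ : ContinuousOn σ (Icc 0 1 ×ˢ univ)) {h : X ≃ₜ X}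
    (hh : ∀ τ, σ (1, τ) = h (σ (0, τ))) :
    Continuous fun p : ℝ × T => (h ^ ⌊p.1⌋) (σ (Int.fract p.1, p.2)) := by
  have key : ∀ m : ℤ, ContinuousOn (fun p : ℝ × T => (h ^ ⌊p.1⌋) (σ (Int.fract p.1, p.2)))
      (Icc (m : ℝ) (m + 1) ×ˢ univ) := by
    intro m
    have h1 : ContinuousOn (fun p : ℝ × T => (h ^ m) (σ (p.1 - m, p.2)))
        (Icc (m : ℝ) (m + 1) ×ˢ univ) := by
      refine (h ^ m).continuous.comp_continuousOn (hσ.comp (by fun_prop) ?_)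
      rintro ⟨x, τ⟩ ⟨hx, -⟩
      exact ⟨⟨by simpa using hx.1, by simpa [add_comm] using hx.2⟩, mem_univ _⟩
    refine h1.congr ?_
    rintro ⟨x, τ⟩ ⟨hx, -⟩
    rcases hx.2.eq_or_lt with e | hlt
    · have e' : x = m + 1 := e
      have hf : ⌊x⌋ = m + 1 := by rw [e', Int.floor_intCast_add, Int.floor_one]
      have hfr : Int.fract x = 0 := by rw [Int.fract, hf, e']; push_cast; ring
      simp only [hf, hfr]
      rw [zpow_add_one, mul_apply, ← hh, e', add_sub_cancel_left]
    · have hf : ⌊x⌋ = m := Int.floor_eq_iff.2 ⟨hx.1, hlt⟩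
      simp only [Int.fract, hf]
  rw [continuous_iff_continuousAt]
  rintro ⟨x, τ⟩
  have hu := (key (⌊x⌋ - 1)).union_of_isClosed (key ⌊x⌋) (isClosed_Icc.prod isClosed_univ)
    (isClosed_Icc.prod isClosed_univ)
  refine hu.continuousAt ?_
  rw [← union_prod]
  refine prod_mem_nhds ?_ univ_mem
  push_cast
  rw [sub_add_cancel, Icc_union_Icc_eq_Icc (by linarith) (by linarith)]
  exact Icc_mem_nhds (by linarith [Int.floor_le x]) (Int.lt_floor_add_one x)

/-- The curve swept out by a fundamental piece is a Jordan curve. -/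
theorem isJordan_floor_glue {X : Type*} [TopologicalSpace X] {σ : ℝ → X}
    (hσ : ContinuousOn σ (Icc 0 1)) {h : X ≃ₜ X} (hh : σ 1 = h (σ 0)) (hN : 0 < orderOf h)
    (hinj : InjOn σ (Ico 0 1))
    (hdisj : ∀ k ∈ zpowers h, ∀ u ∈ Ico (0 : ℝ) 1, ∀ v ∈ Ico (0 : ℝ) 1,
      σ u = k (σ v) → k = 1) :
    ∃ c : ℝ → X, IsJordan c ∧ (∀ x, h (c x) = c (x + 1 / orderOf h)) ∧
      ∀ x, ∃ k ∈ zpowers h, ∃ u ∈ Ico (0 : ℝ) 1, c x = k (σ u) := by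
  set N := orderOf h with hNdef
  have hN' : (N : ℝ) ≠ 0 := by positivity
  have hfr : ∀ x : ℝ, Int.fract x ∈ Ico (0 : ℝ) 1 := fun x =>
    ⟨Int.fract_nonneg x, Int.fract_lt_one x⟩
  have hcont : Continuous fun x : ℝ => (h ^ ⌊x⌋) (σ (Int.fract x)) :=
    (continuous_floor_glue (T := Unit) (σ := fun p => σ p.1)
      (hσ.comp continuousOn_fst fun p hp => hp.1) fun _ => hh).comp
      (continuous_id.prodMk (continuous_const (y := ())))
  refine ⟨fun x => (h ^ ⌊N * x⌋) (σ (Int.fract (N * x))), ⟨?_, ?_, ?_⟩, ?_, ?_⟩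
  · exact hcont.comp (continuous_const.mul continuous_id)
  · intro x
    have e1 : (N : ℝ) * (x + 1) = N * x + (N : ℤ) := by push_cast; ring
    simp only [e1, Int.floor_add_intCast, Int.fract_add_intCast]
    rw [zpow_add, zpow_natCast, hNdef, pow_orderOf_eq_one, mul_one]
  · intro x hx y hy hxy
    simp only at hxy
    have e1 : σ (Int.fract (N * x)) =
        (h ^ (⌊(N : ℝ) * y⌋ - ⌊(N : ℝ) * x⌋)) (σ (Int.fract (N * y))) := by
      rw [sub_eq_neg_add, zpow_add, mul_apply, ← hxy, ← mul_apply,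
        ← zpow_add, neg_add_cancel, zpow_zero]
      rfl
    have e2 := hdisj _ (Subgroup.zpow_mem _ (Subgroup.mem_zpowers h) _) _ (hfr _) _ (hfr _) e1
    rw [e2] at e1
    have e3 : Int.fract ((N : ℝ) * x) = Int.fract (N * y) := hinj (hfr _) (hfr _) e1
    have e4 : (N : ℤ) ∣ ⌊(N : ℝ) * y⌋ - ⌊(N : ℝ) * x⌋ := orderOf_dvd_iff_zpow_eq_one.2 e2
    have hb : ∀ z ∈ Ico (0 : ℝ) 1, 0 ≤ ⌊(N : ℝ) * z⌋ ∧ ⌊(N : ℝ) * z⌋ < N := by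
      intro z hz
      refine ⟨Int.floor_nonneg.2 (mul_nonneg (by positivity) hz.1), Int.floor_lt.2 ?_⟩
      push_cast
      exact mul_lt_of_lt_one_right (by positivity) hz.2
    have e5 : ⌊(N : ℝ) * y⌋ - ⌊(N : ℝ) * x⌋ = 0 := by
      refine Int.eq_zero_of_abs_lt_dvd e4 ?_
      rw [abs_lt]
      constructor <;> linarith [hb x hx, hb y hy]
    have e6 : (N : ℝ) * x = N * y := by
      rw [← Int.floor_add_fract ((N : ℝ) * x), ← Int.floor_add_fract ((N : ℝ) * y), e3,
        sub_eq_zero.1 e5]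
    exact mul_left_cancel₀ hN' e6
  · intro x
    have e1 : (N : ℝ) * (x + 1 / N) = N * x + 1 := by field_simp
    simp only [e1, Int.floor_add_one, Int.fract_add_one]
    rw [add_comm, zpow_add, zpow_one, mul_apply]
  · intro x
    exact ⟨_, Subgroup.zpow_mem _ (Subgroup.mem_zpowers h) _, _, hfr _, rfl⟩

/-- A path from a point to a translate, through points with trivial stabiliser, produces an
invariant Jordan curve. -/
theorem exists_invariant_jordan {X : Type*} [MetricSpace X] {G : Subgroup (X ≃ₜ X)} [Finite G]
    {γ : ℝ → X} (hγ : ContinuousOn γ (Icc 0 1))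
    (hfree : ∀ t ∈ Icc (0 : ℝ) 1, ∀ k ∈ G, k (γ t) = γ t → k = 1) {h₀ : X ≃ₜ X} (hG : h₀ ∈ G)
    (hne : h₀ ≠ 1) (hend : γ 1 = h₀ (γ 0)) :
    ∃ h ∈ G, h ≠ 1 ∧ ∃ c : ℝ → X, IsJordan c ∧
      (∀ x, h (c x) = c (x + 1 / orderOf h)) ∧
      (∀ x, ∃ k ∈ G, ∃ t ∈ Icc (0 : ℝ) 1, c x = k (γ t)) ∧
      ∀ k ∈ G, ∀ x y, k (c x) = c y → k ∈ zpowers h := by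
  classical
  have h01 : γ 0 ≠ γ 1 := fun e => hne (hfree 0 (by simp) h₀ hG (by rw [← hend, ← e]))
  obtain ⟨α, hαc, hαi, hα0, hα1, hαs⟩ := exists_arc hγ h01
  have hαfree : ∀ t ∈ Icc (0 : ℝ) 1, ∀ k ∈ G, k (α t) = α t → k = 1 := by
    intro t ht k hk e
    obtain ⟨s, hs, hst⟩ := hαs t ht
    exact hfree s hs k hk (by rw [hst, e])
  set P : G → Set (ℝ × ℝ) := fun k => if k = 1 then ∅ else
    {p | p ∈ Icc (0 : ℝ) 1 ×ˢ Icc (0 : ℝ) 1 ∧ α p.2 = k.1 (α p.1)} with hP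
  have hPc : ∀ k, IsCompact (P k) := by
    intro k
    by_cases hk : k = 1
    · simp [hP, hk]
    simp only [hP, if_neg hk]
    have h1 : ContinuousOn (fun p : ℝ × ℝ => (α p.2, k.1 (α p.1)))
        (Icc (0 : ℝ) 1 ×ˢ Icc (0 : ℝ) 1) :=
      (hαc.comp continuousOn_snd fun p hp => hp.2).prodMk
        (k.1.continuous.comp_continuousOn (hαc.comp continuousOn_fst fun p hp => hp.1))
    exact (isCompact_Icc.prod isCompact_Icc).of_isClosed_subset
      (h1.preimage_isClosed_of_isClosed (isClosed_Icc.prod isClosed_Icc) isClosed_diagonal)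
      inter_subset_left
  have hPm : ∀ {s t : ℝ}, (s, t) ∈ ⋃ k, P k ↔
      s ∈ Icc (0 : ℝ) 1 ∧ t ∈ Icc (0 : ℝ) 1 ∧ ∃ k ∈ G, k ≠ 1 ∧ α t = k (α s) := by
    intro s t
    rw [mem_iUnion]
    constructor
    · rintro ⟨k, hk⟩
      by_cases hk1 : k = 1
      · simp [hP, hk1] at hk
      simp only [hP, if_neg hk1] at hk
      exact ⟨hk.1.1, hk.1.2, k.1, k.2, fun e => hk1 (Subtype.ext e), hk.2⟩
    · rintro ⟨hs, ht, k, hk, hk1, e⟩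
      refine ⟨⟨k, hk⟩, ?_⟩
      simp only [hP, if_neg (show (⟨k, hk⟩ : G) ≠ 1 from fun e => hk1 (congrArg Subtype.val e))]
      exact ⟨⟨hs, ht⟩, e⟩
  have hsymm : ∀ {s t : ℝ}, (s, t) ∈ ⋃ k, P k → (t, s) ∈ ⋃ k, P k := by
    intro s t hst
    rw [hPm] at hst ⊢
    obtain ⟨hs, ht, k, hk, hk1, e⟩ := hst
    exact ⟨ht, hs, k⁻¹, G.inv_mem hk, inv_ne_one.2 hk1, by
      rw [e, ← mul_apply, inv_mul_cancel]; rfl⟩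
  obtain ⟨⟨s, t⟩, hst, hmin⟩ := (isCompact_iUnion hPc).exists_isMinOn
    (f := fun p : ℝ × ℝ => |p.2 - p.1|) ⟨(0, 1), hPm.2 ⟨by simp, by simp, h₀, hG, hne, by
      rw [hα0, hα1, hend]⟩⟩ (by fun_prop)
  have hmin' : ∀ {u v : ℝ}, (u, v) ∈ ⋃ k, P k → |t - s| ≤ |v - u| := fun h => hmin h
  wlog hlt : s < t generalizing s t
  · refine this t s (hsymm hst) (fun p hp => ?_) (fun h => ?_) ?_
    · simpa [abs_sub_comm s t] using hmin hp
    · rw [abs_sub_comm s t]; exact hmin' h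
    · refine lt_of_le_of_ne (not_lt.1 hlt) ?_
      rintro rfl
      obtain ⟨hs, ht, k, hk, hk1, e⟩ := hPm.1 hst
      exact hk1 (hαfree _ hs k hk e.symm)
  obtain ⟨hs, ht, h, hhG, hh1, hhe⟩ := hPm.1 hst
  set l : ℝ → ℝ := fun x => s + x * (t - s) with hl
  have hlI : ∀ x ∈ Icc (0 : ℝ) 1, l x ∈ Icc (0 : ℝ) 1 := by
    intro x hx
    constructor <;> simp only [hl] <;> nlinarith [hx.1, hx.2, hs.1, ht.2]
  have hfin : 0 < orderOf h := by
    have : 0 < orderOf (⟨h, hhG⟩ : G) := orderOf_pos _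
    rwa [Subgroup.orderOf_mk] at this
  have hkey : ∀ k ∈ G, ∀ u ∈ Ico (0 : ℝ) 1, ∀ v ∈ Ico (0 : ℝ) 1, α (l u) = k (α (l v)) →
      k = 1 := by
    intro k hk u hu v hv e
    by_contra hk1
    have := hmin' (hPm.2 ⟨hlI v ⟨hv.1, hv.2.le⟩, hlI u ⟨hu.1, hu.2.le⟩, k, hk, hk1, e⟩)
    have e1 : l u - l v = (u - v) * (t - s) := by simp only [hl]; ring
    rw [e1, abs_mul] at this
    have h2 : |u - v| < 1 := by rw [abs_lt]; constructor <;> linarith [hu.1, hu.2, hv.1, hv.2]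
    have h3 : 0 < |t - s| := abs_pos.2 (by linarith)
    nlinarith
  have hzG : ∀ k ∈ zpowers h, k ∈ G := fun k hk =>
    (Subgroup.zpowers_le.2 hhG) hk
  obtain ⟨c, hc, hc1, hc2⟩ := isJordan_floor_glue (σ := fun x => α (l x)) (h := h)
    (hαc.comp (by fun_prop) hlI) (by simp [hl, hhe]) hfin (by
      intro u hu v hv e
      have := hαi (hlI u ⟨hu.1, hu.2.le⟩) (hlI v ⟨hv.1, hv.2.le⟩) e
      simp only [hl] at this
      have h2 : (u - v) * (t - s) = 0 := by linarith
      rcases mul_eq_zero.1 h2 with h | h <;> linarith)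
    (fun k hk => hkey k (hzG k hk))
  refine ⟨h, hhG, hh1, c, hc, hc1, fun x => ?_, fun k hk x y e => ?_⟩
  · obtain ⟨k, hk, u, hu, e⟩ := hc2 x
    obtain ⟨v, hv, hvu⟩ := hαs _ (hlI u ⟨hu.1, hu.2.le⟩)
    exact ⟨k, hzG k hk, v, hv, by rw [e, hvu]⟩
  · obtain ⟨k₁, hk₁, u, hu, e1⟩ := hc2 x
    obtain ⟨k₂, hk₂, v, hv, e2⟩ := hc2 y
    rw [e1, e2] at e
    have e3 : k₂⁻¹ * k * k₁ = 1 := by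
      refine hkey _ (G.mul_mem (G.mul_mem (G.inv_mem (hzG _ hk₂)) hk) (hzG _ hk₁)) v hv u hu ?_
      rw [mul_apply, mul_apply, e, ← mul_apply, inv_mul_cancel]
      rfl
    have e4 : k = k₂ * k₁⁻¹ := by
      rw [mul_eq_one_iff_eq_inv] at e3
      rw [← e3, mul_inv_cancel_left]
    rw [e4]
    exact Subgroup.mul_mem _ hk₂ (Subgroup.inv_mem _ hk₁)

lemma exists_path_of_isOpen {U : Set Sphere2} (hU : IsOpen U) (hUc : IsPreconnected U)
    {a b : Sphere2} (ha : a ∈ U) (hb : b ∈ U) :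
    ∃ γ : ℝ → Sphere2, Continuous γ ∧ γ 0 = a ∧ γ 1 = b ∧ ∀ t, γ t ∈ U := by
  obtain ⟨γ, hγ⟩ := ((hU.isConnected_iff_isPathConnected).1 ⟨⟨a, ha⟩, hUc⟩).joinedIn a ha b hb
  refine ⟨γ.extend, γ.continuous_extend, by simp, by simp, fun t => ?_⟩
  exact hγ _

lemma isPreconnected_compl_singleton (a : Sphere2) : IsPreconnected ({a}ᶜ : Set Sphere2) := by
  have := isPreconnected_compl_arc (c := fun _ => a) (s := 0) (t := 0) le_rfl
    continuousOn_const (by simp)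
  simpa using this

namespace IsJordan

variable {c : ℝ → Sphere2} {a b : Sphere2}

lemma exists_notMem_range (hc : IsJordan c) : ∃ a, a ∉ range c := by
  by_contra! h
  refine hc.not_isPreconnected_compl ?_
  rw [eq_univ_of_forall h, compl_univ]
  exact isPreconnected_empty

lemma exists_notMem_side (hc : IsJordan c) (ha : a ∉ range c) :
    ∃ b, b ∉ range c ∧ b ∉ side c a := by
  obtain ⟨b, hb⟩ := hc.exists_notMem_closure_side ha
  rw [hc.closure_side ha] at hb
  exact ⟨b, fun h => hb (Or.inr h), fun h => hb (Or.inl h)⟩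

end IsJordan

lemma mem_side_self {c : ℝ → Sphere2} {a : Sphere2} (ha : a ∉ range c) : a ∈ side c a :=
  mem_connectedComponentIn ha

lemma side_subset (c : ℝ → Sphere2) (a : Sphere2) : side c a ⊆ (range c)ᶜ :=
  connectedComponentIn_subset _ _

lemma side_eq {c : ℝ → Sphere2} {a b : Sphere2} (h : b ∈ side c a) : side c a = side c b :=
  connectedComponentIn_eq h

lemma isPreconnected_side {c : ℝ → Sphere2} {a : Sphere2} : IsPreconnected (side c a) :=
  isPreconnected_connectedComponentIn

lemma subset_side {c : ℝ → Sphere2} {a : Sphere2} {K : Set Sphere2} (hK : IsPreconnected K)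
    (ha : a ∈ K) (hd : ∀ x ∈ K, x ∉ range c) : K ⊆ side c a :=
  hK.subset_connectedComponentIn ha hd

lemma image_side {c : ℝ → Sphere2} {a : Sphere2} {h : Sphere2 ≃ₜ Sphere2}
    (hinv : h '' range c = range c) (ha : a ∉ range c) : h '' side c a = side c (h a) := by
  rw [side, h.image_connectedComponentIn ha, image_compl_eq h.bijective, hinv, side]

lemma notMem_range_of_invariant {c : ℝ → Sphere2} {a : Sphere2} {h : Sphere2 ≃ₜ Sphere2}
    (hinv : h '' range c = range c) (ha : a ∉ range c) : h a ∉ range c := by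
  rw [← hinv]
  rintro ⟨b, hb, e⟩
  exact ha (h.injective e ▸ hb)

lemma IsJordan.exists_fixed_of_image_side (c : ℝ → Sphere2) (hc : IsJordan c) {a : Sphere2}
    (ha : a ∉ range c) {h : Sphere2 ≃ₜ Sphere2} (hs : h '' side c a = side c a) :
    ∃ z ∈ side c a ∪ range c, h z = z := by
  rw [← hc.closure_side ha]
  refine hc.exists_fixed_side ha h.continuous ?_
  rw [mapsTo_iff_image_subset, h.image_closure, hs]

lemma image_range_of_shift {c : ℝ → Sphere2} {h : Sphere2 ≃ₜ Sphere2} {r : ℝ}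
    (hs : ∀ x, h (c x) = c (x + r)) : h '' range c = range c := by
  ext y
  constructor
  · rintro ⟨_, ⟨x, rfl⟩, rfl⟩
    exact ⟨x + r, (hs x).symm⟩
  · rintro ⟨x, rfl⟩
    exact ⟨c (x - r), ⟨_, rfl⟩, by rw [hs, sub_add_cancel]⟩

lemma fixed_of_pow_fixed {p : ℕ} (hp : p.Prime) {g : Sphere2 ≃ₜ Sphere2} (hg : orderOf g = p)
    {k : Sphere2 ≃ₜ Sphere2} (hk : k ∈ zpowers g) (hk1 : k ≠ 1) {x : Sphere2}
    (hx : k x = x) : g x = x := by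
  have hle : zpowers k ≤ zpowers g := Subgroup.zpowers_le.2 hk
  have hgk : g ∈ zpowers k := by
    have hfin : Nat.card (zpowers g) = p := by rw [Nat.card_zpowers, hg]
    have : Finite (zpowers g) := Nat.finite_of_card_ne_zero (hfin ▸ hp.ne_zero)
    have hdvd := Subgroup.card_dvd_of_le hle
    rw [Nat.card_zpowers, hfin] at hdvd
    rcases (Nat.dvd_prime hp).1 hdvd with h | h
    · exact absurd (orderOf_eq_one_iff.1 h) hk1
    · have := Subgroup.eq_of_le_of_card_ge hle (by rw [hfin, Nat.card_zpowers, h])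
      rw [this]
      exact Subgroup.mem_zpowers g
  have hst : zpowers k ≤ MulAction.stabilizer (Sphere2 ≃ₜ Sphere2) x :=
    Subgroup.zpowers_le.2 hx
  exact hst hgk

lemma finite_zpowers {g : Sphere2 ≃ₜ Sphere2} (hg : 0 < orderOf g) :
    Finite (zpowers g) :=
  Nat.finite_of_card_ne_zero (by rw [Nat.card_zpowers]; exact hg.ne')

lemma image_eq_of_mem_zpowers {g k : Sphere2 ≃ₜ Sphere2} (hk : k ∈ zpowers g)
    {V : Set Sphere2} (hV : g '' V = V) : k '' V = V := by
  have hst : zpowers g ≤ MulAction.stabilizer (Sphere2 ≃ₜ Sphere2) V :=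
    Subgroup.zpowers_le.2 hV
  exact hst hk

/-- A map of prime order has a fixed point in every invariant region with connected complement. -/
theorem exists_fixed_of_invariant {p : ℕ} (hp : p.Prime) {g : Sphere2 ≃ₜ Sphere2}
    (hg : orderOf g = p) {V : Set Sphere2} (hV : IsOpen V) (hVc : IsPreconnected V)
    (hV' : IsPreconnected Vᶜ) (hne : V.Nonempty) (hne' : (Vᶜ).Nonempty) (hgV : g '' V = V) :
    ∃ z ∈ V, g z = z := by
  by_contra! hno
  obtain ⟨y, hy⟩ := hne
  obtain ⟨x, hx⟩ := hne'
  have hmem : ∀ k ∈ zpowers g, ∀ z, k z ∈ V ↔ z ∈ V := fun k hk z => by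
    conv_lhs => rw [← image_eq_of_mem_zpowers hk hgV]
    exact k.injective.mem_set_image
  have hfr : ∀ z ∈ V, ∀ k ∈ zpowers g, k z = z → k = 1 := by
    intro z hz k hk e
    by_contra hk1
    exact hno z hz (fixed_of_pow_fixed hp hg hk hk1 e)
  obtain ⟨γ, hγ, hγ0, hγ1, hγV⟩ := exists_path_of_isOpen hV hVc hy
    ((hmem g (Subgroup.mem_zpowers g) y).2 hy)
  have := finite_zpowers (g := g) (hg ▸ hp.pos)
  obtain ⟨h, hh, hh1, c, hc, hcs, hcγ, -⟩ := exists_invariant_jordan (G := zpowers g)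
    hγ.continuousOn (fun t _ => hfr _ (hγV t)) (Subgroup.mem_zpowers g)
    (fun e => hp.one_lt.ne' (by rw [← hg, e, orderOf_one])) (by rw [hγ0, hγ1])
  have hcV : range c ⊆ V := by
    rintro _ ⟨s, rfl⟩
    obtain ⟨k, hk, t, -, e⟩ := hcγ s
    rw [e, hmem k hk]
    exact hγV t
  have hVd : ∀ z ∈ Vᶜ, z ∉ range c := fun z hz h => hz (hcV h)
  have hxc := hVd x hx
  have hinv := image_range_of_shift hcs
  have hV1 : Vᶜ ⊆ side c x := subset_side hV' hx hVd
  have hhx : h x ∈ side c x := hV1 fun h' => hx ((hmem h hh x).1 h')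
  have hU : h '' side c x = side c x := by rw [image_side hinv hxc, ← side_eq hhx]
  obtain ⟨b, hb, hbx⟩ := hc.exists_notMem_side hxc
  have hW : h '' side c b = side c b := by
    rw [← hc.compl_closure_side hxc hb hbx, image_compl_eq h.bijective, h.image_closure, hU]
  obtain ⟨z, hz, hzf⟩ := hc.exists_fixed_of_image_side c hb hW
  have hzV : z ∈ V := by
    rcases hz with hz | hz
    · by_contra hzV
      refine hbx ?_
      rw [side_eq (hV1 hzV), ← side_eq hz]
      exact mem_side_self hb
    · exact hcV hz
  exact hh1 (hfr z hzV h hh hzf)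

lemma exists_second_fixed {p : ℕ} (hp : p.Prime) {g : Sphere2 ≃ₜ Sphere2}
    (hg : orderOf g = p) {x : Sphere2} (hx : g x = x) : ∃ y, y ≠ x ∧ g y = y := by
  obtain ⟨y, hy, h⟩ := exists_fixed_of_invariant hp hg (V := {x}ᶜ) isOpen_compl_singleton
    (isPreconnected_compl_singleton x) (by simpa using isPreconnected_singleton)
    ⟨sti x 0, sti_ne x 0⟩ (by simp) (by
      rw [image_compl_eq g.bijective, image_singleton, hx])
  exact ⟨y, hy, h⟩

/-- A nontrivial free cyclic action has order two and preserves a Jordan curve, whose sides it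
exchanges. -/
theorem exists_antipodal_jordan {f : Sphere2 ≃ₜ Sphere2} (hf : 0 < orderOf f) (hf1 : f ≠ 1)
    (hfree : ∀ k ∈ zpowers f, k ≠ 1 → ∀ x, k x ≠ x) :
    f * f = 1 ∧ ∃ c : ℝ → Sphere2, IsJordan c ∧ (∀ x, f (c x) = c (x + 1 / 2)) ∧
      ∀ a, a ∉ range c → f a ∉ side c a := by
  obtain ⟨y⟩ : Nonempty Sphere2 := inferInstance
  have hff := Subgroup.mem_zpowers f
  have := finite_zpowers hf
  obtain ⟨γ, hγ, hγ0, hγ1, -⟩ := exists_path_of_isOpen isOpen_univ isPreconnected_univ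
    (mem_univ y) (mem_univ (f y))
  obtain ⟨h, hh, hh1, c, hc, hcs, -, hcd⟩ := exists_invariant_jordan (G := zpowers f)
    hγ.continuousOn (fun t _ k hk e => by
      by_contra hk1
      exact hfree k hk hk1 _ e) hff hf1 (by rw [hγ0, hγ1])
  have hinv := image_range_of_shift hcs
  have hswap : ∀ k ∈ zpowers f, k ≠ 1 → k '' range c = range c →
      ∀ a, a ∉ range c → k a ∉ side c a := by
    intro k hk hk1 hkc a ha hka
    obtain ⟨z, -, hz⟩ := hc.exists_fixed_of_image_side c ha (h := k)
      (by rw [image_side hkc ha, ← side_eq hka])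
    exact hfree k hk hk1 z hz
  obtain ⟨a, ha⟩ := hc.exists_notMem_range
  have hha := notMem_range_of_invariant hinv ha
  have hhh : h * h = 1 := by
    by_contra hne
    refine hswap (h * h) (Subgroup.mul_mem _ hh hh) hne ?_ a ha ?_
    · change (h ∘ h) '' _ = _
      rw [image_comp, hinv, hinv]
    · have h1 := hswap h hh hh1 hinv a ha
      have h2 := hswap h hh hh1 hinv (h a) hha
      by_contra h3
      exact h2 (hc.side_eq_of_notMem ha hha h1 (notMem_range_of_invariant hinv hha) h3)
  have hzp : ∀ k ∈ zpowers h, k = 1 ∨ k = h := by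
    rintro _ ⟨i, rfl⟩
    rcases Int.even_or_odd' i with ⟨j, rfl | rfl⟩
    · left
      beta_reduce
      rw [zpow_mul, zpow_two, hhh, one_zpow]
    · right
      beta_reduce
      rw [zpow_add, zpow_mul, zpow_two, hhh, one_zpow, one_mul, zpow_one]
  have hcomm : f * h = h * f := by
    obtain ⟨i, rfl⟩ := hh
    exact (Commute.self_zpow f i).eq
  have hfh : f = h := by
    by_contra hne
    have hdis : ∀ x ∈ f '' range c, x ∉ range c := by
      rintro _ ⟨_, ⟨s, rfl⟩, rfl⟩ ⟨t, e⟩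
      exact (hzp f (hcd f hff s t e.symm)).elim hf1 hne
    have hK : IsPreconnected (f '' range c) :=
      hc.isPreconnected_range.image f f.continuous.continuousOn
    have hm : f (c 0) ∈ f '' range c := mem_image_of_mem _ (mem_range_self _)
    have hm2 : h (f (c 0)) ∈ f '' range c := by
      refine ⟨h (c 0), by rw [hcs]; exact mem_range_self _, ?_⟩
      rw [← mul_apply, hcomm, mul_apply]
    exact hswap h hh hh1 hinv _ (hdis _ hm) (subset_side hK hm hdis hm2)
  subst hfh
  refine ⟨hhh, c, hc, ?_, hswap f hff hf1 hinv⟩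
  have ho : orderOf f = 2 := orderOf_eq_prime (by rw [pow_two, hhh]) hf1
  intro x
  rw [hcs, ho]
  norm_num

/-- An injective path from `a` to `b`, parametrized by the unit interval. -/
structure IsArc (α : ℝ → Sphere2) (a b : Sphere2) : Prop where
  cont : ContinuousOn α (Icc 0 1)
  inj : InjOn α (Icc 0 1)
  zero : α 0 = a
  one : α 1 = b

/-- Two arcs with common end points and no other common points. -/
def ArcDisj (α β : ℝ → Sphere2) : Prop :=
  ∀ s ∈ Icc (0 : ℝ) 1, ∀ t ∈ Icc (0 : ℝ) 1, α s = β t → s = t ∧ (s = 0 ∨ s = 1)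

lemma ArcDisj.symm {α β : ℝ → Sphere2} (h : ArcDisj α β) : ArcDisj β α := fun s hs t ht e => by
  obtain ⟨h1, h2⟩ := h t ht s hs e.symm
  exact ⟨h1.symm, h1 ▸ h2⟩

/-- The closed curve following `α` and then `β` backwards. -/
noncomputable def loop (α β : ℝ → Sphere2) (x : ℝ) : Sphere2 :=
  if Int.fract x ≤ 1 / 2 then α (2 * Int.fract x) else β (2 - 2 * Int.fract x)

variable {α β α₀ α₁ α₂ : ℝ → Sphere2} {a b e : Sphere2}

lemma IsArc.map (h : IsArc α a b) (f : Sphere2 ≃ₜ Sphere2) : IsArc (f ∘ α) (f a) (f b) :=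
  ⟨f.continuous.comp_continuousOn h.cont, f.injective.comp_injOn h.inj, congrArg f h.zero,
    congrArg f h.one⟩

lemma half_mem_Icc : (1 / 2 : ℝ) ∈ Icc (0 : ℝ) 1 := by norm_num

lemma IsArc.isClosed (h : IsArc α a b) : IsClosed (α '' Icc 0 1) :=
  (isCompact_Icc.image_of_continuousOn h.cont).isClosed

lemma IsArc.image_subset (h : IsArc α a b) :
    α '' Icc 0 1 ⊆ α '' Ioo 0 1 ∪ {a, b} := by
  rintro _ ⟨t, ht, rfl⟩
  rcases ht.1.eq_or_lt with h0 | h0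
  · exact Or.inr (Or.inl (by rw [← h0, h.zero]))
  rcases ht.2.eq_or_lt with h1 | h1
  · exact Or.inr (Or.inr (by rw [h1, h.one]; rfl))
  exact Or.inl ⟨t, ⟨h0, h1⟩, rfl⟩

lemma IsArc.left_mem (h : IsArc α a b) : a ∈ α '' Icc 0 1 :=
  ⟨0, left_mem_Icc.2 zero_le_one, h.zero⟩

lemma IsArc.right_mem (h : IsArc α a b) : b ∈ α '' Icc 0 1 :=
  ⟨1, right_mem_Icc.2 zero_le_one, h.one⟩

lemma ArcDisj.notMem (h : ArcDisj α β) {t : ℝ} (ht : t ∈ Ioo (0 : ℝ) 1) :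
    α t ∉ β '' Icc 0 1 := by
  rintro ⟨s, hs, e⟩
  rcases (h t (Ioo_subset_Icc_self ht) s hs e.symm).2 with h | h
  · exact ht.1.ne' h
  · exact ht.2.ne h

lemma isJordan_loop (hα : IsArc α a b) (hβ : IsArc β a b) (hd : ArcDisj α β) :
    IsJordan (loop α β) := by
  refine ⟨?_, ?_, ?_⟩
  · have : ContinuousOn (fun u : ℝ => if u ≤ 1 / 2 then α (2 * u) else β (2 - 2 * u))
        (Icc 0 1) := by
      rw [show Icc (0 : ℝ) 1 = Icc 0 (1 / 2) ∪ Icc (1 / 2) 1 from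
        (Icc_union_Icc_eq_Icc (by norm_num) (by norm_num)).symm]
      refine ContinuousOn.union_of_isClosed ?_ ?_ isClosed_Icc isClosed_Icc
      · refine (hα.cont.comp (f := fun u : ℝ => 2 * u) (by fun_prop) ?_).congr fun u hu => ?_
        · intro u hu
          exact ⟨by linarith [hu.1], by linarith [hu.2]⟩
        · simp only [if_pos hu.2, Function.comp]
      · refine (hβ.cont.comp (f := fun u : ℝ => 2 - 2 * u) (by fun_prop) ?_).congr fun u hu => ?_
        · intro u hu
          exact ⟨by linarith [hu.2], by linarith [hu.1]⟩
        · rcases hu.1.eq_or_lt with h | h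
          · subst h
            norm_num [hα.one, hβ.one]
          · simp only [if_neg h.not_ge, Function.comp]
    exact this.comp_fract'' (by norm_num [hα.zero, hβ.zero])
  · intro x
    simp only [loop, Int.fract_add_one]
  · intro x hx y hy h
    simp only [loop, Int.fract_eq_self.2 hx, Int.fract_eq_self.2 hy] at h
    have hx0 := hx.1
    have hy0 := hy.1
    have hx1 := hx.2
    have hy1 := hy.2
    split_ifs at h with h1 h2 h2
    · have := hα.inj ⟨by linarith, by linarith⟩ ⟨by linarith, by linarith⟩ h
      linarith
    · push Not at h2
      obtain ⟨h3, h4 | h4⟩ := hd _ ⟨by linarith, by linarith⟩ _ ⟨by linarith, by linarith⟩ h <;>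
        linarith
    · push Not at h1
      obtain ⟨h3, h4 | h4⟩ := hd _ ⟨by linarith, by linarith⟩ _ ⟨by linarith, by linarith⟩ h.symm
        <;> linarith
    · push Not at h1 h2
      have := hβ.inj ⟨by linarith, by linarith⟩ ⟨by linarith, by linarith⟩ h
      linarith

lemma range_loop (hα : IsArc α a b) (hβ : IsArc β a b) :
    range (loop α β) = α '' Icc 0 1 ∪ β '' Icc 0 1 := by
  apply Subset.antisymm
  · rintro _ ⟨x, rfl⟩
    have h0 := Int.fract_nonneg x
    have h1 := (Int.fract_lt_one x).le
    rw [loop]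
    split_ifs with h
    · exact Or.inl ⟨_, ⟨by linarith, by linarith⟩, rfl⟩
    · push Not at h
      exact Or.inr ⟨_, ⟨by linarith, by linarith⟩, rfl⟩
  · rintro _ (⟨t, ht, rfl⟩ | ⟨t, ht, rfl⟩)
    · refine ⟨t / 2, ?_⟩
      have : Int.fract (t / 2) = t / 2 :=
        Int.fract_eq_self.2 ⟨by linarith [ht.1], by linarith [ht.2]⟩
      rw [loop, this, if_pos (by linarith [ht.2])]
      congr 1
      ring
    · rcases ht.2.eq_or_lt with rfl | h1
      · refine ⟨1 / 2, ?_⟩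
        have : Int.fract (1 / 2 : ℝ) = 1 / 2 := Int.fract_eq_self.2 (by norm_num)
        rw [loop, this, if_pos le_rfl, hβ.one, ← hα.one]
        norm_num
      rcases ht.1.eq_or_lt with rfl | h0
      · refine ⟨0, ?_⟩
        rw [loop, Int.fract_zero, if_pos (by norm_num), hβ.zero, ← hα.zero, mul_zero]
      · refine ⟨1 - t / 2, ?_⟩
        have : Int.fract (1 - t / 2) = 1 - t / 2 :=
          Int.fract_eq_self.2 ⟨by linarith, by linarith⟩
        rw [loop, this, if_neg (by linarith)]
        congr 1
        ring

lemma side_loop (hα : IsArc α a b) (hβ : IsArc β a b) (x : Sphere2) :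
    side (loop α β) x = connectedComponentIn (α '' Icc 0 1 ∪ β '' Icc 0 1)ᶜ x := by
  rw [side, range_loop hα hβ]

/-- A complementary point of a theta curve not on the far side of one of its circles lies on the
far side of the adjacent circles. -/
theorem conn_of_theta (h₀ : IsArc α₀ a b) (h₁ : IsArc α₁ a b) (h₂ : IsArc α₂ a b)
    (d₀₁ : ArcDisj α₀ α₁) (d₁₂ : ArcDisj α₁ α₂) (d₀₂ : ArcDisj α₀ α₂)
    (he : e ∉ α₀ '' Icc 0 1 ∪ α₁ '' Icc 0 1) {t : ℝ} (ht : t ∈ Ioo (0 : ℝ) 1)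
    (hn : ¬ Conn (α₀ '' Icc 0 1 ∪ α₁ '' Icc 0 1)ᶜ e (α₂ t)) {s : ℝ} (hs : s ∈ Ioo (0 : ℝ) 1) :
    Conn (α₁ '' Icc 0 1 ∪ α₂ '' Icc 0 1)ᶜ e (α₀ s) := by
  have hJ := isJordan_loop h₀ h₁ d₀₁
  have hr := range_loop h₀ h₁
  rw [← hr] at he hn
  have h2 : α₂ '' Ioo 0 1 ⊆ side (loop α₀ α₁) (α₂ t) := by
    refine subset_side ((isPreconnected_Ioo).image _ (h₂.cont.mono Ioo_subset_Icc_self))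
      (mem_image_of_mem _ ht) ?_
    rintro _ ⟨u, hu, rfl⟩
    rw [hr]
    exact fun h => h.elim (d₀₂.symm.notMem hu) (d₁₂.symm.notMem hu)
  have ht2 : α₂ t ∉ range (loop α₀ α₁) := side_subset _ _ (h2 (mem_image_of_mem _ ht))
  rw [conn_iff_mem_connectedComponentIn he] at hn
  have hm : α₀ s ∈ closure (side (loop α₀ α₁) e) := by
    rw [hJ.closure_side he, hr]
    exact Or.inr (Or.inl (mem_image_of_mem _ (Ioo_subset_Icc_self hs)))
  refine ⟨insert (α₀ s) (side (loop α₀ α₁) e), ?_, ?_, Or.inr (mem_side_self he), Or.inl rfl⟩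
  · rintro _ (rfl | hx)
    · exact fun h => h.elim (d₀₁.notMem hs) (d₀₂.notMem hs)
    · rintro (h | h)
      · refine side_subset _ _ hx ?_
        rw [hr]
        exact Or.inr h
      · rcases h₂.image_subset h with h | h
        · refine hn ?_
          change _ ∈ side _ _
          rw [side_eq hx, ← side_eq (h2 h)]
          exact mem_side_self ht2
        · refine side_subset _ _ hx ?_
          rw [hr]
          rcases h with rfl | rfl
          · exact Or.inl h₀.left_mem
          · exact Or.inl h₀.right_mem
  · exact isPreconnected_side.subset_closure (subset_insert _ _)
      (insert_subset hm subset_closure)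

/-- No point is on the far side of all three circles of a theta curve. -/
theorem not_conn_theta (h₀ : IsArc α₀ a b) (h₁ : IsArc α₁ a b) (h₂ : IsArc α₂ a b)
    (d₀₁ : ArcDisj α₀ α₁) (d₁₂ : ArcDisj α₁ α₂) (d₀₂ : ArcDisj α₀ α₂)
    {s t u : ℝ} (hs : s ∈ Ioo (0 : ℝ) 1) (ht : t ∈ Ioo (0 : ℝ) 1) (hu : u ∈ Ioo (0 : ℝ) 1)
    (e₂ : Conn (α₀ '' Icc 0 1 ∪ α₁ '' Icc 0 1)ᶜ e (α₂ u))
    (e₀ : Conn (α₁ '' Icc 0 1 ∪ α₂ '' Icc 0 1)ᶜ e (α₀ s))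
    (e₁ : Conn (α₀ '' Icc 0 1 ∪ α₂ '' Icc 0 1)ᶜ e (α₁ t)) : False := by
  have hJ := isJordan_loop h₀ h₂ d₀₂
  have hr := range_loop h₀ h₂
  obtain ⟨v, hv, hvs⟩ := hJ.exists_notMem_side (a := α₁ t) (by rw [hr]; exact e₁.right_mem)
  rw [hr] at hv
  have hvs' : ¬ Conn (α₀ '' Icc 0 1 ∪ α₂ '' Icc 0 1)ᶜ v (α₁ t) := fun h => hvs (by
    rw [side_loop h₀ h₂]
    exact (conn_iff_mem_connectedComponentIn e₁.right_mem).1 h.symm)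
  have v0 := conn_of_theta h₀ h₂ h₁ d₀₂ d₁₂.symm d₀₁ hv ht hvs' hs
  have v2 := conn_of_theta h₂ h₀ h₁ d₀₂.symm d₀₁ d₁₂.symm (by rwa [union_comm]) ht
    (by rwa [union_comm]) hu
  rw [union_comm] at v0
  have hint : (α₀ '' Icc 0 1 ∪ α₁ '' Icc 0 1) ∩ (α₁ '' Icc 0 1 ∪ α₂ '' Icc 0 1)
      = α₁ '' Icc 0 1 := by
    apply Subset.antisymm
    · rintro x ⟨h | h, h' | h'⟩
      · exact h'
      · rcases h₀.image_subset h with ⟨r, hr, rfl⟩ | rfl | rfl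
        · exact absurd h' (d₀₂.notMem hr)
        · exact h₁.left_mem
        · exact h₁.right_mem
      · exact h
      · exact h
    · exact fun x h => ⟨Or.inr h, Or.inl h⟩
  have := conn_compl_union (h₀.isClosed.union h₁.isClosed) (h₁.isClosed.union h₂.isClosed)
    (by rw [hint]; exact isPreconnected_Icc.image _ h₁.cont) (e₂.trans v2.symm)
    (e₀.trans v0.symm)
  refine hvs' ((this.mono ?_).symm.trans e₁)
  exact compl_subset_compl.2 (union_subset_union subset_union_left subset_union_right)

lemma exists_concat {X : Type*} [TopologicalSpace X] {δ ε : ℝ → X}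
    (hδ : ContinuousOn δ (Icc 0 1)) (hε : ContinuousOn ε (Icc 0 1)) (h : δ 1 = ε 0) :
    ∃ γ : ℝ → X, ContinuousOn γ (Icc 0 1) ∧ γ 0 = δ 0 ∧ γ 1 = ε 1 ∧
      ∀ t ∈ Ioo (0 : ℝ) 1, γ t ∈ δ '' Ioc 0 1 ∪ ε '' Ico 0 1 := by
  refine ⟨fun u : ℝ => if u ≤ 1 / 2 then δ (2 * u) else ε (2 * u - 1), ?_, ?_, ?_, ?_⟩
  · rw [show Icc (0 : ℝ) 1 = Icc 0 (1 / 2) ∪ Icc (1 / 2) 1 from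
      (Icc_union_Icc_eq_Icc (by norm_num) (by norm_num)).symm]
    refine ContinuousOn.union_of_isClosed ?_ ?_ isClosed_Icc isClosed_Icc
    · refine (hδ.comp (f := fun u : ℝ => 2 * u) (by fun_prop) ?_).congr fun u hu => ?_
      · intro u hu
        exact ⟨by linarith [hu.1], by linarith [hu.2]⟩
      · simp only [if_pos hu.2, Function.comp]
    · refine (hε.comp (f := fun u : ℝ => 2 * u - 1) (by fun_prop) ?_).congr fun u hu => ?_
      · intro u hu
        exact ⟨by linarith [hu.1], by linarith [hu.2]⟩
      · rcases hu.1.eq_or_lt with h' | h'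
        · subst h'
          norm_num [h]
        · simp only [if_neg h'.not_ge, Function.comp]
  · norm_num
  · norm_num
  · intro t ht
    beta_reduce
    split_ifs with h'
    · exact Or.inl ⟨_, ⟨by linarith [ht.1], by linarith⟩, rfl⟩
    · push Not at h'
      exact Or.inr ⟨_, ⟨by linarith, by linarith [ht.2]⟩, rfl⟩

lemma exists_access {W U : Set Sphere2} (hW : IsOpen W) (hU : IsOpen U) (hUc : IsPreconnected U)
    (h1 : (U ∩ W).Nonempty) (h2 : (U \ W).Nonempty) :
    ∃ δ : ℝ → Sphere2, ContinuousOn δ (Icc 0 1) ∧ δ 0 ∈ U \ W ∧ ∀ t ∈ Ioc (0 : ℝ) 1, δ t ∈ W := by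
  obtain ⟨w, hwU, hwW⟩ := h1
  obtain ⟨z, hzU, hzW⟩ := h2
  obtain ⟨γ, hγ, h0, h1, hγU⟩ := exists_path_of_isOpen hU hUc hzU hwU
  have hK : IsCompact (Icc (0 : ℝ) 1 ∩ γ ⁻¹' Wᶜ) :=
    isCompact_Icc.inter_right (hW.isClosed_compl.preimage hγ)
  obtain ⟨T, ⟨hT, hTW⟩, hmax⟩ := hK.exists_isGreatest ⟨0, by simp, by rwa [mem_preimage, h0]⟩
  have hT1 : T < 1 := hT.2.lt_of_ne fun h => hTW (by rw [h, h1]; exact hwW)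
  refine ⟨fun t => γ (T + (1 - T) * t), by fun_prop, ⟨hγU _, by simpa using hTW⟩, ?_⟩
  intro t ht
  by_contra hn
  have h3 : 0 < (1 - T) * t := mul_pos (by linarith) ht.1
  have h4 : (1 - T) * t ≤ 1 - T := mul_le_of_le_one_right (by linarith) ht.2
  have := hmax ⟨⟨by linarith [hT.1], by linarith⟩, hn⟩
  linarith

/-- Two regions that meet both a domain and its complement contain boundary points of the domain
joined by a path through it. -/
theorem exists_access_pair {W U V : Set Sphere2} (hW : IsOpen W) (hWc : IsPreconnected W)
    (hU : IsOpen U) (hUc : IsPreconnected U) (hU1 : (U ∩ W).Nonempty) (hU2 : (U \ W).Nonempty)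
    (hV : IsOpen V) (hVc : IsPreconnected V) (hV1 : (V ∩ W).Nonempty) (hV2 : (V \ W).Nonempty) :
    ∃ δ : ℝ → Sphere2, ContinuousOn δ (Icc 0 1) ∧ δ 0 ∈ U \ W ∧ δ 1 ∈ V \ W ∧
      ∀ t ∈ Ioo (0 : ℝ) 1, δ t ∈ W := by
  obtain ⟨δ, hδ, hδ0, hδW⟩ := exists_access hW hU hUc hU1 hU2
  obtain ⟨ε, hε, hε0, hεW⟩ := exists_access hW hV hVc hV1 hV2
  have h1 : (1 : ℝ) ∈ Ioc (0 : ℝ) 1 := by norm_num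
  obtain ⟨γ, hγ, hγ0, hγ1, hγW⟩ := exists_path_of_isOpen hW hWc (hδW 1 h1) (hεW 1 h1)
  obtain ⟨κ, hκ, hκ0, hκ1, hκW⟩ := exists_concat hδ hγ.continuousOn hγ0.symm
  have hε' : ContinuousOn (fun t => ε (1 - t)) (Icc 0 1) :=
    hε.comp (f := fun t : ℝ => 1 - t) (by fun_prop)
      fun t ht => ⟨by linarith [ht.2], by linarith [ht.1]⟩
  obtain ⟨μ, hμ, hμ0, hμ1, hμW⟩ := exists_concat hκ hε' (by simp [hκ1, hγ1])
  have hκW' : ∀ t ∈ Ioc (0 : ℝ) 1, κ t ∈ W := by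
    intro t ht
    rcases ht.2.eq_or_lt with rfl | h
    · rw [hκ1]
      exact hγW _
    · rcases hκW t ⟨ht.1, h⟩ with ⟨s, hs, e⟩ | ⟨s, hs, e⟩
      · rw [← e]
        exact hδW s hs
      · rw [← e]
        exact hγW s
  refine ⟨μ, hμ, by rwa [hμ0, hκ0], by rw [hμ1]; simpa using hε0, fun t ht => ?_⟩
  rcases hμW t ht with ⟨s, hs, e⟩ | ⟨s, hs, e⟩
  · rw [← e]
    exact hκW' s hs
  · rw [← e]
    exact hεW _ ⟨by linarith [hs.2], by linarith [hs.1]⟩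

/-- The fixed point set. -/
def fixSet (g : Sphere2 ≃ₜ Sphere2) : Set Sphere2 := {x | g x = x}

lemma isClosed_fixSet (g : Sphere2 ≃ₜ Sphere2) : IsClosed (fixSet g) :=
  isClosed_eq g.continuous continuous_id

/-- A transversal arc through a fixed-point-free region, between two regions that meet it and its
complement. -/
theorem exists_transversal {p : ℕ} (hp : p.Prime) {g : Sphere2 ≃ₜ Sphere2} (hg : orderOf g = p)
    {W U V : Set Sphere2} (hW : IsOpen W) (hWc : IsPreconnected W)
    (hWF : ∀ x ∈ W, x ∉ fixSet g) (hWf : frontier W ⊆ fixSet g)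
    (hU : IsOpen U) (hUc : IsPreconnected U) (hU1 : (U ∩ W).Nonempty) (hU2 : (U \ W).Nonempty)
    (hV : IsOpen V) (hVc : IsPreconnected V) (hV1 : (V ∩ W).Nonempty) (hV2 : (V \ W).Nonempty)
    (hUV : Disjoint U V) :
    ∃ a ∈ U, ∃ b ∈ V, g a = a ∧ g b = b ∧ ∃ β, IsArc β a b ∧
      (∀ t ∈ Ioo (0 : ℝ) 1, ∃ k ∈ zpowers g, β t ∈ k '' W) ∧
      (∀ t ∈ Ioo (0 : ℝ) 1, β t ∉ fixSet g) ∧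
      ∀ k ∈ zpowers g, k ≠ 1 → ArcDisj β (k ∘ β) := by
  obtain ⟨δ, hδ, hδ0, hδ1, hδW⟩ := exists_access_pair hW hWc hU hUc hU1 hU2 hV hVc hV1 hV2
  have hfr : ∀ t ∈ Icc (0 : ℝ) 1, δ t ∈ closure W := by
    have : δ '' closure (Ioo 0 1) ⊆ closure (δ '' Ioo 0 1) :=
      ContinuousOn.image_closure (by rwa [closure_Ioo zero_ne_one])
    rw [closure_Ioo zero_ne_one] at this
    intro t ht
    refine closure_mono ?_ (this (mem_image_of_mem _ ht))
    rintro _ ⟨s, hs, rfl⟩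
    exact hδW s hs
  have hfix : ∀ t ∈ Icc (0 : ℝ) 1, δ t ∉ W → g (δ t) = δ t := fun t ht h =>
    hWf (by rw [hW.frontier_eq]; exact ⟨hfr t ht, h⟩)
  have ga := hfix 0 (by simp) hδ0.2
  have gb := hfix 1 (by simp) hδ1.2
  have hall : ∀ x, g x = x → ∀ k ∈ zpowers g, k x = x := by
    intro x hx k hk
    have hst : zpowers g ≤ MulAction.stabilizer (Sphere2 ≃ₜ Sphere2) x :=
      Subgroup.zpowers_le.2 hx
    exact hst hk
  have hab : δ 0 ≠ δ 1 := fun h => hUV.le_bot ⟨hδ0.1, by rw [h]; exact hδ1.1⟩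
  have := finite_zpowers (g := g) (hg ▸ hp.pos)
  obtain ⟨β, hβ, hβ0, hβ1, hβδ, hβd⟩ := exists_transversal_arc (G := zpowers g) hab
    (hall _ ga) (hall _ gb) hδ rfl rfl (fun t ht k hk e => by
      by_contra hk1
      exact hWF _ (hδW t ht) (fixed_of_pow_fixed hp hg hk hk1 e))
  have hnf : ∀ t ∈ Ioo (0 : ℝ) 1, β t ∉ fixSet g := by
    intro t ht h
    obtain ⟨s, hs, k, hk, e⟩ := hβδ t ht
    have h1 := hall _ h k⁻¹ (Subgroup.inv_mem _ hk)
    rw [e] at h1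
    have h2 : k⁻¹ (k (δ s)) = δ s := k.symm_apply_apply _
    rw [h2] at h1
    refine hWF _ (hδW s hs) ?_
    rw [h1, ← e]
    exact h
  refine ⟨δ 0, hδ0.1, δ 1, hδ1.1, ga, gb, β, ⟨hβ, ?_, hβ0, hβ1⟩, ?_, hnf, ?_⟩
  · intro s hs t ht e
    exact hβd s hs t ht 1 (Subgroup.one_mem _) e
  · intro t ht
    obtain ⟨s, hs, k, hk, e⟩ := hβδ t ht
    exact ⟨k, hk, δ s, hδW s hs, e.symm⟩
  · intro k hk hk1 s hs t ht e
    have hst := hβd t ht s hs k hk e.symm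
    subst hst
    refine ⟨rfl, ?_⟩
    by_contra! hne
    exact hnf t ⟨hs.1.lt_of_ne' hne.1, hs.2.lt_of_ne hne.2⟩
      (fixed_of_pow_fixed hp hg hk hk1 e.symm)

lemma exists_disjoint_regions {x y : Sphere2} (h : x ≠ y) :
    ∃ U V : Set Sphere2, IsOpen U ∧ IsPreconnected U ∧ IsOpen V ∧ IsPreconnected V ∧
      x ∈ U ∧ y ∈ V ∧ Disjoint U V := by
  obtain ⟨U, V, hU, hV, hx, hy, hd⟩ := t2_separation h
  exact ⟨connectedComponentIn U x, connectedComponentIn V y, hU.connectedComponentIn,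
    isPreconnected_connectedComponentIn, hV.connectedComponentIn,
    isPreconnected_connectedComponentIn, mem_connectedComponentIn hx, mem_connectedComponentIn hy,
    hd.mono (connectedComponentIn_subset _ _) (connectedComponentIn_subset _ _)⟩

lemma isPreconnected_compl_pair (a b : Sphere2) : IsPreconnected ({a, b}ᶜ : Set Sphere2) := by
  by_cases hab : a = b
  · subst hab
    rw [pair_eq_singleton]
    exact isPreconnected_compl_singleton a
  refine isPreconnected_of_conn fun x hx y hy => ?_
  have hx' : x ≠ a ∧ x ≠ b := by simpa using hx
  have hy' : y ≠ a ∧ y ≠ b := by simpa using hy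
  have := conn_compl_union (K := {a}) (L := {b}) isClosed_singleton isClosed_singleton
    (by
      rw [(disjoint_singleton.2 hab).inter_eq]
      exact isPreconnected_empty)
    ((isPreconnected_compl_singleton a).conn hx'.1 hy'.1)
    ((isPreconnected_compl_singleton b).conn hx'.2 hy'.2)
  exact this

lemma ArcDisj.map {α β : ℝ → Sphere2} (h : ArcDisj α β) (f : Sphere2 ≃ₜ Sphere2) :
    ArcDisj (f ∘ α) (f ∘ β) := fun s hs t ht e => h s hs t ht (f.injective e)

/-- A complementary component of the fixed point set. -/
def freePart (g : Sphere2 ≃ₜ Sphere2) (m : Sphere2) : Set Sphere2 :=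
  connectedComponentIn (fixSet g)ᶜ m

section FreePart

variable {g : Sphere2 ≃ₜ Sphere2} {m : Sphere2}

lemma isOpen_freePart : IsOpen (freePart g m) :=
  (isClosed_fixSet g).isOpen_compl.connectedComponentIn

lemma isPreconnected_freePart : IsPreconnected (freePart g m) :=
  isPreconnected_connectedComponentIn

lemma notMem_fixSet_of_mem_freePart {x : Sphere2} (hx : x ∈ freePart g m) : x ∉ fixSet g :=
  connectedComponentIn_subset _ _ hx

lemma frontier_freePart : frontier (freePart g m) ⊆ fixSet g := by
  have := frontier_connectedComponentIn_subset (a := m) (isClosed_fixSet g).isOpen_compl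
  rwa [compl_compl] at this

lemma exists_mem_frontier_freePart (hm : m ∉ fixSet g) {q y : Sphere2} (hq : g q = q)
    (hy : g y = y) (hyq : y ≠ q) : ∃ r ∈ frontier (freePart g m), r ≠ q := by
  by_contra! h
  have hmW : m ∈ freePart g m := mem_connectedComponentIn hm
  have := subset_of_disjoint_frontier (isPreconnected_compl_singleton q)
    ⟨m, fun e => hm (by rw [mem_singleton_iff.1 e]; exact hq), hmW⟩
    (eq_empty_of_forall_notMem fun x hx => hx.1 (h x hx.2))
  exact notMem_fixSet_of_mem_freePart (this hyq) hy

lemma exists_pair_frontier_freePart (hm : m ∉ fixSet g) {x y : Sphere2} (hx : g x = x)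
    (hy : g y = y) (hxy : x ≠ y) :
    ∃ q ∈ frontier (freePart g m), ∃ r ∈ frontier (freePart g m), q ≠ r := by
  obtain ⟨q, hq, -⟩ := exists_mem_frontier_freePart hm hx hy hxy.symm
  have hgq := frontier_freePart hq
  obtain ⟨z, hz, hzq⟩ : ∃ z, g z = z ∧ z ≠ q := by
    by_cases h : x = q
    · exact ⟨y, hy, fun e => hxy (h.trans e.symm)⟩
    · exact ⟨x, hx, h⟩
  obtain ⟨r, hr, hrq⟩ := exists_mem_frontier_freePart hm hgq hz hzq
  exact ⟨q, hq, r, hr, hrq.symm⟩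

lemma inter_freePart_nonempty {q : Sphere2} {U : Set Sphere2} (hU : IsOpen U) (hqU : q ∈ U)
    (hq : q ∈ frontier (freePart g m)) :
    (U ∩ freePart g m).Nonempty ∧ (U \ freePart g m).Nonempty := by
  rw [isOpen_freePart.frontier_eq] at hq
  exact ⟨mem_closure_iff.1 hq.1 U hU hqU, q, hqU, hq.2⟩

end FreePart

lemma exists_ne_ne {X : Type*} {x y z : X} (hxy : x ≠ y) (hxz : x ≠ z) (hyz : y ≠ z) (a b : X) :
    ∃ e, (e = x ∨ e = y ∨ e = z) ∧ e ≠ a ∧ e ≠ b := by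
  by_contra! h
  have h1 := h x (by simp)
  have h2 := h y (by simp)
  have h3 := h z (by simp)
  by_cases hx : x = a <;> by_cases hy : y = a <;> by_cases hz : z = a <;> grind

lemma exists_notMem_fixSet {g : Sphere2 ≃ₜ Sphere2} (hg : g ≠ 1) : ∃ m, m ∉ fixSet g := by
  by_contra! h
  exact hg (Homeomorph.ext h)

lemma apply_eq_of_mem_zpowers {g k : Sphere2 ≃ₜ Sphere2} (hk : k ∈ zpowers g)
    {x : Sphere2} (hx : g x = x) : k x = x := by
  have hst : zpowers g ≤ MulAction.stabilizer (Sphere2 ≃ₜ Sphere2) x :=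
    Subgroup.zpowers_le.2 hx
  exact hst hk

/-- The translates of a transversal arc. -/
def star (g : Sphere2 ≃ₜ Sphere2) (β : ℝ → Sphere2) : Set Sphere2 :=
  ⋃ k ∈ zpowers g, k '' (β '' Icc 0 1)

section Star

variable {g k : Sphere2 ≃ₜ Sphere2} {β : ℝ → Sphere2} {a b : Sphere2}

lemma mem_star (hk : k ∈ zpowers g) {t : ℝ} (ht : t ∈ Icc (0 : ℝ) 1) :
    k (β t) ∈ star g β :=
  mem_biUnion hk (mem_image_of_mem _ (mem_image_of_mem _ ht))

lemma exists_of_mem_star {x : Sphere2} (hx : x ∈ star g β) :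
    ∃ k ∈ zpowers g, ∃ t ∈ Icc (0 : ℝ) 1, k (β t) = x := by
  obtain ⟨k, hk, _, ⟨t, ht, rfl⟩, e⟩ := mem_iUnion₂.1 hx
  exact ⟨k, hk, t, ht, e⟩

lemma isClosed_star (hg : 0 < orderOf g) (hβ : IsArc β a b) : IsClosed (star g β) := by
  have : Set.Finite (zpowers g : Set (Sphere2 ≃ₜ Sphere2)) := finite_zpowers hg
  exact this.isClosed_biUnion fun k _ => k.isClosedMap _ hβ.isClosed

lemma image_star (hk : k ∈ zpowers g) : k '' star g β = star g β := by
  have key : ∀ k ∈ zpowers g, k '' star g β ⊆ star g β := by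
    rintro k hk _ ⟨x, hx, rfl⟩
    obtain ⟨l, hl, t, ht, rfl⟩ := exists_of_mem_star hx
    rw [← mul_apply]
    exact mem_star (Subgroup.mul_mem _ hk hl) ht
  refine (key k hk).antisymm fun x hx => ?_
  exact ⟨k⁻¹ x, key _ (Subgroup.inv_mem _ hk) (mem_image_of_mem _ hx), k.apply_symm_apply x⟩

/-- A component of the complement of a star has a frontier point inside one of the arcs. -/
theorem exists_frontier_star (hg : 0 < orderOf g) (hβ : IsArc β a b) (ha : g a = a) (hb : g b = b)
    {z : Sphere2} (hz : z ∉ star g β) :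
    ∃ k ∈ zpowers g, ∃ t ∈ Ioo (0 : ℝ) 1,
      k (β t) ∈ frontier (connectedComponentIn (star g β)ᶜ z) := by
  by_contra! h
  have hcl := isClosed_star hg hβ
  have h1 := Subgroup.one_mem (zpowers g)
  have hza : z ∈ ({a, b}ᶜ : Set Sphere2) := by
    rintro (rfl | rfl)
    · exact hz (by simpa [hβ.zero] using mem_star (β := β) h1 (t := 0) (by simp))
    · exact hz (by simpa [hβ.one] using mem_star (β := β) h1 (t := 1) (by simp))
  have hsub := subset_of_disjoint_frontier (isPreconnected_compl_pair a b)
    (V := connectedComponentIn (star g β)ᶜ z) ⟨z, hza, mem_connectedComponentIn hz⟩ (by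
      refine eq_empty_of_forall_notMem fun x hx => hx.1 ?_
      have hxs : x ∈ star g β := by
        simpa using frontier_connectedComponentIn_subset hcl.isOpen_compl hx.2
      obtain ⟨k, hk, t, ht, rfl⟩ := exists_of_mem_star hxs
      rcases hβ.image_subset (mem_image_of_mem _ ht) with ⟨s, hs, e⟩ | e | e
      · exact absurd hx.2 (by rw [← e]; exact h k hk s hs)
      · rw [e, apply_eq_of_mem_zpowers hk ha]
        exact Or.inl rfl
      · rw [mem_singleton_iff.1 e, apply_eq_of_mem_zpowers hk hb]
        exact Or.inr rfl)
  have hmid : β (1 / 2) ∈ ({a, b}ᶜ : Set Sphere2) := by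
    rintro (e | e)
    · rw [← hβ.zero] at e
      have := hβ.inj half_mem_Icc (by simp) e
      norm_num at this
    · rw [mem_singleton_iff, ← hβ.one] at e
      have := hβ.inj half_mem_Icc (by simp) e
      norm_num at this
  exact connectedComponentIn_subset _ _ (hsub hmid)
    (by simpa using mem_star (β := β) h1 half_mem_Icc)

end Star

lemma image_frontier_component {k : Sphere2 ≃ₜ Sphere2} {K : Set Sphere2} (hK : k '' K = K)
    {z : Sphere2} (hz : z ∉ K) :
    k '' connectedComponentIn Kᶜ z = connectedComponentIn Kᶜ (k z) := by
  rw [k.image_connectedComponentIn hz, image_compl_eq k.bijective, hK]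

/-- A map of odd prime order has at most two fixed points. -/
theorem eq_two_of_three_fixed {p : ℕ} (hp : p.Prime) {g : Sphere2 ≃ₜ Sphere2} (hg : orderOf g = p)
    {x y z : Sphere2} (hx : g x = x) (hy : g y = y) (hz : g z = z) (hxy : x ≠ y) (hxz : x ≠ z)
    (hyz : y ≠ z) : p = 2 := by
  by_contra hp2
  have hg1 : g ≠ 1 := fun e => hp.one_lt.ne' (by rw [← hg, e, orderOf_one])
  have hgg : g * g ≠ 1 := fun e => by
    have : orderOf g ∣ 2 := orderOf_dvd_of_pow_eq_one (by rw [pow_two, e])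
    rw [hg] at this
    exact hp2 ((Nat.prime_dvd_prime_iff_eq hp Nat.prime_two).1 this)
  obtain ⟨m, hm⟩ := exists_notMem_fixSet hg1
  obtain ⟨q, hq, r, hr, hqr⟩ := exists_pair_frontier_freePart hm hx hy hxy
  obtain ⟨U, V, hU, hUc, hV, hVc, hqU, hrV, hUV⟩ := exists_disjoint_regions hqr
  obtain ⟨a, -, b, -, ha, hb, β, hβ, -, hβF, hβd⟩ := exists_transversal hp hg
    (isOpen_freePart (g := g) (m := m)) isPreconnected_freePart
    (fun x => notMem_fixSet_of_mem_freePart) frontier_freePart hU hUc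
    (inter_freePart_nonempty hU hqU hq).1 (inter_freePart_nonempty hU hqU hq).2 hV hVc
    (inter_freePart_nonempty hV hrV hr).1 (inter_freePart_nonempty hV hrV hr).2 hUV
  obtain ⟨e, he, hea, heb⟩ : ∃ e, g e = e ∧ e ≠ a ∧ e ≠ b := by
    obtain ⟨e, h, h1⟩ := exists_ne_ne hxy hxz hyz a b
    rcases h with rfl | rfl | rfl
    exacts [⟨_, hx, h1⟩, ⟨_, hy, h1⟩, ⟨_, hz, h1⟩]
  have hpos : 0 < orderOf g := hg ▸ hp.pos
  have hgz := Subgroup.mem_zpowers g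
  have heS : e ∉ star g β := by
    intro h
    obtain ⟨k, hk, t, ht, e'⟩ := exists_of_mem_star h
    have h1 : β t = e := by
      have h2 := apply_eq_of_mem_zpowers hk he
      exact k.injective (e'.trans h2.symm)
    rcases hβ.image_subset (mem_image_of_mem _ ht) with ⟨s, hs, h2⟩ | h2 | h2
    · exact hβF s hs (by rw [h2, h1]; exact he)
    · exact hea (h1.symm.trans h2)
    · exact heb (h1.symm.trans h2)
  obtain ⟨k₀, hk₀, t, ht, hfr⟩ := exists_frontier_star hpos hβ ha hb heS
  set E := connectedComponentIn (star g β)ᶜ e with hE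
  have hfr' : ∀ k ∈ zpowers g, k (β t) ∈ closure E := by
    intro k hk
    have hk' : k * k₀⁻¹ ∈ zpowers g := Subgroup.mul_mem _ hk (Subgroup.inv_mem _ hk₀)
    have h1 : (k * k₀⁻¹) '' closure E = closure E := by
      rw [Homeomorph.image_closure, hE, image_frontier_component (image_star hk') heS,
        apply_eq_of_mem_zpowers hk' he]
    rw [← h1]
    refine ⟨_, frontier_subset_closure hfr, ?_⟩
    rw [mul_apply]
    exact congrArg k (k₀.symm_apply_apply _)
  have hconn : ∀ K : Set Sphere2, K ⊆ star g β → ∀ k ∈ zpowers g, k (β t) ∉ K →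
      Conn Kᶜ e (k (β t)) := by
    intro K hK k hk hkK
    refine ⟨insert (k (β t)) E, ?_, isPreconnected_connectedComponentIn.subset_closure
      (subset_insert _ _) (insert_subset (hfr' k hk) subset_closure),
      Or.inr (mem_connectedComponentIn heS), Or.inl rfl⟩
    rintro _ (rfl | h)
    · exact hkK
    · exact fun h' => connectedComponentIn_subset _ _ h (hK h')
  have hsub : ∀ k ∈ zpowers g, (k ∘ β) '' Icc 0 1 ⊆ star g β := by
    rintro k hk _ ⟨s, hs, rfl⟩
    exact mem_star hk hs
  have hggz : g * g ∈ zpowers g := Subgroup.mul_mem _ hgz hgz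
  have h1z := Subgroup.one_mem (zpowers g)
  have d01 : ArcDisj β (g ∘ β) := hβd g hgz hg1
  have d02 : ArcDisj β ((g * g) ∘ β) := hβd _ hggz hgg
  have d12 : ArcDisj (g ∘ β) ((g * g) ∘ β) := d01.map g
  have a1 : IsArc (g ∘ β) a b := by
    have := hβ.map g
    rwa [ha, hb] at this
  have a2 : IsArc ((g * g) ∘ β) a b := by
    have := a1.map g
    rwa [ha, hb] at this
  refine not_conn_theta hβ a1 a2 d01 d12 d02 ht ht ht
    (hconn _ (union_subset (hsub 1 h1z) (hsub g hgz)) (g * g) hggz ?_)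
    (hconn _ (union_subset (hsub g hgz) (hsub _ hggz)) 1 h1z ?_)
    (hconn _ (union_subset (hsub 1 h1z) (hsub _ hggz)) g hgz ?_)
  · exact fun h => h.elim (d02.symm.notMem ht) (d12.symm.notMem ht)
  · exact fun h => h.elim (d01.notMem ht) (d02.notMem ht)
  · exact fun h => h.elim (d01.symm.notMem ht) (d12.notMem ht)

section Halves

variable {c : ℝ → Sphere2} {β : ℝ → Sphere2} {g : Sphere2 ≃ₜ Sphere2} {a b : Sphere2}

lemma isArc_first_half (hc : IsJordan c) :
    IsArc (fun t => c (t / 2)) (c 0) (c (1 / 2)) := by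
  refine ⟨(hc.cont.comp (by fun_prop)).continuousOn, ?_, by simp, rfl⟩
  intro s hs t ht e
  have := hc.inj (x₁ := s / 2) (x₂ := t / 2) ⟨by linarith [hs.1], by linarith [hs.2]⟩
    ⟨by linarith [ht.1], by linarith [ht.2]⟩ e
  linarith

lemma isArc_second_half (hc : IsJordan c) :
    IsArc (fun t => c (1 - t / 2)) (c 0) (c (1 / 2)) := by
  refine ⟨(hc.cont.comp (by fun_prop)).continuousOn, ?_, ?_, by norm_num⟩
  · intro s hs t ht e
    obtain ⟨n, hn⟩ := hc.eq_iff.1 e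
    have h1 : (-1 : ℝ) < n := by linarith [hs.2, ht.1, hs.1, ht.2]
    have h2 : (n : ℝ) < 1 := by linarith [hs.2, ht.1, hs.1, ht.2]
    have : n = 0 := by
      have h1 : -1 < n := by exact_mod_cast h1
      have h2 : n < 1 := by exact_mod_cast h2
      omega
    rw [this] at hn
    push_cast at hn
    linarith
  · simpa using hc.per 0

lemma arcDisj_halves (hc : IsJordan c) :
    ArcDisj (fun t => c (t / 2)) (fun t => c (1 - t / 2)) := by
  intro s hs t ht e
  obtain ⟨n, hn⟩ := hc.eq_iff.1 e
  have h1 : (-2 : ℝ) < n := by linarith [hs.2, ht.1, hs.1, ht.2]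
  have h2 : (n : ℝ) < 1 := by linarith [hs.2, ht.1, hs.1, ht.2]
  have h1 : -2 < n := by exact_mod_cast h1
  have h2 : n < 1 := by exact_mod_cast h2
  obtain rfl | rfl : n = -1 ∨ n = 0 := by omega
  · push_cast at hn
    have : s = 0 := by linarith [hs.1, ht.1]
    exact ⟨by linarith, Or.inl this⟩
  · push_cast at hn
    have : s = 1 := by linarith [hs.2, ht.2]
    exact ⟨by linarith, Or.inr this⟩

lemma union_halves (hc : IsJordan c) :
    (fun t => c (t / 2)) '' Icc 0 1 ∪ (fun t => c (1 - t / 2)) '' Icc 0 1 = range c := by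
  apply Subset.antisymm
  · rintro _ (⟨t, -, rfl⟩ | ⟨t, -, rfl⟩) <;> exact mem_range_self _
  · rw [hc.range_eq_Ico 0]
    rintro _ ⟨t, ht, rfl⟩
    rcases le_total t (1 / 2) with h | h
    · exact Or.inl ⟨2 * t, ⟨by linarith [ht.1], by linarith⟩, congrArg c (by ring)⟩
    · exact Or.inr ⟨2 - 2 * t, ⟨by linarith [ht.2], by linarith⟩, congrArg c (by ring)⟩

/-- The initial piece `[0, T]` of `β`, backwards, followed by its image under `g`. -/
noncomputable def doubled (g : Sphere2 ≃ₜ Sphere2) (β : ℝ → Sphere2) (T t : ℝ) : Sphere2 :=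
  if t ≤ 1 / 2 then β (T * (1 - 2 * t)) else g (β (T * (2 * t - 1)))

lemma isArc_doubled (hβ : IsArc β a b) (ha : g a = a) (hd : ArcDisj β (g ∘ β)) {T : ℝ}
    (hT : T ∈ Ioo (0 : ℝ) 1) : IsArc (doubled g β T) (β T) (g (β T)) := by
  have hT0 := hT.1
  have hT1 := hT.2
  have m1 : ∀ t ∈ Icc (0 : ℝ) (1 / 2), T * (1 - 2 * t) ∈ Icc (0 : ℝ) T := fun t ht =>
    ⟨mul_nonneg hT0.le (by linarith [ht.2]), mul_le_of_le_one_right hT0.le (by linarith [ht.1])⟩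
  have m2 : ∀ t ∈ Icc (1 / 2 : ℝ) 1, T * (2 * t - 1) ∈ Icc (0 : ℝ) T := fun t ht =>
    ⟨mul_nonneg hT0.le (by linarith [ht.1]), mul_le_of_le_one_right hT0.le (by linarith [ht.2])⟩
  have hI : Icc (0 : ℝ) T ⊆ Icc 0 1 := Icc_subset_Icc_right hT1.le
  refine ⟨?_, ?_, by norm_num [doubled], by norm_num [doubled]⟩
  · rw [show Icc (0 : ℝ) 1 = Icc 0 (1 / 2) ∪ Icc (1 / 2) 1 from
      (Icc_union_Icc_eq_Icc (by norm_num) (by norm_num)).symm]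
    refine ContinuousOn.union_of_isClosed ?_ ?_ isClosed_Icc isClosed_Icc
    · refine (hβ.cont.comp (f := fun u : ℝ => T * (1 - 2 * u)) (by fun_prop)
        fun u hu => hI (m1 u hu)).congr fun u hu => ?_
      simp only [doubled, if_pos hu.2, Function.comp]
    · refine ((g.continuous.comp_continuousOn hβ.cont).comp
        (f := fun u : ℝ => T * (2 * u - 1)) (by fun_prop) fun u hu => hI (m2 u hu)).congr
        fun u hu => ?_
      rcases hu.1.eq_or_lt with h' | h'
      · subst h'
        norm_num [doubled, hβ.zero, ha]
      · simp only [doubled, if_neg h'.not_ge, Function.comp]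
  · have hmix : ∀ s ∈ Icc (0 : ℝ) (1 / 2), ∀ t, 1 / 2 < t → t ≤ 1 →
        β (T * (1 - 2 * s)) ≠ g (β (T * (2 * t - 1))) := by
      intro s hs t ht ht1 e
      have hs' := m1 s hs
      have ht' := m2 t ⟨ht.le, ht1⟩
      obtain ⟨h1, h2 | h2⟩ := hd _ (hI hs') _ (hI ht') e
      · rw [h2] at h1
        have : 0 < T * (2 * t - 1) := mul_pos hT0 (by linarith)
        linarith
      · linarith [hs'.2]
    intro s hs t ht e
    simp only [doubled] at e
    split_ifs at e with h1 h2 h2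
    · have := hβ.inj (hI (m1 s ⟨hs.1, h1⟩)) (hI (m1 t ⟨ht.1, h2⟩)) e
      have := mul_left_cancel₀ hT0.ne' this
      linarith
    · exact absurd e (hmix s ⟨hs.1, h1⟩ t (not_le.1 h2) ht.2)
    · exact absurd e.symm (hmix t ⟨ht.1, h2⟩ s (not_le.1 h1) hs.2)
    · have := hβ.inj (hI (m2 s ⟨(not_le.1 h1).le, hs.2⟩)) (hI (m2 t ⟨(not_le.1 h2).le, ht.2⟩))
        (g.injective e)
      have := mul_left_cancel₀ hT0.ne' this
      linarith

lemma apply_doubled (ha : g (β 0) = β 0) (hgg : g * g = 1) (T t : ℝ) :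
    g (doubled g β T t) = doubled g β T (1 - t) := by
  have hgg' : ∀ x, g (g x) = x := fun x => by rw [← mul_apply, hgg]; rfl
  rcases lt_trichotomy t (1 / 2) with h | rfl | h
  · rw [doubled, if_pos h.le, doubled, if_neg (by linarith)]
    congr 3
    ring
  · norm_num [doubled, ha]
  · rw [doubled, if_neg (by linarith), doubled, if_pos (by linarith), hgg']
    congr 2
    ring

lemma exists_of_doubled {T : ℝ} (hT : 0 < T) {t : ℝ} (ht : t ∈ Ioo (0 : ℝ) 1) :
    ∃ s ∈ Ico (0 : ℝ) T, doubled g β T t = β s ∨ doubled g β T t = g (β s) := by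
  rw [doubled]
  split_ifs with h
  · exact ⟨_, ⟨mul_nonneg hT.le (by linarith), mul_lt_of_lt_one_right hT (by linarith [ht.1])⟩,
      Or.inl rfl⟩
  · push Not at h
    exact ⟨_, ⟨mul_nonneg hT.le (by linarith), mul_lt_of_lt_one_right hT (by linarith [ht.2])⟩,
      Or.inr rfl⟩

end Halves

/-- An involution acting freely on a Jordan curve and preserving its sides has at most one fixed
point on each side, if its fixed points are accessible. -/
theorem fixed_unique_of_crosscut {c : ℝ → Sphere2} (hc : IsJordan c) {g : Sphere2 ≃ₜ Sphere2}
    (hgg : g * g = 1) (hgc : ∀ x, g (c x) = c (x + 1 / 2)) {a b : Sphere2} {β : ℝ → Sphere2}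
    (hβ : IsArc β a b) (ha : g a = a) (hd : ArcDisj β (g ∘ β))
    (hβF : ∀ t ∈ Ioo (0 : ℝ) 1, β t ∉ fixSet g)
    (hac : a ∉ range c) (hb : b ∉ range c) (hba : b ∉ side c a) {e : Sphere2} (he : g e = e)
    (hea : e ∈ side c a) : e = a := by
  by_contra hne
  have hgg' : ∀ x, g (g x) = x := fun x => by rw [← mul_apply, hgg]; rfl
  have hinv := image_range_of_shift hgc
  have hgU : ∀ x ∈ side c a, g x ∈ side c a := by
    intro x hx
    have := mem_image_of_mem g hx
    rwa [image_side hinv hac, ha] at this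
  have hK : IsCompact (Icc (0 : ℝ) 1 ∩ {t | β t ∈ range c}) := by
    have := hβ.cont.preimage_isClosed_of_isClosed isClosed_Icc hc.isClosed_range
    exact isCompact_Icc.of_isClosed_subset this inter_subset_left
  have hKne : (Icc (0 : ℝ) 1 ∩ {t | β t ∈ range c}).Nonempty := by
    by_contra hem
    have := subset_of_disjoint_frontier (isPreconnected_Icc.image β hβ.cont) (V := side c a)
      ⟨a, hβ.left_mem, mem_side_self hac⟩ (by
        rw [hc.frontier_side hac]
        refine eq_empty_of_forall_notMem ?_
        rintro _ ⟨⟨t, ht, rfl⟩, hx⟩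
        exact hem ⟨t, ht, hx⟩)
    exact hba (this hβ.right_mem)
  obtain ⟨T, ⟨hT, hTc⟩, hmin⟩ := hK.exists_isLeast hKne
  have hT0 : 0 < T := hT.1.lt_of_ne fun h => hac (by rw [← hβ.zero, h]; exact hTc)
  have hT1 : T < 1 := hT.2.lt_of_ne fun h => hb (by rw [← hβ.one, ← h]; exact hTc)
  have hβU : ∀ t ∈ Ico (0 : ℝ) T, β t ∈ side c a := by
    have : β '' Ico 0 T ⊆ side c a := by
      refine subset_side (isPreconnected_Ico.image β (hβ.cont.mono fun t ht =>
        ⟨ht.1, ht.2.le.trans hT1.le⟩)) ⟨0, ⟨le_rfl, hT0⟩, hβ.zero⟩ ?_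
      rintro _ ⟨t, ht, rfl⟩ h
      exact (hmin ⟨⟨ht.1, ht.2.le.trans hT1.le⟩, h⟩).not_gt ht.2
    exact fun t ht => this (mem_image_of_mem _ ht)
  obtain ⟨s₁, hs₁⟩ := hTc
  -- reparametrize the curve so that it starts at the first point met by `β`
  set c' : ℝ → Sphere2 := fun x => c (x + s₁) with hc'def
  have hc' : IsJordan c' := hc.shift s₁
  have hr : range c' = range c := (Equiv.addRight s₁).surjective.range_comp c
  have hgc' : ∀ x, g (c' x) = c' (x + 1 / 2) := fun x => by
    simp only [hc'def, hgc]
    congr 1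
    ring
  have h0 : c' 0 = β T := by simp only [hc'def, zero_add, hs₁]
  have h12 : c' (1 / 2) = g (β T) := by rw [← h0, hgc', zero_add]
  have A0 := isArc_first_half hc'
  have A2 := isArc_second_half hc'
  have A1 := isArc_doubled hβ ha hd ⟨hT0, hT1⟩
  rw [← h12, ← h0] at A1
  have d02 := arcDisj_halves hc'
  have hAU : ∀ t ∈ Ioo (0 : ℝ) 1, doubled g β T t ∈ side c a := by
    intro t ht
    obtain ⟨s, hs, h | h⟩ := exists_of_doubled (g := g) (β := β) hT0 ht
    · rw [h]
      exact hβU s hs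
    · rw [h]
      exact hgU _ (hβU s hs)
  have hdis : ∀ γ : ℝ → Sphere2, IsArc γ (c' 0) (c' (1 / 2)) → γ '' Icc 0 1 ⊆ range c →
      ArcDisj (doubled g β T) γ := by
    intro γ hγ hγc s hs t ht e'
    rcases hs.1.eq_or_lt with rfl | hs0
    · rw [A1.zero, ← hγ.zero] at e'
      exact ⟨hγ.inj (by simp) ht e', Or.inl rfl⟩
    rcases hs.2.eq_or_lt with rfl | hs1
    · rw [A1.one, ← hγ.one] at e'
      exact ⟨hγ.inj (by simp) ht e', Or.inr rfl⟩
    · exact absurd (hγc (mem_image_of_mem _ ht))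
        (by rw [← e']; exact side_subset _ _ (hAU s ⟨hs0, hs1⟩))
  have hun := union_halves hc'
  rw [hr] at hun
  have d10 := hdis _ A0 (hun ▸ subset_union_left)
  have d12 := hdis _ A2 (hun ▸ subset_union_right)
  have hhalf : (1 / 2 : ℝ) ∈ Ioo (0 : ℝ) 1 := by norm_num
  have hec : e ∉ range c := side_subset _ _ hea
  have heA : e ∉ doubled g β T '' Icc 0 1 := by
    intro h
    rcases A1.image_subset h with ⟨t, ht, h⟩ | h | h
    · obtain ⟨s, hs, h'⟩ := exists_of_doubled (g := g) (β := β) hT0 ht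
      have hβe : β s = e := by
        rcases h' with h' | h'
        · rw [← h', h]
        · rw [← hgg' (β s), ← h', h, he]
      rcases hs.1.eq_or_lt with rfl | hs0
      · exact hne (by rw [← hβe, hβ.zero])
      · exact hβF s ⟨hs0, hs.2.trans hT1⟩ (by rw [hβe]; exact he)
    · exact hec (by rw [h, ← hr]; exact mem_range_self _)
    · exact hec (by rw [mem_singleton_iff.1 h, ← hr]; exact mem_range_self _)
  have hgA : g '' (doubled g β T '' Icc 0 1) = doubled g β T '' Icc 0 1 := by
    have key : g '' (doubled g β T '' Icc 0 1) ⊆ doubled g β T '' Icc 0 1 := by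
      rintro _ ⟨_, ⟨t, ht, rfl⟩, rfl⟩
      exact ⟨1 - t, ⟨by linarith [ht.2], by linarith [ht.1]⟩,
        (apply_doubled (by rw [hβ.zero, ha]) hgg T t).symm⟩
    refine key.antisymm fun x hx => ⟨g x, key (mem_image_of_mem _ hx), hgg' x⟩
  have hg0 : g '' ((fun t => c' (t / 2)) '' Icc 0 1) = (fun t => c' (1 - t / 2)) '' Icc 0 1 := by
    ext x
    constructor
    · rintro ⟨_, ⟨t, ht, rfl⟩, rfl⟩
      refine ⟨1 - t, ⟨by linarith [ht.2], by linarith [ht.1]⟩, ?_⟩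
      simp only [hgc']
      congr 1
      ring
    · rintro ⟨t, ht, rfl⟩
      refine ⟨c' ((1 - t) / 2), ⟨1 - t, ⟨by linarith [ht.2], by linarith [ht.1]⟩, rfl⟩, ?_⟩
      simp only [hgc']
      congr 1
      ring
  have hg2 : g '' ((fun t => c' (1 - t / 2)) '' Icc 0 1) = (fun t => c' (t / 2)) '' Icc 0 1 := by
    rw [← hg0, image_image]
    simp [hgg']
  have e1 : Conn ((fun t => c' (t / 2)) '' Icc 0 1 ∪ (fun t => c' (1 - t / 2)) '' Icc 0 1)ᶜ e
      (doubled g β T (1 / 2)) := by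
    rw [hun]
    exact (isPreconnected_side.conn hea (hAU _ hhalf)).mono (side_subset _ _)
  have hmem : g (c' (1 / 2 / 2)) = c' (1 - 1 / 2 / 2) := by
    rw [hgc']
    norm_num
  have hmem' : g (c' (1 - 1 / 2 / 2)) = c' (1 / 2 / 2) := by
    rw [← hmem, hgg']
  have himg : ∀ K : Set Sphere2, ∀ y, Conn Kᶜ e y → Conn (g '' K)ᶜ e (g y) := by
    intro K y h
    have := h.image g.continuous.continuousOn
    rwa [image_compl_eq g.bijective, he] at this
  by_cases hcase : Conn ((fun t => c' (t / 2)) '' Icc 0 1 ∪ doubled g β T '' Icc 0 1)ᶜ e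
      (c' (1 - 1 / 2 / 2))
  · have h2 := himg _ _ hcase
    rw [image_union, hgA, hg0, hmem', union_comm] at h2
    exact not_conn_theta A0 A1 A2 d10.symm d12 d02 hhalf hhalf hhalf hcase h2 e1
  · have h2 := conn_of_theta A0 A1 A2 d10.symm d12 d02
      (fun h => h.elim (fun h => hec (hun ▸ Or.inl h)) heA) hhalf hcase hhalf
    have h3 := himg _ _ h2
    rw [image_union, hgA, hg2, hmem, union_comm] at h3
    exact hcase h3

/-- If an involution has three fixed points, then it preserves no complementary component of its
fixed point set. -/
theorem apply_notMem_freePart {g : Sphere2 ≃ₜ Sphere2} (hg : orderOf g = 2) {x y z : Sphere2}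
    (hx : g x = x) (hy : g y = y) (hz : g z = z) (hxy : x ≠ y) (hxz : x ≠ z) (hyz : y ≠ z)
    {m : Sphere2} (hm : m ∉ fixSet g) : g m ∉ freePart g m := by
  intro hgm
  have hgg : g * g = 1 := by rw [← pow_two, ← hg, pow_orderOf_eq_one]
  have hg1 : g ≠ 1 := fun e => by rw [e, orderOf_one] at hg; omega
  have hzp : ∀ k ∈ zpowers g, k = 1 ∨ k = g := by
    rintro _ ⟨i, rfl⟩
    rcases Int.even_or_odd' i with ⟨j, rfl | rfl⟩
    · left
      beta_reduce
      rw [zpow_mul, zpow_two, hgg, one_zpow]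
    · right
      beta_reduce
      rw [zpow_add, zpow_mul, zpow_two, hgg, one_zpow, one_mul, zpow_one]
  have hFinv : g '' fixSet g = fixSet g := by
    apply Subset.antisymm
    · rintro _ ⟨w, hw, rfl⟩
      exact congrArg g hw
    · exact fun w hw => ⟨w, hw, hw⟩
  have hmW : m ∈ freePart g m := mem_connectedComponentIn hm
  have hgW : g '' freePart g m = freePart g m := by
    rw [freePart, image_frontier_component hFinv hm]
    exact (connectedComponentIn_eq hgm).symm
  have hkW : ∀ k ∈ zpowers g, k '' freePart g m = freePart g m :=
    fun k hk => image_eq_of_mem_zpowers hk hgW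
  obtain ⟨γ, hγ, hγ0, hγ1, hγW⟩ := exists_path_of_isOpen isOpen_freePart isPreconnected_freePart
    hmW hgm
  have := finite_zpowers (g := g) (by omega)
  obtain ⟨h, hh, hh1, c, hc, hcs, hcγ, -⟩ := exists_invariant_jordan (G := zpowers g)
    hγ.continuousOn (fun t _ k hk e => (hzp k hk).resolve_right fun hkg =>
      notMem_fixSet_of_mem_freePart (hγW t) (hkg ▸ e)) (Subgroup.mem_zpowers g) hg1
    (by rw [hγ0, hγ1])
  obtain rfl : h = g := (hzp h hh).resolve_left hh1
  have hcW : range c ⊆ freePart h m := by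
    rintro _ ⟨s, rfl⟩
    obtain ⟨k, hk, t, -, e⟩ := hcγ s
    rw [e, ← hkW k hk]
    exact mem_image_of_mem _ (hγW t)
  have hcs' : ∀ x, h (c x) = c (x + 1 / 2) := fun x => by rw [hcs, hg]; norm_num
  have hinv := image_range_of_shift hcs
  have hfc : ∀ u, h u = u → u ∉ range c := fun u hu h' =>
    notMem_fixSet_of_mem_freePart (hcW h') hu
  have huniq : ∀ u v, h u = u → h v = v → v ∈ side c u → v = u := by
    intro u v hu hv hvu
    have huc := hfc u hu
    obtain ⟨w, hw, hwu⟩ := hc.exists_notMem_side huc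
    have hsu : h '' side c u = side c u := by rw [image_side hinv huc, hu]
    have hsw : h '' side c w = side c w := by
      rw [← hc.compl_closure_side huc hw hwu, image_compl_eq h.bijective, h.image_closure, hsu]
    obtain ⟨b₀, hb₀, hb₀f⟩ := hc.exists_fixed_of_image_side c hw hsw
    have hb₀w : b₀ ∈ side c w := hb₀.resolve_right (hfc _ hb₀f)
    have hdisj : Disjoint (side c u) (side c w) := by
      rw [disjoint_left]
      intro q hq hq'
      refine hwu ?_
      rw [side_eq hq, ← side_eq hq']
      exact mem_side_self hw
    have hmeet : ∀ q, q ∉ range c → (side c q ∩ freePart h m).Nonempty := by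
      intro q hq
      rw [inter_comm]
      have : c 0 ∈ closure (side c q) := by
        rw [hc.closure_side hq]
        exact Or.inr (mem_range_self _)
      exact mem_closure_iff.1 this _ isOpen_freePart (hcW (mem_range_self _))
    obtain ⟨a, haU, b, hbV, ha, hb, β, hβ, -, hβF, hβd⟩ := exists_transversal Nat.prime_two hg
      (isOpen_freePart (g := h) (m := m)) isPreconnected_freePart
      (fun x => notMem_fixSet_of_mem_freePart) frontier_freePart (hc.isOpen_side (a := u))
      isPreconnected_side (hmeet u huc)
      ⟨u, mem_side_self huc, fun h' => notMem_fixSet_of_mem_freePart h' hu⟩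
      (hc.isOpen_side (a := w)) isPreconnected_side (hmeet w hw)
      ⟨b₀, hb₀w, fun h' => notMem_fixSet_of_mem_freePart h' hb₀f⟩ hdisj
    have hside := side_eq haU
    have key : ∀ e, h e = e → e ∈ side c u → e = a := fun e he heu =>
      fixed_unique_of_crosscut hc hgg hcs' hβ ha
        (hβd h (Subgroup.mem_zpowers h) hg1) hβF (hfc a ha) (hfc b hb)
        (fun h' => hdisj.le_bot ⟨by rw [hside]; exact h', hbV⟩) he (by rwa [← hside])
    rw [key v hv hvu, key u hu (mem_side_self huc)]
  have h1 : y ∉ side c x := fun h' => hxy (huniq x y hx hy h').symm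
  have h2 : z ∉ side c x := fun h' => hxz (huniq x z hx hz h').symm
  exact hyz (huniq y z hy hz (hc.side_eq_of_notMem (hfc x hx) (hfc y hy) h1 (hfc z hz) h2)).symm

lemma one_le_norm_sub_of_exp_eq_one {z w : ℂ} (hz : exp z = 1)
    (hw : exp w = 1) (h : z ≠ w) : 1 ≤ ‖z - w‖ := by
  have h1 : exp (z - w) = 1 := by rw [Complex.exp_sub, hz, hw, div_one]
  obtain ⟨n, hn⟩ := Complex.exp_eq_one_iff.1 h1
  have hn0 : n ≠ 0 := by
    rintro rfl
    exact h (sub_eq_zero.1 (by simpa using hn))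
  have h2 : (1 : ℝ) ≤ |(n : ℝ)| := by exact_mod_cast Int.one_le_abs hn0
  rw [hn]
  simp only [norm_mul, Complex.norm_intCast, Complex.norm_I, norm_real, Complex.norm_ofNat,
    mul_one, Real.norm_of_nonneg Real.pi_pos.le]
  nlinarith [Real.pi_gt_three]

/-- If a continuous function is `2πiℤ`-valued off the open set `O` and takes different values at two
points off `O`, then it takes different values at the endpoints of some component of `O`. -/
theorem exists_jump_gap {μ : ℝ → ℂ} {O : Set ℝ} {a b : ℝ} (hab : a ≤ b) (hO : IsOpen O) (ha : a ∉ O)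
    (hb : b ∉ O) (hμ : Continuous μ) (h1 : ∀ t ∉ O, exp (μ t) = 1) (hne : μ a ≠ μ b) :
    ∃ s q, s < q ∧ s ∉ O ∧ q ∉ O ∧ Ioo s q ⊆ O ∧ μ s ≠ μ q := by
  obtain ⟨s, ⟨⟨hs, hsO⟩, hsa⟩, hsm⟩ : ∃ s, IsGreatest ((Icc a b ∩ Oᶜ) ∩ {t | μ t = μ a}) s := by
    refine ((isCompact_Icc.inter_right hO.isClosed_compl).inter_right
      (isClosed_eq hμ continuous_const)).exists_isGreatest ?_
    exact ⟨a, ⟨left_mem_Icc.2 hab, ha⟩, rfl⟩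
  obtain ⟨q, ⟨⟨hq, hqO⟩, hqa⟩, hqm⟩ :
      ∃ q, IsLeast ((Icc s b ∩ Oᶜ) ∩ {t | 1 ≤ ‖μ t - μ a‖}) q := by
    refine ((isCompact_Icc.inter_right hO.isClosed_compl).inter_right
      (isClosed_le continuous_const (hμ.sub continuous_const).norm)).exists_isLeast ?_
    exact ⟨b, ⟨right_mem_Icc.2 hs.2, hb⟩,
      one_le_norm_sub_of_exp_eq_one (h1 b hb) (h1 a ha) hne.symm⟩
  have hsa' : μ s = μ a := hsa
  have hqa' : 1 ≤ ‖μ q - μ a‖ := hqa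
  have hsq : μ s ≠ μ q := by
    intro h
    rw [← h, hsa', sub_self, norm_zero] at hqa'
    linarith
  have hlt : s < q := lt_of_le_of_ne hq.1 fun h => hsq (by rw [h])
  refine ⟨s, q, hlt, hsO, hqO, fun t ht => ?_, hsq⟩
  by_contra htO
  by_cases h : μ t = μ a
  · exact absurd (hsm ⟨⟨⟨hs.1.trans ht.1.le, ht.2.le.trans hq.2⟩, htO⟩, h⟩) (not_le.2 ht.1)
  · exact absurd (hqm ⟨⟨⟨ht.1.le, ht.2.le.trans hq.2⟩, htO⟩,
      one_le_norm_sub_of_exp_eq_one (h1 t htO) (h1 a ha) h⟩) (not_le.2 ht.2)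

/-- The map which is `g` on `W` and the identity elsewhere. -/
noncomputable def foldMap (g : Sphere2 → Sphere2) (W : Set Sphere2) (z : Sphere2) : Sphere2 :=
  open Classical in if z ∈ W then g z else z

lemma foldMap_of_mem {g : Sphere2 → Sphere2} {W : Set Sphere2} {z : Sphere2} (h : z ∈ W) :
    foldMap g W z = g z := if_pos h

lemma foldMap_of_notMem {g : Sphere2 → Sphere2} {W : Set Sphere2} {z : Sphere2} (h : z ∉ W) :
    foldMap g W z = z := if_neg h

lemma continuous_foldMap {g : Sphere2 → Sphere2} {W : Set Sphere2} (hg : Continuous g)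
    (hW : ∀ z ∈ frontier W, g z = z) : Continuous (foldMap g W) := by
  classical
  exact Continuous.if hW hg continuous_id

/-- The circle of radius `r` about `x` in the stereographic chart from `w`. -/
noncomputable def scirc (x w : Sphere2) (r t : ℝ) : Sphere2 := sti w (st w x + r * circ t)

lemma continuous_scirc {x w : Sphere2} {r : ℝ} : Continuous (scirc x w r) := by
  have := isJordan_circ.cont
  exact (continuous_sti w).comp (by fun_prop)

lemma cr_scirc {x w : Sphere2} {r t : ℝ} : cr x w (scirc x w r t) = r * circ t := by
  rw [cr, scirc, st_sti]
  ring

lemma exp_eq_cr_scirc {x w : Sphere2} {r t : ℝ} (hr : 0 < r) :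
    exp (Real.log r + 2 * π * t * I) = cr x w (scirc x w r t) := by
  rw [cr_scirc, exp_add, circ, ← Complex.ofReal_exp, Real.exp_log hr]

lemma scirc_ne_left {x w : Sphere2} {r t : ℝ} (hr : 0 < r) : scirc x w r t ≠ x := by
  intro h
  have := cr_scirc (x := x) (w := w) (r := r) (t := t)
  rw [h, cr, sub_self, ← exp_eq_cr_scirc (x := x) (w := w) hr |>.trans cr_scirc] at this
  exact Complex.exp_ne_zero _ this.symm

lemma scirc_add_one {x w : Sphere2} {r t : ℝ} : scirc x w r (t + 1) = scirc x w r t := by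
  rw [scirc, scirc, isJordan_circ.per]

lemma isClosed_image_Icc {X : Type*} [TopologicalSpace X] [T2Space X] {c : ℝ → X}
    (hc : Continuous c) (s q : ℝ) : IsClosed (c '' Icc s q) :=
  (isCompact_Icc.image hc).isClosed

lemma not_conn_scirc {x w : Sphere2} {r : ℝ} (hr : 0 < r) (hxw : x ≠ w) {K : Set Sphere2}
    (hK : IsClosed K) (hs : range (scirc x w r) ⊆ K) : ¬ Conn Kᶜ x w := by
  intro h
  obtain ⟨L, hL, he⟩ := (hasLog_cr_of_conn hK hxw h).mono hs
  have h1 := sub_eq_sub_of_exp_eq (K := univ) (l := fun t => L (scirc x w r t))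
    (m := fun t : ℝ => Real.log r + 2 * π * t * I) isPreconnected_univ
    (hL.comp_continuous continuous_scirc fun t => mem_range_self t).continuousOn
    (by fun_prop) (fun t _ => by rw [he _ (mem_range_self t), exp_eq_cr_scirc hr])
    (mem_univ 0) (mem_univ (0 + 1))
  simp only [scirc_add_one] at h1
  rw [sub_right_inj] at h1
  simp at h1

/-- A piece of a small circle about a boundary point `x` of `W`, together with its mirror image,
separates `x` from `w`. -/
theorem exists_separating_piece {g : Sphere2 ≃ₜ Sphere2} (hgg : g * g = 1) {W : Set Sphere2}
    (hW : IsOpen W) (hWc : IsPreconnected W) (hgW : ∀ z ∈ W, g z ∉ W)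
    (hWf : ∀ z ∈ frontier W, g z = z) {x w : Sphere2} (hx : x ∈ frontier W) (hw : w ∈ W)
    {r : ℝ} (hr : 0 < r) :
    ∃ σ K : Set Sphere2, σ ⊆ range (scirc x w r) ∧ IsPreconnected σ ∧ IsClosed K ∧
      K ⊆ range (scirc x w r) ∪ g '' range (scirc x w r) ∧ K ∩ W ⊆ σ ∧ σ ⊆ W ∧ ¬ Conn Kᶜ x w := by
  have hgg' : ∀ z, g (g z) = z := fun z => congrArg (fun k : Sphere2 ≃ₜ Sphere2 => k z) hgg
  have hxW : x ∉ W := fun h => (hW.frontier_eq ▸ hx).2 h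
  have hxw : x ≠ w := fun h => hxW (h ▸ hw)
  have hc := continuous_scirc (x := x) (w := w) (r := r)
  have hgmem : ∀ z, g z ∈ W → z ∉ W := fun z h h' => hgW z h' h
  have hper : Function.Periodic (scirc x w r) 1 := fun t => scirc_add_one
  by_cases hS : range (scirc x w r) ⊆ W
  · have hcl : IsClosed (range (scirc x w r)) := by
      rw [← hper.image_Icc one_pos 0]
      exact isClosed_image_Icc hc _ _
    have hK : IsClosed (range (scirc x w r) ∪ g '' range (scirc x w r)) :=
      hcl.union (g.isClosedMap _ hcl)
    refine ⟨_, _, subset_rfl, isPreconnected_range hc, hK, subset_rfl, ?_, hS,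
      not_conn_scirc hr hxw hK subset_union_left⟩
    rintro z ⟨h | ⟨y, hy, rfl⟩, hz⟩
    · exact h
    · exact absurd (hS hy) (hgmem _ hz)
  obtain ⟨_, ⟨t₀, rfl⟩, ht₀⟩ := not_subset.1 hS
  set c := scirc x w r with hcdef
  have hπ := continuous_foldMap g.continuous hWf
  have hclK' : IsClosed (range fun t => foldMap g W (c t)) := by
    have : Function.Periodic (fun t => foldMap g W (c t)) 1 := fun t => by beta_reduce; rw [hper t]
    rw [← this.image_Icc one_pos 0]
    exact isClosed_image_Icc (hπ.comp hc) _ _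
  have hconn : Conn (range fun t => foldMap g W (c t))ᶜ x w := by
    refine ⟨insert x W, ?_, hWc.subset_closure (subset_insert _ _)
      (insert_subset hx.1 subset_closure), mem_insert _ _, mem_insert_of_mem _ hw⟩
    rintro z hz ⟨t, rfl⟩
    beta_reduce at hz
    by_cases h : c t ∈ W
    · rw [foldMap_of_mem h] at hz
      rcases hz with hz | hz
      · refine hxW ?_
        rw [← hWf x hx, ← hz, hgg']
        exact h
      · exact hgW _ h hz
    · rw [foldMap_of_notMem h] at hz
      rcases hz with hz | hz
      · exact scirc_ne_left hr hz
      · exact h hz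
  obtain ⟨L', hL', he'⟩ := hasLog_cr_of_conn hclK' hxw hconn
  have hL'c : Continuous fun t => L' (foldMap g W (c t)) :=
    hL'.comp_continuous (hπ.comp hc) fun t => mem_range_self t
  have hα : Continuous fun t : ℝ => (Real.log r + 2 * π * t * I : ℂ) := by fun_prop
  obtain ⟨s, q, hsq, hs, hq, hgap, hne⟩ := exists_jump_gap (O := c ⁻¹' W)
    (μ := fun t => Real.log r + 2 * π * t * I - L' (foldMap g W (c t)))
    (by linarith : t₀ ≤ t₀ + 1) (hW.preimage hc) ht₀ (by rw [mem_preimage, hper]; exact ht₀)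
    (hα.sub hL'c) (by
      intro t ht
      have ht' : c t ∉ W := ht
      rw [Complex.exp_sub, exp_eq_cr_scirc (x := x) (w := w) hr, he' _ (mem_range_self t),
        foldMap_of_notMem ht']
      refine div_self (cr_ne_zero hxw (scirc_ne_left hr) ?_)
      exact sti_ne _ _)
    (by
      simp only [hper t₀]
      intro h
      rw [sub_left_inj] at h
      simp at h)
  have hIcc : Icc s q ⊆ c ⁻¹' closure W := by
    rw [← closure_Ioo hsq.ne]
    exact (closure_mono hgap).trans (hc.closure_preimage_subset W)
  have hfr : ∀ t ∈ Icc s q, c t ∉ W → g (c t) = c t := fun t ht h =>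
    hWf _ (by rw [hW.frontier_eq]; exact ⟨hIcc ht, h⟩)
  have hfold : ∀ t ∈ Icc s q, foldMap g W (c t) = g (c t) := by
    intro t ht
    by_cases h : c t ∈ W
    · exact foldMap_of_mem h
    · rw [foldMap_of_notMem h, hfr t ht h]
  have hK : IsClosed (c '' Icc s q ∪ g '' (c '' Icc s q)) :=
    (isClosed_image_Icc hc _ _).union (g.isClosedMap _ (isClosed_image_Icc hc _ _))
  have hcl : ∀ t ∈ Icc s q, c t ∈ W → t ∈ Ioo s q := fun t ht h =>
    ⟨lt_of_le_of_ne ht.1 fun e => hs (by rw [e]; exact h),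
      lt_of_le_of_ne ht.2 fun e => hq (by rw [← e]; exact h)⟩
  refine ⟨c '' Ioo s q, _, image_subset_range _ _, isPreconnected_Ioo.image _ hc.continuousOn, hK,
    union_subset_union (image_subset_range _ _) (image_mono (image_subset_range _ _)), ?_,
    image_subset_iff.2 hgap, fun hconnK => hne ?_⟩
  · rintro z ⟨⟨t, ht, rfl⟩ | ⟨_, ⟨t, ht, rfl⟩, rfl⟩, hz⟩
    · exact ⟨t, hcl t ht hz, rfl⟩
    · have h1 := hgmem _ hz
      rw [hfr t ht h1] at hz
      exact absurd hz h1
  · obtain ⟨L, hL, he⟩ := hasLog_cr_of_conn hK hxw hconnK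
    have m1 : ∀ t ∈ Icc s q, c t ∈ c '' Icc s q ∪ g '' (c '' Icc s q) := fun t ht =>
      Or.inl (mem_image_of_mem _ ht)
    have m2 : ∀ t ∈ Icc s q, g (c t) ∈ c '' Icc s q ∪ g '' (c '' Icc s q) := fun t ht =>
      Or.inr (mem_image_of_mem _ (mem_image_of_mem _ ht))
    have e1 := sub_eq_sub_of_exp_eq (l := fun t : ℝ => Real.log r + 2 * π * t * I)
      (m := fun t => L (c t)) isPreconnected_Icc hα.continuousOn (hL.comp hc.continuousOn m1)
      (fun t ht => by rw [he _ (m1 t ht), exp_eq_cr_scirc hr]) (left_mem_Icc.2 hsq.le)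
      (right_mem_Icc.2 hsq.le)
    have e2 := sub_eq_sub_of_exp_eq (l := fun t => L' (foldMap g W (c t)))
      (m := fun t => L (g (c t))) isPreconnected_Icc hL'c.continuousOn
      (hL.comp (g.continuous.comp hc).continuousOn m2)
      (fun t ht => by rw [he _ (m2 t ht), he' _ (mem_range_self t), hfold t ht])
      (left_mem_Icc.2 hsq.le) (right_mem_Icc.2 hsq.le)
    beta_reduce at e1 e2 ⊢
    rw [hfr s (left_mem_Icc.2 hsq.le) hs, hfr q (right_mem_Icc.2 hsq.le) hq] at e2
    linear_combination e1 - e2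

lemma blc_of_reflection {g : Sphere2 ≃ₜ Sphere2} (hgg : g * g = 1) {W : Set Sphere2}
    (hW : IsOpen W) (hWc : IsPreconnected W) (hgW : ∀ z ∈ W, g z ∉ W)
    (hWf : ∀ z ∈ frontier W, g z = z) {x : Sphere2} (hx : x ∈ frontier W) : BLC W x := by
  obtain ⟨w, hw⟩ : W.Nonempty := closure_nonempty_iff.1 ⟨x, hx.1⟩
  have hxW : x ∉ W := fun h => (hW.frontier_eq ▸ hx).2 h
  have hxw : x ≠ w := fun h => hxW (h ▸ hw)
  have hsx : sti w (st w x) = x := sti_st hxw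
  have hsmall : ∀ N ∈ 𝓝 x, ∃ R > 0, sti w '' closedBall (st w x) R ⊆ N := by
    intro N hN
    have : sti w ⁻¹' N ∈ 𝓝 (st w x) := (continuous_sti w).continuousAt (by rwa [hsx])
    obtain ⟨R, hR, h⟩ := Metric.nhds_basis_closedBall.mem_iff.1 this
    exact ⟨R, hR, image_subset_iff.2 h⟩
  intro N hN
  obtain ⟨R, hR, hRN⟩ := hsmall N hN
  set D := sti w '' closedBall (st w x) R with hD
  have hDn : D ∈ 𝓝 x := by
    have := (isOpenEmbedding_sti w).isOpenMap.image_mem_nhds (closedBall_mem_nhds (st w x) hR)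
    rwa [hsx] at this
  have hDc : IsPreconnected Dᶜ := by
    have h : D = (fun z => sti w (st w x + R * z)) '' closedBall 0 1 := by
      rw [hD, ← image_image (sti w) (fun z => st w x + R * z)]
      congr 1
      ext z
      constructor
      · intro hz
        refine ⟨(z - st w x) / R, ?_, ?_⟩
        · rw [mem_closedBall_zero_iff, norm_div, norm_real, Real.norm_of_nonneg hR.le,
            div_le_one hR, ← dist_eq_norm]
          exact hz
        · have : (R : ℂ) ≠ 0 := by exact_mod_cast hR.ne'
          field_simp
          ring
      · rintro ⟨y, hy, rfl⟩
        rw [mem_closedBall_zero_iff] at hy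
        rw [mem_closedBall_iff_norm, add_sub_cancel_left, norm_mul, norm_real,
          Real.norm_of_nonneg hR.le]
        nlinarith
    rw [h]
    refine isPreconnected_compl_disc ((continuous_sti w).comp (by fun_prop)).continuousOn ?_
    intro y _ z _ hyz
    have h1 := sti_injective w hyz
    have : (R : ℂ) ≠ 0 := by exact_mod_cast hR.ne'
    exact mul_left_cancel₀ this (add_left_cancel h1)
  have hwD : w ∈ Dᶜ := by
    rintro ⟨z, -, h⟩
    exact sti_ne w z h
  obtain ⟨r, hr, hrD⟩ := hsmall (D ∩ g ⁻¹' D) (inter_mem hDn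
    (g.continuous.continuousAt (by rwa [hWf x hx])))
  have hSD : range (scirc x w r) ⊆ D ∩ g ⁻¹' D := by
    refine Subset.trans ?_ hrD
    rintro _ ⟨t, rfl⟩
    exact mem_image_of_mem _ (by simp [abs_of_pos hr])
  obtain ⟨σ, K, hσS, hσc, hK, hKS, hKσ, hσW, hsep⟩ :=
    exists_separating_piece hgg hW hWc hgW hWf hx hw hr
  have hKD : K ⊆ D := hKS.trans (union_subset (hSD.trans inter_subset_left)
    (image_subset_iff.2 (hSD.trans inter_subset_right)))
  have hxK : x ∉ K := by
    intro h
    rcases hKS h with ⟨t, h⟩ | ⟨_, ⟨t, rfl⟩, h⟩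
    · exact scirc_ne_left hr h
    · exact scirc_ne_left hr (g.injective (h.trans (hWf x hx).symm))
  set U := connectedComponentIn Kᶜ x with hU
  have hUD : U ⊆ D := by
    intro y hy
    by_contra h
    exact hsep (((conn_iff_mem_connectedComponentIn hxK).2 hy).trans
      ((hDc.conn h hwD).mono (compl_subset_compl.2 hKD)))
  have hUo : IsOpen U := hK.isOpen_compl.connectedComponentIn
  refine ⟨U, hUo.mem_nhds (mem_connectedComponentIn hxK), ?_⟩
  have key : ∀ v ∈ W ∩ U, ∃ y ∈ σ, Conn (W ∩ N) v y := by
    intro v hv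
    have hf := frontier_connectedComponentIn_subset (a := v) (hW.inter hUo)
    obtain ⟨y, hyW, hy⟩ : (W ∩ frontier (connectedComponentIn (W ∩ U) v)).Nonempty := by
      rw [nonempty_iff_ne_empty]
      intro h
      have := subset_of_disjoint_frontier hWc ⟨v, hv.1, mem_connectedComponentIn hv⟩ h hw
      exact hwD (hUD (connectedComponentIn_subset _ _ this).2)
    have hyU : y ∉ U := fun h => hf hy ⟨hyW, h⟩
    have hyK : y ∈ K := by
      have : y ∈ frontier U := by
        rw [hUo.frontier_eq]
        exact ⟨closure_mono ((connectedComponentIn_subset _ _).trans inter_subset_right) hy.1, hyU⟩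
      simpa using frontier_connectedComponentIn_subset hK.isOpen_compl this
    refine ⟨y, hKσ ⟨hyK, hyW⟩, insert y (connectedComponentIn (W ∩ U) v), ?_,
      isPreconnected_connectedComponentIn.subset_closure (subset_insert _ _)
      (insert_subset hy.1 subset_closure), mem_insert_of_mem _ (mem_connectedComponentIn hv),
      mem_insert _ _⟩
    refine insert_subset ⟨hyW, hRN (hKD hyK)⟩ ((connectedComponentIn_subset _ _).trans ?_)
    exact inter_subset_inter_right _ (hUD.trans hRN)
  intro w₁ hw₁ w₂ hw₂
  obtain ⟨y₁, hy₁, h₁⟩ := key w₁ hw₁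
  obtain ⟨y₂, hy₂, h₂⟩ := key w₂ hw₂
  exact h₁.trans (((hσc.conn hy₁ hy₂).mono (subset_inter hσW
    ((hσS.trans hSD).trans (inter_subset_left.trans hRN)))).trans h₂.symm)

lemma IsDisc.isJordan {Φ : ℂ → Sphere2} {W : Set Sphere2} (h : IsDisc Φ W) :
    IsJordan fun t => Φ (circ t) := by
  have hm : ∀ t, circ t ∈ closedBall (0 : ℂ) 1 := fun t => by simp
  refine ⟨h.cont.comp_continuous isJordan_circ.cont hm, fun t => ?_, fun s hs t ht e => ?_⟩
  · rw [isJordan_circ.per]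
  · exact isJordan_circ.inj hs ht (h.inj (hm s) (hm t) e)

/-- An involution with at least three fixed points is a topological reflection: its fixed point set
is a Jordan curve, and it exchanges the two sides of that curve. -/
theorem exists_jordan_of_three_fixed {g : Sphere2 ≃ₜ Sphere2} (hg : orderOf g = 2)
    {x y z : Sphere2} (hx : g x = x) (hy : g y = y) (hz : g z = z) (hxy : x ≠ y) (hxz : x ≠ z)
    (hyz : y ≠ z) :
    ∃ c, IsJordan c ∧ fixSet g = range c ∧ ∀ a, a ∉ range c → g a ∉ side c a := by
  have hgg : g * g = 1 := by rw [← pow_two, ← hg, pow_orderOf_eq_one]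
  have hgg' : ∀ z, g (g z) = z := fun z => congrArg (fun k : Sphere2 ≃ₜ Sphere2 => k z) hgg
  obtain ⟨m, hm⟩ := exists_notMem_fixSet (g := g) fun e => by rw [e, orderOf_one] at hg; omega
  set W := freePart g m with hWdef
  have hmW : m ∈ W := mem_connectedComponentIn hm
  have hW : IsOpen W := isOpen_freePart
  have hWc : IsPreconnected W := isPreconnected_freePart
  have hWF : ∀ z ∈ W, z ∉ fixSet g := fun z => notMem_fixSet_of_mem_freePart
  have hgW : ∀ z ∈ W, g z ∉ W := by
    intro u hu
    have : W = freePart g u := connectedComponentIn_eq hu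
    rw [this]
    exact apply_notMem_freePart hg hx hy hz hxy hxz hyz (hWF u hu)
  have hWf : ∀ z ∈ frontier W, g z = z := fun z hz => frontier_freePart hz
  set V := g '' W with hVdef
  have hV : IsOpen V := g.isOpenMap _ hW
  have hVc : IsPreconnected V := hWc.image _ g.continuous.continuousOn
  have hfV : frontier V = frontier W := by
    rw [hVdef, ← g.image_frontier]
    ext u
    constructor
    · rintro ⟨u, hu, rfl⟩
      rwa [hWf u hu]
    · exact fun hu => ⟨u, hu, hWf u hu⟩
  have hVW : V ⊆ Wᶜ := by
    rintro _ ⟨u, hu, rfl⟩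
    exact hgW u hu
  have hVcl : closure V ⊆ Wᶜ := closure_minimal hVW hW.isClosed_compl
  have hgm : g m ∈ V := mem_image_of_mem _ hmW
  have hv : g m ∉ closure W := by
    rw [closure_eq_self_union_frontier]
    rintro (h | h)
    · exact hgW m hmW h
    · exact hm ((hgg' m ▸ hWf _ h).symm)
  have key : ∀ u ∈ Wᶜ, Conn Wᶜ u (g m) := by
    intro u hu
    by_cases huf : u ∈ closure W
    · have : u ∈ closure V := by
        rw [closure_eq_self_union_frontier, hfV, hW.frontier_eq]
        exact Or.inr ⟨huf, hu⟩
      exact (hVc.closure.conn this (subset_closure hgm)).mono hVcl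
    · set C := connectedComponentIn (closure W)ᶜ u with hC
      have huC : u ∈ C := mem_connectedComponentIn huf
      have hCW : C ⊆ Wᶜ :=
        (connectedComponentIn_subset _ _).trans (compl_subset_compl.2 subset_closure)
      have hCW' : closure C ⊆ Wᶜ := closure_minimal hCW hW.isClosed_compl
      obtain ⟨y, hy⟩ : (frontier C).Nonempty := by
        rw [nonempty_iff_ne_empty]
        intro h
        exact hCW (subset_of_disjoint_frontier isPreconnected_univ ⟨u, mem_univ _, huC⟩
          (by rw [h, inter_empty]) (mem_univ m)) hmW
      have hyW : y ∈ closure W := by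
        simpa using frontier_connectedComponentIn_subset isClosed_closure.isOpen_compl hy
      have hyV : y ∈ closure V := by
        rw [closure_eq_self_union_frontier, hfV, hW.frontier_eq]
        exact Or.inr ⟨hyW, hCW' hy.1⟩
      exact ((isPreconnected_connectedComponentIn.closure.conn (subset_closure huC) hy.1).mono
        hCW').trans ((hVc.closure.conn hyV (subset_closure hgm)).mono hVcl)
  have hW' : IsPreconnected Wᶜ :=
    isPreconnected_of_conn fun a ha b hb => (key a ha).trans (key b hb).symm
  obtain ⟨Φ, hΦ, -⟩ := exists_isDisc hW hWc hW' hv hmW fun a ha =>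
    blc_of_reflection hgg hW hWc hgW hWf ha
  have hc := hΦ.isJordan
  have hr : range (fun t => Φ (circ t)) = frontier W := by
    rw [← hΦ.image_sphere hW, ← range_circ, ← range_comp]
    rfl
  set c := fun t => Φ (circ t) with hcdef
  have hside : ∀ (Y : Set Sphere2) (u : Sphere2), IsOpen Y → IsPreconnected Y → u ∈ Y →
      frontier Y = range c → side c u = Y := by
    intro Y u hY hYc hu hf
    have hd : ∀ v ∈ Y, v ∉ range c := fun v hv h => by
      rw [← hf, hY.frontier_eq] at h
      exact h.2 hv
    refine (subset_of_disjoint_frontier isPreconnected_side ⟨u, mem_side_self (hd u hu), hu⟩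
      ?_).antisymm (subset_side hYc hu hd)
    rw [hf]
    exact (disjoint_left.2 fun v hv => side_subset _ _ hv).inter_eq
  have hsW := hside W m hW hWc hmW hr.symm
  have hsV := hside V (g m) hV hVc hgm (hfV.trans hr.symm)
  have hmc : m ∉ range c := by
    rw [hr, hW.frontier_eq]
    exact fun h => h.2 hmW
  have hgmc : g m ∉ range c := by
    rw [hr, hW.frontier_eq]
    exact fun h => hv h.1
  have hcases : ∀ a, a ∉ range c → a ∈ W ∨ a ∈ V := by
    intro a ha
    by_cases h : a ∈ W
    · exact Or.inl h
    · right
      rw [← hsV]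
      exact hc.side_eq_of_notMem hmc hgmc (by rw [hsW]; exact hVW hgm) ha (by rwa [hsW])
  refine ⟨c, hc, ?_, fun a ha => ?_⟩
  · apply Subset.antisymm
    · intro a ha
      by_contra h
      rcases hcases a h with h | ⟨b, hb, rfl⟩
      · exact hWF a h ha
      · exact hWF b hb (g.injective ha)
    · rw [hr]
      exact hWf
  · rcases hcases a ha with h | ⟨b, hb, rfl⟩
    · rw [← side_eq (by rwa [hsW] : a ∈ side c m), hsW]
      exact hgW a h
    · rw [← side_eq (by rw [hsV]; exact mem_image_of_mem _ hb : g b ∈ side c (g m)), hsV, hgg']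
      exact fun h => hVW h hb

/-- The horizontal coordinates of a point of the sphere, as a complex number. -/
noncomputable def xy (v : Sphere2) : ℂ := ⟨v.1 0, v.1 1⟩

/-- The vertical coordinate of a point of the sphere. -/
noncomputable def ht (v : Sphere2) : ℝ := v.1 2

lemma continuous_xy : Continuous xy := by
  have h : ∀ i, Continuous fun v : Sphere2 => v.1 i := fun i => by fun_prop
  have : xy = fun v => (v.1 0 : ℂ) + (v.1 1 : ℂ) * I := by
    ext v
    exact Complex.mk_eq_add_mul_I _ _
  rw [this]
  exact (Complex.continuous_ofReal.comp (h 0)).add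
    ((Complex.continuous_ofReal.comp (h 1)).mul continuous_const)

lemma continuous_ht : Continuous ht := by
  unfold ht
  fun_prop

lemma norm_xy_sq_add (v : Sphere2) : ‖xy v‖ ^ 2 + ht v ^ 2 = 1 := by
  have h : ‖v.1‖ = 1 := mem_sphere_zero_iff_norm.1 v.2
  have h2 := EuclideanSpace.norm_sq_eq v.1
  rw [h, Fin.sum_univ_three] at h2
  simp only [Real.norm_eq_abs, sq_abs] at h2
  rw [Complex.sq_norm, normSq_apply, xy, ht]
  simp only
  linarith

lemma sphere_ext {v w : Sphere2} (h1 : xy v = xy w) (h2 : ht v = ht w) : v = w := by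
  have h3 := congrArg Complex.re h1
  have h4 := congrArg Complex.im h1
  ext i
  fin_cases i
  · exact h3
  · exact h4
  · exact h2

/-- The point of the sphere with the given coordinates, provided that these satisfy the equation of
the sphere. -/
noncomputable def pt (z : ℂ) (t : ℝ) : Sphere2 :=
  open Classical in
  if h : ‖z‖ ^ 2 + t ^ 2 = 1 then
    ⟨!₂[z.re, z.im, t], by
      rw [mem_sphere_zero_iff_norm, ← sq_eq_sq₀ (norm_nonneg _) zero_le_one,
        EuclideanSpace.norm_sq_eq, Fin.sum_univ_three]
      rw [Complex.sq_norm, normSq_apply] at h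
      simp
      linarith⟩
  else Classical.arbitrary _

lemma xy_pt {z : ℂ} {t : ℝ} (h : ‖z‖ ^ 2 + t ^ 2 = 1) : xy (pt z t) = z := by
  rw [pt, dif_pos h, xy]
  simp

lemma ht_pt {z : ℂ} {t : ℝ} (h : ‖z‖ ^ 2 + t ^ 2 = 1) : ht (pt z t) = t := by
  rw [pt, dif_pos h, ht]
  simp

lemma pt_xy_ht (v : Sphere2) : pt (xy v) (ht v) = v :=
  sphere_ext (xy_pt (norm_xy_sq_add v)) (ht_pt (norm_xy_sq_add v))

lemma continuous_pt {X : Type*} [TopologicalSpace X] {z : X → ℂ} {t : X → ℝ} (hz : Continuous z)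
    (ht : Continuous t) (h : ∀ x, ‖z x‖ ^ 2 + t x ^ 2 = 1) : Continuous fun x => pt (z x) (t x) := by
  rw [continuous_induced_rng]
  have : (Subtype.val ∘ fun x => pt (z x) (t x)) = fun x => !₂[(z x).re, (z x).im, t x] := by
    ext x
    simp only [Function.comp, pt, dif_pos (h x)]
  rw [this]
  refine (PiLp.continuous_toLp 2 _).comp (continuous_pi fun i => ?_)
  fin_cases i
  · exact Complex.continuous_re.comp hz
  · exact Complex.continuous_im.comp hz
  · exact ht

lemma norm_xy_le (v : Sphere2) : ‖xy v‖ ≤ 1 := by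
  nlinarith [norm_xy_sq_add v, norm_nonneg (xy v), sq_nonneg (ht v)]

lemma norm_xy_eq_one {v : Sphere2} (h : ht v = 0) : ‖xy v‖ = 1 := by
  have := norm_xy_sq_add v
  rw [h] at this
  nlinarith [norm_nonneg (xy v)]

lemma norm_xy_lt_one {v : Sphere2} (h : ht v ≠ 0) : ‖xy v‖ < 1 := by
  have : 0 < ht v ^ 2 := by positivity
  nlinarith [norm_xy_sq_add v, norm_nonneg (xy v)]

lemma apply_apply_of_mul_self {g : Sphere2 ≃ₜ Sphere2} (h : g * g = 1) (z : Sphere2) :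
    g (g z) = z := congrArg (fun k : Sphere2 ≃ₜ Sphere2 => k z) h

/-- An involution which exchanges the sides of a Jordan curve and acts on the curve as a rotation is
conjugate to a linear map. -/
theorem exists_conj_of_swap {f : Sphere2 ≃ₜ Sphere2} (hff : f * f = 1) {c : ℝ → Sphere2}
    (hc : IsJordan c) {δ : ℝ} {n : ℤ} (hδ : 2 * δ = n) (hcs : ∀ x, f (c x) = c (x + δ))
    {a : Sphere2} (ha : a ∉ range c) (hs : f a ∉ side c a) :
    ∃ H : Sphere2 ≃ₜ Sphere2, H (pt 0 1) = a ∧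
      ∀ v w, xy w = circ δ * xy v → ht w = - ht v → f (H v) = H w := by
  classical
  have hff' := apply_apply_of_mul_self hff
  obtain ⟨Ψ, hΨ, hΨ0, hΨc⟩ := hc.exists_schoenflies ha
  have hcirc : ∀ x y, circ (x + y) = circ x * circ y := by
    intro x y
    rw [circ, circ, circ, ← exp_add]
    push_cast
    ring_nf
  have hωω : circ δ * circ δ = 1 := by
    rw [← hcirc, ← two_mul, hδ]
    have : circ ((n : ℝ)) = circ 0 := isJordan_circ.eq_iff.2 ⟨n, by simp⟩
    rw [this]
    simp [circ]
  have hωω' : ∀ z, circ δ * (circ δ * z) = z := fun z => by rw [← mul_assoc, hωω, one_mul]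
  have hm : ∀ v, xy v ∈ closedBall (0 : ℂ) 1 := fun v => by simpa using norm_xy_le v
  have hm' : ∀ v, circ δ * xy v ∈ closedBall (0 : ℂ) 1 := fun v => by simpa using norm_xy_le v
  have hinv := image_range_of_shift hcs
  have heq : ∀ v, ht v = 0 → Ψ (xy v) ∈ range c ∧ Ψ (xy v) = f (Ψ (circ δ * xy v)) := by
    intro v hv
    obtain ⟨x, hx⟩ : xy v ∈ range circ := by
      rw [range_circ]
      simpa using norm_xy_eq_one hv
    rw [← hx, ← hcirc, hΨc, hΨc, hcs]
    refine ⟨mem_range_self _, hc.eq_iff.2 ⟨-n, ?_⟩⟩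
    push_cast
    linarith
  have hW := hc.isOpen_side (a := a)
  have hball : ∀ z : ℂ, ‖z‖ < 1 → Ψ z ∈ side c a := fun z hz => by
    rw [← hΨ.image_ball]
    exact mem_image_of_mem _ (by simpa using hz)
  have hup : ∀ v, ht v ≠ 0 → Ψ (xy v) ∈ side c a := fun v hv => hball _ (norm_xy_lt_one hv)
  have hlow : ∀ v, ht v ≠ 0 → f (Ψ (circ δ * xy v)) ∈ side c (f a) := fun v hv => by
    rw [← image_side hinv ha]
    exact mem_image_of_mem _ (hball _ (by simpa using norm_xy_lt_one hv))
  have hdisj : ∀ z, z ∈ side c a → z ∉ side c (f a) := by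
    intro z h1 h2
    refine hs ?_
    rw [side_eq h1, ← side_eq h2]
    exact mem_side_self (notMem_range_of_invariant hinv ha)
  set H : Sphere2 → Sphere2 := fun v => if 0 ≤ ht v then Ψ (xy v) else f (Ψ (circ δ * xy v))
    with hH
  have Hpos : ∀ v, 0 ≤ ht v → H v = Ψ (xy v) := fun v hv => if_pos hv
  have Hneg : ∀ v, ht v ≤ 0 → H v = f (Ψ (circ δ * xy v)) := by
    intro v hv
    rcases hv.lt_or_eq with h | h
    · exact if_neg (not_le.2 h)
    · rw [Hpos v h.ge, (heq v h).2]
  have Hc : Continuous H := by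
    refine Continuous.if_le ?_ ?_ continuous_const continuous_ht fun v hv => (heq v hv.symm).2
    · exact hΨ.cont.comp_continuous continuous_xy hm
    · exact f.continuous.comp (hΨ.cont.comp_continuous (continuous_const.mul continuous_xy) hm')
  have hsurjdisc : ∀ y ∈ closure (side c a), ∃ z : ℂ, ‖z‖ ≤ 1 ∧ Ψ z = y := by
    intro y hy
    rw [← hΨ.image_closedBall] at hy
    obtain ⟨z, hz, rfl⟩ := hy
    exact ⟨z, by simpa using hz, rfl⟩
  have hsq : ∀ z : ℂ, ‖z‖ ≤ 1 → ‖z‖ ^ 2 + √(1 - ‖z‖ ^ 2) ^ 2 = 1 := by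
    intro z hz
    rw [Real.sq_sqrt (by nlinarith [norm_nonneg z])]
    ring
  have hsq' : ∀ z : ℂ, ‖z‖ ≤ 1 → ‖circ δ * z‖ ^ 2 + (-√(1 - ‖z‖ ^ 2)) ^ 2 = 1 := by
    intro z hz
    rw [norm_mul, norm_circ, one_mul, neg_sq, hsq z hz]
  have Hinj : Function.Injective H := by
    have hinjΨ : ∀ v w, Ψ (xy v) = Ψ (xy w) → xy v = xy w := fun v w h => hΨ.inj (hm v) (hm w) h
    have hht : ∀ v w, xy v = xy w → 0 ≤ ht v * ht w → v = w := by
      intro v w h h'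
      refine sphere_ext h ?_
      have h1 := norm_xy_sq_add v
      rw [h] at h1
      have h2 : ht v ^ 2 = ht w ^ 2 := by linarith [norm_xy_sq_add w]
      rcases sq_eq_sq_iff_eq_or_eq_neg.1 h2 with e | e
      · exact e
      · rw [e] at h' ⊢
        have : ht w = 0 := by nlinarith
        rw [this, neg_zero]
    have mixed : ∀ v w, 0 ≤ ht v → ht w < 0 → H v ≠ H w := by
      intro v w hv hw h
      rw [Hpos v hv, Hneg w hw.le] at h
      have h1 := hlow w hw.ne
      rw [← h] at h1
      rcases hv.lt_or_eq with h2 | h2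
      · exact hdisj _ (hup v h2.ne') h1
      · exact side_subset _ _ h1 (heq v h2.symm).1
    intro v w h
    rcases le_or_gt 0 (ht v) with h1 | h1 <;> rcases le_or_gt 0 (ht w) with h2 | h2
    · rw [Hpos v h1, Hpos w h2] at h
      exact hht v w (hinjΨ v w h) (mul_nonneg h1 h2)
    · exact absurd h (mixed v w h1 h2)
    · exact absurd h.symm (mixed w v h2 h1)
    · rw [Hneg v h1.le, Hneg w h2.le] at h
      have h3 := hΨ.inj (hm' v) (hm' w) (f.injective h)
      have h4 : xy v = xy w := by rw [← hωω' (xy v), h3, hωω']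
      exact hht v w h4 (mul_nonneg_of_nonpos_of_nonpos h1.le h2.le)
  have Hsurj : Function.Surjective H := by
    intro y
    by_cases hy : y ∈ closure (side c a)
    · obtain ⟨z, hz, rfl⟩ := hsurjdisc y hy
      refine ⟨pt z √(1 - ‖z‖ ^ 2), ?_⟩
      rw [Hpos _ (by rw [ht_pt (hsq z hz)]; exact Real.sqrt_nonneg _), xy_pt (hsq z hz)]
    · have hfy : f y ∈ closure (side c a) := by
        have h1 : y ∈ side c (f a) := by
          rw [← hc.compl_closure_side ha (notMem_range_of_invariant hinv ha) hs]
          exact hy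
        rw [← image_side hinv ha] at h1
        obtain ⟨u, hu, rfl⟩ := h1
        rw [hff']
        exact subset_closure hu
      obtain ⟨z, hz, hzy⟩ := hsurjdisc _ hfy
      refine ⟨pt (circ δ * z) (-√(1 - ‖z‖ ^ 2)), ?_⟩
      rw [Hneg _ (by rw [ht_pt (hsq' z hz)]; simp), xy_pt (hsq' z hz), hωω', hzy, hff']
  refine ⟨Continuous.homeoOfEquivCompactToT2 (f := Equiv.ofBijective H ⟨Hinj, Hsurj⟩) Hc,
    ?_, fun v w h1 h2 => ?_⟩
  · show H (pt 0 1) = a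
    have h01 : ‖(0 : ℂ)‖ ^ 2 + (1 : ℝ) ^ 2 = 1 := by simp
    rw [Hpos _ (by rw [ht_pt h01]; exact zero_le_one), xy_pt h01, hΨ0]
  · show f (H v) = H w
    rcases le_total 0 (ht v) with h | h
    · rw [Hpos v h, Hneg w (by linarith), h1, hωω']
    · rw [Hneg v h, Hpos w (by linarith), h1, hff']

lemma exists_mem_zpowers_prime {G : Type*} [Group G] {k : G} (hk : 0 < orderOf k) (hk1 : k ≠ 1) :
    ∃ g ∈ zpowers k, (orderOf g).Prime := by
  have h1 : orderOf k ≠ 1 := fun h => hk1 (orderOf_eq_one_iff.1 h)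
  refine ⟨k ^ (orderOf k / (orderOf k).minFac), Subgroup.npow_mem_zpowers _ _, ?_⟩
  rw [orderOf_pow_orderOf_div hk.ne' (Nat.minFac_dvd _)]
  exact Nat.minFac_prime h1

/-- An arc joining two fixed points of a periodic map and disjoint from its translates. -/
structure IsSpine (f : Sphere2 ≃ₜ Sphere2) (β : ℝ → Sphere2) (a b : Sphere2) : Prop where
  pos : 0 < orderOf f
  ne_one : f ≠ 1
  fix_left : f a = a
  fix_right : f b = b
  arc : IsArc β a b
  disj : ∀ k ∈ zpowers f, k ≠ 1 → ArcDisj β (k ∘ β)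
  free : ∀ k ∈ zpowers f, k ≠ 1 → ∀ x, k x = x → x = a ∨ x = b

lemma exists_isSpine {f : Sphere2 ≃ₜ Sphere2} {a b : Sphere2} (hf : 0 < orderOf f) (hf1 : f ≠ 1)
    (hab : a ≠ b) (ha : f a = a) (hb : f b = b)
    (hfree : ∀ k ∈ zpowers f, k ≠ 1 → ∀ x, k x = x → x = a ∨ x = b) :
    ∃ β, IsSpine f β a b := by
  have : Finite (zpowers f) := finite_zpowers hf
  obtain ⟨U, V, hU, hUc, hV, hVc, haU, hbV, hUV⟩ := exists_disjoint_regions hab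
  have hW : IsOpen ({a, b}ᶜ : Set Sphere2) := (Set.toFinite _).isClosed.isOpen_compl
  have hmeet : ∀ U : Set Sphere2, IsOpen U → U.Nonempty → (U ∩ {a, b}ᶜ).Nonempty := by
    intro U hU hne
    rw [inter_compl_nonempty_iff]
    intro hsub
    have h1 : U = univ := by
      refine IsClopen.eq_univ ⟨((Set.toFinite _).subset hsub).isClosed, hU⟩ hne
    obtain ⟨c, hc⟩ := exists_ne_ne (x := pt 1 0) (y := pt 0 1) (z := pt 0 (-1))
      (fun h => by simpa [ht_pt] using congrArg ht h) (fun h => by simpa [ht_pt] using congrArg ht h)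
      (fun h => by have := congrArg ht h; norm_num [ht_pt] at this) a b
    rcases hsub (h1 ▸ mem_univ c) with h | h
    exacts [hc.2.1 h, hc.2.2 h]
  obtain ⟨δ, hδ, h0, h1, hδW⟩ := exists_access_pair hW (isPreconnected_compl_pair a b) hU hUc
    (hmeet U hU ⟨a, haU⟩) ⟨a, haU, by simp⟩ hV hVc (hmeet V hV ⟨b, hbV⟩) ⟨b, hbV, by simp⟩
  have h0' : δ 0 = a := by
    rcases not_not.1 h0.2 with h | h
    · exact h
    · exact absurd hbV (disjoint_left.1 hUV (by rw [← mem_singleton_iff.1 h]; exact h0.1))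
  have h1' : δ 1 = b := by
    rcases not_not.1 h1.2 with h | h
    · exact absurd h1.1 (disjoint_left.1 hUV (by rw [h]; exact haU))
    · exact h
  have hz : ∀ {x : Sphere2}, f x = x → ∀ k ∈ zpowers f, k x = x :=
    fun hx k hk => apply_eq_of_mem_zpowers hk hx
  obtain ⟨β, hβ, hβ0, hβ1, hβδ, hinj⟩ := exists_transversal_arc hab (hz ha) (hz hb) hδ h0' h1' (by
    intro t ht k hk hkt
    by_contra hk1
    exact hδW t ht (hfree k hk hk1 _ hkt))
  refine ⟨β, hf, hf1, ha, hb,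
    ⟨hβ, fun s hs t ht e => hinj s hs t ht 1 (Subgroup.one_mem _) e, hβ0, hβ1⟩,
    fun k hk hk1 s hs t ht e => ?_, hfree⟩
  have hst : t = s := hinj t ht s hs k hk e.symm
  subst hst
  refine ⟨rfl, ?_⟩
  by_contra! hne
  obtain ⟨u, hu, l, hl, e'⟩ := hβδ t ⟨lt_of_le_of_ne ht.1 (Ne.symm hne.1), lt_of_le_of_ne ht.2 hne.2⟩
  have hmem := hfree k hk hk1 _ e.symm
  refine hδW u hu ?_
  have hl' : ∀ x, f x = x → l (δ u) = x → δ u = x := fun x hx h =>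
    l.injective (h.trans (hz hx l hl).symm)
  rw [e'] at hmem
  exact hmem.imp (hl' a ha) (hl' b hb)

section Spine

variable {f k l m : Sphere2 ≃ₜ Sphere2} {β : ℝ → Sphere2} {a b : Sphere2}

lemma IsSpine.isArc (h : IsSpine f β a b) (hk : k ∈ zpowers f) : IsArc (k ∘ β) a b := by
  have := h.arc.map k
  rwa [apply_eq_of_mem_zpowers hk h.fix_left, apply_eq_of_mem_zpowers hk h.fix_right] at this

lemma IsSpine.arcDisj (h : IsSpine f β a b) (hk : k ∈ zpowers f)
    (hl : l ∈ zpowers f) (hkl : k ≠ l) : ArcDisj (k ∘ β) (l ∘ β) := by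
  have h1 := (h.disj (k⁻¹ * l) (Subgroup.mul_mem _ (Subgroup.inv_mem _ hk) hl)
    (fun e => hkl (inv_mul_eq_one.1 e))).map k
  have h2 : k ∘ ((k⁻¹ * l : Sphere2 ≃ₜ Sphere2) ∘ β) = l ∘ β :=
    funext fun t => k.apply_symm_apply (l (β t))
  rwa [h2] at h1

lemma image_subset_star (hk : k ∈ zpowers f) : (k ∘ β) '' Icc 0 1 ⊆ star f β := by
  rintro _ ⟨t, ht, rfl⟩
  exact mem_star hk ht

lemma IsSpine.left_mem_star (h : IsSpine f β a b) : a ∈ star f β :=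
  image_subset_star (Subgroup.one_mem _) (h.isArc (Subgroup.one_mem _)).left_mem

lemma IsSpine.right_mem_star (h : IsSpine f β a b) : b ∈ star f β :=
  image_subset_star (Subgroup.one_mem _) (h.isArc (Subgroup.one_mem _)).right_mem

lemma IsSpine.ne_of_mem_Ioo (h : IsSpine f β a b) (hk : k ∈ zpowers f) {t : ℝ}
    (ht : t ∈ Ioo (0 : ℝ) 1) : k (β t) ∉ ({a, b} : Set Sphere2) := by
  have hA := h.isArc hk
  have ht' := Ioo_subset_Icc_self ht
  rintro (e | e)
  · exact ht.1.ne' (hA.inj ht' (by simp) (e.trans hA.zero.symm))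
  · exact ht.2.ne (hA.inj ht' (by simp) (e.trans hA.one.symm))

lemma IsSpine.exists_of_mem_star (h : IsSpine f β a b) {x : Sphere2} (hx : x ∈ star f β)
    (hxab : x ∉ ({a, b} : Set Sphere2)) :
    ∃ k ∈ zpowers f, ∃ t ∈ Ioo (0 : ℝ) 1, k (β t) = x := by
  obtain ⟨k, hk, t, ht, rfl⟩ := Kerekjarto.exists_of_mem_star hx
  rcases (h.isArc hk).image_subset (mem_image_of_mem _ ht) with ⟨s, hs, e⟩ | e
  · exact ⟨k, hk, s, hs, e⟩
  · exact absurd e hxab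

lemma IsSpine.exists_notMem_star (h : IsSpine f β a b) : ∃ e, e ∉ star f β := by
  by_contra! hall
  set B : Set Sphere2 :=
    ⋃ k ∈ {k : Sphere2 ≃ₜ Sphere2 | k ∈ zpowers f ∧ k ≠ 1}, k '' (β '' Icc 0 1) with hB
  have hfin : Set.Finite {k : Sphere2 ≃ₜ Sphere2 | k ∈ zpowers f ∧ k ≠ 1} := by
    have : Set.Finite (zpowers f : Set (Sphere2 ≃ₜ Sphere2)) := finite_zpowers h.pos
    exact this.subset fun k hk => hk.1
  have hBc : IsClosed B := hfin.isClosed_biUnion fun k _ => k.isClosedMap _ h.arc.isClosed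
  have h1 := Subgroup.one_mem (zpowers f)
  have hf := Subgroup.mem_zpowers f
  have hh : (1 / 2 : ℝ) ∈ Ioo (0 : ℝ) 1 := by norm_num
  obtain ⟨x, hx, ⟨t, ht, e⟩, hxB⟩ := isPreconnected_closed_iff.1 (isPreconnected_compl_pair a b)
    (β '' Icc 0 1) B h.arc.isClosed hBc (by
      intro x hx
      obtain ⟨k, hk, t, ht, rfl⟩ := h.exists_of_mem_star (hall x) hx
      have ht' := Ioo_subset_Icc_self ht
      by_cases hk1 : k = 1
      · subst hk1
        exact Or.inl (mem_image_of_mem _ ht')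
      · exact Or.inr (mem_biUnion (show k ∈ {k | _} from ⟨hk, hk1⟩)
          (mem_image_of_mem _ (mem_image_of_mem _ ht'))))
    ⟨β (1 / 2), h.ne_of_mem_Ioo h1 hh, mem_image_of_mem _ half_mem_Icc⟩
    ⟨f (β (1 / 2)), h.ne_of_mem_Ioo hf hh, mem_biUnion (show f ∈ {k | _} from ⟨hf, h.ne_one⟩)
      (mem_image_of_mem _ (mem_image_of_mem _ half_mem_Icc))⟩
  obtain ⟨k, ⟨hk, hk1⟩, _, ⟨s, hs, rfl⟩, e'⟩ := mem_iUnion₂.1 hxB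
  rcases (h.disj k hk hk1 t ht s hs (e.trans e'.symm)).2 with h0 | h0
  · exact hx (Or.inl (by rw [← e, h0, h.arc.zero]))
  · exact hx (Or.inr (by rw [← e, h0, h.arc.one]; rfl))

/-- The component of the complement of the star containing `z`. -/
def region (f : Sphere2 ≃ₜ Sphere2) (β : ℝ → Sphere2) (z : Sphere2) : Set Sphere2 :=
  connectedComponentIn (star f β)ᶜ z

/-- The region of `z` touches the arc `k β` in an interior point. -/
def Adj (f : Sphere2 ≃ₜ Sphere2) (β : ℝ → Sphere2) (z : Sphere2) (k : Sphere2 ≃ₜ Sphere2) : Prop :=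
  ∃ t ∈ Ioo (0 : ℝ) 1, k (β t) ∈ closure (region f β z)

variable {z w : Sphere2}

lemma conn_of_mem_closure_region (hz : z ∉ star f β) {K : Set Sphere2} (hK : K ⊆ star f β)
    (hw : w ∈ closure (region f β z)) (hwK : w ∉ K) : Conn Kᶜ z w := by
  refine ⟨insert w (region f β z), ?_, isPreconnected_connectedComponentIn.subset_closure
      (subset_insert _ _) (insert_subset hw subset_closure),
      Or.inr (mem_connectedComponentIn hz), Or.inl rfl⟩
  rintro _ (rfl | h)
  · exact hwK
  · exact fun h' => connectedComponentIn_subset _ _ h (hK h')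

lemma IsSpine.not_adj_three (h : IsSpine f β a b) (hz : z ∉ star f β)
    (hk : k ∈ zpowers f) (hl : l ∈ zpowers f) (hm : m ∈ zpowers f)
    (hkl : k ≠ l) (hlm : l ≠ m) (hkm : k ≠ m) (ak : Adj f β z k) (al : Adj f β z l) :
    ¬ Adj f β z m := by
  intro am
  obtain ⟨s, hs, hs'⟩ := ak
  obtain ⟨t, ht, ht'⟩ := al
  obtain ⟨u, hu, hu'⟩ := am
  have dkl := h.arcDisj hk hl hkl
  have dlm := h.arcDisj hl hm hlm
  have dkm := h.arcDisj hk hm hkm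
  have ik := image_subset_star (β := β) hk
  have il := image_subset_star (β := β) hl
  have im := image_subset_star (β := β) hm
  refine not_conn_theta (h.isArc hk) (h.isArc hl) (h.isArc hm) dkl dlm dkm hs ht hu
    (conn_of_mem_closure_region hz (union_subset ik il) hu' ?_)
    (conn_of_mem_closure_region hz (union_subset il im) hs' ?_)
    (conn_of_mem_closure_region hz (union_subset ik im) ht' ?_)
  · exact fun h => h.elim (dkm.symm.notMem hu) (dlm.symm.notMem hu)
  · exact fun h => h.elim (dkl.notMem hs) (dkm.notMem hs)
  · exact fun h => h.elim (dkl.symm.notMem ht) (dlm.notMem ht)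

lemma frontier_region_subset (hf : 0 < orderOf f) (hβ : IsArc β a b) :
    frontier (region f β z) ⊆ star f β := by
  simpa [region] using frontier_connectedComponentIn_subset (isClosed_star hf hβ).isOpen_compl (a := z)

lemma IsSpine.exists_adj_ne (h : IsSpine f β a b) (hz : z ∉ star f β)
    (hk : k ∈ zpowers f) : ∃ l ∈ zpowers f, l ≠ k ∧ Adj f β z l := by
  by_contra! hno
  have hA := h.isArc hk
  have hsub := subset_of_disjoint_frontier
    (isPreconnected_compl_arc zero_le_one hA.cont hA.inj) (V := region f β z)
    ⟨z, fun h => hz (image_subset_star hk h), mem_connectedComponentIn hz⟩ (by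
      refine eq_empty_of_forall_notMem fun x hx => ?_
      have hxab : x ∉ ({a, b} : Set Sphere2) := by
        rintro (rfl | rfl)
        exacts [hx.1 hA.left_mem, hx.1 hA.right_mem]
      obtain ⟨l, hl, t, ht, rfl⟩ := h.exists_of_mem_star (frontier_region_subset h.pos h.arc hx.2)
        hxab
      refine hno l hl ?_ ⟨t, ht, frontier_subset_closure hx.2⟩
      rintro rfl
      exact hx.1 (mem_image_of_mem _ (Ioo_subset_Icc_self ht)))
  have hf := Subgroup.mem_zpowers f
  have hh : (1 / 2 : ℝ) ∈ Ioo (0 : ℝ) 1 := by norm_num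
  have hfk : f * k ∈ zpowers f := Subgroup.mul_mem _ hf hk
  have hd := h.arcDisj hfk hk (fun e => h.ne_one (mul_eq_right.1 e))
  exact connectedComponentIn_subset _ _ (hsub (hd.notMem hh)) (mem_star hfk half_mem_Icc)

lemma IsSpine.region_eq_side (h : IsSpine f β a b) (hz : z ∉ star f β)
    (hk : k ∈ zpowers f) (hl : l ∈ zpowers f) (hkl : k ≠ l)
    (ak : Adj f β z k) (al : Adj f β z l) :
    region f β z = side (loop (k ∘ β) (l ∘ β)) z := by
  have hr := range_loop (h.isArc hk) (h.isArc hl)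
  have hrs : range (loop (k ∘ β) (l ∘ β)) ⊆ star f β := by
    rw [hr]
    exact union_subset (image_subset_star hk) (image_subset_star hl)
  apply Subset.antisymm
  · exact connectedComponentIn_mono _ (compl_subset_compl.2 hrs)
  · refine subset_of_disjoint_frontier isPreconnected_side
      ⟨z, mem_side_self (fun h => hz (hrs h)), mem_connectedComponentIn hz⟩ ?_
    refine eq_empty_of_forall_notMem fun x hx => ?_
    have hx1 : x ∉ range (loop (k ∘ β) (l ∘ β)) := side_subset _ _ hx.1
    rw [hr] at hx1
    have hxab : x ∉ ({a, b} : Set Sphere2) := by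
      rintro (rfl | rfl)
      exacts [hx1 (Or.inl (h.isArc hk).left_mem), hx1 (Or.inl (h.isArc hk).right_mem)]
    obtain ⟨m, hm, t, ht, rfl⟩ := h.exists_of_mem_star (frontier_region_subset h.pos h.arc hx.2)
      hxab
    have ht' := Ioo_subset_Icc_self ht
    refine h.not_adj_three hz hk hl hm hkl ?_ ?_ ak al ⟨t, ht, frontier_subset_closure hx.2⟩
    · rintro rfl
      exact hx1 (Or.inr (mem_image_of_mem _ ht'))
    · rintro rfl
      exact hx1 (Or.inl (mem_image_of_mem _ ht'))

lemma image_region (hk : k ∈ zpowers f) (hz : z ∉ star f β) :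
    k '' region f β z = region f β (k z) :=
  image_frontier_component (image_star hk) hz

lemma apply_notMem_star (hk : k ∈ zpowers f) (hz : z ∉ star f β) : k z ∉ star f β := by
  intro h
  rw [← image_star hk] at h
  obtain ⟨x, hx, e⟩ := h
  exact hz (k.injective e ▸ hx)

lemma Adj.map (hk : k ∈ zpowers f) (hz : z ∉ star f β) (h : Adj f β z l) :
    Adj f β (k z) (k * l) := by
  obtain ⟨t, ht, ht'⟩ := h
  refine ⟨t, ht, ?_⟩
  rw [← image_region hk hz, ← Homeomorph.image_closure]
  exact mem_image_of_mem _ ht'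

lemma region_eq_of_mem (h : w ∈ region f β z) : region f β z = region f β w :=
  connectedComponentIn_eq h

/-- The nontrivial powers move every region. -/
theorem IsSpine.apply_notMem_region (h : IsSpine f β a b) (hz : z ∉ star f β)
    (hk : k ∈ zpowers f) (hk1 : k ≠ 1) : ∀ x ∈ region f β z, k x ∉ region f β z := by
  intro x hx hkx
  have h1 := Subgroup.one_mem (zpowers f)
  obtain ⟨k₁, hk₁, -, a₁⟩ := h.exists_adj_ne hz h1
  obtain ⟨k₂, hk₂, hne, a₂⟩ := h.exists_adj_ne hz hk₁
  have hR := h.region_eq_side hz hk₁ hk₂ hne.symm a₁ a₂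
  have hJ := isJordan_loop (h.isArc hk₁) (h.isArc hk₂) (h.arcDisj hk₁ hk₂ hne.symm)
  have hxs : x ∉ star f β := connectedComponentIn_subset _ _ hx
  have hinv : k '' region f β z = region f β z := by
    rw [region_eq_of_mem hx, image_region hk hxs, ← region_eq_of_mem hkx, region_eq_of_mem hx]
  have hkpos := Nat.pos_of_dvd_of_pos (orderOf_dvd_of_mem_zpowers hk) h.pos
  obtain ⟨g, hg, hp⟩ := exists_mem_zpowers_prime hkpos hk1
  have hgf : g ∈ zpowers f := (Subgroup.zpowers_le.2 hk) hg
  obtain ⟨y, hy, hgy⟩ := exists_fixed_of_invariant hp rfl (V := region f β z)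
    (isClosed_star h.pos h.arc).isOpen_compl.connectedComponentIn
    isPreconnected_connectedComponentIn (by rw [hR]; exact hJ.isPreconnected_compl_side)
    ⟨x, hx⟩ ⟨a, fun ha => connectedComponentIn_subset _ _ ha h.left_mem_star⟩
    (image_eq_of_mem_zpowers hg hinv)
  have hys : y ∉ star f β := connectedComponentIn_subset _ _ hy
  have hg1 : g ≠ 1 := fun e => hp.one_lt.ne' (by rw [e, orderOf_one])
  rcases h.free g hgf hg1 y hgy with rfl | rfl
  exacts [hys h.left_mem_star, hys h.right_mem_star]

/-- Only two regions touch a given arc. -/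
theorem IsSpine.adj_one_unique (h : IsSpine f β a b) {z₁ z₂ z₃ : Sphere2} (h₁ : z₁ ∉ star f β)
    (h₂ : z₂ ∉ star f β) (h₃ : z₃ ∉ star f β) (hk : k ∈ zpowers f)
    (hl : l ∈ zpowers f) (hk1 : k ≠ 1) (hl1 : l ≠ 1)
    (a₁ : Adj f β z₁ 1) (a₁' : Adj f β z₁ k) (a₂ : Adj f β z₂ 1) (a₂' : Adj f β z₂ l)
    (a₃ : Adj f β z₃ 1) (h12 : z₂ ∉ region f β z₁) (h13 : z₃ ∉ region f β z₁) :
    z₃ ∈ region f β z₂ := by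
  by_contra h23
  have hone := Subgroup.one_mem (zpowers f)
  have e₁ := h.region_eq_side h₁ hone hk hk1.symm a₁ a₁'
  have e₂ := h.region_eq_side h₂ hone hl hl1.symm a₂ a₂'
  have dk := h.arcDisj hone hk hk1.symm
  have dl := h.arcDisj hone hl hl1.symm
  have A1 := h.isArc hone
  have Ak := h.isArc hk
  have Al := h.isArc hl
  have Jk := isJordan_loop A1 Ak dk
  have Jl := isJordan_loop A1 Al dl
  have rk := range_loop A1 Ak
  have rl := range_loop A1 Al
  have sk : range (loop ((1 : Sphere2 ≃ₜ Sphere2) ∘ β) (k ∘ β)) ⊆ star f β :=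
    rk ▸ union_subset (image_subset_star hone) (image_subset_star hk)
  have sl : range (loop ((1 : Sphere2 ≃ₜ Sphere2) ∘ β) (l ∘ β)) ⊆ star f β :=
    rl ▸ union_subset (image_subset_star hone) (image_subset_star hl)
  have hh : (1 / 2 : ℝ) ∈ Ioo (0 : ℝ) 1 := by norm_num
  rw [e₁] at h12 h13
  rw [e₂] at h23
  by_cases hkl : k = l
  · subst hkl
    exact h23 (Jk.side_eq_of_notMem (fun h => h₁ (sk h)) (fun h => h₂ (sk h)) h12
      (fun h => h₃ (sk h)) h13)
  have dkl := h.arcDisj hk hl hkl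
  have hstar : ∀ {x z : Sphere2}, x ∈ star f β → x ∉ region f β z :=
    fun hx h => connectedComponentIn_subset _ _ h hx
  have c₁ : Conn (range (loop ((1 : Sphere2 ≃ₜ Sphere2) ∘ β) (k ∘ β)))ᶜ z₃ ((l ∘ β) (1 / 2)) := by
    refine (conn_iff_mem_connectedComponentIn (mem_compl fun h => h₃ (sk h))).2 ?_
    refine Jk.side_eq_of_notMem (fun h => h₁ (sk h)) (fun h => h₃ (sk h)) h13 ?_ ?_
    · rw [rk]
      exact fun h => h.elim (dl.symm.notMem hh) (dkl.symm.notMem hh)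
    · rw [← e₁]
      exact hstar (mem_star hl half_mem_Icc)
  have c₂ : Conn (range (loop ((1 : Sphere2 ≃ₜ Sphere2) ∘ β) (l ∘ β)))ᶜ z₃ ((k ∘ β) (1 / 2)) := by
    refine (conn_iff_mem_connectedComponentIn (mem_compl fun h => h₃ (sl h))).2 ?_
    refine Jl.side_eq_of_notMem (fun h => h₂ (sl h)) (fun h => h₃ (sl h)) h23 ?_ ?_
    · rw [rl]
      exact fun h => h.elim (dk.symm.notMem hh) (dkl.notMem hh)
    · rw [← e₂]
      exact hstar (mem_star hk half_mem_Icc)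
  obtain ⟨t, ht, ht'⟩ := a₃
  rw [rk, union_comm] at c₁
  rw [rl] at c₂
  refine not_conn_theta Ak A1 Al dk.symm dl dkl hh ht hh c₁ c₂
    (conn_of_mem_closure_region h₃ (union_subset (image_subset_star hk) (image_subset_star hl))
      ht' ?_)
  exact fun h => h.elim (dk.notMem ht) (dl.notMem ht)

/-- The closures of the translates of one region under a single generator cover the sphere. -/
theorem IsSpine.exists_generator (h : IsSpine f β a b) :
    ∃ h' ∈ zpowers f, f ∈ zpowers h' ∧ h' ≠ 1 ∧ ∃ z, z ∉ star f β ∧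
      region f β z = side (loop β (h' ∘ β)) z ∧
      ∀ x, ∃ k ∈ zpowers h', ∃ y ∈ closure (region f β z), k y = x := by
  have hone := Subgroup.one_mem (zpowers f)
  obtain ⟨e, he⟩ := h.exists_notMem_star
  obtain ⟨k₁, hk₁, -, a₁⟩ := h.exists_adj_ne he hone
  obtain ⟨k₂, hk₂, hne, a₂⟩ := h.exists_adj_ne he hk₁
  set z := k₁⁻¹ e with hzdef
  set h' := k₁⁻¹ * k₂ with hh'
  have hi := Subgroup.inv_mem _ hk₁
  have hz : z ∉ star f β := apply_notMem_star hi he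
  have hh'f : h' ∈ zpowers f := Subgroup.mul_mem _ hi hk₂
  have hh'1 : h' ≠ 1 := fun e => hne (inv_mul_eq_one.1 e).symm
  have b₁ : Adj f β z 1 := by
    have := a₁.map hi he
    rwa [inv_mul_cancel] at this
  have b₂ : Adj f β z h' := a₂.map hi he
  have hR : region f β z = side (loop β (h' ∘ β)) z :=
    h.region_eq_side hz hone hh'f hh'1.symm b₁ b₂
  have hle : zpowers h' ≤ zpowers f := Subgroup.zpowers_le.2 hh'f
  have A' := h.isArc hh'f
  have hJ := isJordan_loop h.arc A' (h.disj h' hh'f hh'1)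
  have hr := range_loop h.arc A'
  have hzr : z ∉ range (loop β (h' ∘ β)) := by
    rw [hr]
    exact fun h => hz (h.elim (fun h => image_subset_star hone h) fun h => image_subset_star hh'f h)
  have hcl : closure (region f β z) =
      region f β z ∪ (β '' Icc 0 1 ∪ (h' ∘ β) '' Icc 0 1) := by
    rw [hR, hJ.closure_side hzr, hr]
  have hop : ∀ w, IsOpen (region f β w) :=
    fun w => (isClosed_star h.pos h.arc).isOpen_compl.connectedComponentIn
  set T : Set Sphere2 := ⋃ k ∈ zpowers h', k '' closure (region f β z) with hT
  have hTmem : ∀ k ∈ zpowers h', ∀ y ∈ closure (region f β z), k y ∈ T :=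
    fun k hk y hy => mem_biUnion hk (mem_image_of_mem _ hy)
  have hTc : IsClosed T := by
    have : Set.Finite (zpowers h' : Set (Sphere2 ≃ₜ Sphere2)) := by
      have hfin : Set.Finite (zpowers f : Set (Sphere2 ≃ₜ Sphere2)) := finite_zpowers h.pos
      exact hfin.subset hle
    exact this.isClosed_biUnion fun k _ => k.isClosedMap _ isClosed_closure
  have hTinv : ∀ k ∈ zpowers h', ∀ x ∈ T, k x ∈ T := by
    intro k hk x hx
    obtain ⟨l, hl, y, hy, rfl⟩ := mem_iUnion₂.1 hx
    rw [← mul_apply]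
    exact hTmem _ (Subgroup.mul_mem _ hk hl) y hy
  have hTint : ∀ k ∈ zpowers h', ∀ x ∈ interior T, k x ∈ interior T := by
    intro k hk x hx
    have h1 : k '' interior T ⊆ interior T := by
      refine interior_maximal ?_ (k.isOpenMap _ isOpen_interior)
      rintro _ ⟨y, hy, rfl⟩
      exact hTinv k hk y (interior_subset hy)
    exact h1 (mem_image_of_mem _ hx)
  have hself := Subgroup.mem_zpowers h'
  have hinv' := Subgroup.inv_mem _ hself
  have hone' := Subgroup.one_mem (zpowers h')
  have hz' : h'⁻¹ z ∉ star f β := apply_notMem_star (hle hinv') hz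
  have c₁ : Adj f β (h'⁻¹ z) 1 := by simpa using b₂.map (hle hinv') hz
  have c₂ : Adj f β (h'⁻¹ z) h'⁻¹ := by simpa using b₁.map (hle hinv') hz
  have hzz' : h'⁻¹ z ∉ region f β z :=
    h.apply_notMem_region hz (hle hinv') (inv_ne_one.2 hh'1) z (mem_connectedComponentIn hz)
  have hβint : ∀ t ∈ Ioo (0 : ℝ) 1, β t ∈ interior T := by
    intro t ht
    by_contra hnot
    set B : Set Sphere2 := ⋃ k ∈ {k : Sphere2 ≃ₜ Sphere2 | k ∈ zpowers f ∧ k ≠ 1},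
      k '' (β '' Icc 0 1) with hB
    have hBc : IsClosed B := by
      have hfin : Set.Finite (zpowers f : Set (Sphere2 ≃ₜ Sphere2)) := finite_zpowers h.pos
      exact (hfin.subset fun k hk => hk.1).isClosed_biUnion
        fun k _ => k.isClosedMap _ h.arc.isClosed
    have htB : β t ∉ B := by
      intro hx
      obtain ⟨k, ⟨hk, hk1⟩, hx'⟩ := mem_iUnion₂.1 hx
      rw [← image_comp] at hx'
      exact (h.disj k hk hk1).notMem ht hx'
    set U := connectedComponentIn Bᶜ (β t) with hU
    have hUo : IsOpen U := hBc.isOpen_compl.connectedComponentIn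
    have htU : β t ∈ U := mem_connectedComponentIn htB
    obtain ⟨y, hyU, hyT⟩ : ∃ y ∈ U, y ∉ T := by
      by_contra! hall
      exact hnot (interior_maximal hall hUo htU)
    have hUstar : ∀ x ∈ U, x ∈ star f β → ∃ s ∈ Ioo (0 : ℝ) 1, β s = x := by
      intro x hxU hxs
      have hxB : x ∉ B := connectedComponentIn_subset _ _ hxU
      have hxab : x ∉ ({a, b} : Set Sphere2) := by
        have hf := Subgroup.mem_zpowers f
        have hBf : (f ∘ β) '' Icc 0 1 ⊆ B := by
          rw [image_comp]
          exact subset_biUnion_of_mem (u := fun k : Sphere2 ≃ₜ Sphere2 => k '' (β '' Icc 0 1))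
            (show f ∈ {k | _} from ⟨hf, h.ne_one⟩)
        rintro (rfl | rfl)
        exacts [hxB (hBf (h.isArc hf).left_mem), hxB (hBf (h.isArc hf).right_mem)]
      obtain ⟨k, hk, s, hs, rfl⟩ := h.exists_of_mem_star hxs hxab
      by_cases hk1 : k = 1
      · exact ⟨s, hs, by rw [hk1]; rfl⟩
      · exact absurd (mem_biUnion (show k ∈ {k | k ∈ zpowers f ∧ k ≠ 1} from ⟨hk, hk1⟩)
          (mem_image_of_mem _ (mem_image_of_mem _ (Ioo_subset_Icc_self hs)))) hxB
    have hys : y ∉ star f β := by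
      intro hy
      obtain ⟨s, hs, rfl⟩ := hUstar y hyU hy
      refine hyT (hTmem 1 hone' _ ?_)
      rw [hcl]
      exact Or.inr (Or.inl (mem_image_of_mem _ (Ioo_subset_Icc_self hs)))
    have c₃ : Adj f β y 1 := by
      by_contra hno
      have hsub := subset_of_disjoint_frontier (C := U) (V := region f β y)
        isPreconnected_connectedComponentIn ⟨y, hyU, mem_connectedComponentIn hys⟩ (by
          refine eq_empty_of_forall_notMem fun x hx => hno ?_
          obtain ⟨s, hs, rfl⟩ := hUstar x hx.1 (frontier_region_subset h.pos h.arc hx.2)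
          exact ⟨s, hs, frontier_subset_closure hx.2⟩)
      exact connectedComponentIn_subset _ _ (hsub htU) (mem_star hone (Ioo_subset_Icc_self ht))
    have hy2 := h.adj_one_unique hz hz' hys hh'f (hle hinv') hh'1 (inv_ne_one.2 hh'1) b₁ b₂ c₁ c₂ c₃
      hzz' fun hy => hyT (hTmem 1 hone' _ (subset_closure hy))
    rw [← image_region (hle hinv') hz] at hy2
    obtain ⟨u, hu, rfl⟩ := hy2
    exact hyT (hTmem _ hinv' u (subset_closure hu))
  have hTfr : ∀ x ∈ T, x ∉ ({a, b} : Set Sphere2) → x ∈ interior T := by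
    intro x hx hxab
    obtain ⟨k, hk, y, hy, rfl⟩ := mem_iUnion₂.1 hx
    refine hTint k hk y ?_
    have hyab : y ∉ ({a, b} : Set Sphere2) := by
      rintro (rfl | rfl)
      · exact hxab (Or.inl (apply_eq_of_mem_zpowers (hle hk) h.fix_left))
      · exact hxab (Or.inr (apply_eq_of_mem_zpowers (hle hk) h.fix_right))
    rw [hcl] at hy
    rcases hy with hy | hy | hy
    · exact interior_maximal (fun u hu => hTmem 1 hone' u (subset_closure hu)) (hop z) hy
    · rcases h.arc.image_subset hy with ⟨s, hs, rfl⟩ | e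
      exacts [hβint s hs, absurd e hyab]
    · rcases A'.image_subset hy with ⟨s, hs, rfl⟩ | e
      exacts [hTint h' hself _ (hβint s hs), absurd e hyab]
  have hhalf : (1 / 2 : ℝ) ∈ Ioo (0 : ℝ) 1 := by norm_num
  have hsub := subset_of_disjoint_frontier (isPreconnected_compl_pair a b) (V := T)
    ⟨β (1 / 2), h.ne_of_mem_Ioo hone hhalf, interior_subset (hβint _ hhalf)⟩ (by
      refine eq_empty_of_forall_notMem fun x hx => hx.2.2 (hTfr x ?_ hx.1)
      exact hTc.frontier_subset hx.2)
  have hall : ∀ x, x ∈ T := by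
    intro x
    by_cases hx : x ∈ ({a, b} : Set Sphere2)
    · have hβT : β '' Icc 0 1 ⊆ T := fun y hy => hTmem 1 hone' y (by
        rw [hcl]
        exact Or.inr (Or.inl hy))
      rcases hx with rfl | rfl
      exacts [hβT h.arc.left_mem, hβT h.arc.right_mem]
    · exact hsub hx
  refine ⟨h', hh'f, ?_, hh'1, z, hz, hR, fun x => ?_⟩
  · obtain ⟨k, hk, y, hy, e⟩ := mem_iUnion₂.1 (hall (f (β (1 / 2))))
    have hkf := Subgroup.mul_mem _ (Subgroup.inv_mem _ (hle hk)) (Subgroup.mem_zpowers f)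
    have ey : y = (k⁻¹ * f) (β (1 / 2)) := by
      have h1 : y = k⁻¹ (k y) := (k.symm_apply_apply y).symm
      rw [h1, e]
      rfl
    have hd : ∀ l ∈ zpowers f, y ∈ (l ∘ β) '' Icc 0 1 → k⁻¹ * f = l := by
      intro l hl hy'
      by_contra hne
      rw [ey] at hy'
      exact (h.arcDisj hkf hl hne).notMem hhalf hy'
    rw [hcl] at hy
    rcases hy with hy | hy | hy
    · exact absurd (ey ▸ mem_star hkf half_mem_Icc) (connectedComponentIn_subset _ _ hy)
    · rw [inv_mul_eq_iff_eq_mul.1 (hd 1 hone hy), mul_one]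
      exact hk
    · rw [inv_mul_eq_iff_eq_mul.1 (hd h' hh'f hy)]
      exact Subgroup.mul_mem _ hk hself
  · obtain ⟨k, hk, y, hy, e⟩ := mem_iUnion₂.1 (hall x)
    exact ⟨k, hk, y, hy, e⟩

end Spine

lemma circ_add (x y : ℝ) : circ (x + y) = circ x * circ y := by
  rw [circ, circ, circ, ← exp_add]
  push_cast
  ring_nf

lemma circ_ne_zero (x : ℝ) : circ x ≠ 0 := Complex.exp_ne_zero _

lemma sq_norm_sqrt_mul_circ {t : ℝ} (ht : t ∈ Icc (-1 : ℝ) 1) (x : ℝ) :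
    ‖(√(1 - t ^ 2) : ℂ) * circ x‖ ^ 2 + t ^ 2 = 1 := by
  rw [norm_mul, norm_circ, mul_one, norm_real, Real.norm_eq_abs, sq_abs,
    Real.sq_sqrt (by nlinarith [ht.1, ht.2])]
  ring

lemma ht_mem_Icc (v : Sphere2) : ht v ∈ Icc (-1 : ℝ) 1 := by
  have := norm_xy_sq_add v
  constructor <;> nlinarith [sq_nonneg ‖xy v‖]

lemma norm_xy_eq_sqrt (v : Sphere2) : ‖xy v‖ = √(1 - ht v ^ 2) := by
  rw [← norm_xy_sq_add v, add_sub_cancel_right, Real.sqrt_sq (norm_nonneg _)]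

lemma xy_eq_zero_of_ht {v : Sphere2} (h : ht v ^ 2 = 1) : xy v = 0 := by
  rw [← norm_eq_zero, norm_xy_eq_sqrt, h]
  simp

/-- A fundamental piece for a cyclic group gives a conjugacy with a rotation. -/
theorem exists_conj_of_fundamental {h : Sphere2 ≃ₜ Sphere2} (hn : 0 < orderOf h)
    {σ : ℝ → ℝ → Sphere2} {a b : Sphere2}
    (hσ : ContinuousOn (fun p : ℝ × ℝ => σ p.1 p.2) (Icc 0 1 ×ˢ Icc (-1) 1))
    (hglue : ∀ t ∈ Icc (-1 : ℝ) 1, σ 1 t = h (σ 0 t))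
    (htop : ∀ s ∈ Icc (0 : ℝ) 1, σ s 1 = a) (hbot : ∀ s ∈ Icc (0 : ℝ) 1, σ s (-1) = b)
    (ha : h a = a) (hb : h b = b)
    (hsurj : ∀ x, ∃ k ∈ zpowers h, ∃ s ∈ Icc (0 : ℝ) 1, ∃ t ∈ Icc (-1 : ℝ) 1,
      k (σ s t) = x)
    (hinj : ∀ k ∈ zpowers h, ∀ s ∈ Ico (0 : ℝ) 1, ∀ s' ∈ Ico (0 : ℝ) 1,
      ∀ t ∈ Icc (-1 : ℝ) 1, ∀ t' ∈ Icc (-1 : ℝ) 1, σ s t = k (σ s' t') →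
        t = t' ∧ (t ^ 2 = 1 ∨ (k = 1 ∧ s = s'))) :
    ∃ H : Sphere2 ≃ₜ Sphere2, H (pt 0 1) = a ∧ H (pt 0 (-1)) = b ∧
      ∀ v w, xy w = circ (1 / orderOf h) * xy v → ht w = ht v → h (H v) = H w := by
  set n := orderOf h with hndef
  have hnR : (n : ℝ) ≠ 0 := Nat.cast_ne_zero.2 hn.ne'
  set Θ : ℝ → ℝ → Sphere2 := fun x t => (h ^ ⌊x⌋) (σ (Int.fract x) t) with hΘ
  have hΘadd : ∀ x t, ∀ i : ℤ, Θ (x + i) t = (h ^ i) (Θ x t) := by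
    intro x t i
    simp only [hΘ]
    rw [Int.floor_add_intCast, Int.fract_add_intCast, ← mul_apply, ← zpow_add, add_comm]
  have hΘσ : ∀ s ∈ Icc (0 : ℝ) 1, ∀ t ∈ Icc (-1 : ℝ) 1, Θ s t = σ s t := by
    intro s hs t ht
    rcases hs.2.lt_or_eq with h1 | rfl
    · simp only [hΘ]
      rw [Int.floor_eq_zero_iff.2 ⟨hs.1, h1⟩, Int.fract_eq_self.2 ⟨hs.1, h1⟩]
      rfl
    · simp only [hΘ]
      rw [Int.floor_one, Int.fract_one, zpow_one, hglue t ht]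
  have hpow : ∀ i : ℤ, (h ^ i) a = a ∧ (h ^ i) b = b := fun i =>
    ⟨apply_eq_of_mem_zpowers ⟨i, rfl⟩ ha, apply_eq_of_mem_zpowers ⟨i, rfl⟩ hb⟩
  have hfr : ∀ x : ℝ, Int.fract x ∈ Ico (0 : ℝ) 1 :=
    fun x => ⟨Int.fract_nonneg x, Int.fract_lt_one x⟩
  have hΘtop : ∀ x, Θ x 1 = a := fun x => by
    simp only [hΘ]
    rw [htop _ (Ico_subset_Icc_self (hfr x)), (hpow _).1]
  have hΘbot : ∀ x, Θ x (-1) = b := fun x => by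
    simp only [hΘ]
    rw [hbot _ (Ico_subset_Icc_self (hfr x)), (hpow _).2]
  have hΘc : ContinuousOn (fun p : ℝ × ℝ => Θ p.1 p.2) (univ ×ˢ Icc (-1) 1) := by
    have h1 := continuous_floor_glue (T := Icc (-1 : ℝ) 1) (σ := fun p => σ p.1 p.2.1) (h := h)
      (hσ.comp (f := fun p : ℝ × Icc (-1 : ℝ) 1 => (p.1, p.2.1)) (by fun_prop)
        fun p hp => ⟨hp.1, p.2.2⟩) fun τ => hglue τ.1 τ.2
    rw [continuousOn_iff_continuous_domRestrict]
    exact h1.comp (f := fun p : (univ ×ˢ Icc (-1) 1 : Set (ℝ × ℝ)) =>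
      (p.1.1, (⟨p.1.2, p.2.2⟩ : Icc (-1 : ℝ) 1))) (by fun_prop)
  set H : Sphere2 → Sphere2 := fun v => Θ (n * ((xy v).arg / (2 * π))) (ht v) with hH
  have hHeq : ∀ v x, xy v = √(1 - ht v ^ 2) * circ (x / n) → H v = Θ x (ht v) := by
    intro v x hv
    by_cases h0 : xy v = 0
    · have h1 : ht v ^ 2 = 1 := by
        have := norm_xy_sq_add v
        rw [h0] at this
        simpa using this
      rcases sq_eq_sq_iff_eq_or_eq_neg.1 (h1.trans (one_pow 2).symm) with e | e
      · simp only [hH]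
        rw [e, hΘtop, hΘtop]
      · simp only [hH]
        rw [e, hΘbot, hΘbot]
    · have h1 := norm_mul_circ (xy v)
      rw [norm_xy_eq_sqrt] at h1
      have hne : (√(1 - ht v ^ 2) : ℂ) ≠ 0 := by
        intro e
        rw [e, zero_mul] at hv
        exact h0 hv
      obtain ⟨i, hi⟩ := isJordan_circ.eq_iff.1 (mul_left_cancel₀ hne (h1.trans hv))
      have h2 : n * ((xy v).arg / (2 * π)) = x + ((n * i : ℤ) : ℝ) := by
        rw [hi]
        push_cast
        field_simp
      simp only [hH]
      rw [h2, hΘadd, zpow_mul, zpow_natCast, hndef, pow_orderOf_eq_one, one_zpow]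
      rfl
  set q : ℝ × ℝ → Sphere2 := fun p => pt (√(1 - p.2 ^ 2) * circ (p.1 / n)) p.2 with hq
  have hqxy : ∀ x, ∀ t ∈ Icc (-1 : ℝ) 1, xy (q (x, t)) = √(1 - t ^ 2) * circ (x / n) ∧
      ht (q (x, t)) = t := fun x t ht =>
    ⟨xy_pt (sq_norm_sqrt_mul_circ ht _), ht_pt (sq_norm_sqrt_mul_circ ht _)⟩
  have hHq : ∀ x, ∀ t ∈ Icc (-1 : ℝ) 1, H (q (x, t)) = Θ x t := by
    intro x t ht
    obtain ⟨h1, h2⟩ := hqxy x t ht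
    rw [hHeq (q (x, t)) x (by rw [h1, h2]), h2]
  have hpolar : ∀ v, xy v = √(1 - ht v ^ 2) * circ ((n * ((xy v).arg / (2 * π))) / n) := by
    intro v
    rw [mul_div_cancel_left₀ _ hnR, ← norm_xy_eq_sqrt, norm_mul_circ]
  have hHc : Continuous H := by
    set K : Set (ℝ × ℝ) := Icc (-(n : ℝ)) n ×ˢ Icc (-1) 1 with hK
    have hKc : IsCompact K := isCompact_Icc.prod isCompact_Icc
    have hqc : ContinuousOn q K := by
      rw [continuousOn_iff_continuous_domRestrict]
      refine continuous_pt ?_ (by fun_prop) fun p => sq_norm_sqrt_mul_circ p.2.2 _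
      have := isJordan_circ.cont
      fun_prop
    have h1 : ContinuousOn H (q '' K) := by
      refine continuousOn_image_of_comp hKc hqc ?_
      refine (hΘc.mono (t := K) fun p hp => ⟨mem_univ _, hp.2⟩).congr fun p hp => ?_
      exact hHq p.1 p.2 hp.2
    have h2 : q '' K = univ := by
      refine eq_univ_of_forall fun v => ⟨(n * ((xy v).arg / (2 * π)), ht v),
        ⟨?_, ht_mem_Icc v⟩, ?_⟩
      · have h3 := Complex.abs_arg_le_pi (xy v)
        have h4 : |(xy v).arg / (2 * π)| ≤ 1 := by
          rw [abs_div, abs_of_pos (a := 2 * π) (by positivity), div_le_one (by positivity)]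
          linarith [Real.pi_pos]
        have h5 : |n * ((xy v).arg / (2 * π))| ≤ n := by
          rw [abs_mul, Nat.abs_cast]
          exact mul_le_of_le_one_right (Nat.cast_nonneg _) h4
        exact abs_le.1 h5
      · obtain ⟨h1, h2⟩ := hqxy (n * ((xy v).arg / (2 * π))) (ht v) (ht_mem_Icc v)
        exact sphere_ext (h1.trans (hpolar v).symm) h2
    rw [h2] at h1
    exact continuousOn_univ.1 h1
  have hHinj : Function.Injective H := by
    intro v w e
    set x := n * ((xy v).arg / (2 * π)) with hx
    set y := n * ((xy w).arg / (2 * π)) with hy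
    have e' : σ (Int.fract x) (ht v) = (h ^ (⌊y⌋ - ⌊x⌋)) (σ (Int.fract y) (ht w)) := by
      have e1 : (h ^ ⌊x⌋) (σ (Int.fract x) (ht v)) = (h ^ ⌊y⌋) (σ (Int.fract y) (ht w)) := e
      apply (h ^ ⌊x⌋).injective
      rw [e1, ← mul_apply, ← zpow_add]
      congr 3
      ring
    obtain ⟨h1, h2⟩ := hinj _ ⟨_, rfl⟩ _ (hfr x) _ (hfr y) _ (ht_mem_Icc v) _ (ht_mem_Icc w) e'
    refine sphere_ext ?_ h1
    rcases h2 with h2 | ⟨h2, h3⟩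
    · rw [xy_eq_zero_of_ht h2, xy_eq_zero_of_ht (h1 ▸ h2)]
    · rw [hpolar v, hpolar w, ← hx, ← hy, h1]
      congr 1
      obtain ⟨i, hi⟩ := orderOf_dvd_iff_zpow_eq_one.2 h2
      refine isJordan_circ.eq_iff.2 ⟨-i, ?_⟩
      have hi' : (⌊y⌋ : ℝ) - ⌊x⌋ = n * i := by exact_mod_cast hi
      have hxy : x = y + n * (-i) := by
        have := Int.floor_add_fract x
        have := Int.floor_add_fract y
        linarith
      rw [hxy]
      push_cast
      field_simp
  have hHsurj : Function.Surjective H := by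
    intro x
    obtain ⟨k, ⟨i, rfl⟩, s, hs, t, ht, rfl⟩ := hsurj x
    exact ⟨q (s + i, t), by rw [hHq _ t ht, hΘadd, hΘσ s hs t ht]⟩
  refine ⟨Continuous.homeoOfEquivCompactToT2 (f := Equiv.ofBijective H ⟨hHinj, hHsurj⟩) hHc,
    ?_, ?_, fun v w h1 h2 => ?_⟩
  · show H (pt 0 1) = a
    rw [hHeq _ 0 (by rw [xy_pt (by simp), ht_pt (by simp)]; simp), ht_pt (by simp), hΘtop]
  · show H (pt 0 (-1)) = b
    rw [hHeq _ 0 (by rw [xy_pt (by simp), ht_pt (by simp)]; simp), ht_pt (by simp), hΘbot]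
  · show h (H v) = H w
    set x := n * ((xy v).arg / (2 * π)) with hx
    have h3 : H w = Θ (x + (1 : ℤ)) (ht w) := by
      refine hHeq w _ ?_
      rw [h1, h2]
      conv_lhs => rw [hpolar v]
      rw [Int.cast_one, add_div, circ_add, ← hx]
      ring
    rw [h3, hΘadd, zpow_one, h2]

lemma loop_of_mem_Icc {α β : ℝ → Sphere2} {a b : Sphere2} (hα : IsArc α a b) (hβ : IsArc β a b)
    {x : ℝ} (hx : x ∈ Icc (0 : ℝ) (1 / 2)) :
    loop α β x = α (2 * x) ∧ loop α β (-x) = β (2 * x) := by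
  have hf : Int.fract x = x := Int.fract_eq_self.2 ⟨hx.1, by linarith [hx.2]⟩
  refine ⟨by rw [loop, hf, if_pos hx.2], ?_⟩
  rcases hx.1.eq_or_lt with h0 | h0
  · rw [← h0]
    simp [loop, hα.zero, hβ.zero]
  · have hf' : Int.fract (-x) = 1 - x := by
      rw [Int.fract_neg (by rw [hf]; exact h0.ne'), hf]
    rw [loop, hf']
    split_ifs with h1
    · have h2 : x = 1 / 2 := by linarith [hx.2]
      rw [h2]
      norm_num
      rw [hα.one, hβ.one]
    · congr 1
      ring

lemma circ_arccos {t : ℝ} (ht : t ∈ Icc (-1 : ℝ) 1) :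
    circ (Real.arccos t / (2 * π)) = ⟨t, √(1 - t ^ 2)⟩ ∧
      circ (-(Real.arccos t / (2 * π))) = ⟨t, -√(1 - t ^ 2)⟩ := by
  have h : ∀ x : ℝ, circ (x / (2 * π)) = ⟨Real.cos x, Real.sin x⟩ := by
    intro x
    have h1 : circ (x / (2 * π)) = exp (x * I) := by
      rw [circ]
      congr 1
      push_cast
      field_simp
    rw [h1, Complex.exp_mul_I, ← Complex.ofReal_cos, ← Complex.ofReal_sin]
    exact (Complex.mk_eq_add_mul_I _ _).symm
  rw [← neg_div, h, h, Real.cos_neg, Real.sin_neg, Real.cos_arccos ht.1 ht.2, Real.sin_arccos]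
  exact ⟨rfl, rfl⟩

/-- A periodic map with two fixed points, whose nontrivial powers have no other fixed points, is
conjugate to a rotation. -/
theorem exists_conj_rotation {f : Sphere2 ≃ₜ Sphere2} {a b : Sphere2} (hf : 0 < orderOf f)
    (hf1 : f ≠ 1) (hab : a ≠ b) (ha : f a = a) (hb : f b = b)
    (hfree : ∀ k ∈ zpowers f, k ≠ 1 → ∀ x, k x = x → x = a ∨ x = b) :
    ∃ (H : Sphere2 ≃ₜ Sphere2) (ω : ℂ), ‖ω‖ = 1 ∧ H (pt 0 1) = a ∧ H (pt 0 (-1)) = b ∧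
      ∀ v w, xy w = ω * xy v → ht w = ht v → f (H v) = H w := by
  obtain ⟨β, hβ⟩ := exists_isSpine hf hf1 hab ha hb hfree
  obtain ⟨h, hh, hfh, hh1, z, hz, hR, hcov⟩ := hβ.exists_generator
  have hle : zpowers h ≤ zpowers f := Subgroup.zpowers_le.2 hh
  have hone := Subgroup.one_mem (zpowers f)
  have Ah := hβ.isArc hh
  have hJ := isJordan_loop hβ.arc Ah (hβ.disj h hh hh1)
  have hzr : z ∉ range (loop β (h ∘ β)) := by
    rw [range_loop hβ.arc Ah]
    exact fun h => hz (h.elim (fun h => image_subset_star hone h) fun h => image_subset_star hh h)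
  obtain ⟨Ψ, hΨ, -, hΨc⟩ := hJ.exists_schoenflies hzr
  rw [← hR] at hΨ
  set P : ℝ → ℝ → ℂ := fun s t => ⟨t, (1 - 2 * s) * √(1 - t ^ 2)⟩ with hP
  have hPc : Continuous fun p : ℝ × ℝ => P p.1 p.2 := by
    have : (fun p : ℝ × ℝ => P p.1 p.2) =
        fun p => (p.2 : ℂ) + ((1 - 2 * p.1) * √(1 - p.2 ^ 2) : ℝ) * I :=
      funext fun p => Complex.mk_eq_add_mul_I _ _
    rw [this]
    fun_prop
  have hPn : ∀ s, ∀ t ∈ Icc (-1 : ℝ) 1,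
      ‖P s t‖ ^ 2 = t ^ 2 + (1 - 2 * s) ^ 2 * (1 - t ^ 2) := by
    intro s t ht
    rw [Complex.sq_norm, normSq_apply]
    simp only [hP]
    have := Real.mul_self_sqrt (show 0 ≤ 1 - t ^ 2 by nlinarith [ht.1, ht.2])
    linear_combination (1 - 2 * s) ^ 2 * this
  have hPm : ∀ s ∈ Icc (0 : ℝ) 1, ∀ t ∈ Icc (-1 : ℝ) 1, P s t ∈ closedBall (0 : ℂ) 1 := by
    intro s hs t ht
    rw [mem_closedBall_zero_iff, ← sq_le_one_iff₀ (norm_nonneg _), hPn s t ht]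
    have h1 : 0 ≤ 1 - t ^ 2 := by nlinarith [ht.1, ht.2]
    have h2 : (1 - 2 * s) ^ 2 ≤ 1 := by nlinarith [hs.1, hs.2]
    nlinarith
  have hx : ∀ t : ℝ, Real.arccos t / (2 * π) ∈ Icc (0 : ℝ) (1 / 2) := by
    intro t
    refine ⟨div_nonneg (Real.arccos_nonneg t) (by positivity), ?_⟩
    rw [div_le_iff₀ (by positivity)]
    linarith [Real.arccos_le_pi t]
  have h2x : ∀ t : ℝ, 2 * (Real.arccos t / (2 * π)) ∈ Icc (0 : ℝ) 1 :=
    fun t => ⟨by linarith [(hx t).1], by linarith [(hx t).2]⟩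
  have hP0 : ∀ t ∈ Icc (-1 : ℝ) 1, Ψ (P 0 t) = β (2 * (Real.arccos t / (2 * π))) := by
    intro t ht
    have : P 0 t = circ (Real.arccos t / (2 * π)) := by
      rw [(circ_arccos ht).1]
      simp [hP]
    rw [this, hΨc, (loop_of_mem_Icc hβ.arc Ah (hx t)).1]
  have hP1 : ∀ t ∈ Icc (-1 : ℝ) 1, Ψ (P 1 t) = h (β (2 * (Real.arccos t / (2 * π)))) := by
    intro t ht
    have : P 1 t = circ (-(Real.arccos t / (2 * π))) := by
      rw [(circ_arccos ht).2]
      simp only [hP]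
      congr 1
      ring
    rw [this, hΨc, (loop_of_mem_Icc hβ.arc Ah (hx t)).2]
    rfl
  have hpole : ∀ s t, t ^ 2 = 1 → P s t = P 0 t := by
    intro s t ht
    simp [hP, ht]
  have hPtop : Ψ (P 0 1) = a := by
    rw [hP0 1 (by simp), Real.arccos_one]
    simpa using hβ.arc.zero
  have hPbot : Ψ (P 0 (-1)) = b := by
    rw [hP0 (-1) (by simp), Real.arccos_neg_one]
    have : 2 * (π / (2 * π)) = 1 := by field_simp
    rw [this, hβ.arc.one]
  have hposh := Nat.pos_of_dvd_of_pos (orderOf_dvd_of_mem_zpowers hh) hf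
  obtain ⟨H, hHa, hHb, hHr⟩ := exists_conj_of_fundamental hposh (σ := fun s t => Ψ (P s t))
    (a := a) (b := b) (hΨ.cont.comp hPc.continuousOn fun p hp => hPm _ hp.1 _ hp.2)
    (fun t ht => by rw [hP1 t ht, hP0 t ht])
    (fun s _ => by rw [hpole s 1 (by norm_num), hPtop])
    (fun s _ => by rw [hpole s (-1) (by norm_num), hPbot])
    (apply_eq_of_mem_zpowers hh ha) (apply_eq_of_mem_zpowers hh hb) (by
      intro x
      obtain ⟨k, hk, y, hy, e⟩ := hcov x
      rw [← hΨ.image_closedBall] at hy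
      obtain ⟨u, hu, rfl⟩ := hy
      have hu' : u.re ^ 2 + u.im ^ 2 ≤ 1 := by
        have h1 : ‖u‖ ^ 2 ≤ 1 := (sq_le_one_iff₀ (norm_nonneg _)).2 (by simpa using hu)
        rw [Complex.sq_norm, normSq_apply] at h1
        linarith
      have hre : u.re ∈ Icc (-1 : ℝ) 1 := by
        constructor <;> nlinarith [sq_nonneg u.im]
      have hd : |u.im| ≤ √(1 - u.re ^ 2) := Real.abs_le_sqrt (by linarith)
      obtain ⟨hd1, hd2⟩ := abs_le.1 hd
      rcases (Real.sqrt_nonneg (1 - u.re ^ 2)).eq_or_lt with h0 | h0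
      · refine ⟨k, hk, 0, by simp, u.re, hre, ?_⟩
        have : P 0 u.re = u := by
          rw [← h0] at hd1 hd2
          refine Complex.ext rfl ?_
          simp only [hP]
          rw [← h0]
          linarith
        rw [this, e]
      · refine ⟨k, hk, (1 - u.im / √(1 - u.re ^ 2)) / 2, ?_, u.re, hre, ?_⟩
        · have h1 : u.im / √(1 - u.re ^ 2) ≤ 1 := (div_le_one h0).2 hd2
          have h2 : -1 ≤ u.im / √(1 - u.re ^ 2) := by
            rw [le_div_iff₀ h0]
            linarith
          constructor <;> linarith
        · have : P ((1 - u.im / √(1 - u.re ^ 2)) / 2) u.re = u := by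
            refine Complex.ext rfl ?_
            simp only [hP]
            field_simp
            ring
          rw [this, e]) (by
      intro k hk s hs s' hs' t ht t' ht' e
      have hkf := hle hk
      have hcases : ∀ s ∈ Ico (0 : ℝ) 1, ∀ t ∈ Icc (-1 : ℝ) 1, Ψ (P s t) ∈ region f β z ∨
          ∃ τ ∈ Icc (0 : ℝ) 1, Ψ (P s t) = β τ := by
        intro s hs t ht
        have hn := hPm s (Ico_subset_Icc_self hs) t ht
        rw [mem_closedBall_zero_iff] at hn
        rcases hn.lt_or_eq with hn | hn
        · refine Or.inl ?_
          rw [← hΨ.image_ball]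
          exact mem_image_of_mem _ (by simpa using hn)
        · refine Or.inr ⟨_, h2x t, ?_⟩
          rw [← hP0 t ht]
          congr 1
          have h1 := hPn s t ht
          rw [hn] at h1
          have h2 : (1 - t ^ 2) * (s * (1 - s)) = 0 := by linear_combination h1 / 4
          rcases mul_eq_zero.1 h2 with h3 | h3
          · exact hpole s t (by linarith)
          · rcases mul_eq_zero.1 h3 with h4 | h4
            · rw [h4]
            · exact absurd hs.2 (by linarith)
      have hm := hPm s (Ico_subset_Icc_self hs) t ht
      have hm' := hPm s' (Ico_subset_Icc_self hs') t' ht'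
      have hPinj : Ψ (P s t) = Ψ (P s' t') → t = t' ∧ (t ^ 2 = 1 ∨ s = s') := by
        intro e
        have e1 := hΨ.inj hm hm' e
        have h1 : t = t' := congrArg Complex.re e1
        subst h1
        refine ⟨rfl, ?_⟩
        have h2 : (1 - 2 * s) * √(1 - t ^ 2) = (1 - 2 * s') * √(1 - t ^ 2) :=
          congrArg Complex.im e1
        by_cases h3 : t ^ 2 = 1
        · exact Or.inl h3
        · have h4 : √(1 - t ^ 2) ≠ 0 := by
            have : 0 < 1 - t ^ 2 := lt_of_le_of_ne (by nlinarith [ht.1, ht.2])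
              (fun e => h3 (by linarith))
            exact (Real.sqrt_pos.2 this).ne'
          have := mul_right_cancel₀ h4 h2
          exact Or.inr (by linarith)
      by_cases hk1 : k = 1
      · subst hk1
        obtain ⟨h1, h2⟩ := hPinj e
        exact ⟨h1, h2.imp id fun h => ⟨rfl, h⟩⟩
      · rcases hcases s hs t ht with h1 | ⟨τ, hτ, h1⟩
        · have h1s : Ψ (P s t) ∉ star f β := connectedComponentIn_subset _ _ h1
          rcases hcases s' hs' t' ht' with h2 | ⟨τ', hτ', h2⟩
          · rw [e] at h1
            exact absurd h1 (hβ.apply_notMem_region hz hkf hk1 _ h2)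
          · rw [e, h2] at h1s
            exact absurd (mem_star hkf hτ') h1s
        · rcases hcases s' hs' t' ht' with h2 | ⟨τ', hτ', h2⟩
          · have h2s := apply_notMem_star hkf (connectedComponentIn_subset _ _ h2)
            rw [← e, h1] at h2s
            exact absurd (mem_star hone hτ) h2s
          · rw [h1, h2] at e
            obtain ⟨h3, h4⟩ := hβ.disj k hkf hk1 τ hτ τ' hτ' e
            refine ⟨(hPinj (by rw [h1, h2, h3])).1, Or.inl ?_⟩
            have key : ∀ t₀ ∈ Icc (-1 : ℝ) 1, t₀ ^ 2 = 1 → Ψ (P s t) = Ψ (P 0 t₀) →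
                t ^ 2 = 1 := by
              intro t₀ ht₀ h5 h6
              have h7 : t = t₀ := congrArg Complex.re (hΨ.inj hm (hPm 0 (by simp) t₀ ht₀) h6)
              rw [h7, h5]
            rcases h4 with h4 | h4
            · exact key 1 (by simp) (by norm_num) (by rw [hPtop, h1, h4, hβ.arc.zero])
            · exact key (-1) (by simp) (by norm_num) (by rw [hPbot, h1, h4, hβ.arc.one]))
  obtain ⟨i, hi⟩ := (orderOf_pos_iff.1 hposh).mem_powers_iff_mem_zpowers.2 hfh
  simp only at hi
  rw [← hi]
  refine ⟨H, circ (1 / orderOf h) ^ i, by rw [norm_pow, norm_circ, one_pow], hHa, hHb, ?_⟩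
  have key : ∀ j : ℕ, ∀ v w, xy w = circ (1 / orderOf h) ^ j * xy v → ht w = ht v →
      (h ^ j) (H v) = H w := by
    intro j
    induction j with
    | zero =>
      intro v w h1 h2
      rw [sphere_ext (v := v) (w := w) (by rw [h1]; simp) h2.symm]
      rfl
    | succ j ih =>
      intro v w h1 h2
      have hs : ‖circ (1 / orderOf h) ^ j * xy v‖ ^ 2 + ht v ^ 2 = 1 := by
        rw [norm_mul, norm_pow, norm_circ, one_pow, one_mul, norm_xy_sq_add]
      rw [pow_succ', mul_apply, ih v (pt (circ (1 / orderOf h) ^ j * xy v) (ht v))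
        (xy_pt hs) (ht_pt hs)]
      refine hHr _ _ ?_ ?_
      · rw [xy_pt hs, h1]
        ring
      · rw [ht_pt hs, h2]
  exact key i

/-- The `m`-th power map in the angular coordinate. -/
noncomputable def powMap (m : ℕ) (v : Sphere2) : Sphere2 :=
  pt (xy v ^ m / (‖xy v‖ : ℂ) ^ (m - 1)) (ht v)

section PowMap

variable {m : ℕ}

lemma norm_pow_div {z : ℂ} (hm : m ≠ 0) : ‖z ^ m / (‖z‖ : ℂ) ^ (m - 1)‖ = ‖z‖ := by
  by_cases hz : z = 0
  · simp [hz, hm]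
  · have : ‖z‖ ≠ 0 := norm_ne_zero_iff.2 hz
    obtain ⟨k, rfl⟩ := Nat.exists_eq_succ_of_ne_zero hm
    rw [norm_div, norm_pow, norm_pow, norm_real, norm_norm, Nat.succ_eq_add_one,
      Nat.add_sub_cancel, pow_succ]
    field_simp

lemma powMap_aux (hm : m ≠ 0) (v : Sphere2) :
    ‖xy v ^ m / (‖xy v‖ : ℂ) ^ (m - 1)‖ ^ 2 + ht v ^ 2 = 1 := by
  rw [norm_pow_div hm, norm_xy_sq_add]

lemma xy_powMap (hm : m ≠ 0) (v : Sphere2) :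
    xy (powMap m v) = xy v ^ m / (‖xy v‖ : ℂ) ^ (m - 1) := xy_pt (powMap_aux hm v)

lemma ht_powMap (hm : m ≠ 0) (v : Sphere2) : ht (powMap m v) = ht v := ht_pt (powMap_aux hm v)

lemma norm_xy_powMap (hm : m ≠ 0) (v : Sphere2) : ‖xy (powMap m v)‖ = ‖xy v‖ := by
  rw [xy_powMap hm, norm_pow_div hm]

lemma continuous_powMap (hm : m ≠ 0) : Continuous (powMap m) := by
  refine continuous_pt ?_ continuous_ht (powMap_aux hm)
  rw [continuous_iff_continuousAt]
  intro v
  by_cases hv : xy v = 0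
  · rw [ContinuousAt, hv]
    simp only [zero_pow hm, zero_div]
    rw [tendsto_zero_iff_norm_tendsto_zero]
    simp only [norm_pow_div hm]
    have := continuous_xy.norm.tendsto v
    rwa [hv, norm_zero] at this
  · have h1 := continuous_xy.continuousAt (x := v)
    refine (h1.pow m).div ((Complex.continuous_ofReal.continuousAt.comp h1.norm).pow _) ?_
    exact pow_ne_zero _ (Complex.ofReal_ne_zero.2 (norm_ne_zero_iff.2 hv))

lemma powMap_eq_iff (hm : m ≠ 0) {v w : Sphere2} :
    powMap m v = powMap m w ↔ ht v = ht w ∧ xy v ^ m = xy w ^ m := by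
  constructor
  · intro h
    have h1 := congrArg ht h
    rw [ht_powMap hm, ht_powMap hm] at h1
    refine ⟨h1, ?_⟩
    have hn : ‖xy v‖ = ‖xy w‖ := by rw [norm_xy_eq_sqrt, norm_xy_eq_sqrt, h1]
    have h2 := congrArg xy h
    rw [xy_powMap hm, xy_powMap hm, hn] at h2
    by_cases h0 : xy w = 0
    · rw [h0, norm_zero, norm_eq_zero] at hn
      rw [h0, hn]
    · have : (‖xy w‖ : ℂ) ^ (m - 1) ≠ 0 :=
        pow_ne_zero _ (Complex.ofReal_ne_zero.2 (norm_ne_zero_iff.2 h0))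
      exact (div_left_inj' this).1 h2
  · rintro ⟨h1, h2⟩
    have hn : ‖xy v‖ = ‖xy w‖ := by rw [norm_xy_eq_sqrt, norm_xy_eq_sqrt, h1]
    refine sphere_ext ?_ ?_
    · rw [xy_powMap hm, xy_powMap hm, hn, h2]
    · rw [ht_powMap hm, ht_powMap hm, h1]

lemma surjective_powMap (hm : m ≠ 0) : Function.Surjective (powMap m) := by
  intro y
  set x := (xy y).arg / (2 * π) with hx
  have hs := sq_norm_sqrt_mul_circ (ht_mem_Icc y) (x / m)
  refine ⟨pt (√(1 - ht y ^ 2) * circ (x / m)) (ht y), sphere_ext ?_ ?_⟩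
  · have hc : circ (x / m) ^ m = circ x := by
      rw [circ, circ, ← Complex.exp_nat_mul]
      congr 1
      push_cast
      field_simp
    rw [xy_powMap hm, xy_pt hs, mul_pow, hc, norm_mul, norm_circ, mul_one, norm_real,
      Real.norm_eq_abs, abs_of_nonneg (Real.sqrt_nonneg _)]
    conv_rhs => rw [← norm_mul_circ (xy y), norm_xy_eq_sqrt, ← hx]
    by_cases h0 : (√(1 - ht y ^ 2) : ℂ) = 0
    · rw [h0]
      simp [hm]
    · obtain ⟨k, rfl⟩ := Nat.exists_eq_succ_of_ne_zero hm
      rw [Nat.succ_eq_add_one, Nat.add_sub_cancel, pow_succ]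
      field_simp
  · rw [ht_powMap hm, ht_pt hs]

lemma isQuotientMap_powMap (hm : m ≠ 0) : IsQuotientMap (powMap m) :=
  (continuous_powMap hm).isClosedMap.isQuotientMap (continuous_powMap hm) (surjective_powMap hm)

lemma xy_powMap_eq_zero (hm : m ≠ 0) {v : Sphere2} : xy (powMap m v) = 0 ↔ xy v = 0 := by
  rw [← norm_eq_zero, norm_xy_powMap hm, norm_eq_zero]

end PowMap

/-- The sphere without its poles is connected. -/
theorem isPreconnected_xy_ne_zero : IsPreconnected {v : Sphere2 | xy v ≠ 0} := by
  have : {v : Sphere2 | xy v ≠ 0} = {pt 0 1, pt 0 (-1)}ᶜ := by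
    ext v
    have h1 : ‖(0 : ℂ)‖ ^ 2 + (1 : ℝ) ^ 2 = 1 := by simp
    have h2 : ‖(0 : ℂ)‖ ^ 2 + (-1 : ℝ) ^ 2 = 1 := by simp
    refine not_congr ⟨fun h => ?_, ?_⟩
    · have h3 := norm_xy_sq_add v
      rw [h, norm_zero] at h3
      rcases sq_eq_sq_iff_eq_or_eq_neg.1 (show ht v ^ 2 = 1 ^ 2 by linarith) with e | e
      · exact Or.inl (sphere_ext (by rw [h, xy_pt h1]) (by rw [e, ht_pt h1]))
      · exact Or.inr (sphere_ext (by rw [h, xy_pt h2]) (by rw [e, ht_pt h2]))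
    · rintro (rfl | rfl)
      exacts [xy_pt h1, xy_pt h2]
  rw [this]
  exact isPreconnected_compl_pair _ _

/-- Two lifts through the power map differ by a rotation. -/
theorem exists_root_of_powMap_eq {m : ℕ} (hm : m ≠ 0) {A B : Sphere2 → Sphere2} (hA : Continuous A)
    (hB : Continuous B) (hB0 : ∀ v, xy (B v) = 0 → xy v = 0)
    (h : ∀ v, powMap m (A v) = powMap m (B v)) :
    ∃ ζ : ℂ, ζ ^ m = 1 ∧ ∀ v, xy v ≠ 0 → xy (A v) = ζ * xy (B v) := by
  have hfin : {z : ℂ | z ^ m = 1}.Finite := by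
    have : {z : ℂ | z ^ m = 1} = ↑(Polynomial.nthRootsFinset m (1 : ℂ)) := by
      ext z
      simp [Polynomial.mem_nthRootsFinset (Nat.pos_of_ne_zero hm)]
    rw [this]
    exact Finset.finite_toSet _
  have hdisc : DiscreteTopology {z : ℂ | z ^ m = 1} := hfin.isDiscrete.to_subtype
  have hBne : ∀ v, xy v ≠ 0 → xy (B v) ≠ 0 := fun v hv e => hv (hB0 v e)
  obtain ⟨ζ, hζ, hζe⟩ := isPreconnected_xy_ne_zero.eqOn_const_of_mapsTo (T := {z : ℂ | z ^ m = 1})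
    hfin.isDiscrete (f := fun v => xy (A v) / xy (B v))
    (((continuous_xy.comp hA).continuousOn).div (continuous_xy.comp hB).continuousOn hBne) (by
      intro v hv
      show (xy (A v) / xy (B v)) ^ m = 1
      rw [div_pow, ((powMap_eq_iff hm).1 (h v)).2, div_self (pow_ne_zero _ (hBne v hv))])
    ⟨1, one_pow m⟩
  refine ⟨ζ, hζ, fun v hv => ?_⟩
  have := hζe hv
  exact (div_eq_iff (hBne v hv)).1 this

/-- The angular and vertical coordinates of a point off the poles. -/
noncomputable def angle (v : Sphere2) : ℝ × ℝ := ((xy v).arg / (2 * π), ht v / ‖xy v‖)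

/-- The point with given angular and vertical coordinates. -/
noncomputable def cyl (p : ℝ × ℝ) : Sphere2 :=
  pt (((√(1 + p.2 ^ 2))⁻¹ : ℝ) * circ p.1) (p.2 * (√(1 + p.2 ^ 2))⁻¹)

lemma cyl_aux (p : ℝ × ℝ) : ‖(((√(1 + p.2 ^ 2))⁻¹ : ℝ) : ℂ) * circ p.1‖ ^ 2 +
    (p.2 * (√(1 + p.2 ^ 2))⁻¹) ^ 2 = 1 := by
  have h : 0 < 1 + p.2 ^ 2 := by positivity
  rw [norm_mul, norm_circ, mul_one, norm_real, Real.norm_eq_abs, sq_abs, mul_pow, inv_pow,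
    Real.sq_sqrt h.le]
  field_simp

lemma xy_cyl (p : ℝ × ℝ) : xy (cyl p) = ((√(1 + p.2 ^ 2))⁻¹ : ℝ) * circ p.1 := xy_pt (cyl_aux p)

lemma ht_cyl (p : ℝ × ℝ) : ht (cyl p) = p.2 * (√(1 + p.2 ^ 2))⁻¹ := ht_pt (cyl_aux p)

lemma sqrt_one_add_sq_pos (y : ℝ) : 0 < √(1 + y ^ 2) := Real.sqrt_pos.2 (by positivity)

lemma norm_xy_cyl (p : ℝ × ℝ) : ‖xy (cyl p)‖ = (√(1 + p.2 ^ 2))⁻¹ := by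
  rw [xy_cyl, norm_mul, norm_circ, mul_one, norm_real, Real.norm_eq_abs,
    abs_of_pos (inv_pos.2 (sqrt_one_add_sq_pos _))]

lemma xy_cyl_ne_zero (p : ℝ × ℝ) : xy (cyl p) ≠ 0 := by
  rw [← norm_ne_zero_iff, norm_xy_cyl]
  exact (inv_pos.2 (sqrt_one_add_sq_pos _)).ne'

lemma continuous_cyl : Continuous cyl := by
  have h0 : ∀ p : ℝ × ℝ, √(1 + p.2 ^ 2) ≠ 0 := fun p => (sqrt_one_add_sq_pos _).ne'
  have h1 : Continuous fun p : ℝ × ℝ => (√(1 + p.2 ^ 2))⁻¹ :=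
    Continuous.inv₀ (by fun_prop) h0
  refine continuous_pt ((Complex.continuous_ofReal.comp h1).mul
    (isJordan_circ.cont.comp continuous_fst)) (continuous_snd.mul h1) cyl_aux

lemma cyl_angle {v : Sphere2} (hv : xy v ≠ 0) : cyl (angle v) = v := by
  have hn : 0 < ‖xy v‖ := norm_pos_iff.2 hv
  have h1 : √(1 + (ht v / ‖xy v‖) ^ 2) = ‖xy v‖⁻¹ := by
    have : 1 + (ht v / ‖xy v‖) ^ 2 = (‖xy v‖⁻¹) ^ 2 := by
      field_simp
      linarith [norm_xy_sq_add v]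
    rw [this, Real.sqrt_sq (inv_nonneg.2 hn.le)]
  refine sphere_ext ?_ ?_
  · rw [xy_cyl]
    simp only [angle]
    rw [h1, inv_inv, norm_mul_circ]
  · rw [ht_cyl]
    simp only [angle]
    rw [h1, inv_inv]
    field_simp

lemma powMap_cyl {m : ℕ} (hm : m ≠ 0) (p : ℝ × ℝ) : powMap m (cyl p) = cyl (m * p.1, p.2) := by
  refine sphere_ext ?_ ?_
  · rw [xy_powMap hm, norm_xy_cyl, xy_cyl, xy_cyl]
    have hc : circ p.1 ^ m = circ (m * p.1) := by
      rw [circ, circ, ← Complex.exp_nat_mul]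
      congr 1
      push_cast
      ring
    rw [mul_pow, hc]
    have h0 : (((√(1 + p.2 ^ 2))⁻¹ : ℝ) : ℂ) ≠ 0 :=
      Complex.ofReal_ne_zero.2 (inv_pos.2 (sqrt_one_add_sq_pos _)).ne'
    obtain ⟨k, rfl⟩ := Nat.exists_eq_succ_of_ne_zero hm
    rw [Nat.succ_eq_add_one, Nat.add_sub_cancel, pow_succ]
    generalize (((√(1 + p.2 ^ 2))⁻¹ : ℝ) : ℂ) = r at h0 ⊢
    field_simp
  · rw [ht_powMap hm, ht_cyl, ht_cyl]

lemma cyl_add_one (p : ℝ × ℝ) : cyl (p.1 + 1, p.2) = cyl p := by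
  have hc : circ (p.1 + 1) = circ p.1 := isJordan_circ.eq_iff.2 ⟨1, by simp⟩
  refine sphere_ext ?_ ?_
  · rw [xy_cyl, xy_cyl, hc]
  · rw [ht_cyl, ht_cyl]

lemma circ_half : circ (1 / 2) = -1 := by
  rw [circ, ← Complex.exp_pi_mul_I]
  congr 1
  push_cast
  ring

/-- A function which is periodic in the angular coordinate is continuous off the poles. -/
theorem continuousAt_comp_angle {Y : Type*} [TopologicalSpace Y] {φ : ℝ × ℝ → Y}
    (hφ : Continuous φ) (hper : ∀ p : ℝ × ℝ, φ (p.1 + 1, p.2) = φ p) {v : Sphere2}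
    (hv : xy v ≠ 0) : ContinuousAt (fun v => φ (angle v)) v := by
  have hx := continuous_xy.continuousAt (x := v)
  have h2 : ContinuousAt (fun v => ht v / ‖xy v‖) v :=
    continuous_ht.continuousAt.div hx.norm (norm_ne_zero_iff.2 hv)
  have hper' : ∀ i : ℤ, ∀ x y, φ (x + i, y) = φ (x, y) := by
    intro i x y
    have : Function.Periodic (fun x => φ (x, y)) 1 := fun x => hper (x, y)
    simpa using this.int_mul i x
  by_cases hs : xy v ∈ slitPlane
  · have h1 : ContinuousAt (fun v => (xy v).arg / (2 * π)) v :=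
      ((Complex.continuousAt_arg hs).comp hx).div_const _
    exact hφ.continuousAt.comp (h1.prodMk h2)
  · have hs' : -xy v ∈ slitPlane := by
      rw [Complex.mem_slitPlane_iff] at hs ⊢
      push Not at hs
      left
      rw [Complex.neg_re]
      have : (xy v).re ≠ 0 := fun e => hv (Complex.ext e hs.2)
      have := lt_of_le_of_ne hs.1 this
      linarith
    have h1 : ContinuousAt (fun v => (-xy v).arg / (2 * π) + 1 / 2) v :=
      ((ContinuousAt.comp (f := fun v => -xy v) (Complex.continuousAt_arg hs') hx.neg).div_const _).add_const _
    have h3 := hφ.continuousAt.comp (h1.prodMk h2)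
    refine h3.congr ?_
    filter_upwards [hx.eventually_ne hv] with w hw
    have hc : circ ((-xy w).arg / (2 * π) + 1 / 2) = circ ((xy w).arg / (2 * π)) := by
      have hn : (‖xy w‖ : ℂ) ≠ 0 := Complex.ofReal_ne_zero.2 (norm_ne_zero_iff.2 hw)
      have e1 := norm_mul_circ (xy w)
      have e2 := norm_mul_circ (-xy w)
      rw [norm_neg] at e2
      apply mul_left_cancel₀ hn
      rw [circ_add, ← mul_assoc, e2, e1, circ_half]
      ring
    obtain ⟨i, hi⟩ := isJordan_circ.eq_iff.1 hc
    show φ (_, _) = φ (_, _)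
    rw [hi, hper']

/-- Maps preserving the poles lift through the power map. -/
theorem exists_lift_powMap {m : ℕ} (hm : m ≠ 0) {F : Sphere2 → Sphere2} (hF : Continuous F)
    (h0 : ∀ v, xy (F v) = 0 ↔ xy v = 0) :
    ∃ G : Sphere2 → Sphere2, Continuous G ∧ ∀ v, powMap m (G v) = F (powMap m v) := by
  have hmC : (m : ℂ) ≠ 0 := Nat.cast_ne_zero.2 hm
  obtain ⟨M, hM, hMe⟩ := hasLog_univ (X := ℝ × ℝ) (F := fun p => xy (F (cyl p)))
    (continuous_xy.comp (hF.comp continuous_cyl)) fun p => by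
      rw [Ne, h0]
      exact xy_cyl_ne_zero p
  have hMc : Continuous M := continuousOn_univ.1 hM
  have hMe' : ∀ p, exp (M p) = xy (F (cyl p)) := fun p => hMe p (mem_univ _)
  obtain ⟨d, hd⟩ : ∃ d : ℤ, ∀ p : ℝ × ℝ,
      M (p.1 + 1, p.2) = M p + d * (2 * π * I) := by
    have hexp : ∀ p : ℝ × ℝ, exp (M (p.1 + 1, p.2)) = exp (M p) := fun p => by
      rw [hMe', hMe', cyl_add_one]
    obtain ⟨d, hd⟩ := Complex.exp_eq_exp_iff_exists_int.1 (hexp (0, 0))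
    refine ⟨d, fun p => ?_⟩
    have := sub_eq_sub_of_exp_eq (K := (univ : Set (ℝ × ℝ))) isPreconnected_univ
      (l := fun p => M (p.1 + 1, p.2)) (m := M) (by fun_prop) hM (fun p _ => hexp p)
      (mem_univ p) (mem_univ (0, 0))
    simp only at this
    rw [hd] at this
    linear_combination this
  have hdm : ∀ (k : ℕ) (x y : ℝ), M (x + k, y) = M (x, y) + k * (d * (2 * π * I)) := by
    intro k x y
    induction k with
    | zero => simp
    | succ k ih =>
      have := hd (x + k, y)
      simp only at this
      push_cast
      rw [← add_assoc, this, ih]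
      ring
  set φ : ℝ × ℝ → ℂ := fun p => exp (((M (m * p.1, p.2)).im / m : ℝ) * I) with hφ
  have hφc : Continuous φ := by fun_prop
  have hφn : ∀ p, ‖φ p‖ = 1 := fun p => Complex.norm_exp_ofReal_mul_I _
  have hφper : ∀ p : ℝ × ℝ, φ (p.1 + 1, p.2) = φ p := by
    intro p
    simp only [hφ]
    rw [mul_add, mul_one, hdm]
    refine Complex.exp_eq_exp_iff_exists_int.2 ⟨d, ?_⟩
    have him : ((m : ℂ) * (d * (2 * π * I))).im = m * (d * (2 * π)) := by
      have : (m : ℂ) * (d * (2 * π * I)) =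
          ((m * (d * (2 * π)) : ℝ) : ℂ) * I := by
        push_cast
        ring
      rw [this, Complex.im_ofReal_mul, Complex.I_im, mul_one]
    rw [Complex.add_im, him]
    push_cast
    field_simp
  have hφm : ∀ p, ‖xy (F (cyl (m * p.1, p.2)))‖ * φ p ^ m = xy (F (cyl (m * p.1, p.2))) := by
    intro p
    rw [← hMe', Complex.norm_exp]
    simp only [hφ]
    rw [← Complex.exp_nat_mul, Complex.ofReal_exp, ← exp_add]
    congr 1
    push_cast
    rw [← mul_assoc, mul_div_cancel₀ _ hmC, Complex.re_add_im]
  have haux : ∀ v, ‖(‖xy (F (powMap m v))‖ : ℂ) * φ (angle v)‖ ^ 2 + ht (F (powMap m v)) ^ 2 = 1 := by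
    intro v
    rw [norm_mul, hφn, mul_one, norm_real, norm_norm, norm_xy_sq_add]
  have hFq : Continuous fun v => F (powMap m v) := hF.comp (continuous_powMap hm)
  refine ⟨fun v => pt (‖xy (F (powMap m v))‖ * φ (angle v)) (ht (F (powMap m v))), ?_, fun v => ?_⟩
  · refine continuous_pt ?_ (continuous_ht.comp hFq) haux
    have hn : Continuous fun v => ‖xy (F (powMap m v))‖ := (continuous_xy.comp hFq).norm
    rw [continuous_iff_continuousAt]
    intro v
    by_cases hv : xy v = 0
    · have h1 : xy (F (powMap m v)) = 0 := (h0 _).2 ((xy_powMap_eq_zero hm).2 hv)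
      rw [ContinuousAt, h1, norm_zero, Complex.ofReal_zero, zero_mul,
        tendsto_zero_iff_norm_tendsto_zero]
      have h2 := hn.tendsto v
      rw [h1, norm_zero] at h2
      simpa [norm_mul, hφn] using h2
    · exact (Complex.continuous_ofReal.comp hn).continuousAt.mul
        (continuousAt_comp_angle hφc hφper hv)
  · have hnv : ‖(‖xy (F (powMap m v))‖ : ℂ) * φ (angle v)‖ = ‖xy (F (powMap m v))‖ := by
      rw [norm_mul, hφn, mul_one, norm_real, norm_norm]
    refine sphere_ext ?_ ?_
    · rw [xy_powMap hm, xy_pt (haux v), hnv, mul_pow]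
      by_cases hv : xy v = 0
      · rw [(h0 _).2 ((xy_powMap_eq_zero hm).2 hv)]
        simp [hm]
      · have h1 : F (powMap m v) = F (cyl (m * (angle v).1, (angle v).2)) := by
          rw [← powMap_cyl hm, cyl_angle hv]
        have h2 := hφm (angle v)
        rw [← h1] at h2
        have h3 : (‖xy (F (powMap m v))‖ : ℂ) ≠ 0 := by
          rw [Complex.ofReal_ne_zero, norm_ne_zero_iff, Ne, h0, xy_powMap_eq_zero hm]
          exact hv
        conv_rhs => rw [← h2]
        obtain ⟨k, rfl⟩ := Nat.exists_eq_succ_of_ne_zero hm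
        rw [Nat.succ_eq_add_one, Nat.add_sub_cancel, pow_succ (‖xy _‖ : ℂ)]
        field_simp
    · rw [ht_powMap hm, ht_pt (haux v)]

lemma xy_eq_zero_iff {v : Sphere2} : xy v = 0 ↔ v = pt 0 1 ∨ v = pt 0 (-1) := by
  constructor
  · intro h
    have h1 := norm_xy_sq_add v
    rw [h, norm_zero, zero_pow two_ne_zero, zero_add, sq_eq_one_iff] at h1
    rcases h1 with h1 | h1
    · left
      rw [← pt_xy_ht v, h, h1]
    · right
      rw [← pt_xy_ht v, h, h1]
  · rintro (rfl | rfl) <;> exact xy_pt (by simp)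

lemma north_ne_south : pt 0 1 ≠ pt 0 (-1) := by
  intro h
  have := congrArg ht h
  rw [ht_pt (by simp), ht_pt (by simp)] at this
  norm_num at this

/-- A rotation of the sphere taking one given point to another and commuting with the antipodal
map. -/
theorem exists_homeomorph_neg (a b : Sphere2) :
    ∃ O : Sphere2 ≃ₜ Sphere2, O a = b ∧ ∀ v, O (-v) = -O v := by
  set R := (Submodule.span ℝ {(a : EuclideanSpace ℝ (Fin 3)) - b})ᗮ.reflection
  have hR : ∀ x, x ∈ sphere (0 : EuclideanSpace ℝ (Fin 3)) 1 ↔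
      R.toHomeomorph x ∈ sphere (0 : EuclideanSpace ℝ (Fin 3)) 1 := fun x => by simp
  refine ⟨R.toHomeomorph.subtype hR, Subtype.ext ?_, fun v => Subtype.ext ?_⟩
  · exact Submodule.reflection_sub (by simp)
  · exact map_neg R _

lemma eq_neg_iff {v w : Sphere2} : w = -v ↔ xy w = circ (1 / 2) * xy v ∧ ht w = -ht v := by
  have h1 : xy (-v) = -xy v := by apply Complex.ext <;> simp [xy]
  have h2 : ht (-v) = -ht v := by simp [ht]
  rw [circ_half, neg_one_mul, ← h1, ← h2]
  exact ⟨fun e => by simp [e], fun e => sphere_ext e.1 e.2⟩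

/-- An involution swapping the poles which is either free or has three fixed points is conjugate
to an orthogonal map by a homeomorphism fixing the poles. -/
theorem exists_conj_fixing_poles {g : Sphere2 ≃ₜ Sphere2} (hgg : g * g = 1)
    (hN : g (pt 0 1) = pt 0 (-1))
    (hfix : (∀ x, g x ≠ x) ∨ (fixSet g).Infinite) :
    ∃ (H : Sphere2 ≃ₜ Sphere2) (δ : ℝ), (∀ v, xy (H v) = 0 ↔ xy v = 0) ∧
      ∀ v w, xy w = circ δ * xy v → ht w = -ht v → g (H v) = H w := by
  have h1 : g ≠ 1 := by
    rintro rfl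
    exact north_ne_south hN
  have ho : orderOf g = 2 := orderOf_eq_prime (by rw [sq, hgg]) h1
  have key : ∀ (H : Sphere2 ≃ₜ Sphere2), H (pt 0 1) = pt 0 1 → H (pt 0 (-1)) = pt 0 (-1) →
      ∀ v, xy (H v) = 0 ↔ xy v = 0 := by
    intro H e1 e2 v
    rw [xy_eq_zero_iff, xy_eq_zero_iff]
    exact or_congr ⟨fun e => H.injective (e.trans e1.symm), fun e => e ▸ e1⟩
      ⟨fun e => H.injective (e.trans e2.symm), fun e => e ▸ e2⟩
  rcases hfix with hfree | hinf
  · obtain ⟨-, c, hc, hcs, hs⟩ := exists_antipodal_jordan (by rw [ho]; exact two_pos) h1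
      fun k hk hk1 x hkx => hfree x (fixed_of_pow_fixed Nat.prime_two ho hk hk1 hkx)
    obtain ⟨a, ha⟩ := hc.exists_notMem_range
    obtain ⟨H, -, hH⟩ := exists_conj_of_swap (n := 1) hgg hc (by norm_num) hcs ha (hs a ha)
    obtain ⟨O, hO, hOn⟩ := exists_homeomorph_neg (pt 0 1) (H.symm (pt 0 1))
    have hH' : ∀ v, g (H v) = H (-v) := fun v => hH v _ (eq_neg_iff.1 rfl).1 (eq_neg_iff.1 rfl).2
    have hS : pt 0 (-1) = -pt 0 1 := by
      rw [eq_neg_iff, xy_pt (by simp), xy_pt (by simp), ht_pt (by simp), ht_pt (by simp)]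
      simp
    have e1 : H (O (pt 0 1)) = pt 0 1 := by rw [hO, H.apply_symm_apply]
    refine ⟨O.trans H, 1 / 2, key _ e1 ?_, fun v w hx hy => ?_⟩
    · show H (O (pt 0 (-1))) = _
      rw [hS, hOn, ← hH', e1, hN, hS]
    · show g (H (O v)) = H (O w)
      rw [eq_neg_iff.2 ⟨hx, hy⟩, hOn, hH']
  · obtain ⟨t, ht, ht3⟩ := hinf.exists_subset_card_eq 3
    obtain ⟨x, y, z, hxy, hxz, hyz, rfl⟩ := Finset.card_eq_three.1 ht3
    obtain ⟨c, hc, hfix, hs⟩ := exists_jordan_of_three_fixed ho (ht (by simp) : g x = x)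
      (ht (by simp) : g y = y) (ht (by simp) : g z = z) hxy hxz hyz
    have hNc : pt 0 1 ∉ range c := by
      rw [← hfix]
      intro h
      exact north_ne_south (hN.symm.trans h).symm
    obtain ⟨H, hHN, hH⟩ := exists_conj_of_swap (n := 0) (δ := 0) hgg hc (by norm_num) (fun x => by
      rw [add_zero]
      exact hfix.symm.subset (mem_range_self x)) hNc (hs _ hNc)
    refine ⟨H, 0, key H hHN ?_, hH⟩
    rw [← hH (pt 0 1) (pt 0 (-1)), hHN, hN]
    · rw [xy_pt (by simp), xy_pt (by simp), mul_zero]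
    · rw [ht_pt (by simp), ht_pt (by simp)]

/-- Homeomorphisms preserving the poles lift through the power map. -/
theorem exists_homeomorph_lift_powMap {m : ℕ} (hm : m ≠ 0) {H : Sphere2 ≃ₜ Sphere2}
    (h0 : ∀ v, xy (H v) = 0 ↔ xy v = 0) :
    ∃ G : Sphere2 ≃ₜ Sphere2, ∀ v, powMap m (G v) = H (powMap m v) := by
  have key : ∀ A : Sphere2 → Sphere2, Continuous A → (∀ v, powMap m (A v) = powMap m v) →
      Function.Bijective A := by
    intro A hA h
    obtain ⟨ζ, hζ, hAζ⟩ := exists_root_of_powMap_eq hm hA continuous_id (fun v hv => hv) h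
    have hζ0 : ζ ≠ 0 := by
      rintro rfl
      simp [hm] at hζ
    have hζn : ‖ζ‖ = 1 := Complex.norm_eq_one_of_pow_eq_one hζ hm
    have hAx : ∀ v, xy (A v) = ζ * xy v := by
      intro v
      by_cases hv : xy v = 0
      · rw [hv, mul_zero, ← xy_powMap_eq_zero hm, h, xy_powMap_eq_zero hm, hv]
      · exact hAζ v hv
    have hAh : ∀ v, ht (A v) = ht v := fun v => ((powMap_eq_iff hm).1 (h v)).1
    refine ⟨fun v w e => sphere_ext ?_ ?_, fun w => ?_⟩
    · apply mul_left_cancel₀ hζ0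
      rw [← hAx, ← hAx, e]
    · rw [← hAh, ← hAh w, e]
    · have haux : ‖ζ⁻¹ * xy w‖ ^ 2 + ht w ^ 2 = 1 := by
        rw [norm_mul, norm_inv, hζn, inv_one, one_mul, norm_xy_sq_add]
      refine ⟨pt (ζ⁻¹ * xy w) (ht w), sphere_ext ?_ ?_⟩
      · rw [hAx, xy_pt haux, mul_inv_cancel_left₀ hζ0]
      · rw [hAh, ht_pt haux]
  obtain ⟨G, hG, hGq⟩ := exists_lift_powMap hm H.continuous h0
  obtain ⟨G', hG', hGq'⟩ := exists_lift_powMap hm H.symm.continuous fun v => by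
    rw [← h0, H.apply_symm_apply]
  have hb : Function.Bijective G := by
    refine ⟨Function.Injective.of_comp (f := G') (key _ (hG'.comp hG) fun v => ?_).1,
      Function.Surjective.of_comp (g := G') (key _ (hG.comp hG') fun v => ?_).2⟩
    · rw [Function.comp_apply, hGq', hGq, H.symm_apply_apply]
    · rw [Function.comp_apply, hGq, hGq', H.apply_symm_apply]
  exact ⟨hG.homeoOfEquivCompactToT2 (f := Equiv.ofBijective G hb), hGq⟩

/-- `f` is topologically conjugate to an orthogonal map in standard form. -/
def IsConjOrthogonal (f : Sphere2 ≃ₜ Sphere2) : Prop :=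
  ∃ (H : Sphere2 ≃ₜ Sphere2) (ω : ℂ) (ε : ℝ), ‖ω‖ = 1 ∧ ε ^ 2 = 1 ∧
    ∀ v w, xy w = ω * xy v → ht w = ε * ht v → f (H v) = H w

lemma IsConjOrthogonal.of_conj {f f' K : Sphere2 ≃ₜ Sphere2} (hf' : IsConjOrthogonal f')
    (hK : ∀ v, f (K v) = K (f' v)) : IsConjOrthogonal f := by
  obtain ⟨H, ω, ε, hω, hε, h⟩ := hf'
  refine ⟨H.trans K, ω, ε, hω, hε, fun v w h1 h2 => ?_⟩
  show f (K (H v)) = K (H w)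
  rw [hK, h v w h1 h2]

lemma isConjOrthogonal_of_swap {f H : Sphere2 ≃ₜ Sphere2} {δ : ℝ}
    (h : ∀ v w, xy w = circ δ * xy v → ht w = -ht v → f (H v) = H w) : IsConjOrthogonal f :=
  ⟨H, circ δ, -1, norm_circ δ, by norm_num, fun v w h1 h2 => h v w h1 (by rw [h2, neg_one_mul])⟩

section Swap

variable {f : Sphere2 ≃ₜ Sphere2} {m : ℕ} {ω : ℂ}

lemma xy_sq_pow (hx : ∀ v, xy (f (f v)) = ω * xy v) (i : ℕ) (v : Sphere2) :
    xy (((f * f) ^ i) v) = ω ^ i * xy v := by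
  induction i with
  | zero => simp
  | succ i ih => rw [pow_succ', mul_apply, mul_apply, hx, ih, pow_succ']; ring

lemma ht_sq_pow (hh : ∀ v, ht (f (f v)) = ht v) (i : ℕ) (v : Sphere2) :
    ht (((f * f) ^ i) v) = ht v := by
  induction i with
  | zero => simp
  | succ i ih => rw [pow_succ', mul_apply, mul_apply, hh, ih]

lemma powMap_eq_iff_exists_pow (hm : m ≠ 0) (hω : IsPrimitiveRoot ω m)
    (hx : ∀ v, xy (f (f v)) = ω * xy v) (hh : ∀ v, ht (f (f v)) = ht v) {v w : Sphere2} :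
    powMap m v = powMap m w ↔ ∃ i : ℕ, w = ((f * f) ^ i) v := by
  rw [powMap_eq_iff hm]
  constructor
  · rintro ⟨h1, h2⟩
    by_cases hv : xy v = 0
    · refine ⟨0, sphere_ext ?_ h1.symm⟩
      rw [hv, zero_pow hm] at h2
      rw [eq_zero_of_pow_eq_zero h2.symm]
      exact hv.symm
    · have : NeZero m := ⟨hm⟩
      obtain ⟨i, -, hi⟩ := hω.eq_pow_of_pow_eq_one (ξ := xy w / xy v)
        (by rw [div_pow, ← h2, div_self (pow_ne_zero _ hv)])
      refine ⟨i, sphere_ext ?_ ?_⟩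
      · rw [xy_sq_pow hx, hi, div_mul_cancel₀ _ hv]
      · rw [ht_sq_pow hh, h1]
  · rintro ⟨i, rfl⟩
    rw [xy_sq_pow hx, ht_sq_pow hh, mul_pow, ← pow_mul, mul_comm i, pow_mul, hω.pow_eq_one,
      one_pow, one_mul]
    exact ⟨rfl, rfl⟩

/-- A homeomorphism whose square is a rotation descends to the quotient by that rotation. -/
theorem exists_quotient_involution (hm : m ≠ 0) (hω : IsPrimitiveRoot ω m)
    (hx : ∀ v, xy (f (f v)) = ω * xy v) (hh : ∀ v, ht (f (f v)) = ht v) :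
    ∃ g : Sphere2 ≃ₜ Sphere2, g * g = 1 ∧ ∀ v, g (powMap m v) = powMap m (f v) := by
  have hfib : ∀ {v w}, powMap m v = powMap m w ↔ ∃ i : ℕ, w = ((f * f) ^ i) v :=
    powMap_eq_iff_exists_pow hm hω hx hh
  have hsur := surjective_powMap hm
  set φ : Sphere2 → Sphere2 := fun y => powMap m (f (Function.surjInv hsur y))
  have hφ : ∀ v, φ (powMap m v) = powMap m (f v) := by
    intro v
    obtain ⟨i, hi⟩ := hfib.1 (Function.surjInv_eq hsur (powMap m v))
    refine hfib.2 ⟨i, ?_⟩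
    conv_lhs => rw [hi]
    rw [← mul_apply, ← mul_apply]
    congr 1
    exact ((Commute.refl f).mul_right (Commute.refl f)).pow_right i
  have hφc : Continuous φ := (isQuotientMap_powMap hm).continuous_iff.2 (by
    rw [show φ ∘ powMap m = fun v => powMap m (f v) from funext hφ]
    exact (continuous_powMap hm).comp f.continuous)
  have hφφ : ∀ y, φ (φ y) = y := by
    intro y
    obtain ⟨v, rfl⟩ := hsur y
    exact (congrArg φ (hφ v)).trans ((hφ (f v)).trans (hfib.2 ⟨1, by rw [pow_one]; rfl⟩).symm)
  exact ⟨⟨⟨φ, φ, hφφ, hφφ⟩, hφc, hφc⟩, Homeomorph.ext hφφ, hφ⟩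

/-- If the quotient involution has a fixed point then it has infinitely many. -/
theorem infinite_fixSet_quotient (hm : 2 ≤ m) (hω : IsPrimitiveRoot ω m)
    (hx : ∀ v, xy (f (f v)) = ω * xy v) (hh : ∀ v, ht (f (f v)) = ht v)
    (hN : f (pt 0 1) = pt 0 (-1)) (hS : f (pt 0 (-1)) = pt 0 1) {g : Sphere2 ≃ₜ Sphere2}
    (hg : ∀ v, g (powMap m v) = powMap m (f v)) {x : Sphere2}
    (hgx : g (powMap m x) = powMap m x) : (fixSet g).Infinite := by
  have hm0 : m ≠ 0 := by lia
  have hfib : ∀ {v w}, powMap m v = powMap m w ↔ ∃ i : ℕ, w = ((f * f) ^ i) v :=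
    powMap_eq_iff_exists_pow hm0 hω hx hh
  have hpow : ∀ j : ℕ, ω ^ j = 1 → (f * f) ^ j = 1 := fun j hj =>
    Homeomorph.ext fun v => sphere_ext (by rw [xy_sq_pow hx, hj, one_mul]; rfl) (ht_sq_pow hh j v)
  have hfixS : ∀ j : ℕ, ((f * f) ^ j) (pt 0 (-1)) = pt 0 (-1) := fun j =>
    sphere_ext (by rw [xy_sq_pow hx, xy_pt (by simp), mul_zero]) (ht_sq_pow hh j _)
  rw [hg] at hgx
  obtain ⟨i, hi⟩ := hfib.1 hgx
  have hx0 : xy x ≠ 0 := by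
    intro h
    have h2 := ((powMap_eq_iff hm0).1 hgx).1
    rcases xy_eq_zero_iff.1 h with rfl | rfl
    · rw [hN, ht_pt (by simp), ht_pt (by simp)] at h2
      norm_num at h2
    · rw [hS, ht_pt (by simp), ht_pt (by simp)] at h2
      norm_num at h2
  set k : Sphere2 ≃ₜ Sphere2 := (f * f) ^ i * f with hk
  have hkx : k x = x := hi.symm
  have hcomm : Commute k (f * f) := by
    have h1 : Commute f (f * f) := (Commute.refl f).mul_right (Commute.refl f)
    exact ((Commute.refl (f * f)).pow_left i).mul_left h1
  have hkk : k * k = (f * f) ^ (2 * i + 1) := by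
    simp only [hk, ← sq, ← pow_mul, ← pow_succ]
    congr 1
    ring
  have hω1 : ω ^ (2 * i + 1) = 1 := by
    have h1 : (k * k) x = x := by rw [mul_apply, hkx, hkx]
    have h2 := congrArg xy h1
    rw [hkk, xy_sq_pow hx] at h2
    exact mul_right_cancel₀ hx0 (h2.trans (one_mul _).symm)
  have hk1 : k ≠ 1 := by
    intro h
    have : k (pt 0 1) = pt 0 (-1) := by rw [hk, mul_apply, hN, hfixS]
    rw [h] at this
    exact north_ne_south this
  have ho : orderOf k = 2 := orderOf_eq_prime (by rw [sq, hkk, hpow _ hω1]) hk1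
  have hm3 : 3 ≤ m := by
    have h1 := hω.dvd_of_pow_eq_one _ hω1
    by_contra h
    have : m = 2 := by lia
    subst this
    lia
  have hfixk : ∀ j : ℕ, k (((f * f) ^ j) x) = ((f * f) ^ j) x := by
    intro j
    rw [← mul_apply, (hcomm.pow_right j).eq, mul_apply, hkx]
  have hne : ∀ a b : ℕ, a < b → b < m → ((f * f) ^ a) x ≠ ((f * f) ^ b) x := by
    intro a b hab hb h
    have h2 := congrArg xy h
    rw [xy_sq_pow hx, xy_sq_pow hx] at h2
    exact hab.ne (hω.pow_inj (hab.trans hb) hb (mul_right_cancel₀ hx0 h2))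
  obtain ⟨c, hc, hfixc, -⟩ := exists_jordan_of_three_fixed ho (hfixk 0) (hfixk 1) (hfixk 2)
    (hne 0 1 (by lia) (by lia)) (hne 0 2 (by lia) (by lia)) (hne 1 2 (by lia) (by lia))
  have hinf : (fixSet k).Infinite := by
    rw [hfixc]
    exact ((Ico_infinite zero_lt_one).image hc.inj).mono (image_subset_range _ _)
  intro hfin
  have hρ : 0 < orderOf (f * f) :=
    orderOf_pos_iff.2 (isOfFinOrder_iff_pow_eq_one.2 ⟨m, by lia, hpow m hω.pow_eq_one⟩)
  have : Finite (zpowers (f * f)) := finite_zpowers hρ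
  refine hinf ((hfin.preimage' (f := powMap m) fun b _ => ?_).subset fun v hv => ?_)
  · obtain ⟨w, rfl⟩ := surjective_powMap hm0 b
    refine (Set.finite_range fun l : zpowers (f * f) => (l : Sphere2 ≃ₜ Sphere2) w).subset ?_
    intro v hv
    obtain ⟨j, hj⟩ := hfib.1 (Eq.symm hv)
    exact ⟨⟨(f * f) ^ j, Subgroup.npow_mem_zpowers _ j⟩, hj.symm⟩
  · show g (powMap m v) = powMap m v
    rw [hg]
    exact hfib.2 ⟨i, (Eq.symm hv)⟩

/-- A homeomorphism swapping the poles whose square is a nontrivial rotation is conjugate to an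
orthogonal map. -/
theorem isConjOrthogonal_of_sq_rotation (hm : 2 ≤ m) (hω : IsPrimitiveRoot ω m)
    (hx : ∀ v, xy (f (f v)) = ω * xy v) (hh : ∀ v, ht (f (f v)) = ht v)
    (hN : f (pt 0 1) = pt 0 (-1)) (hS : f (pt 0 (-1)) = pt 0 1) : IsConjOrthogonal f := by
  have hm0 : m ≠ 0 := by lia
  have hmR : (m : ℝ) ≠ 0 := Nat.cast_ne_zero.2 hm0
  obtain ⟨g, hgg, hg⟩ := exists_quotient_involution hm0 hω hx hh
  have hpole : ∀ e : ℝ, e ^ 2 = 1 → powMap m (pt 0 e) = pt 0 e := by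
    intro e he
    have he' : ‖(0 : ℂ)‖ ^ 2 + e ^ 2 = 1 := by simp [he]
    refine sphere_ext ?_ (ht_powMap hm0 _)
    rw [(xy_powMap_eq_zero hm0).2] <;> rw [xy_pt he']
  have hgN : g (pt 0 1) = pt 0 (-1) := by
    rw [← hpole 1 (by norm_num), hg, hN, hpole _ (by norm_num)]
  obtain ⟨H, δ, hH0, hH⟩ := exists_conj_fixing_poles hgg hgN (by
    by_cases hfree : ∀ x, g x ≠ x
    · exact Or.inl hfree
    · push Not at hfree
      obtain ⟨y, hy⟩ := hfree
      obtain ⟨x, rfl⟩ := surjective_powMap hm0 y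
      exact Or.inr (infinite_fixSet_quotient hm hω hx hh hN hS hg hy))
  obtain ⟨G, hG⟩ := exists_homeomorph_lift_powMap hm0 hH0
  set θ := circ (δ / m) with hθ
  have hθn : ‖θ‖ = 1 := norm_circ _
  have hθm : θ ^ m = circ δ := by
    rw [hθ, circ, circ, ← Complex.exp_nat_mul]
    congr 1
    have : (m : ℂ) ≠ 0 := Nat.cast_ne_zero.2 hm0
    push_cast
    field_simp
  have haux : ∀ v, ‖θ * xy v‖ ^ 2 + (-ht v) ^ 2 = 1 := fun v => by
    rw [norm_mul, hθn, one_mul, neg_sq, norm_xy_sq_add]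
  set B : Sphere2 → Sphere2 := fun v => pt (θ * xy v) (-ht v)
  have hBx : ∀ v, xy (B v) = θ * xy v := fun v => xy_pt (haux v)
  have hBh : ∀ v, ht (B v) = -ht v := fun v => ht_pt (haux v)
  have hBc : Continuous B := continuous_pt (continuous_const.mul continuous_xy)
    continuous_ht.neg haux
  have hB0 : ∀ v, xy (B v) = 0 → xy v = 0 := by
    intro v hv
    rw [hBx] at hv
    exact (mul_eq_zero.1 hv).resolve_left (circ_ne_zero _)
  have hAB : ∀ v, powMap m (G.symm (f (G v))) = powMap m (B v) := by
    intro v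
    apply H.injective
    rw [← hG, G.apply_symm_apply, ← hg, hG]
    refine hH _ _ ?_ ?_
    · rw [xy_powMap hm0, xy_powMap hm0, hBx, norm_mul, hθn, one_mul, mul_pow, hθm, mul_div_assoc]
    · rw [ht_powMap hm0, ht_powMap hm0, hBh]
  obtain ⟨ζ, hζ, hAζ⟩ := exists_root_of_powMap_eq hm0
    (A := fun v => G.symm (f (G v))) (by fun_prop) hBc hB0 hAB
  refine ⟨G, ζ * θ, -1, ?_, by norm_num, fun v w h1 h2 => ?_⟩
  · rw [norm_mul, hθn, mul_one, Complex.norm_eq_one_of_pow_eq_one hζ hm0]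
  · rw [← G.symm_apply_eq]
    refine sphere_ext ?_ ?_
    · by_cases hv : xy v = 0
      · rw [h1, hv, mul_zero, ← xy_powMap_eq_zero hm0, hAB, xy_powMap_eq_zero hm0, hBx, hv, mul_zero]
      · rw [hAζ v hv, h1, hBx, mul_assoc]
    · rw [h2, ((powMap_eq_iff hm0).1 (hAB v)).1, hBh, neg_one_mul]

end Swap

lemma eq_of_mem_zpowers_of_orderOf_eq_two {G : Type*} [Group G] {F k l : G}
    (hk : k ∈ zpowers F) (hl : l ∈ zpowers F) (hk2 : orderOf k = 2)
    (hl2 : orderOf l = 2) : k = l := by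
  have key : ∀ i : ℤ, orderOf (F ^ i) = 2 → ∃ a : ℤ, 2 * i = orderOf F * a ∧ ¬ Even a := by
    intro i hi
    have h1 : F ^ (2 * i) = 1 := by
      rw [mul_comm, zpow_mul]
      exact_mod_cast hi ▸ pow_orderOf_eq_one (F ^ i)
    obtain ⟨a, ha⟩ := orderOf_dvd_iff_zpow_eq_one.2 h1
    refine ⟨a, ha, ?_⟩
    rintro ⟨b, rfl⟩
    have : F ^ i = 1 := orderOf_dvd_iff_zpow_eq_one.1 ⟨b, by linarith⟩
    rw [this, orderOf_one] at hi
    norm_num at hi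
  obtain ⟨i, rfl⟩ := hk
  obtain ⟨j, rfl⟩ := hl
  beta_reduce at *
  obtain ⟨a, ha, hae⟩ := key i hk2
  obtain ⟨b, hb, hbe⟩ := key j hl2
  obtain ⟨d, hd⟩ : Even (a - b) := by
    rw [Int.even_sub]
    exact iff_of_false hae hbe
  have : F ^ (i - j) = 1 := orderOf_dvd_iff_zpow_eq_one.1 ⟨d, by
    have : (orderOf F : ℤ) * (a - b) = orderOf F * (d + d) := by rw [hd]
    linarith⟩
  rwa [zpow_sub, mul_inv_eq_one] at this

lemma orderOf_pos_of_mem_zpowers {G : Type*} [Group G] {F k : G} (hF : 0 < orderOf F)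
    (hk : k ∈ zpowers F) : 0 < orderOf k :=
  Nat.pos_of_dvd_of_pos (orderOf_dvd_of_mem_zpowers hk) hF

lemma commute_of_mem_zpowers {G : Type*} [Group G] {F k l : G}
    (hk : k ∈ zpowers F) (hl : l ∈ zpowers F) : Commute k l := by
  obtain ⟨i, rfl⟩ := hk
  obtain ⟨j, rfl⟩ := hl
  exact (Commute.refl F).zpow_zpow i j

lemma exists_sq_of_mem_zpowers_sq {G : Type*} [Group G] {F l : G}
    (hl : l ∈ zpowers (F * F)) : ∃ s ∈ zpowers F, l = s * s := by
  obtain ⟨i, rfl⟩ := hl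
  exact ⟨F ^ i, ⟨i, rfl⟩, (Commute.refl F).mul_zpow i⟩

lemma apply_mem_fixSet {s k : Sphere2 ≃ₜ Sphere2} (h : Commute s k) {x : Sphere2} (hx : k x = x) :
    k (s x) = s x := by
  rw [← mul_apply, ← h.eq, mul_apply, hx]

lemma image_fixSet {s k : Sphere2 ≃ₜ Sphere2} (h : Commute s k) :
    s '' fixSet k = fixSet k := by
  refine Subset.antisymm (image_subset_iff.2 fun x hx => apply_mem_fixSet h hx) fun x hx => ?_
  exact ⟨s⁻¹ x, apply_mem_fixSet h.inv_left hx, s.apply_symm_apply x⟩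

/-- The square of a homeomorphism preserving a Jordan curve has fixed points on both sides. -/
theorem exists_fixed_of_sq {c : ℝ → Sphere2} (hc : IsJordan c) {s : Sphere2 ≃ₜ Sphere2}
    (hs : s '' range c = range c) (hp : (orderOf (s * s)).Prime) {a : Sphere2}
    (ha : a ∉ range c) : ∃ z ∉ range c, (s * s) z = z := by
  have hsa := notMem_range_of_invariant hs ha
  have hssa := notMem_range_of_invariant hs hsa
  have himg := image_side hs ha
  have h1 : s (s a) ∈ side c a := by
    by_cases h : s a ∈ side c a
    · rw [side_eq h, ← himg]
      exact mem_image_of_mem s h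
    · by_contra h2
      have h3 := hc.side_eq_of_notMem ha hsa h hssa h2
      rw [← himg] at h3
      exact h (s.injective.mem_set_image.1 h3)
  have h2 : (s * s) '' side c a = side c a := by
    rw [show ⇑(s * s) = s ∘ s from rfl, image_comp, himg, image_side hs hsa, ← side_eq h1]
  obtain ⟨z, hz, hgz⟩ := exists_fixed_of_invariant hp rfl hc.isOpen_side isPreconnected_side
    hc.isPreconnected_compl_side ⟨a, mem_side_self ha⟩
    ⟨c 0, fun h => side_subset c a h (mem_range_self 0)⟩ h2
  exact ⟨z, side_subset c a hz, hgz⟩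

lemma fixed_subset_pair {F g : Sphere2 ≃ₜ Sphere2} (hF : 0 < orderOf F) {a b : Sphere2}
    (hab : a ≠ b) (ha : F a = a) (hb : F b = b) (hg : g ∈ zpowers F)
    (hp : (orderOf g).Prime) (hfix : ∀ x, g x = x → x = a ∨ x = b) :
    ∀ k ∈ zpowers F, k ≠ 1 → ∀ x, k x = x → x = a ∨ x = b := by
  intro k hk hk1 x hkx
  by_contra! hx
  obtain ⟨l, hl, hlp⟩ := exists_mem_zpowers_prime (orderOf_pos_of_mem_zpowers hF hk) hk1
  have hlF : l ∈ zpowers F := Subgroup.zpowers_le.2 hk hl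
  have hlx := apply_eq_of_mem_zpowers hl hkx
  have hla := apply_eq_of_mem_zpowers hlF ha
  have hlb := apply_eq_of_mem_zpowers hlF hb
  have hl2 := eq_two_of_three_fixed hlp rfl hla hlb hlx hab hx.1.symm hx.2.symm
  obtain ⟨c, hc, hfixc, -⟩ :=
    exists_jordan_of_three_fixed hl2 hla hlb hlx hab hx.1.symm hx.2.symm
  rcases hp.eq_two_or_odd' with h2 | ⟨i, hi⟩
  · rw [eq_of_mem_zpowers_of_orderOf_eq_two hg hlF h2 hl2] at hfix
    exact (hfix x hlx).elim hx.1 hx.2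
  · have hgs : g ^ (i + 1) * g ^ (i + 1) = g := by
      rw [← pow_add, show i + 1 + (i + 1) = orderOf g + 1 by omega, pow_succ, pow_orderOf_eq_one,
        one_mul]
    obtain ⟨u, hu⟩ := hc.exists_notMem_range
    have hs : ⇑(g ^ (i + 1)) '' range c = range c := by
      rw [← hfixc]
      exact image_fixSet ((commute_of_mem_zpowers hg hlF).pow_left _)
    obtain ⟨z, hz, hgz⟩ := exists_fixed_of_sq hc hs (hgs.symm ▸ hp) hu
    rw [hgs] at hgz
    rw [← hfixc] at hz
    rcases hfix z hgz with rfl | rfl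
    · exact hz hla
    · exact hz hlb

/-- If `f` swaps two points and `f * f` is a nontrivial rotation about them, then `f` is conjugate
to an orthogonal map. -/
theorem isConjOrthogonal_of_swap_pair {f : Sphere2 ≃ₜ Sphere2} (hf : 0 < orderOf f) {a b : Sphere2}
    (hab : a ≠ b) (ha : f a = b) (hb : f b = a) (h1 : f * f ≠ 1)
    (hfix : ∀ k ∈ zpowers (f * f), k ≠ 1 → ∀ x, k x = x → x = a ∨ x = b) :
    IsConjOrthogonal f := by
  have hρ : 0 < orderOf (f * f) :=
    orderOf_pos_of_mem_zpowers hf (sq f ▸ Subgroup.npow_mem_zpowers f 2)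
  obtain ⟨H, ω, hω, hN, hS, hH⟩ := exists_conj_rotation hρ h1 hab
    (by rw [mul_apply, ha, hb]) (by rw [mul_apply, hb, ha]) hfix
  have hH' : ∀ v, xy (H.symm (f (f (H v)))) = ω * xy v ∧ ht (H.symm (f (f (H v)))) = ht v := by
    intro v
    have haux : ‖ω * xy v‖ ^ 2 + ht v ^ 2 = 1 := by rw [norm_mul, hω, one_mul, norm_xy_sq_add]
    rw [← mul_apply f, hH v _ (xy_pt haux) (ht_pt haux), H.symm_apply_apply, xy_pt haux,
      ht_pt haux]
    exact ⟨rfl, rfl⟩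
  set f' : Sphere2 ≃ₜ Sphere2 := H⁻¹ * f * H⁻¹⁻¹ with hf'
  have hf'v : ∀ v, f' v = H.symm (f (H v)) := fun v => rfl
  have hx : ∀ v, xy (f' (f' v)) = ω * xy v := fun v => by
    rw [hf'v, hf'v, H.apply_symm_apply, (hH' v).1]
  have hh : ∀ v, ht (f' (f' v)) = ht v := fun v => by
    rw [hf'v, hf'v, H.apply_symm_apply, (hH' v).2]
  have hfin : (f' * f') ^ orderOf f = 1 := by
    rw [(Commute.refl f').mul_pow, hf', conj_pow, pow_orderOf_eq_one, mul_one, mul_inv_cancel,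
      one_mul]
  have hωf : ω ^ orderOf f = 1 := by
    have h := xy_sq_pow hx (orderOf f) (pt 1 0)
    rw [hfin, Homeomorph.one_apply, xy_pt (by simp), mul_one] at h
    exact h.symm
  have hω1 : ω ≠ 1 := by
    rintro rfl
    refine h1 (Homeomorph.ext fun v => ?_)
    have := hH (H.symm v) (H.symm v) (by rw [one_mul]) rfl
    rwa [H.apply_symm_apply] at this
  have hm0 : 0 < orderOf ω := orderOf_pos_iff.2 (isOfFinOrder_iff_pow_eq_one.2 ⟨_, hf, hωf⟩)
  have hm1 : orderOf ω ≠ 1 := fun h => hω1 (orderOf_eq_one_iff.1 h)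
  have := isConjOrthogonal_of_sq_rotation (f := f') (m := orderOf ω) (by lia)
    (IsPrimitiveRoot.orderOf ω) hx hh (by rw [hf'v, hN, ha, ← hS, H.symm_apply_apply])
    (by rw [hf'v, hS, hb, ← hN, H.symm_apply_apply])
  exact this.of_conj (K := H) fun v => by rw [hf'v, H.apply_symm_apply]

lemma isConjOrthogonal_of_pair {f g : Sphere2 ≃ₜ Sphere2} (hf : 0 < orderOf f) {a b : Sphere2}
    (hab : a ≠ b) (hg : g ∈ zpowers f) (hp : (orderOf g).Prime) (ha : g a = a)
    (hb : g b = b) (hfix : ∀ x, g x = x → x = a ∨ x = b) : IsConjOrthogonal f := by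
  have hcomm : Commute f g := commute_of_mem_zpowers (Subgroup.mem_zpowers f) hg
  have h1g : g ≠ 1 := fun h => hp.ne_one (h ▸ orderOf_one)
  rcases hfix _ (apply_mem_fixSet hcomm ha) with hfa | hfa
  · have hfb : f b = b := (hfix _ (apply_mem_fixSet hcomm hb)).resolve_left
      fun h => hab (f.injective (hfa.trans h.symm))
    obtain ⟨H, ω, hω, -, -, hH⟩ := exists_conj_rotation hf
      (fun h => h1g (by rwa [h, Subgroup.zpowers_one_eq_bot, Subgroup.mem_bot] at hg))
      hab hfa hfb (fixed_subset_pair hf hab hfa hfb hg hp hfix)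
    exact ⟨H, ω, 1, hω, one_pow 2, fun v w h1 h2 => hH v w h1 (by rw [h2, one_mul])⟩
  · have hfb : f b = a := (hfix _ (apply_mem_fixSet hcomm hb)).resolve_right
      fun h => hab (f.injective (hfa.trans h.symm))
    have hffa : (f * f) a = a := by rw [mul_apply, hfa, hfb]
    have hffb : (f * f) b = b := by rw [mul_apply, hfb, hfa]
    have hgff : g ∈ zpowers (f * f) := by
      obtain ⟨j, rfl⟩ := hg
      beta_reduce at *
      obtain ⟨i, rfl | rfl⟩ := j.even_or_odd'
      · exact ⟨i, by rw [zpow_mul, zpow_two]⟩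
      · rw [zpow_add_one, mul_apply, hfa, zpow_mul] at ha
        have : (f ^ (2 : ℤ)) ^ i ∈ zpowers (f * f) := ⟨i, by rw [zpow_two]⟩
        rw [apply_eq_of_mem_zpowers this hffb] at ha
        exact absurd ha.symm hab
    refine isConjOrthogonal_of_swap_pair hf hab hfa hfb
      (fun h => h1g (by rwa [h, Subgroup.zpowers_one_eq_bot, Subgroup.mem_bot] at hgff))
      (fixed_subset_pair ?_ hab hffa hffb hgff hp hfix)
    exact orderOf_pos_of_mem_zpowers hf (sq f ▸ Subgroup.npow_mem_zpowers f 2)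

lemma isConjOrthogonal_of_orderOf_pos {f : Sphere2 ≃ₜ Sphere2} (hf : 0 < orderOf f) :
    IsConjOrthogonal f := by
  by_cases hf1 : f = 1
  · refine ⟨1, 1, 1, norm_one, one_pow 2, fun v w h1 h2 => ?_⟩
    rw [hf1, sphere_ext (h1.trans (one_mul _)) (h2.trans (one_mul _))]
    rfl
  by_contra hcon
  have hthree : ∀ g ∈ zpowers f, (orderOf g).Prime → ∀ x, g x = x → orderOf g = 2 ∧
      ∃ c, IsJordan c ∧ fixSet g = range c ∧ ∀ a, a ∉ range c → g a ∉ side c a := by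
    intro g hg hp x hx
    obtain ⟨y, hyx, hy⟩ := exists_second_fixed hp rfl hx
    by_cases h : ∀ z, g z = z → z = x ∨ z = y
    · exact absurd (isConjOrthogonal_of_pair hf hyx.symm hg hp hx hy h) hcon
    · push Not at h
      obtain ⟨z, hz, hzx, hzy⟩ := h
      have h2 := eq_two_of_three_fixed hp rfl hx hy hz hyx.symm hzx.symm hzy.symm
      exact ⟨h2, exists_jordan_of_three_fixed h2 hx hy hz hyx.symm hzx.symm hzy.symm⟩
  by_cases hfree : ∀ k ∈ zpowers f, k ≠ 1 → ∀ x, k x ≠ x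
  · obtain ⟨hff, c, hc, hcs, hs⟩ := exists_antipodal_jordan hf hf1 hfree
    obtain ⟨a, ha⟩ := hc.exists_notMem_range
    obtain ⟨H, -, hH⟩ := exists_conj_of_swap (n := 1) hff hc (by norm_num) hcs ha (hs a ha)
    exact hcon (isConjOrthogonal_of_swap hH)
  · push Not at hfree
    obtain ⟨k, hk, hk1, x, hx⟩ := hfree
    obtain ⟨g, hgk, hp⟩ := exists_mem_zpowers_prime (orderOf_pos_of_mem_zpowers hf hk) hk1
    have hg : g ∈ zpowers f := Subgroup.zpowers_le.2 hk hgk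
    obtain ⟨hg2, c, hc, hfixc, hs⟩ := hthree g hg hp x (apply_eq_of_mem_zpowers hgk hx)
    obtain ⟨u, hu⟩ := hc.exists_notMem_range
    have hff : f * f = 1 := by
      by_contra hff
      obtain ⟨l, hl, hlp⟩ := exists_mem_zpowers_prime
        (orderOf_pos_of_mem_zpowers hf (sq f ▸ Subgroup.npow_mem_zpowers f 2)) hff
      obtain ⟨s, hsf, rfl⟩ := exists_sq_of_mem_zpowers_sq hl
      obtain ⟨z, hz, hlz⟩ := exists_fixed_of_sq hc
        (by rw [← hfixc]; exact image_fixSet (commute_of_mem_zpowers hsf hg)) hlp hu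
      have hssf := Subgroup.mul_mem _ hsf hsf
      have := eq_of_mem_zpowers_of_orderOf_eq_two hssf hg (hthree _ hssf hlp z hlz).1 hg2
      rw [← hfixc] at hz
      exact hz (this ▸ hlz)
    obtain rfl := eq_of_mem_zpowers_of_orderOf_eq_two (Subgroup.mem_zpowers f) hg
      (orderOf_eq_prime (by rw [sq, hff]) hf1) hg2
    obtain ⟨H, -, hH⟩ := exists_conj_of_swap (n := 0) (δ := 0) hff hc (by norm_num) (fun x => by
      rw [add_zero]
      exact hfixc.symm.subset (mem_range_self x)) hu (hs u hu)
    exact hcon (isConjOrthogonal_of_swap hH)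

end Kerekjarto

/-- Every periodic homeomorphism of the 2-sphere is topologically conjugate to (the restriction
to the sphere of) an orthogonal transformation `x ↦ A x` with `A ∈ O(3)`. -/
theorem stmt3 (f : Sphere2 ≃ₜ Sphere2) (n : ℕ) (hn : 1 ≤ n)
    (hfn : (f : Sphere2 → Sphere2)^[n] = id) :
    ∃ A ∈ Matrix.orthogonalGroup (Fin 3) ℝ, ∃ h : Sphere2 ≃ₜ Sphere2,
      ∀ x : Sphere2,
        ((h.symm (f (h x)) : EuclideanSpace ℝ (Fin 3))) =
          A.mulVec (x : EuclideanSpace ℝ (Fin 3)) := by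
  have hpow : f ^ n = 1 := by
    have : ∀ k : ℕ, ∀ x, (f ^ k) x = f^[k] x := by
      intro k
      induction k with
      | zero => exact fun x => rfl
      | succ k ih =>
        intro x
        rw [pow_succ, mul_apply, ih, Function.iterate_succ_apply]
    exact Homeomorph.ext fun x => by rw [this, hfn]; rfl
  obtain ⟨H, ω, ε, hω, hε, h⟩ := Kerekjarto.isConjOrthogonal_of_orderOf_pos
    (orderOf_pos_iff.2 (isOfFinOrder_iff_pow_eq_one.2 ⟨n, hn, hpow⟩))
  have hω2 : ω.re ^ 2 + ω.im ^ 2 = 1 := by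
    have := Complex.sq_norm ω
    rw [hω, normSq_apply] at this
    linarith
  refine ⟨!![ω.re, -ω.im, 0; ω.im, ω.re, 0; 0, 0, ε], ?_, H, fun x => ?_⟩
  · rw [Matrix.mem_orthogonalGroup_iff]
    ext i j
    fin_cases i <;> fin_cases j <;> simp [Matrix.mul_apply, Fin.sum_univ_three] <;> linarith
  · have haux : ‖ω * Kerekjarto.xy x‖ ^ 2 + (ε * Kerekjarto.ht x) ^ 2 = 1 := by
      rw [norm_mul, hω, one_mul, mul_pow, hε, one_mul, Kerekjarto.norm_xy_sq_add]
    rw [h x _ (Kerekjarto.xy_pt haux) (Kerekjarto.ht_pt haux), H.symm_apply_apply]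
    have h1 := Kerekjarto.xy_pt haux
    have h2 := Kerekjarto.ht_pt haux
    ext i
    fin_cases i
    · have := congrArg Complex.re h1
      simp [Kerekjarto.xy] at this
      simp [Matrix.mulVec, dotProduct, Fin.sum_univ_three, Kerekjarto.xy]
      linarith
    · have := congrArg Complex.im h1
      simp [Kerekjarto.xy] at this
      simp [Matrix.mulVec, dotProduct, Fin.sum_univ_three, Kerekjarto.xy]
      linarith
    · simp [Matrix.mulVec, dotProduct, Fin.sum_univ_three]
      exact h2
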